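/- Let d ≥ 3 be an integer and a ∈ (0,1]. Let a^{ij} : ℝ^d → ℝ (1 ≤ i,j ≤ d) be smooth functions with a^{ij} = a^{ji}, such that the matrix (a^{ij}(x)) is positive definite for every x ∈ ℝ^d and such that, for some constant B > 0 and every multi-index α with |α| ≤ 4, one has |∂^α(a^{ij}(x) − δ^{ij})| ≤ B(1+|x|)^{-1-a-|α|} for all x. Then for every R > 0, every δ₀ ∈ (0,1], and every positive integer m there exists a constant C > 0 (depending only on d, a, the coefficients a^{ij}, R, δ₀ and m, and in particular independent of the size of the support of the initial data) such that: every smooth solution ψ : ℝ × ℝ^d → ℝ of ∂_t²ψ = Σ_{i,j} ∂_i(a^{ij} ∂_j ψ) whose initial data ψ(0,·) and ∂_tψ(0,·) are compactly supported satisfies, for every τ > 0, ∫_{|x| ≤ R} (|∂_tψ(τ,x)|² + |∇_xψ(τ,x)|²) dx ≤ C·(log(2+τ))^{-2m} · Σ_{j=0}^{m} ∫_{ℝ^d} (|∂_t^{j+1}ψ(0,x)|² + |∇_x ∂_t^j ψ(0,x)|²) dx + C·τ^{-δ₀} ∫_{ℝ^d} (1+|x|)^{δ₀} (|∂_tψ(0,x)|²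 + |∇_xψ(0,x)|²) dx. -/

import Mathlib

open MeasureTheory Set Filter

/-- The time derivative `∂_t ψ` of a function `ψ : ℝ × ℝ^d → ℝ`. -/
noncomputable def timeDeriv {d : ℕ} (ψ : ℝ × EuclideanSpace ℝ (Fin d) → ℝ) (t : ℝ)
    (x : EuclideanSpace ℝ (Fin d)) : ℝ :=
  deriv (fun s => ψ (s, x)) t

/-- The iterated time derivative `∂_t^j ψ` of a function `ψ : ℝ × ℝ^d → ℝ`. -/
noncomputable def timeIteratedDeriv {d : ℕ} (j : ℕ) (ψ : ℝ × EuclideanSpace ℝ (Fin d) → ℝ)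
    (t : ℝ) (x : EuclideanSpace ℝ (Fin d)) : ℝ :=
  iteratedDeriv j (fun s => ψ (s, x)) t

/-- The spatial partial derivative `∂_i f` of a function `f : ℝ^d → ℝ`. -/
noncomputable def spatialDeriv {d : ℕ} (i : Fin d) (f : EuclideanSpace ℝ (Fin d) → ℝ)
    (x : EuclideanSpace ℝ (Fin d)) : ℝ :=
  fderiv ℝ f x (EuclideanSpace.single i 1)

namespace LogDecay

open Real
open Finset (sum_congr mul_sum sum_add_distrib sum_le_sum sum_sub_distrib sum_nonneg sum_mul)

section Ring

variable (V : Type*) [NormedAddCommGroup V] [NormedSpace ℝ V]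

/-- Smooth real functions, as a subalgebra of all functions. -/
def smoothSubalgebra : Subalgebra ℝ (V → ℝ) where
  carrier := {f | ContDiff ℝ (⊤ : ℕ∞) f}
  mul_mem' := by intro f g hf hg; exact (show ContDiff ℝ (⊤ : ℕ∞) f from hf).mul hg
  add_mem' := by intro f g hf hg; exact (show ContDiff ℝ (⊤ : ℕ∞) f from hf).add hg
  algebraMap_mem' := fun c => (contDiff_const : ContDiff ℝ (⊤ : ℕ∞) (fun _ : V => c))

/-- The ring of smooth real functions on `V`. -/
def Sm : Type _ := smoothSubalgebra V

noncomputable instance : CommRing (Sm V) := inferInstanceAs (CommRing (smoothSubalgebra V))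
noncomputable instance : Algebra ℝ (Sm V) := inferInstanceAs (Algebra ℝ (smoothSubalgebra V))

instance : CoeFun (Sm V) (fun _ => V → ℝ) := ⟨fun f => f.1⟩

variable {V}

theorem Sm.smooth (f : Sm V) : ContDiff ℝ (⊤ : ℕ∞) f := f.2
theorem Sm.continuous (f : Sm V) : Continuous f := f.smooth.continuous
theorem Sm.differentiable (f : Sm V) : Differentiable ℝ f :=
  f.smooth.differentiable (by simp)

@[ext] theorem Sm.ext {f g : Sm V} (h : ∀ x, f x = g x) : f = g := Subtype.ext (funext h)

/-- Bundle a smooth function. -/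
def Sm.mk (f : V → ℝ) (hf : ContDiff ℝ (⊤ : ℕ∞) f) : Sm V := ⟨f, hf⟩

@[simp] theorem Sm.mk_apply (f : V → ℝ) (hf) (x : V) : Sm.mk f hf x = f x := rfl
@[simp] theorem Sm.add_apply (f g : Sm V) (x : V) : (f + g) x = f x + g x := rfl
@[simp] theorem Sm.sub_apply (f g : Sm V) (x : V) : (f - g) x = f x - g x := rfl
@[simp] theorem Sm.neg_apply (f : Sm V) (x : V) : (-f) x = -f x := rfl
@[simp] theorem Sm.mul_apply (f g : Sm V) (x : V) : (f * g) x = f x * g x := rfl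
@[simp] theorem Sm.zero_apply (x : V) : (0 : Sm V) x = 0 := rfl
@[simp] theorem Sm.one_apply (x : V) : (1 : Sm V) x = 1 := rfl
@[simp] theorem Sm.pow_apply (f : Sm V) (n : ℕ) (x : V) : (f ^ n) x = f x ^ n := rfl
@[simp] theorem Sm.smul_apply (c : ℝ) (f : Sm V) (x : V) : (c • f) x = c * f x := rfl
@[simp] theorem Sm.algebraMap_apply (c : ℝ) (x : V) : (algebraMap ℝ (Sm V) c) x = c := rfl
@[simp] theorem Sm.natCast_apply (n : ℕ) (x : V) : ((n : Sm V)) x = n := rfl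
@[simp] theorem Sm.ofNat_apply (n : ℕ) [n.AtLeastTwo] (x : V) :
    ((ofNat(n) : Sm V)) x = ofNat(n) := rfl

/-- Evaluation at a point, as a ring homomorphism. -/
noncomputable def Sm.ev (x : V) : Sm V →+* ℝ where
  toFun f := f x
  map_one' := rfl
  map_mul' _ _ := rfl
  map_zero' := rfl
  map_add' _ _ := rfl

@[simp] theorem Sm.sum_apply {ι : Type*} (s : Finset ι) (f : ι → Sm V) (x : V) :
    (∑ i ∈ s, f i) x = ∑ i ∈ s, f i x := map_sum (Sm.ev x) f s

theorem fderiv_smooth_aux (f : Sm V) (v : V) :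
    ContDiff ℝ (⊤ : ℕ∞) (fun x => fderiv ℝ f x v) :=
  (f.smooth.fderiv_right (m := (⊤ : ℕ∞)) (by simp)).clm_apply contDiff_const

/-- The directional derivative as a derivation. -/
noncomputable def D (v : V) : Derivation ℝ (Sm V) (Sm V) :=
  Derivation.mk'
    { toFun := fun f => Sm.mk (fun x => fderiv ℝ f x v) (fderiv_smooth_aux f v)
      map_add' := fun f g => by
        ext x
        change fderiv ℝ (fun y => f y + g y) x v = fderiv ℝ f x v + fderiv ℝ g x v
        rw [fderiv_fun_add f.differentiable.differentiableAt g.differentiable.differentiableAt]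
        rfl
      map_smul' := fun c f => by
        ext x
        change fderiv ℝ (fun y => c * f y) x v = c * fderiv ℝ f x v
        rw [fderiv_const_mul f.differentiable.differentiableAt]
        rfl }
    (fun f g => by
      ext x
      change fderiv ℝ (fun y => f y * g y) x v = f x * fderiv ℝ g x v + g x * fderiv ℝ f x v
      rw [fderiv_fun_mul f.differentiable.differentiableAt g.differentiable.differentiableAt]
      rfl)

theorem D_apply (v : V) (f : Sm V) (x : V) : D v f x = fderiv ℝ f x v := rfl

@[simp] theorem D_mul (v : V) (f g : Sm V) : D v (f * g) = f * D v g + g * D v f := by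
  simp [Derivation.leibniz]

theorem D_comm (v w : V) (f : Sm V) : D v (D w f) = D w (D v f) := by
  ext x
  have hf2 : ContDiff ℝ 2 f := f.smooth.of_le (WithTop.coe_le_coe.2 le_top)
  have hs : IsSymmSndFDerivAt ℝ f x := hf2.contDiffAt.isSymmSndFDerivAt (by simp)
  have hd : DifferentiableAt ℝ (fderiv ℝ f) x :=
    ((hf2.fderiv_right (m := 1) (by norm_num)).differentiable (by simp)).differentiableAt
  have key : ∀ a b : V, D a (D b f) x = fderiv ℝ (fderiv ℝ f) x a b := by
    intro a b
    change fderiv ℝ (fun y => fderiv ℝ f y b) x a = _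
    rw [fderiv_clm_apply hd (differentiableAt_const b)]
    simp
  rw [key, key]
  exact hs v w

@[simp] theorem D_algebraMap (v : V) (c : ℝ) : D v (algebraMap ℝ (Sm V) c) = 0 :=
  Derivation.map_algebraMap _ _

/-- Composition with a real function smooth near the range. -/
noncomputable def Sm.comp (g : ℝ → ℝ) (f : Sm V) (h : ∀ x, ContDiffAt ℝ (⊤ : ℕ∞) g (f x)) : Sm V :=
  Sm.mk (fun x => g (f x)) (contDiff_iff_contDiffAt.2 fun x =>
    (h x).comp x f.smooth.contDiffAt)

theorem D_comp_apply (g : ℝ → ℝ) (f : Sm V) (h) (v : V) (x : V) :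
    D v (Sm.comp g f h) x = deriv g (f x) * D v f x := by
  have h1 : HasDerivAt g (deriv g (f x)) (f x) :=
    ((h x).differentiableAt (by simp)).hasDerivAt
  have h2 := h1.comp_hasFDerivAt x (f.differentiable x).hasFDerivAt
  have h3 : fderiv ℝ (Sm.comp g f h) x = deriv g (f x) • fderiv ℝ f x := h2.fderiv
  rw [D_apply, h3]
  rfl

theorem D_eq_zero_of_eventually {f : Sm V} {x : V} (h : ∀ᶠ y in nhds x, f y = 0) (v : V) :
    D v f x = 0 := by
  have : (f : V → ℝ) =ᶠ[nhds x] fun _ => 0 := h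
  rw [D_apply, this.fderiv_eq]
  simp

theorem D_eq_zero_of_notMem {f : Sm V} {K : Set V} (hK : IsClosed K) (h : ∀ x ∉ K, f x = 0)
    {x : V} (hx : x ∉ K) (v : V) : D v f x = 0 :=
  D_eq_zero_of_eventually ((hK.isOpen_compl.eventually_mem hx).mono fun y hy => h y hy) v

end Ring

/-- The space `ℝ^d`. -/
abbrev E (d : ℕ) := EuclideanSpace ℝ (Fin d)

variable {d : ℕ} {A : Fin d → Fin d → Sm (E d)} {K : Set (E d)} {u f g v φ μ g1 f1 : Sm (E d)}
  {x : E d} {ξ : Fin d → ℝ} {a B c₀ η T M z p S δ C C2 θ ζ t s l ω r R3 Q σ e c n lam0 b w k dN Nn NdN C4 C3 lam err R Nv χ ρ ε β S2 S1 C₀ κ q m L : ℝ}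

theorem integrable_of_zero_off {f : E d → ℝ} (hf : Continuous f) (hK : IsCompact K) (h : ∀ x ∉ K, f x = 0) : Integrable f :=
  hf.integrable_of_hasCompactSupport (HasCompactSupport.intro hK h)

theorem Sm.integrable (hK : IsCompact K) (h : ∀ x ∉ K, f x = 0) : Integrable f :=
  integrable_of_zero_off f.continuous hK h

theorem integral_D_eq_zero (v : E d) (hK : IsCompact K) (h : ∀ x ∉ K, f x = 0) : ∫ x, D v f x = 0 := by
  have h1 : Integrable f := Sm.integrable hK h
  have h2 : Integrable (D v f) :=
    Sm.integrable hK fun x hx => D_eq_zero_of_notMem hK.isClosed h hx v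
  have := integral_mul_fderiv_eq_neg_fderiv_mul_of_integrable (𝕜 := ℝ) (μ := volume)
    (f := fun _ : E d => (1 : ℝ)) (g := f) (v := v) (by simp) (by simpa [← D_apply] using h2)
    (by simpa using h1) (by simp) (fun x _ => f.differentiable x)
  simpa [D_apply] using this

/-- The partial derivative `∂_i`. -/
noncomputable abbrev pd (i : Fin d) : Derivation ℝ (Sm (E d)) (Sm (E d)) :=
  D (EuclideanSpace.single i (1 : ℝ))

/-- Coordinate functions. -/
noncomputable def X (i : Fin d) : Sm (E d) :=
  Sm.mk (fun x => x i) (by fun_prop)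

@[simp] theorem X_apply (i : Fin d) (x : E d) : X i x = x i := rfl

@[simp] theorem pd_X (i j : Fin d) : pd i (X j : Sm (E d)) = if i = j then 1 else 0 := by
  ext x
  have h : (X j : Sm (E d)).1 = (EuclideanSpace.proj (𝕜 := ℝ) j : E d →L[ℝ] ℝ) := rfl
  have : pd i (X j : Sm (E d)) x = (EuclideanSpace.single i (1 : ℝ) : E d) j := by
    rw [D_apply, h, ContinuousLinearMap.fderiv]
    rfl
  rw [this]
  by_cases hij : i = j
  · subst hij; simp
  · simp [hij, Ne.symm hij]

/-- The derivative of `u` along the vector field `Y`. -/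
noncomputable def vf (Y : Fin d → Sm (E d)) (u : Sm (E d)) : Sm (E d) := ∑ i, Y i * pd i u

/-- The divergence of the vector field `Y`. -/
noncomputable def dv (Y : Fin d → Sm (E d)) : Sm (E d) := ∑ i, pd i (Y i)

/-- The flux `A ∇u`. -/
noncomputable def fl (A : Fin d → Fin d → Sm (E d)) (u : Sm (E d)) (i : Fin d) : Sm (E d) :=
  ∑ j, A i j * pd j u

/-- The elliptic operator `∂_i (A_ij ∂_j u)`. -/
noncomputable def Pop (A : Fin d → Fin d → Sm (E d)) (u : Sm (E d)) : Sm (E d) := dv (fl A u)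

theorem vf_mul (Y : Fin d → Sm (E d)) (f g : Sm (E d)) :
    vf Y (f * g) = f * vf Y g + g * vf Y f := by
  simp only [vf, D_mul, mul_sum, ← sum_add_distrib]
  exact sum_congr rfl fun i _ => by ring

theorem vf_add (Y : Fin d → Sm (E d)) (f g : Sm (E d)) : vf Y (f + g) = vf Y f + vf Y g := by
  simp only [vf, map_add, mul_add, sum_add_distrib]

theorem vf_smul_left (f : Sm (E d)) (Y : Fin d → Sm (E d)) (g : Sm (E d)) :
    vf (fun i => f * Y i) g = f * vf Y g := by
  simp only [vf, mul_sum, mul_assoc]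

theorem dv_mul (f : Sm (E d)) (Y : Fin d → Sm (E d)) :
    dv (fun i => f * Y i) = f * dv Y + vf Y f := by
  simp only [dv, vf, D_mul, mul_sum, ← sum_add_distrib]

theorem dv_add (Y Z : Fin d → Sm (E d)) : dv (fun i => Y i + Z i) = dv Y + dv Z := by
  simp only [dv, map_add, sum_add_distrib]

theorem dv_sub (Y Z : Fin d → Sm (E d)) : dv (fun i => Y i - Z i) = dv Y - dv Z := by
  simp only [dv, map_sub, sum_sub_distrib]

theorem vf_fl_symm (hA : ∀ i j, A i j = A j i)
    (u v : Sm (E d)) : vf (fl A u) v = vf (fl A v) u := by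
  simp only [vf, fl, sum_mul]
  rw [Finset.sum_comm]
  refine sum_congr rfl fun i _ => sum_congr rfl fun j _ => ?_
  rw [hA j i]; ring

theorem vf_vf_fl (hA : ∀ i j, A i j = A j i)
    (Y : Fin d → Sm (E d)) (v : Sm (E d)) :
    2 * vf (fl A v) (vf Y v) = 2 * (∑ i, fl A v i * ∑ k, pd i (Y k) * pd k v)
      + vf Y (vf (fl A v) v)
      - ∑ k, Y k * ∑ i, ∑ j, pd k (A i j) * pd i v * pd j v := by
  have h1 : vf (fl A v) (vf Y v) = (∑ i, fl A v i * ∑ k, pd i (Y k) * pd k v)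
      + ∑ k, Y k * ∑ i, fl A v i * pd k (pd i v) := by
    have : ∀ i, pd i (vf Y v) = (∑ k, pd i (Y k) * pd k v) + ∑ k, Y k * pd k (pd i v) := by
      intro i
      simp only [vf, map_sum, D_mul, ← sum_add_distrib]
      refine sum_congr rfl fun k _ => ?_
      rw [D_comm (EuclideanSpace.single i 1)]; ring
    conv_lhs => rw [vf]
    simp only [this, mul_add, sum_add_distrib]
    congr 1
    simp only [mul_sum]
    rw [Finset.sum_comm]
    refine sum_congr rfl fun i _ => sum_congr rfl fun j _ => ?_
    ring
  have h2 : ∀ k, pd k (vf (fl A v) v) = 2 * (∑ i, fl A v i * pd k (pd i v))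
      + ∑ i, ∑ j, pd k (A i j) * pd i v * pd j v := by
    intro k
    have e1 : pd k (vf (fl A v) v) = (∑ i, fl A v i * pd k (pd i v))
        + ((∑ i, ∑ j, A i j * pd i v * pd k (pd j v))
          + ∑ i, ∑ j, pd k (A i j) * pd i v * pd j v) := by
      simp only [vf, fl, map_sum, D_mul, ← sum_add_distrib, sum_mul]
      refine sum_congr rfl fun i _ => sum_congr rfl fun j _ => ?_
      ring
    have e2 : (∑ i, ∑ j, A i j * pd i v * pd k (pd j v)) = ∑ i, fl A v i * pd k (pd i v) := by
      simp only [fl, sum_mul]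
      rw [Finset.sum_comm]
      refine sum_congr rfl fun i _ => sum_congr rfl fun j _ => ?_
      rw [hA j i]
    rw [e1, e2]; ring
  rw [h1]
  conv_rhs => rw [vf.eq_1 Y]
  simp only [h2, mul_add, sum_add_distrib]
  simp only [mul_sum]
  ring_nf

/-- The conjugated operator `e^φ (P + l) e^{-φ}`. -/
noncomputable def Pconj (A : Fin d → Fin d → Sm (E d)) (φ l v : Sm (E d)) : Sm (E d) :=
  Pop A v - 2 * vf (fl A φ) v - Pop A φ * v + (vf (fl A φ) φ + l) * v

/-- The quadratic form in the gradient of `v` in the multiplier identity. -/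
noncomputable def Gform (A : Fin d → Fin d → Sm (E d)) (Y : Fin d → Sm (E d))
    (φ q v : Sm (E d)) : Sm (E d) :=
  4 * vf (fl A φ) v * vf Y v + 2 * (∑ i, fl A v i * ∑ k, pd i (Y k) * pd k v)
    - (∑ k, Y k * ∑ i, ∑ j, pd k (A i j) * pd i v * pd j v) - (dv Y - q) * vf (fl A v) v

/-- Twice the coefficient of `v ^ 2` in the multiplier identity. -/
noncomputable def Zcoef (A : Fin d → Fin d → Sm (E d)) (Y : Fin d → Sm (E d))
    (φ l q : Sm (E d)) : Sm (E d) :=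
  2 * ((dv Y - q) * (vf (fl A φ) φ + l) + vf Y (vf (fl A φ) φ + l))
    - Pop A q - 2 * (vf Y (Pop A φ) + Pop A φ * dv Y + vf (fl A φ) q)

/-- The current in the multiplier identity. -/
noncomputable def Jcur (A : Fin d → Fin d → Sm (E d)) (Y : Fin d → Sm (E d))
    (φ l q v : Sm (E d)) (i : Fin d) : Sm (E d) :=
  vf (fl A v) v * Y i * 2 - vf Y v * fl A v i * 4 - q * v * fl A v i * 2 + v * v * fl A q i
    + q * v * v * fl A φ i * 2 + Pop A φ * v * v * Y i * 2
    - (vf (fl A φ) φ + l) * v * v * Y i * 2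

theorem dv_mul' (f : Sm (E d)) (Y : Fin d → Sm (E d)) :
    dv (fun i => f * Y i * 2) = 2 * (f * dv Y + vf Y f) := by
  rw [← dv_mul]
  simp only [dv, D_mul, mul_sum]
  refine sum_congr rfl fun i _ => ?_
  have : pd i (2 : Sm (E d)) = 0 := by
    have := D_algebraMap (EuclideanSpace.single i (1 : ℝ)) (2 : ℝ)
    rwa [map_ofNat] at this
  rw [this]; ring

theorem dv_mul4 (f : Sm (E d)) (Y : Fin d → Sm (E d)) :
    dv (fun i => f * Y i * 4) = 4 * (f * dv Y + vf Y f) := by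
  have h := dv_mul' (f * 2) Y
  have h2 := dv_mul' f (fun i => Y i * 2)
  have h3 : dv (fun i => Y i * 2) = 2 * dv Y := by
    simpa [vf] using dv_mul' 1 Y
  have h4 : vf (fun i => Y i * 2) f = 2 * vf Y f := by
    simp only [vf, mul_sum]
    exact sum_congr rfl fun i _ => by ring
  have h5 : (fun i => f * Y i * 4) = fun i => f * (Y i * 2) * 2 := by
    funext i; ring
  rw [h5, h2, h3, h4]; ring

theorem multiplier_identity (hA : ∀ i j, A i j = A j i)
    (Y : Fin d → Sm (E d)) (φ l q v : Sm (E d)) :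
    -(2 * (Pconj A φ l v * (2 * vf Y v + q * v)))
      = 2 * Gform A Y φ q v + Zcoef A Y φ l q * v ^ 2 + dv (Jcur A Y φ l q v) := by
  unfold Jcur
  rw [dv_sub, dv_add, dv_add, dv_add, dv_sub, dv_sub, dv_mul', dv_mul4, dv_mul', dv_mul,
    dv_mul', dv_mul', dv_mul']
  have h2 := vf_vf_fl hA Y v
  have s1 := vf_fl_symm hA φ v
  have s2 := vf_fl_symm hA q v
  have s3 := vf_fl_symm hA φ q
  simp only [vf_mul, ← Pop.eq_1] at *
  unfold Pconj Gform Zcoef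
  linear_combination 2 * h2 - 2 * v * s2

theorem integral_dv_eq_zero {J : Fin d → Sm (E d)} (hK : IsCompact K)
    (h : ∀ i, ∀ x ∉ K, J i x = 0) : ∫ x, dv J x = 0 := by
  have : ∀ x, dv J x = ∑ i, pd i (J i) x := fun x => by simp [dv]
  simp only [this]
  rw [integral_finsetSum]
  · exact Finset.sum_eq_zero fun i _ => integral_D_eq_zero _ hK (h i)
  · intro i _
    exact Sm.integrable hK fun x hx => D_eq_zero_of_notMem hK.isClosed (h i) hx _

theorem multiplier_integral (hA : ∀ i j, A i j = A j i)
    (Y : Fin d → Sm (E d)) (φ l q v : Sm (E d)) (hK : IsCompact K)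
    (hv : ∀ x ∉ K, v x = 0) {H : E d → ℝ} (hHi : Integrable H)
    (hH : ∀ x, H x ≤ 2 * Gform A Y φ q v x + Zcoef A Y φ l q x * v x ^ 2) :
    ∫ x, H x ≤ ∫ x, -(2 * (Pconj A φ l v x * (2 * vf Y v x + q x * v x))) := by
  have hvi : ∀ i, ∀ x ∉ K, pd i v x = 0 := fun i x hx =>
    D_eq_zero_of_notMem hK.isClosed hv hx _
  have hvf : ∀ (Z : Fin d → Sm (E d)), ∀ x ∉ K, vf Z v x = 0 := fun Z x hx => by
    simp [vf, hvi _ x hx]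
  have hfl : ∀ i, ∀ x ∉ K, fl A v i x = 0 := fun i x hx => by simp [fl, hvi _ x hx]
  have hJ : ∀ i, ∀ x ∉ K, Jcur A Y φ l q v i x = 0 := fun i x hx => by
    simp [Jcur, hv x hx, hvf _ x hx]
  have hid := multiplier_identity hA Y φ l q v
  have hpt : ∀ x, -(2 * (Pconj A φ l v x * (2 * vf Y v x + q x * v x)))
      = (2 * Gform A Y φ q v x + Zcoef A Y φ l q x * v x ^ 2) + dv (Jcur A Y φ l q v) x := by
    intro x
    have := congrArg (fun f : Sm (E d) => f x) hid
    simpa using this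
  simp only [hpt]
  have hdvJ : ∀ x ∉ K, dv (Jcur A Y φ l q v) x = 0 := fun x hx => by
    simp only [dv, Sm.sum_apply]
    exact Finset.sum_eq_zero fun i _ => D_eq_zero_of_notMem hK.isClosed (hJ i) hx _
  have hG : ∀ x ∉ K, (2 * Gform A Y φ q v + Zcoef A Y φ l q * v ^ 2 : Sm (E d)) x = 0 := fun x hx => by
    simp [Gform, hv x hx, hvf _ x hx, hvi _ x hx]
  have hGi : Integrable fun x => 2 * Gform A Y φ q v x + Zcoef A Y φ l q x * v x ^ 2 :=
    (Sm.integrable hK hG :)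
  rw [integral_add hGi (Sm.integrable hK hdvJ), integral_dv_eq_zero hK hJ, add_zero]
  exact integral_mono hHi hGi hH

/-- The weight `1 + |x|^2`. -/
noncomputable def zz : Sm (E d) := 1 + ∑ i, X i ^ 2

theorem zz_apply (x : E d) : zz x = 1 + ‖x‖ ^ 2 := by
  simp [zz, EuclideanSpace.norm_sq_eq]

theorem one_le_zz (x : E d) : 1 ≤ zz x := by rw [zz_apply]; nlinarith [sq_nonneg ‖x‖]
theorem zz_pos (x : E d) : 0 < zz x := lt_of_lt_of_le one_pos (one_le_zz x)

@[simp] theorem pd_zz (i : Fin d) : pd i (zz : Sm (E d)) = 2 * X i := by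
  simp only [zz, pow_two, map_add, map_sum, D_mul, pd_X, Derivation.map_one_eq_zero, zero_add,
    sum_add_distrib, mul_ite, mul_one, mul_zero, Finset.sum_ite_eq, Finset.mem_univ, if_true]
  ring

/-- Quantitative ellipticity and asymptotic flatness of a coefficient matrix. -/
structure Coef (d : ℕ) (a c₀ B : ℝ) (A : Fin d → Fin d → Sm (E d)) : Prop where
  symm : ∀ i j, A i j = A j i
  ell : ∀ x (ξ : Fin d → ℝ), c₀ * ∑ i, ξ i ^ 2 ≤ ∑ i, ∑ j, A i j x * ξ i * ξ j
  dec0 : ∀ i j x, |A i j x - if i = j then 1 else 0| ≤ B * (zz x) ^ (-(1 + a) / 2)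
  dec1 : ∀ i j k x, |pd k (A i j) x| * √(zz x) ≤ B * (zz x) ^ (-(1 + a) / 2)
  dec2 : ∀ i j k l x, |pd l (pd k (A i j)) x| * zz x ≤ B * (zz x) ^ (-(1 + a) / 2)

/-- The size of the perturbation at `x`. -/
noncomputable def dl (a B : ℝ) (x : E d) : ℝ := B * (zz x) ^ (-(1 + a) / 2)

/-- The vector field `A x`. -/
noncomputable def NN (A : Fin d → Fin d → Sm (E d)) (i : Fin d) : Sm (E d) := ∑ l, A i l * X l

/-- The function `x · A x`. -/
noncomputable def nn (A : Fin d → Fin d → Sm (E d)) : Sm (E d) := ∑ k, X k * NN A k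

theorem abs_sum_le_card {f : Fin d → ℝ} (h : ∀ i, |f i| ≤ m) : |∑ i, f i| ≤ d * m := by
  refine (Finset.abs_sum_le_sum_abs _ _).trans ((sum_le_sum fun i _ => h i).trans ?_)
  simp

theorem abs_le_sqrt_sum (ξ : Fin d → ℝ) (i : Fin d) : |ξ i| ≤ √(∑ i, ξ i ^ 2) := by
  rw [← sqrt_sq_eq_abs]
  exact sqrt_le_sqrt (Finset.single_le_sum (f := fun i => ξ i ^ 2)
    (fun i _ => sq_nonneg _) (Finset.mem_univ i))

theorem abs_coord_le (x : E d) (i : Fin d) : |x i| ≤ ‖x‖ := by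
  have := abs_le_sqrt_sum (fun i => x i) i
  rwa [EuclideanSpace.norm_eq, show (∑ i, ‖x i‖ ^ 2) = ∑ i, x i ^ 2 by simp]

theorem norm_le_sqrt_zz (x : E d) : ‖x‖ ≤ √(zz x) := by
  rw [zz_apply]; exact le_sqrt_of_sq_le (by linarith)

theorem abs_mul_le' (ha : |a| ≤ p) (hb : |b| ≤ q) : |a * b| ≤ p * q := by
  rw [abs_mul]; exact mul_le_mul ha hb (abs_nonneg _) ((abs_nonneg _).trans ha)

theorem rank_one_vf {ζ : Sm (E d)} (h : ∀ i, pd i φ = ζ * X i) : fl A φ = fun i => ζ * NN A i := by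
  funext i
  simp only [fl, NN, h, mul_sum]
  exact sum_congr rfl fun j _ => by ring

theorem vf_NN_radial {ζ : Sm (E d)} (h : ∀ i, pd i φ = ζ * X i) : vf (NN A) φ = ζ * nn A := by
  simp only [vf, nn, h, mul_sum]
  exact sum_congr rfl fun j _ => by ring

theorem Pop_radial {ζ ζ1 : Sm (E d)} (h : ∀ i, pd i φ = ζ * X i) (h1 : ∀ i, pd i ζ = ζ1 * X i) :
    Pop A φ = ζ1 * nn A + ζ * dv (NN A) := by
  rw [Pop, rank_one_vf h, dv_mul, vf_NN_radial h1]; ring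

theorem Zcoef_radial {ζ ζ1 ζ2 q q1 q2 : Sm (E d)} (l : ℝ) (hf : ∀ i, pd i f = f1 * X i)
    (hφ : ∀ i, pd i φ = ζ * X i) (hζ : ∀ i, pd i ζ = ζ1 * X i) (hζ1 : ∀ i, pd i ζ1 = ζ2 * X i)
    (hq : ∀ i, pd i q = q1 * X i) (hq1 : ∀ i, pd i q1 = q2 * X i) :
    Zcoef A (fun i => f * NN A i) φ (algebraMap ℝ _ l) q
      = 2 * ((f1 * nn A + f * dv (NN A) - q) * (ζ ^ 2 * nn A + algebraMap ℝ _ l)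
          + f * (2 * ζ * ζ1 * nn A ^ 2 + ζ ^ 2 * vf (NN A) (nn A)))
        - (q2 * nn A + q1 * dv (NN A))
        - 2 * (f * (ζ2 * nn A ^ 2 + ζ1 * vf (NN A) (nn A) + ζ1 * nn A * dv (NN A)
            + ζ * vf (NN A) (dv (NN A)))
          + (ζ1 * nn A + ζ * dv (NN A)) * (f1 * nn A + f * dv (NN A)) + ζ * q1 * nn A) := by
  have hl : vf (NN A) (algebraMap ℝ (Sm (E d)) l) = 0 := by simp [vf]
  rw [Zcoef, Pop_radial hφ hζ, Pop_radial hq hq1, rank_one_vf hφ]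
  simp only [vf_smul_left, dv_mul, vf_NN_radial hφ, vf_NN_radial hq, vf_NN_radial hf, vf_add,
    vf_mul, vf_NN_radial hζ, vf_NN_radial hζ1, hl]
  ring

theorem pd_NN (A : Fin d → Fin d → Sm (E d)) (k i : Fin d) :
    pd k (NN A i) = A i k + ∑ l, pd k (A i l) * X l := by
  simp only [NN, map_sum, D_mul, pd_X, sum_add_distrib]
  simp [mul_comm]

theorem pd_nn (hA : ∀ i j, A i j = A j i) (k : Fin d) :
    pd k (nn A) = 2 * NN A k + ∑ i, X i * ∑ l, pd k (A i l) * X l := by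
  simp only [nn, map_sum, D_mul, pd_X, pd_NN, mul_add, sum_add_distrib]
  have : ∑ i, X i * A i k = NN A k := by
    simp only [NN]
    exact sum_congr rfl fun i _ => by rw [hA i k]; ring
  rw [this]
  simp only [mul_ite, mul_one, mul_zero, Finset.sum_ite_eq, Finset.mem_univ, if_true]
  ring

theorem Gform_radial (hA : ∀ i j, A i j = A j i)
    {ζ : Sm (E d)} (q v : Sm (E d)) (hf : ∀ i, pd i f = f1 * X i)
    (hφ : ∀ i, pd i φ = ζ * X i) :
    Gform A (fun i => f * NN A i) φ q v
      = (4 * ζ * f + 2 * f1) * vf (NN A) v ^ 2 + 2 * f * ∑ i, fl A v i ^ 2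
        - (f1 * nn A + f * dv (NN A) - q) * vf (fl A v) v
        + f * (2 * (∑ i, fl A v i * ∑ k, (∑ l, pd i (A k l) * X l) * pd k v)
          - ∑ k, NN A k * ∑ i, ∑ j, pd k (A i j) * pd i v * pd j v) := by
  have h1 : ∀ i, ∑ k, pd i (f * NN A k) * pd k v
      = f * fl A v i + f * (∑ k, (∑ l, pd i (A k l) * X l) * pd k v) + f1 * X i * vf (NN A) v := by
    intro i
    simp only [D_mul, pd_NN, hf, vf, fl, mul_sum, ← sum_add_distrib]
    refine sum_congr rfl fun k _ => ?_
    rw [hA k i]; ring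
  have h2 : vf (NN A) v = ∑ i, fl A v i * X i := by
    simp only [vf, NN, fl, sum_mul]
    rw [Finset.sum_comm]
    refine sum_congr rfl fun i _ => sum_congr rfl fun k _ => ?_
    rw [hA i k]; ring
  have h3 : ∑ i, fl A v i * ∑ k, pd i (f * NN A k) * pd k v
      = f * ∑ i, fl A v i ^ 2
        + f * (∑ i, fl A v i * ∑ k, (∑ l, pd i (A k l) * X l) * pd k v)
        + f1 * vf (NN A) v ^ 2 := by
    have aux : ∀ (F T : Fin d → Sm (E d)) (s : Sm (E d)),
        ∑ i, F i * (f * F i + f * T i + f1 * X i * s)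
          = f * ∑ i, F i ^ 2 + f * ∑ i, F i * T i + f1 * (s * ∑ i, F i * X i) := by
      intro F T s
      simp only [mul_sum, ← sum_add_distrib]
      exact sum_congr rfl fun i _ => by ring
    simp only [h1]
    rw [aux, ← h2, pow_two (vf (NN A) v)]
  have h4 : ∑ k, f * NN A k * ∑ i, ∑ j, pd k (A i j) * pd i v * pd j v
      = f * ∑ k, NN A k * ∑ i, ∑ j, pd k (A i j) * pd i v * pd j v := by
    rw [mul_sum]
    exact sum_congr rfl fun k _ => by ring
  rw [Gform, h3, h4, rank_one_vf hφ, vf_smul_left, vf_smul_left, dv_mul, vf_NN_radial hf]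
  ring

/-- The universal constant in the geometric bounds. -/
noncomputable def CG (d : ℕ) (B : ℝ) : ℝ := 3 * (d : ℝ) ^ 4 * (1 + B) ^ 2

/-- Bounds on the radial geometry of the coefficients at a point. -/
structure Geo (d : ℕ) (c₀ C δ z r n dN Nn NdN : ℝ) : Prop where
  hz : z = 1 + r ^ 2
  hr : 0 ≤ r
  hδ : 0 ≤ δ
  n_lo : c₀ * r ^ 2 ≤ n
  n_err : |n - r ^ 2| ≤ C * δ * r ^ 2
  dN_err : |dN - d| ≤ C * δ
  Nn_lo : 2 * n ^ 2 ≤ r ^ 2 * (Nn + C * δ * r ^ 2)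
  Nn_abs : |Nn| ≤ C * r ^ 2
  NdN_abs : |NdN| ≤ C

/-- Bounds on the quadratic forms in a gradient at a point. -/
structure Grd (c₀ C δ r p F Q Nv err : ℝ) : Prop where
  hp : 0 ≤ p
  FQ : |F - Q| ≤ C * δ * p
  Qp : |Q - p| ≤ C * δ * p
  Q_lo : c₀ * p ≤ Q
  Nv_le : Nv ^ 2 ≤ r ^ 2 * F
  err_le : |err| ≤ C * δ * p

theorem dl_nonneg (hB : 0 ≤ B) (x : E d) : 0 ≤ dl a B x :=
  mul_nonneg hB (rpow_nonneg (zz_pos x).le _)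

theorem dl_le (ha : 0 < a) (hB : 0 ≤ B) (x : E d) : dl a B x ≤ B := by
  refine mul_le_of_le_one_right hB (rpow_le_one_of_one_le_of_nonpos (one_le_zz x) ?_)
  linarith

namespace Coef

theorem abs_A (h : Coef d a c₀ B A) (ha : 0 < a) (hB : 0 ≤ B) (i j : Fin d) (x : E d) :
    |A i j x| ≤ 1 + B := by
  have h1 := (h.dec0 i j x).trans (dl_le ha hB x)
  have h2 : |(if i = j then (1 : ℝ) else 0)| ≤ 1 := by split_ifs <;> simp
  have h3 := abs_add_le (A i j x - if i = j then 1 else 0) (if i = j then (1 : ℝ) else 0)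
  rw [sub_add_cancel] at h3
  linarith

theorem lin_abs (h : Coef d a c₀ B A) (ha : 0 < a) (hB : 0 ≤ B) (hξ : ∀ i, |ξ i| ≤ p) (i : Fin d) (x : E d) :
    |∑ j, A i j x * ξ j| ≤ d * ((1 + B) * p) :=
  abs_sum_le_card fun j => abs_mul_le' (h.abs_A ha hB i j x) (hξ j)

theorem lin_err (h : Coef d a c₀ B A) (hξ : ∀ i, |ξ i| ≤ p) (i : Fin d) (x : E d) :
    |∑ j, A i j x * ξ j - ξ i| ≤ d * (dl a B x * p) := by
  have : ∑ j, A i j x * ξ j - ξ i = ∑ j, (A i j x - if i = j then 1 else 0) * ξ j := by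
    simp [sub_mul, sum_sub_distrib]
  rw [this]
  exact abs_sum_le_card fun j => abs_mul_le' (h.dec0 i j x) (hξ j)

theorem dA_abs (h : Coef d a c₀ B A) (i j k : Fin d) (x : E d) :
    |pd k (A i j) x| ≤ dl a B x / √(zz x) :=
  (le_div_iff₀ (sqrt_pos.2 (zz_pos x))).2 (h.dec1 i j k x)

theorem ddA_abs (h : Coef d a c₀ B A) (i j k l : Fin d) (x : E d) :
    |pd l (pd k (A i j)) x| ≤ dl a B x / zz x :=
  (le_div_iff₀ (zz_pos x)).2 (h.dec2 i j k l x)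

theorem form_err (h : Coef d a c₀ B A) (hξ : ∀ i, |ξ i| ≤ p) (x : E d) :
    |∑ i, (∑ j, A i j x * ξ j) * ξ i - ∑ i, ξ i ^ 2| ≤ d * (d * (dl a B x * p) * p) := by
  rw [← sum_sub_distrib]
  refine abs_sum_le_card fun i => ?_
  rw [show (∑ j, A i j x * ξ j) * ξ i - ξ i ^ 2 = (∑ j, A i j x * ξ j - ξ i) * ξ i by ring]
  exact abs_mul_le' (h.lin_err hξ i x) (hξ i)

theorem form_lo (h : Coef d a c₀ B A) (ξ : Fin d → ℝ) (x : E d) :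
    c₀ * ∑ i, ξ i ^ 2 ≤ ∑ i, (∑ j, A i j x * ξ j) * ξ i := by
  refine (h.ell x ξ).trans (le_of_eq ?_)
  refine sum_congr rfl fun i _ => ?_
  rw [sum_mul]
  exact sum_congr rfl fun j _ => by ring

end Coef

theorem NN_apply (A : Fin d → Fin d → Sm (E d)) (i : Fin d) (x : E d) :
    NN A i x = ∑ l, A i l x * x l := by simp [NN]

theorem nn_apply (A : Fin d → Fin d → Sm (E d)) (x : E d) :
    nn A x = ∑ i, (∑ l, A i l x * x l) * x i := by simp [nn, NN_apply, mul_comm]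

theorem norm_sq_eq_sum (x : E d) : ‖x‖ ^ 2 = ∑ i, x i ^ 2 := by
  simp [EuclideanSpace.norm_sq_eq]

theorem CG_ge (hd : 1 ≤ d) (hB : 0 ≤ B) {k : ℕ} (hk : k ≤ 4) (ht : 0 ≤ t) :
    3 * (d : ℝ) ^ k * (1 + B) * t ≤ CG d B * t := by
  have hd' : (1 : ℝ) ≤ d := by exact_mod_cast hd
  have h1 : (d : ℝ) ^ k ≤ (d : ℝ) ^ 4 := pow_le_pow_right₀ hd' hk
  have h2 : (1 + B) ≤ (1 + B) ^ 2 := by nlinarith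
  unfold CG
  gcongr

theorem pd_dv_NN (A : Fin d → Fin d → Sm (E d)) (k : Fin d) :
    pd k (dv (NN A)) = ∑ i, (pd k (A i i)
      + (∑ l, pd k (pd i (A i l)) * X l + pd i (A i k))) := by
  rw [dv, map_sum]
  refine sum_congr rfl fun i _ => ?_
  rw [pd_NN, map_add, map_sum]
  congr 1
  have : ∀ l, pd k (pd i (A i l) * X l)
      = pd k (pd i (A i l)) * X l + if k = l then pd i (A i l) else 0 := fun l => by
    rw [D_mul, pd_X, mul_ite, mul_one, mul_zero, add_comm, mul_comm]
  simp only [this, sum_add_distrib, Finset.sum_ite_eq, Finset.mem_univ, if_true]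

theorem Coef.geo (hd : 1 ≤ d) (h : Coef d a c₀ B A) (ha : 0 < a) (hB : 0 ≤ B) (x : E d) :
    Geo d c₀ (CG d B) (dl a B x) (zz x) ‖x‖ (nn A x) (dv (NN A) x) (vf (NN A) (nn A) x)
      (vf (NN A) (dv (NN A)) x) := by
  have hx := abs_coord_le x
  have hd' : (1 : ℝ) ≤ d := by exact_mod_cast hd
  have hδ := dl_nonneg (a := a) hB x
  have hδB := dl_le (a := a) ha hB x
  set δ := dl a B x with hδdef
  set r := ‖x‖ with hrdef
  have hr : 0 ≤ r := norm_nonneg x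
  set w := √(zz x) with hwdef
  have hw : 0 < w := sqrt_pos.2 (zz_pos x)
  have hw2 : w ^ 2 = zz x := sq_sqrt (zz_pos x).le
  have hrw : r ≤ w := norm_le_sqrt_zz x
  have hrw1 : r / w ≤ 1 := (div_le_one hw).2 hrw
  have hNN : ∀ i, |NN A i x| ≤ d * ((1 + B) * r) := fun i => by
    rw [NN_apply]; exact h.lin_abs ha hB hx i x
  have hErow : ∀ k i, |∑ l, pd k (A i l) x * x l| ≤ d * (δ / w * r) := fun k i =>
    abs_sum_le_card fun l => abs_mul_le' (h.dA_abs i l k x) (hx l)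
  have hδw : δ / w * r ≤ δ := by
    rw [div_mul_eq_mul_div, mul_div_assoc]; exact mul_le_of_le_one_right hδ hrw1
  have hnn2 : nn A x = ∑ k, x k * NN A k x := by simp [nn]
  have hdN : dv (NN A) x = ∑ k, (A k k x + ∑ l, pd k (A k l) x * x l) := by
    simp [dv, pd_NN]
  have he : ∀ k, |∑ i, x i * ∑ l, pd k (A i l) x * x l| ≤ d * (r * (d * (δ / w * r))) :=
    fun k => abs_sum_le_card fun i => abs_mul_le' (hx i) (hErow k i)
  have hNn : vf (NN A) (nn A) x = 2 * (∑ k, NN A k x ^ 2)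
      + ∑ k, NN A k x * ∑ i, x i * ∑ l, pd k (A i l) x * x l := by
    simp only [vf, Sm.sum_apply, Sm.mul_apply, pd_nn h.symm, Sm.add_apply, Sm.ofNat_apply,
      X_apply, mul_add, sum_add_distrib, mul_sum]
    congr 1
    exact sum_congr rfl fun k _ => by ring
  have hNnerr : |∑ k, NN A k x * ∑ i, x i * ∑ l, pd k (A i l) x * x l|
      ≤ d * (d * ((1 + B) * r) * (d * (r * (d * (δ / w * r))))) :=
    abs_sum_le_card fun k => abs_mul_le' (hNN k) (he k)
  have hNnerr2 : d * (d * ((1 + B) * r) * (d * (r * (d * (δ / w * r)))))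
      ≤ (d : ℝ) ^ 4 * (1 + B) * (δ * r ^ 2) := by
    have : (d : ℝ) * (d * ((1 + B) * r) * (d * (r * (d * (δ / w * r)))))
      = (d : ℝ) ^ 4 * (1 + B) * (δ / w * r * r ^ 2) := by ring
    rw [this]; gcongr
  refine ⟨zz_apply x, hr, hδ, ?_, ?_, ?_, ?_, ?_, ?_⟩
  · rw [nn_apply, hrdef, norm_sq_eq_sum]; exact h.form_lo (fun i => x i) x
  · have := h.form_err hx x
    rw [nn_apply, hrdef, norm_sq_eq_sum]
    refine this.trans ?_
    rw [← norm_sq_eq_sum, ← hrdef]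
    have := CG_ge hd hB (k := 2) (by norm_num) (t := δ * r ^ 2) (by positivity)
    have h3 : (0 : ℝ) ≤ (d : ℝ) ^ 2 * (δ * r ^ 2) := by positivity
    nlinarith [mul_nonneg h3 hB]
  · have : dv (NN A) x - d = ∑ k, (A k k x - 1 + ∑ l, pd k (A k l) x * x l) := by
      rw [hdN, sum_add_distrib, sum_add_distrib, sum_sub_distrib]
      simp; ring
    rw [this]
    have h1 : ∀ k, |A k k x - 1 + ∑ l, pd k (A k l) x * x l| ≤ δ + d * δ := fun k => by
      have e1 := h.dec0 k k x
      rw [if_pos rfl] at e1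
      refine (abs_add_le _ _).trans (add_le_add e1 ((hErow k k).trans ?_))
      gcongr
    refine (abs_sum_le_card h1).trans ?_
    have := CG_ge hd hB (k := 2) (by norm_num) (t := δ) hδ
    have h3 : (0 : ℝ) ≤ (d : ℝ) ^ 2 * δ := by positivity
    nlinarith [mul_nonneg h3 hB, mul_nonneg (sub_nonneg.2 hd') hδ,
      mul_nonneg (mul_nonneg (sub_nonneg.2 hd') hδ) (by positivity : (0 : ℝ) ≤ d)]
  · have hcs : nn A x ^ 2 ≤ r ^ 2 * ∑ k, NN A k x ^ 2 := by
      rw [hnn2, hrdef, norm_sq_eq_sum]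
      exact Finset.sum_mul_sq_le_sq_mul_sq _ _ _
    have e1 := neg_le_of_abs_le (hNnerr.trans hNnerr2)
    have e2 := CG_ge hd hB (k := 4) le_rfl (t := δ * r ^ 2) (by positivity)
    have h3 : (0 : ℝ) ≤ (d : ℝ) ^ 4 * (1 + B) * (δ * r ^ 2) := by positivity
    have e3 : 2 * ∑ k, NN A k x ^ 2 ≤ vf (NN A) (nn A) x + CG d B * δ * r ^ 2 := by
      rw [hNn]; linarith
    nlinarith [mul_le_mul_of_nonneg_left e3 (sq_nonneg r)]
  · rw [hNn]
    have e1 : |∑ k, NN A k x ^ 2| ≤ d * (d * ((1 + B) * r) * (d * ((1 + B) * r))) :=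
      abs_sum_le_card fun k => by rw [pow_two]; exact abs_mul_le' (hNN k) (hNN k)
    have e2 := hNnerr.trans hNnerr2
    refine (abs_add_le _ _).trans ?_
    rw [abs_mul, abs_two]
    have e3 : (d : ℝ) ^ 3 ≤ (d : ℝ) ^ 4 := pow_le_pow_right₀ hd' (by norm_num)
    have e4 : 2 * |∑ k, NN A k x ^ 2| ≤ 2 * ((d : ℝ) ^ 4 * (1 + B) ^ 2 * r ^ 2) := by
      have : 2 * |∑ k, NN A k x ^ 2| ≤ 2 * ((d : ℝ) ^ 3 * (1 + B) ^ 2 * r ^ 2) := by linarith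
      refine this.trans ?_; gcongr
    have e5 : (d : ℝ) ^ 4 * (1 + B) * (δ * r ^ 2) ≤ (d : ℝ) ^ 4 * (1 + B) ^ 2 * r ^ 2 := by
      have : (d : ℝ) ^ 4 * (1 + B) * (δ * r ^ 2) ≤ (d : ℝ) ^ 4 * (1 + B) * ((1 + B) * r ^ 2) := by
        gcongr; linarith
      linarith
    unfold CG; linarith
  · have hpd : ∀ k, |pd k (dv (NN A)) x| ≤ d * ((d + 2) * (δ / w)) := by
      intro k
      have : pd k (dv (NN A)) x = ∑ i, (pd k (A i i) x
          + (∑ l, pd k (pd i (A i l)) x * x l + pd i (A i k) x)) := by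
        rw [pd_dv_NN]; simp
      rw [this]
      refine abs_sum_le_card fun i => ?_
      have e1 : |∑ l, pd k (pd i (A i l)) x * x l| ≤ d * (δ / w) := by
        refine abs_sum_le_card fun l => (abs_mul_le' (h.ddA_abs i l i k x) (hx l)).trans ?_
        rw [← hw2, ← hδdef, pow_two, ← div_div, div_mul_eq_mul_div, mul_div_assoc]
        exact mul_le_of_le_one_right (by positivity) hrw1
      have e2 := abs_add_le (pd k (A i i) x)
        (∑ l, pd k (pd i (A i l)) x * x l + pd i (A i k) x)
      have e3 := abs_add_le (∑ l, pd k (pd i (A i l)) x * x l) (pd i (A i k) x)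
      have e4 := h.dA_abs i i k x
      have e5 := h.dA_abs i k i x
      linarith
    have : vf (NN A) (dv (NN A)) x = ∑ k, NN A k x * pd k (dv (NN A)) x := by simp [vf]
    rw [this]
    refine (abs_sum_le_card fun k => abs_mul_le' (hNN k) (hpd k)).trans ?_
    have e1 : (d : ℝ) * (d * ((1 + B) * r) * (d * ((d + 2) * (δ / w))))
        = (d : ℝ) ^ 3 * (d + 2) * (1 + B) * (δ / w * r) := by ring
    rw [e1]
    have e2 : (d : ℝ) ^ 3 * (d + 2) * (1 + B) * (δ / w * r)
        ≤ (d : ℝ) ^ 3 * (3 * d) * (1 + B) * (1 + B) := by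
      gcongr
      · linarith
      · linarith
    unfold CG; linarith

/-- The error term in the radial form of the gradient quadratic form. -/
noncomputable def Gerr (A : Fin d → Fin d → Sm (E d)) (v : Sm (E d)) : Sm (E d) :=
  2 * (∑ i, fl A v i * ∑ k, (∑ l, pd i (A k l) * X l) * pd k v)
          - ∑ k, NN A k * ∑ i, ∑ j, pd k (A i j) * pd i v * pd j v

/-- The squared length of the gradient. -/
noncomputable def gsq (v : Sm (E d)) : Sm (E d) := ∑ i, pd i v ^ 2

theorem gsq_apply (v : Sm (E d)) (x : E d) : gsq v x = ∑ i, pd i v x ^ 2 := by simp [gsq]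

theorem gsq_nonneg (v : Sm (E d)) (x : E d) : 0 ≤ gsq v x := by
  rw [gsq_apply]; exact sum_nonneg fun i _ => sq_nonneg _

theorem Coef.grd (hd : 1 ≤ d) (h : Coef d a c₀ B A) (ha : 0 < a) (hB : 0 ≤ B) (v : Sm (E d))
    (x : E d) :
    Grd c₀ (CG d B) (dl a B x) ‖x‖ (gsq v x) (∑ i, fl A v i x ^ 2) (vf (fl A v) v x)
      (vf (NN A) v x) (Gerr A v x) := by
  have hx := abs_coord_le x
  have hd' : (1 : ℝ) ≤ d := by exact_mod_cast hd
  have hδ := dl_nonneg (a := a) hB x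
  set p := √(gsq v x) with hp
  have hp0 : 0 ≤ p := sqrt_nonneg _
  have hp2 : p ^ 2 = gsq v x := sq_sqrt (gsq_nonneg v x)
  have hv : ∀ i, |pd i v x| ≤ p := fun i => by
    rw [hp, gsq_apply]; exact abs_le_sqrt_sum (fun i => pd i v x) i
  set δ := dl a B x with hδdef
  set r := ‖x‖ with hrdef
  have hr : 0 ≤ r := norm_nonneg x
  set w := √(zz x) with hwdef
  have hw : 0 < w := sqrt_pos.2 (zz_pos x)
  have hrw1 : r / w ≤ 1 := (div_le_one hw).2 (norm_le_sqrt_zz x)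
  have hδw : δ / w * r ≤ δ := by
    rw [div_mul_eq_mul_div, mul_div_assoc]; exact mul_le_of_le_one_right hδ hrw1
  have hfl : ∀ i, fl A v i x = ∑ j, A i j x * pd j v x := fun i => by simp [fl]
  have hfl1 : ∀ i, |fl A v i x| ≤ d * ((1 + B) * p) := fun i => by
    rw [hfl]; exact h.lin_abs ha hB hv i x
  have hfl2 : ∀ i, |fl A v i x - pd i v x| ≤ d * (δ * p) := fun i => by
    rw [hfl]; exact h.lin_err hv i x
  have hQ : vf (fl A v) v x = ∑ i, (∑ j, A i j x * pd j v x) * pd i v x := by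
    simp [vf, hfl]
  have hNN : ∀ i, |NN A i x| ≤ d * ((1 + B) * r) := fun i => by
    rw [NN_apply]; exact h.lin_abs ha hB hx i x
  have hErow : ∀ k i, |∑ l, pd k (A i l) x * x l| ≤ d * δ := fun k i =>
    (abs_sum_le_card fun l => abs_mul_le' (h.dA_abs i l k x) (hx l)).trans (by gcongr)
  have hG : Gerr A v x = 2 * (∑ i, fl A v i x * ∑ k, (∑ l, pd i (A k l) x * x l) * pd k v x)
      - ∑ k, NN A k x * ∑ i, ∑ j, pd k (A i j) x * pd i v x * pd j v x := by
    simp [Gerr]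
  refine ⟨gsq_nonneg v x, ?_, ?_, ?_, ?_, ?_⟩
  · have e1 : (∑ i, fl A v i x ^ 2) - vf (fl A v) v x
        = ∑ i, fl A v i x * (fl A v i x - pd i v x) := by
      rw [hQ, ← sum_sub_distrib]
      exact sum_congr rfl fun i _ => by rw [hfl]; ring
    rw [e1, ← hp2]
    refine (abs_sum_le_card fun i => abs_mul_le' (hfl1 i) (hfl2 i)).trans ?_
    have := CG_ge hd hB (k := 3) (by norm_num) (t := δ * p ^ 2) (by positivity)
    have h3 : (0 : ℝ) ≤ (d : ℝ) ^ 3 * (1 + B) * (δ * p ^ 2) := by positivity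
    linarith
  · rw [hQ, ← hp2]
    have e1 := h.form_err hv x
    rw [← gsq_apply, ← hp2] at e1
    refine e1.trans ?_
    have := CG_ge hd hB (k := 2) (by norm_num) (t := δ * p ^ 2) (by positivity)
    have h3 : (0 : ℝ) ≤ (d : ℝ) ^ 2 * (δ * p ^ 2) := by positivity
    nlinarith [mul_nonneg h3 hB]
  · rw [hQ, gsq_apply]; exact h.form_lo (fun i => pd i v x) x
  · have e1 : vf (NN A) v x = ∑ i, x i * fl A v i x := by
      simp only [vf, NN, fl, Sm.sum_apply, Sm.mul_apply, X_apply, sum_mul, mul_sum]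
      rw [Finset.sum_comm]
      refine sum_congr rfl fun i _ => sum_congr rfl fun k _ => ?_
      rw [h.symm i k]; ring
    rw [e1, hrdef, norm_sq_eq_sum]
    exact Finset.sum_mul_sq_le_sq_mul_sq _ _ _
  · rw [hG, ← hp2]
    have e1 : |∑ i, fl A v i x * ∑ k, (∑ l, pd i (A k l) x * x l) * pd k v x|
        ≤ d * (d * ((1 + B) * p) * (d * (d * δ * p))) :=
      abs_sum_le_card fun i => abs_mul_le' (hfl1 i)
        (abs_sum_le_card fun k => abs_mul_le' (hErow i k) (hv k))
    have e2 : |∑ k, NN A k x * ∑ i, ∑ j, pd k (A i j) x * pd i v x * pd j v x|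
        ≤ d * (d * ((1 + B) * r) * (d * (d * (δ / w * p * p)))) :=
      abs_sum_le_card fun k => abs_mul_le' (hNN k)
        (abs_sum_le_card fun i => abs_sum_le_card fun j =>
          abs_mul_le' (abs_mul_le' (h.dA_abs i j k x) (hv i)) (hv j))
    have e3 : (d : ℝ) * (d * ((1 + B) * r) * (d * (d * (δ / w * p * p))))
        ≤ (d : ℝ) ^ 4 * (1 + B) * (δ * p ^ 2) := by
      have : (d : ℝ) * (d * ((1 + B) * r) * (d * (d * (δ / w * p * p))))
        = (d : ℝ) ^ 4 * (1 + B) * (δ / w * r * p ^ 2) := by ring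
      rw [this]; gcongr
    refine (abs_sub _ _).trans ?_
    rw [abs_mul, abs_two]
    have := CG_ge hd hB (k := 4) le_rfl (t := δ * p ^ 2) (by positivity)
    linarith

theorem Gform_radial_apply (hA : ∀ i j, A i j = A j i)
    {ζ : Sm (E d)} (q v : Sm (E d)) (hf : ∀ i, pd i f = f1 * X i)
    (hφ : ∀ i, pd i φ = ζ * X i) (x : E d) :
    Gform A (fun i => f * NN A i) φ q v x
      = (4 * ζ x * f x + 2 * f1 x) * vf (NN A) v x ^ 2 + 2 * f x * ∑ i, fl A v i x ^ 2
        - (f1 x * nn A x + f x * dv (NN A) x - q x) * vf (fl A v) v x + f x * Gerr A v x := by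
  rw [Gform_radial hA q v hf hφ, ← Gerr]
  simp

section General

variable {V : Type*} [NormedAddCommGroup V] [NormedSpace ℝ V]

/-- Real powers of positive smooth functions. -/
noncomputable def Sm.rp (f : Sm V) (hf : ∀ x, 0 < f x) (p : ℝ) : Sm V :=
  Sm.comp (fun y => y ^ p) f fun x => Real.contDiffAt_rpow_const_of_ne (hf x).ne'

@[simp] theorem Sm.rp_apply (f : Sm V) (hf) (p : ℝ) (x : V) : Sm.rp f hf p x = f x ^ p := rfl

theorem D_rp (f : Sm V) (hf : ∀ x, 0 < f x) (p : ℝ) (v : V) :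
    D v (Sm.rp f hf p) = p • (Sm.rp f hf (p - 1) * D v f) := by
  ext x
  rw [Sm.rp, D_comp_apply, (hasDerivAt_rpow_const (Or.inl (hf x).ne')).deriv]
  simp [mul_assoc]

/-- The exponential of a smooth function. -/
noncomputable def Sm.exp (f : Sm V) : Sm V :=
  Sm.comp Real.exp f fun _ => Real.contDiff_exp.contDiffAt

@[simp] theorem Sm.exp_apply (f : Sm V) (x : V) : Sm.exp f x = Real.exp (f x) := rfl

@[simp] theorem D_exp (f : Sm V) (v : V) : D v (Sm.exp f) = Sm.exp f * D v f := by
  ext x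
  rw [Sm.exp, D_comp_apply, Real.deriv_exp]
  rfl

end General

/-- The powers of `1 + |x|^2`. -/
noncomputable def zp (p : ℝ) : Sm (E d) := Sm.rp zz zz_pos p

@[simp] theorem zp_apply (p : ℝ) (x : E d) : zp p x = zz x ^ p := rfl

theorem pd_zp (p : ℝ) (i : Fin d) : pd i (zp p : Sm (E d)) = (2 * p) • (zp p * zp (-1)) * X i := by
  ext x
  have : zz x ^ (p - 1) = zz x ^ p * zz x ^ (-1 : ℝ) := by
    rw [← rpow_add (zz_pos x)]; ring_nf
  rw [zp, D_rp, pd_zz]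
  simp [this]; ring

theorem pd_zp_neg_one (i : Fin d) :
    pd i (zp (-1) : Sm (E d)) = (-2) * zp (-1) ^ 2 * X i := by
  rw [pd_zp]; ext x; simp; ring

/-- The positive function `K + (1 + |x|^2)^η`. -/
theorem Kz_pos {K : ℝ} (hK : 0 < K) (η : ℝ) (x : E d) :
    0 < (algebraMap ℝ (Sm (E d)) K + zp η : Sm (E d)) x :=
  add_pos hK (rpow_pos_of_pos (zz_pos x) _)

/-- The radial transition function `z^η / (K + z^η)`. -/
noncomputable def th (K : ℝ) (hK : 0 < K) (η : ℝ) : Sm (E d) :=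
  zp η * Sm.rp _ (Kz_pos hK η) (-1)

theorem th_apply {K : ℝ} (hK : 0 < K) (η : ℝ) (x : E d) :
    th K hK η x = zz x ^ η / (K + zz x ^ η) := by
  simp [th, rpow_neg_one]; rfl

theorem one_sub_th {K : ℝ} (hK : 0 < K) (η : ℝ) (x : E d) :
    1 - th K hK η x = K / (K + zz x ^ η) := by
  have : 0 < K + zz x ^ η := Kz_pos hK η x
  rw [th_apply]; field_simp; ring

theorem pd_th {K : ℝ} (hK : 0 < K) (η : ℝ) (i : Fin d) :
    pd i (th K hK η : Sm (E d)) = (2 * η) • (th K hK η * (1 - th K hK η) * zp (-1)) * X i := by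
  ext x
  have h0 : 0 < K + zz x ^ η := Kz_pos hK η x
  have e : (algebraMap ℝ (Sm (E d)) K + zp η : Sm (E d)) x = K + zz x ^ η := rfl
  have h1 := one_sub_th hK η x
  have h2 := th_apply hK η x
  have e2 : (K + zz x ^ η) ^ ((-1 : ℝ) - 1) = ((K + zz x ^ η) ^ 2)⁻¹ := by
    rw [show (-1 : ℝ) - 1 = -(2 : ℕ) by norm_num, rpow_neg h0.le, rpow_natCast]
  simp only [Sm.smul_apply, Sm.mul_apply, Sm.sub_apply, Sm.one_apply, zp_apply, h1, h2]
  rw [th, D_mul, D_rp, map_add, D_algebraMap, pd_zp]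
  simp only [Sm.smul_apply, Sm.mul_apply, Sm.add_apply, zp_apply, Sm.rp_apply, e, e2,
    rpow_neg_one, Sm.zero_apply, zero_add]
  field_simp
  ring

/-- The radial weight `(K + z^η)^(-1/(2η))`. -/
noncomputable def bt (K : ℝ) (hK : 0 < K) (η : ℝ) : Sm (E d) :=
  Sm.rp _ (Kz_pos hK η) (-1 / (2 * η))

theorem bt_apply {K : ℝ} (hK : 0 < K) (η : ℝ) (x : E d) :
    bt K hK η x = (K + zz x ^ η) ^ (-1 / (2 * η)) := rfl

theorem bt_pos {K : ℝ} (hK : 0 < K) (η : ℝ) (x : E d) : 0 < bt K hK η x :=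
  rpow_pos_of_pos (Kz_pos hK η x) _

theorem pd_bt {K : ℝ} (hK : 0 < K) (hη : 0 < η) (i : Fin d) :
    pd i (bt K hK η : Sm (E d)) = (-(th K hK η * bt K hK η * zp (-1))) * X i := by
  ext x
  have h0 : 0 < K + zz x ^ η := Kz_pos hK η x
  have e : (algebraMap ℝ (Sm (E d)) K + zp η : Sm (E d)) x = K + zz x ^ η := rfl
  have e2 : (K + zz x ^ η) ^ (-1 / (2 * η) - 1) = bt K hK η x * (K + zz x ^ η)⁻¹ := by
    rw [bt_apply, rpow_sub h0, rpow_one]; rfl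
  simp only [Sm.mul_apply, Sm.neg_apply, th_apply]
  conv_lhs => rw [bt, D_rp, map_add, D_algebraMap, pd_zp]
  simp only [Sm.smul_apply, Sm.mul_apply, Sm.add_apply, zp_apply, Sm.rp_apply, e, e2,
    rpow_neg_one, Sm.zero_apply, zero_add]
  field_simp

theorem zp_neg_one_apply (x : E d) : zp (-1) x = (zz x)⁻¹ := by
  rw [zp_apply, rpow_neg_one]

theorem th_nonneg {K : ℝ} (hK : 0 < K) (η : ℝ) (x : E d) : 0 ≤ th K hK η x := by
  rw [th_apply]
  exact div_nonneg (rpow_nonneg (zz_pos x).le _) (Kz_pos hK η x).le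

theorem th_lt_one {K : ℝ} (hK : 0 < K) (η : ℝ) (x : E d) : th K hK η x < 1 := by
  have := one_sub_th hK η x
  have h2 : 0 < K / (K + zz x ^ η) := div_pos hK (Kz_pos hK η x)
  linarith

theorem half_rpow_le {K : ℝ} (hK : 0 < K) (hK1 : 1 ≤ K) (hη : 0 ≤ η) (x : E d) :
    zz x ^ (-η) / 2 ≤ 1 - th K hK η x := by
  have h0 : 0 < K + zz x ^ η := Kz_pos hK η x
  have h1 : 1 ≤ zz x ^ η := one_le_rpow (one_le_zz x) hη
  rw [one_sub_th, rpow_neg (zz_pos x).le, le_div_iff₀ h0, inv_eq_one_div, div_div,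
    div_mul_eq_mul_div, div_le_iff₀ (by positivity)]
  nlinarith

theorem half_le_of_le {K : ℝ} (hK : 0 < K) (hη : 0 ≤ η) (hKR : R ^ η ≤ K) (hx : zz x ≤ R) : 1 / 2 ≤ 1 - th K hK η x := by
  have h0 : 0 < K + zz x ^ η := Kz_pos hK η x
  have h1 : zz x ^ η ≤ K := (rpow_le_rpow (zz_pos x).le hx hη).trans hKR
  rw [one_sub_th, le_div_iff₀ h0]
  linarith

/-- A smooth primitive of `h` along the function `zz`. -/
theorem exists_primitive (h : ℝ → ℝ) (hh : ContDiffOn ℝ (⊤ : ℕ∞) h (Ioi 0)) (c : ℝ) :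
    ∃ g : ℝ → ℝ, g 1 = c ∧ ContDiffOn ℝ (⊤ : ℕ∞) g (Ioi 0) ∧
      (∀ y > 0, HasDerivAt g (h y) y) := by
  refine ⟨fun y => c + ∫ t in (1 : ℝ)..y, h t, by simp, ?_⟩
  have hder : ∀ y > 0, HasDerivAt (fun y => c + ∫ t in (1 : ℝ)..y, h t) (h y) y := by
    intro y hy
    have hi : IntervalIntegrable h volume 1 y := by
      apply ContinuousOn.intervalIntegrable
      refine hh.continuousOn.mono fun t ht => ?_
      have : min 1 y ≤ t := ht.1
      exact lt_of_lt_of_le (lt_min one_pos hy) this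
    have hc : ContinuousAt h y := (hh.continuousOn).continuousAt (Ioi_mem_nhds hy)
    have hm : StronglyMeasurableAtFilter h (nhds y) volume :=
      hh.continuousOn.stronglyMeasurableAtFilter isOpen_Ioi y hy
    exact (intervalIntegral.integral_hasDerivAt_right hi hm hc).const_add c
  refine ⟨?_, hder⟩
  rw [contDiffOn_infty_iff_deriv_of_isOpen isOpen_Ioi]
  refine ⟨fun y hy => (hder y hy).differentiableAt.differentiableWithinAt, ?_⟩
  exact hh.congr fun y hy => (hder y hy).deriv

theorem exists_radial_primitive (h : ℝ → ℝ) (hh : ContDiffOn ℝ (⊤ : ℕ∞) h (Ioi 0)) (c : ℝ)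
    (ζ : Sm (E d)) (hζ : ∀ x, ζ x = 2 * h (zz x)) :
    ∃ (g : ℝ → ℝ) (φ : Sm (E d)), g 1 = c ∧ (∀ y > 0, HasDerivAt g (h y) y) ∧
      (∀ x, φ x = g (zz x)) ∧ ∀ i, pd i φ = ζ * X i := by
  obtain ⟨g, hg1, hg2, hg3⟩ := exists_primitive h hh c
  refine ⟨g, Sm.comp g zz fun x => hg2.contDiffAt (Ioi_mem_nhds (zz_pos x)), hg1, hg3,
    fun x => rfl, fun i => ?_⟩
  ext x
  rw [D_comp_apply, (hg3 _ (zz_pos x)).deriv, pd_zz]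
  simp [hζ]; ring

namespace Geo

theorem z_pos (g : Geo d c₀ C δ z r n dN Nn NdN) : 0 < z := by
  rw [g.hz]; positivity

theorem one_le_z (g : Geo d c₀ C δ z r n dN Nn NdN) : 1 ≤ z := by
  rw [g.hz]; nlinarith [sq_nonneg r]

theorem r_sq_le (g : Geo d c₀ C δ z r n dN Nn NdN) : r ^ 2 ≤ z := by
  rw [g.hz]; linarith

theorem n_nonneg (g : Geo d c₀ C δ z r n dN Nn NdN) (hc : 0 ≤ c₀) : 0 ≤ n :=
  (mul_nonneg hc (sq_nonneg r)).trans g.n_lo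

theorem n_div_le (g : Geo d c₀ C δ z r n dN Nn NdN) (hC : 0 ≤ C) : n / z ≤ 1 + C * δ := by
  have h1 := (abs_le.1 g.n_err).2
  have h2 : 0 ≤ C * δ := mul_nonneg hC g.hδ
  rw [div_le_iff₀ g.z_pos]
  nlinarith [g.r_sq_le, mul_le_mul_of_nonneg_left g.r_sq_le h2]

/-- The part of the zeroth order coefficient which is quadratic in the weight. -/
theorem quad_lower (g : Geo d c₀ C δ z r n dN Nn NdN) (hc : 0 ≤ c₀) (hC : 0 ≤ C)
    (hθ : 0 ≤ θ) (hθ1 : θ ≤ 1) (hl : 0 ≤ l) :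
    (1 - θ - 2 * (C * δ) - C2 / z) * (ζ ^ 2 * n + l)
        + ζ ^ 2 * (2 * σ * n ^ 2 / z - C * δ * r ^ 2)
      ≤ (-θ / z * n + dN - (d - 1 + C2 / z)) * (ζ ^ 2 * n + l)
        + (2 * ζ * ((σ - 1) * ζ / z) * n ^ 2 + ζ ^ 2 * Nn) := by
  have hz := g.z_pos
  have hn := g.n_nonneg hc
  have h1 := (abs_le.1 g.dN_err).1
  have h2 : 0 ≤ C * δ := mul_nonneg hC g.hδ
  have h3 : θ * (n / z) ≤ θ + C * δ := by
    nlinarith [mul_le_mul_of_nonneg_left (g.n_div_le hC) hθ, mul_le_mul_of_nonneg_right hθ1 h2]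
  have hA : (1 - θ - 2 * (C * δ) - C2 / z) * (ζ ^ 2 * n + l)
      ≤ (-θ / z * n + dN - (d - 1 + C2 / z)) * (ζ ^ 2 * n + l) := by
    refine mul_le_mul_of_nonneg_right ?_ (by positivity)
    have : -θ / z * n = -(θ * (n / z)) := by ring
    rw [this]; linarith
  have hB : 2 * n ^ 2 / z ≤ Nn + C * δ * r ^ 2 := by
    rcases eq_or_ne r 0 with h0 | h0
    · have e1 : n = 0 := by simpa [h0] using g.n_err
      have e2 : Nn = 0 := by simpa [h0] using g.Nn_abs
      simp [e1, e2, h0]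
    · have hr2 : 0 < r ^ 2 := by positivity
      have hS : 0 ≤ Nn + C * δ * r ^ 2 := by
        by_contra hneg
        push Not at hneg
        nlinarith [g.Nn_lo, mul_pos hr2 (neg_pos.2 hneg), sq_nonneg n]
      rw [div_le_iff₀ hz]
      nlinarith [g.Nn_lo, mul_le_mul_of_nonneg_right g.r_sq_le hS]
  have hB' := mul_le_mul_of_nonneg_left hB (sq_nonneg ζ)
  have e : 2 * ζ * ((σ - 1) * ζ / z) * n ^ 2 + ζ ^ 2 * Nn
      = ζ ^ 2 * (2 * σ * n ^ 2 / z) - ζ ^ 2 * (2 * n ^ 2 / z) + ζ ^ 2 * Nn := by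
    ring
  rw [e]; nlinarith [hA, hB']

end Geo

/-- Constant for the terms independent of the weight. -/
noncomputable def C3c (d : ℕ) (m S1 S2 : ℝ) : ℝ := (S2 * m + S1 * (d + m)) / 2

/-- Constant for the terms linear in the weight. -/
noncomputable def C4c (d : ℕ) (C m S W S1 : ℝ) : ℝ :=
  W * m ^ 2 + S * C + S * m * (d + m) + C + (S * m + (d + m)) * (m + (d + m)) + S1 * m

theorem Geo.half_Z_lower (g : Geo d c₀ C δ z r n dN Nn NdN) (hc : 0 ≤ c₀) (hC : 0 ≤ C)
    {W w1 w2 : ℝ} (hθ : 0 ≤ θ) (hθ1 : θ ≤ 1) (hl : 0 ≤ l) (hζ : 0 ≤ ζ)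
    (hb : 0 ≤ b) (hm : 1 + C * δ ≤ m) (hS : |σ - 1| ≤ S) (hW : |w| ≤ W) (hS1 : |w1| ≤ S1)
    (hS2 : |w2| ≤ S2) :
    b * ((1 - θ - 2 * (C * δ) - C2 / z) * (ζ ^ 2 * n + l)
        + ζ ^ 2 * (2 * σ * n ^ 2 / z - C * δ * r ^ 2)
        - C3c d m S1 S2 / z - C4c d C m S W S1 * ζ)
      ≤ ((-(θ * b / z)) * n + b * dN - b * (d - 1 + C2 / z)) * (ζ ^ 2 * n + l)
        + b * (2 * ζ * ((σ - 1) * ζ / z) * n ^ 2 + ζ ^ 2 * Nn)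
        - (b * w2 / z ^ 2 * n + b * w1 / z * dN) / 2
        - b * (w * ζ / z ^ 2 * n ^ 2 + (σ - 1) * ζ / z * Nn + (σ - 1) * ζ / z * n * dN
            + ζ * NdN)
        - ((σ - 1) * ζ / z * n + ζ * dN) * ((-(θ * b / z)) * n + b * dN)
        - ζ * (b * w1 / z) * n := by
  have hz := g.z_pos
  have hn := g.n_nonneg hc
  have h2 : 0 ≤ C * δ := mul_nonneg hC g.hδ
  have hq := g.quad_lower hc hC (C2 := C2) (ζ := ζ) (σ := σ) hθ hθ1 hl
  set k := n / z with hk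
  have hk0 : |k| ≤ m := by
    rw [abs_of_nonneg (by positivity)]; exact (g.n_div_le hC).trans hm
  have hdN : |dN| ≤ d + m := by
    have := abs_sub_abs_le_abs_sub dN d
    have h3 := g.dN_err
    rw [abs_of_nonneg (Nat.cast_nonneg d : (0 : ℝ) ≤ d)] at this
    linarith
  have hm0 : 0 ≤ m := (abs_nonneg _).trans hk0
  have hS0 : 0 ≤ S := (abs_nonneg _).trans hS
  have hNn : |Nn / z| ≤ C := by
    rw [abs_div, abs_of_pos hz, div_le_iff₀ hz]
    exact g.Nn_abs.trans (mul_le_mul_of_nonneg_left g.r_sq_le hC)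
  have hθk : |θ * k| ≤ m := by
    rw [abs_mul, abs_of_nonneg hθ]
    nlinarith [abs_nonneg k]
  have T3 : (w2 * k + w1 * dN) / 2 ≤ C3c d m S1 S2 := by
    have a1 := abs_mul_le' hS2 hk0
    have a2 := abs_mul_le' hS1 hdN
    unfold C3c
    linarith [le_abs_self (w2 * k), le_abs_self (w1 * dN)]
  have T4 : w * k ^ 2 + (σ - 1) * (Nn / z) + (σ - 1) * k * dN + NdN
      + ((σ - 1) * k + dN) * (-(θ * k) + dN) + w1 * k ≤ C4c d C m S W S1 := by
    have hk2 : |k ^ 2| ≤ m ^ 2 := by rw [abs_pow]; gcongr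
    have a1 := abs_mul_le' hW hk2
    have a2 := abs_mul_le' hS hNn
    have a3 := abs_mul_le' (abs_mul_le' hS hk0) hdN
    have a4 := abs_mul_le' ((abs_add_le _ _).trans (add_le_add (abs_mul_le' hS hk0) hdN))
      ((abs_add_le (-(θ * k)) dN).trans (add_le_add (show |-(θ * k)| ≤ m by rwa [abs_neg]) hdN))
    have a5 := abs_mul_le' hS1 hk0
    unfold C4c
    linarith [(abs_le.1 a1).2, (abs_le.1 a2).2, (abs_le.1 a3).2, (abs_le.1 a4).2,
      (abs_le.1 a5).2, (abs_le.1 g.NdN_abs).2]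
  have T3' : (w2 * k + w1 * dN) / 2 / z ≤ C3c d m S1 S2 / z := by gcongr
  have T4' := mul_le_mul_of_nonneg_right T4 hζ
  have key := mul_le_mul_of_nonneg_left (add_le_add hq (add_le_add (neg_le_neg T3') (neg_le_neg T4'))) hb
  refine le_trans (le_of_eq ?_) (key.trans (le_of_eq ?_))
  · ring
  · rw [hk]; field_simp; ring

theorem Geo.G_lower (g : Geo d c₀ C δ z r n dN Nn NdN) {F : ℝ}
    (h : Grd c₀ C δ r p F Q Nv err) (hc : 0 ≤ c₀) (hC : 0 ≤ C)
    (hδB : δ ≤ B) (hθ : 0 ≤ θ) (hθ1 : θ ≤ 1) (hζ : 0 ≤ ζ) (hb : 0 ≤ b)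
    (hC2 : 0 ≤ C2) :
    b * ((1 - θ + c₀ * C2 / z - (9 * C + 2 * C ^ 2 * B) * δ) * p)
      ≤ (4 * ζ * b + 2 * (-(θ * b / z))) * Nv ^ 2 + 2 * b * F
        - ((-(θ * b / z)) * n + b * dN - b * (d - 1 + C2 / z)) * Q + b * err := by
  have hz := g.z_pos
  have h2 : 0 ≤ C * δ := mul_nonneg hC g.hδ
  have hp := h.hp
  set D := C * δ * p with hD
  have hD0 : 0 ≤ D := mul_nonneg h2 hp
  have hDB : C * δ * D ≤ C ^ 2 * B * δ * p := by
    have : C * δ * D = C ^ 2 * δ * p * δ := by rw [hD]; ring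
    rw [this]
    have := mul_le_mul_of_nonneg_left hδB (show 0 ≤ C ^ 2 * δ * p from by
      have := g.hδ; positivity)
    linarith
  have q1 := abs_le.1 h.Qp
  have q2 := abs_le.1 h.FQ
  have q3 := abs_le.1 h.err_le
  have hQ : 0 ≤ Q := (mul_nonneg hc hp).trans h.Q_lo
  have hF : p - 2 * D ≤ F := by linarith
  set ρ := r ^ 2 / z with hρ
  have hρ0 : 0 ≤ ρ := by positivity
  have hρ1 : ρ ≤ 1 := by rw [hρ, div_le_one hz]; exact g.r_sq_le
  have hN : θ / z * Nv ^ 2 ≤ θ * ρ * F := by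
    have := mul_le_mul_of_nonneg_left h.Nv_le (show 0 ≤ θ / z by positivity)
    calc _ ≤ _ := this
      _ = _ := by rw [hρ]; ring
  have hn : ρ * (1 - C * δ) ≤ n / z := by
    rw [hρ, div_mul_eq_mul_div, div_le_div_iff_of_pos_right hz]
    linarith [(abs_le.1 g.n_err).1]
  have hn' := mul_le_mul_of_nonneg_right (mul_le_mul_of_nonneg_left hn hθ) hQ
  have hdN := mul_le_mul_of_nonneg_right (abs_le.1 g.dN_err).2 hQ
  have hθρ : θ * ρ ≤ 1 := mul_le_one₀ hθ1 hρ0 hρ1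
  have hθρ0 : 0 ≤ θ * ρ := mul_nonneg hθ hρ0
  have hCQ : C * δ * Q ≤ D + C * δ * D := by
    have := mul_le_mul_of_nonneg_left (show Q ≤ p + D by linarith) h2
    linarith
  have k1 : 2 * (1 - θ * ρ) * (p - 2 * D) ≤ 2 * (1 - θ * ρ) * F :=
    mul_le_mul_of_nonneg_left hF (by linarith)
  have k2 : θ * ρ * C * δ * Q ≤ C * δ * Q := by
    have := mul_le_mul_of_nonneg_right hθρ (mul_nonneg h2 hQ)
    linarith
  have k3 : (θ * ρ - 1) * (p + D) ≤ (θ * ρ - 1) * Q := by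
    have := mul_le_mul_of_nonneg_left (show Q ≤ p + D by linarith) (show 0 ≤ 1 - θ * ρ by linarith)
    linarith
  have k4 : C2 / z * (c₀ * p) ≤ C2 / z * Q := mul_le_mul_of_nonneg_left h.Q_lo (by positivity)
  have k5 : 0 ≤ 4 * ζ * Nv ^ 2 := by positivity
  have k6 : (1 - θ) * p ≤ (1 - θ * ρ) * p :=
    mul_le_mul_of_nonneg_right (by nlinarith) hp
  have k7 : (1 - θ * ρ) * D ≤ D := by nlinarith
  have key : (1 - θ + c₀ * C2 / z - (9 * C + 2 * C ^ 2 * B) * δ) * p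
      ≤ 4 * ζ * Nv ^ 2 - 2 * (θ / z * Nv ^ 2) + 2 * F
        + (θ * (n / z) - dN + d - 1 + C2 / z) * Q + err := by
    have e1 : c₀ * C2 / z * p = C2 / z * (c₀ * p) := by ring
    have e2 : (9 * C + 2 * C ^ 2 * B) * δ * p = 9 * D + 2 * (C ^ 2 * B * δ * p) := by
      rw [hD]; ring
    linarith
  refine (mul_le_mul_of_nonneg_left key hb).trans (le_of_eq ?_)
  field_simp; ring

theorem half_le_of_error {D Z0 : ℝ} (hc : 0 < c₀) (hD : 0 ≤ D) (hB : 0 ≤ B)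
    (hz : 0 < z) (he : 0 ≤ e) (hδB : δ ≤ B) (hδe : δ * √z ≤ 2 * B * e) (hZ0 : 4 * (D * B) ≤ √Z0)
    (hC2 : D * B * Z0 / c₀ ≤ C2) (hC20 : 0 ≤ C2) :
    e / 2 ≤ e + c₀ * C2 / z - D * δ := by
  have hsz : 0 < √z := sqrt_pos.2 hz
  rcases le_total z Z0 with h | h
  · have h1 : D * δ ≤ D * B := mul_le_mul_of_nonneg_left hδB hD
    have h2 : D * B ≤ c₀ * C2 / z := by
      rw [le_div_iff₀ hz]
      rw [div_le_iff₀ hc] at hC2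
      nlinarith [mul_le_mul_of_nonneg_left h (mul_nonneg hD hB)]
    linarith
  · have h1 : √Z0 ≤ √z := sqrt_le_sqrt h
    have h2 : 0 ≤ c₀ * C2 / z := by positivity
    have h3 : D * δ * √z ≤ e / 2 * √z := by
      have := mul_le_mul_of_nonneg_left hδe hD
      have := mul_le_mul_of_nonneg_right (hZ0.trans h1) he
      linarith
    have := le_of_mul_le_mul_right h3 hsz
    linarith

/-- Positivity of the zeroth order coefficient away from the center. -/
theorem Geo.far_lower (g : Geo d c₀ C δ z r n dN Nn NdN) (hc : 0 < c₀) (hC : 0 ≤ C) (hC2 : 0 ≤ C2) (he : 0 < e) (he1 : e ≤ 1) (hδe : δ * √z ≤ 2 * B * e)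
    (hze : 1 ≤ 2 * e * √z) (hz1 : 32 * (C * B) + 16 * C2 ≤ √z) (hl : 0 ≤ l)
    (hs : 0 ≤ s) (hσ : -s ≤ σ) :
    7 / 8 * e * (ζ ^ 2 * n + l) - e / 8 * (ζ ^ 2 * n) - 4 * s * (ζ ^ 2 * n) - C3 / z - C4 * ζ
      ≤ (e - 2 * (C * δ) - C2 / z) * (ζ ^ 2 * n + l)
        + ζ ^ 2 * (2 * σ * n ^ 2 / z - C * δ * r ^ 2) - C3 / z - C4 * ζ := by
  have hz := g.z_pos
  have hn := g.n_nonneg hc.le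
  have hsz : 0 < √z := sqrt_pos.2 hz
  have hδ := g.hδ
  have hsq : √z * √z = z := mul_self_sqrt hz.le
  have h1 : C * δ * √z ≤ 2 * (C * B) * e := by
    have := mul_le_mul_of_nonneg_left hδe hC; linarith
  have h2 : C2 / z * √z ≤ 2 * C2 * e := by
    have : C2 / z * √z = C2 / √z := by
      rw [div_mul_eq_mul_div, div_eq_div_iff hz.ne' hsz.ne', mul_assoc, hsq]
    rw [this, div_le_iff₀ hsz]
    have := mul_le_mul_of_nonneg_left hze hC2
    linarith
  have h3 : 2 * (C * δ) + C2 / z ≤ e / 8 := by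
    refine le_of_mul_le_mul_right ?_ hsz
    have := mul_le_mul_of_nonneg_right hz1 he.le
    nlinarith
  have hCδ : C * δ ≤ 1 / 16 := by
    have : 0 ≤ C2 / z := by positivity
    linarith
  have hnr : r ^ 2 / 2 ≤ n := by
    have := (abs_le.1 g.n_err).1
    nlinarith [mul_le_mul_of_nonneg_right hCδ (sq_nonneg r)]
  have hnz : n / z ≤ 2 := (g.n_div_le hC).trans (by linarith)
  have h4 : C * δ * r ^ 2 ≤ e / 8 * n := by
    have h0 : 0 ≤ C * δ := mul_nonneg hC hδ
    have : C * δ ≤ e / 16 := by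
      have : 0 ≤ C2 / z := by positivity
      linarith
    nlinarith [mul_le_mul_of_nonneg_left hnr h0, mul_le_mul_of_nonneg_right this hn]
  have hy : 0 ≤ ζ ^ 2 * n := by positivity
  have h5 : -(4 * s) * (ζ ^ 2 * n) ≤ 2 * σ * (n / z) * (ζ ^ 2 * n) := by
    refine mul_le_mul_of_nonneg_right ?_ hy
    have hk : 0 ≤ n / z := by positivity
    nlinarith [mul_le_mul_of_nonneg_right hσ hk, mul_le_mul_of_nonneg_left hnz hs]
  have h6 := mul_le_mul_of_nonneg_left h4 (sq_nonneg ζ)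
  have h7 : 7 / 8 * e * (ζ ^ 2 * n + l) ≤ (e - 2 * (C * δ) - C2 / z) * (ζ ^ 2 * n + l) :=
    mul_le_mul_of_nonneg_right (by linarith) (by positivity)
  have e1 : ζ ^ 2 * (2 * σ * n ^ 2 / z - C * δ * r ^ 2)
      = 2 * σ * (n / z) * (ζ ^ 2 * n) - ζ ^ 2 * (C * δ * r ^ 2) := by ring
  rw [e1]
  linarith

/-- Absorption of the lower order terms. -/
theorem absorb_lower (hz : 0 < z) (he : 0 < e) (he1 : e ≤ 1)
    (hC3 : 0 ≤ C3) (hnz : z / 4 ≤ n)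
    (h : 16 * (C3 + 16 * C4 ^ 2) ≤ e ^ 2 * z * (ζ ^ 2 * n + l)) :
    C3 / z + C4 * ζ ≤ e / 16 * (ζ ^ 2 * n) + e / 16 * (ζ ^ 2 * n + l) := by
  have h1 : C3 / z ≤ C3 / (e * z) := by
    apply div_le_div_of_nonneg_left hC3 (by positivity)
    nlinarith
  have h2 : C4 * ζ ≤ e / 16 * (ζ ^ 2 * (z / 4)) + 16 * C4 ^ 2 / (e * z) := by
    have hez : 0 < e * z := by positivity
    have : C4 * ζ * (e * z) ≤ (e / 16 * (ζ ^ 2 * (z / 4)) + 16 * C4 ^ 2 / (e * z)) * (e * z) := by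
      rw [add_mul, div_mul_cancel₀ _ hez.ne']
      nlinarith [sq_nonneg (e * z * ζ / 8 - 4 * C4)]
    exact le_of_mul_le_mul_right this hez
  have h3 : e / 16 * (ζ ^ 2 * (z / 4)) ≤ e / 16 * (ζ ^ 2 * n) := by gcongr
  have h4 : C3 / (e * z) + 16 * C4 ^ 2 / (e * z) ≤ e / 16 * (ζ ^ 2 * n + l) := by
    rw [← add_div, div_le_iff₀ (by positivity)]
    nlinarith
  linarith

set_option maxHeartbeats 800000 in
/-- Positivity in the intermediate region. -/
theorem Geo.mid_lower (g : Geo d c₀ C δ z r n dN Nn NdN) (hc : 0 < c₀) (hC : 0 ≤ C)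
    (hB : 0 ≤ B) (hC2 : 0 ≤ C2) (he0 : 0 ≤ e) (he1 : e ≤ 1) (hδB : δ ≤ B) (hr : 1 / 4 ≤ r)
    (hL : L = 2 * (C * B) + C2 + 1 + C * B / c₀) (hl : 0 ≤ l)
    (hζ : 0 ≤ ζ) (hσ : 17 * L / c₀ ≤ σ) (hC3 : 0 ≤ C3)
    (h1 : l ≤ c₀ / 48 * ζ ^ 2) (h2 : C3 ≤ c₀ / 48 * ζ ^ 2) (h3 : C4 ≤ c₀ / 48 * ζ) :
    e / 4 * (ζ ^ 2 * n + l)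
      ≤ (e - 2 * (C * δ) - C2 / z) * (ζ ^ 2 * n + l)
        + ζ ^ 2 * (2 * σ * n ^ 2 / z - C * δ * r ^ 2) - C3 / z - C4 * ζ := by
  have hz := g.z_pos
  have hz1 := g.one_le_z
  have hCB : 0 ≤ C * B := mul_nonneg hC hB
  have hL1 : 1 ≤ L := by
    have : 0 ≤ C * B / c₀ := by positivity
    linarith
  have hCδ : C * δ ≤ C * B := mul_le_mul_of_nonneg_left hδB hC
  have hr2 : 1 / 16 ≤ r ^ 2 := by nlinarith
  have hn16 : c₀ / 16 ≤ n := by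
    have := g.n_lo
    nlinarith
  have hn : 0 < n := by linarith [div_pos hc (by norm_num : (0 : ℝ) < 16)]
  have hrn : r ^ 2 ≤ n / c₀ := by
    rw [le_div_iff₀ hc]; linarith [g.n_lo]
  have hk : c₀ / 17 ≤ n / z := by
    rw [div_le_div_iff₀ (by norm_num) hz]
    have := g.n_lo
    have := g.hz
    nlinarith
  have hy : 0 ≤ ζ ^ 2 * n := by positivity
  have hσ0 : 0 ≤ σ := le_trans (by positivity) hσ
  have a1 : L ≤ σ * (n / z) := by
    calc L = 17 * L / c₀ * (c₀ / 17) := by field_simp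
      _ ≤ _ := mul_le_mul hσ hk (by positivity) hσ0
  have a2 : 2 * L * (ζ ^ 2 * n) ≤ 2 * (σ * (n / z)) * (ζ ^ 2 * n) := by gcongr
  have a3 : ζ ^ 2 * (C * δ * r ^ 2) ≤ C * B / c₀ * (ζ ^ 2 * n) := by
    have : C * δ * r ^ 2 ≤ C * B * (n / c₀) := mul_le_mul hCδ hrn (sq_nonneg r) hCB
    calc _ ≤ ζ ^ 2 * (C * B * (n / c₀)) := by gcongr
      _ = _ := by ring
  have hC2z : C2 / z ≤ C2 := div_le_self hC2 hz1
  have hC3z : C3 / z ≤ C3 := div_le_self hC3 hz1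
  have a4 : -(2 * (C * B) + C2) * (ζ ^ 2 * n + l)
      ≤ (e - 2 * (C * δ) - C2 / z) * (ζ ^ 2 * n + l) :=
    mul_le_mul_of_nonneg_right (by linarith) (by positivity)
  have a5 : e / 4 * (ζ ^ 2 * n + l) ≤ 1 * (ζ ^ 2 * n + l) :=
    mul_le_mul_of_nonneg_right (by linarith) (by positivity)
  have a6 : c₀ / 16 * ζ ^ 2 ≤ ζ ^ 2 * n := by nlinarith [mul_le_mul_of_nonneg_right hn16 (sq_nonneg ζ)]
  have a7 : C4 * ζ ≤ c₀ / 48 * ζ ^ 2 := by nlinarith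
  have a8 : L * l ≤ L * (c₀ / 48 * ζ ^ 2) := by gcongr
  have a9 : c₀ / 48 * ζ ^ 2 ≤ L * (c₀ / 48 * ζ ^ 2) := by
    have : 0 ≤ c₀ / 48 * ζ ^ 2 := by positivity
    nlinarith
  have a10 : L * (c₀ / 16 * ζ ^ 2) ≤ L * (ζ ^ 2 * n) := by gcongr
  have a11 : (2 * (C * B) + C2 + 1) * l ≤ L * l := by
    refine mul_le_mul_of_nonneg_right ?_ hl
    have : 0 ≤ C * B / c₀ := by positivity
    linarith
  have e1 : ζ ^ 2 * (2 * σ * n ^ 2 / z - C * δ * r ^ 2)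
      = 2 * (σ * (n / z)) * (ζ ^ 2 * n) - ζ ^ 2 * (C * δ * r ^ 2) := by ring
  rw [e1]
  have e2 : L * (ζ ^ 2 * n) = (2 * (C * B) + C2 + 1 + C * B / c₀) * (ζ ^ 2 * n) := by rw [hL]
  clear hL h1 h3 hσ hCδ hr2 hn16 hrn hk a1
  generalize ζ ^ 2 * n = y at *
  linarith

/-- The lower bound near the center. -/
theorem Geo.near_lower (g : Geo d c₀ C δ z r n dN Nn NdN) (hc : 0 < c₀) (hC : 0 ≤ C)
    (hB : 0 ≤ B) (hC2 : 0 ≤ C2) (he0 : 0 ≤ e) (he1 : e ≤ 1) (hδB : δ ≤ B) (hr : r ≤ 1 / 4)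
    {C1 C8 : ℝ} (hl0 : 0 < lam0) (hl : lam0 ≤ lam) (hC1 : 0 ≤ C1) (hC4 : 0 ≤ C4)
    (hζ : 0 ≤ ζ) (hζ1 : ζ ≤ C1 * lam) (hσ : -3 ≤ σ) (hC3 : 0 ≤ C3)
    (hC8 : (2 * (C * B) + C2 + 1) * (1 + C * B + 1) + 6 * (1 + C * B) ^ 2 + C * B
      + C3 / lam0 ^ 2 + C4 / lam0 ≤ C8) :
    e / 4 * (ζ ^ 2 * n + lam ^ 2) - C8 * (1 + C1) ^ 2 * lam ^ 2
      ≤ (e - 2 * (C * δ) - C2 / z) * (ζ ^ 2 * n + lam ^ 2)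
        + ζ ^ 2 * (2 * σ * n ^ 2 / z - C * δ * r ^ 2) - C3 / z - C4 * ζ := by
  have hz := g.z_pos
  have hz1 := g.one_le_z
  have hn := g.n_nonneg hc.le
  have hCB : 0 ≤ C * B := mul_nonneg hC hB
  have hCδ : C * δ ≤ C * B := mul_le_mul_of_nonneg_left hδB hC
  have hCδ0 : 0 ≤ C * δ := mul_nonneg hC g.hδ
  have hlam : 0 < lam := hl0.trans_le hl
  have hr2 : r ^ 2 ≤ 1 := by nlinarith [g.hr]
  set k := n / z with hkd
  set m := 1 + C * B with hm
  have hk1 : k ≤ m := (g.n_div_le hC).trans (by linarith)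
  have hnb : n ≤ m := by
    have := (abs_le.1 g.n_err).2
    have := mul_le_mul hCδ hr2 (sq_nonneg r) hCB
    linarith
  have hm1 : 1 ≤ m := by linarith
  have hk0 : 0 ≤ k := by positivity
  set T := (1 + C1) ^ 2 * lam ^ 2 with hT
  have hlT : lam ^ 2 ≤ T := by
    rw [hT]
    exact le_mul_of_one_le_left (sq_nonneg _) (one_le_pow₀ (by linarith))
  have hζT : ζ ^ 2 ≤ T := by
    rw [hT, ← mul_pow]
    refine pow_le_pow_left₀ hζ (hζ1.trans ?_) 2
    gcongr; linarith
  have hT0 : 0 ≤ T := (sq_nonneg _).trans hlT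
  have a3 : ζ ^ 2 * (C * δ * r ^ 2) ≤ T * (C * B * 1) :=
    mul_le_mul hζT (mul_le_mul hCδ hr2 (sq_nonneg r) hCB) (by positivity) hT0
  have a6 : C3 ≤ C3 / lam0 ^ 2 * T := by
    have h1 : lam0 ^ 2 ≤ T := le_trans (by gcongr) hlT
    rw [div_mul_eq_mul_div, le_div_iff₀ (by positivity)]
    gcongr
  have a7 : C4 * ζ ≤ C4 / lam0 * T := by
    have h1 : lam0 * ζ ≤ T := by
      calc lam0 * ζ ≤ lam * (C1 * lam) := by gcongr
        _ = C1 * lam ^ 2 := by ring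
        _ ≤ (1 + C1) ^ 2 * lam ^ 2 := mul_le_mul_of_nonneg_right (by nlinarith) (sq_nonneg _)
    rw [div_mul_eq_mul_div, le_div_iff₀ hl0, mul_assoc, mul_comm ζ]
    gcongr
  have hyT : ζ ^ 2 * n ≤ T * m := mul_le_mul hζT hnb hn hT0
  have hy : 0 ≤ ζ ^ 2 * n := by positivity
  have e1 : ζ ^ 2 * (2 * σ * n ^ 2 / z - C * δ * r ^ 2)
      = 2 * σ * (k * (ζ ^ 2 * n)) - ζ ^ 2 * (C * δ * r ^ 2) := by rw [hkd]; ring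
  have e2 : C8 * (1 + C1) ^ 2 * lam ^ 2 = C8 * T := by rw [hT]; ring
  have a8 := mul_le_mul_of_nonneg_right hC8 hT0
  rw [e1, e2]
  have hC2z : C2 / z ≤ C2 := div_le_self hC2 hz1
  have hC3z : C3 / z ≤ C3 := div_le_self hC3 hz1
  generalize ζ ^ 2 * n = y at *
  have a1 : k * y ≤ m * (T * m) := mul_le_mul hk1 hyT hy (by linarith)
  have a1' : -3 * (k * y) ≤ σ * (k * y) := mul_le_mul_of_nonneg_right hσ (by positivity)
  have a4 : -(2 * (C * B) + C2) * (y + lam ^ 2)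
      ≤ (e - 2 * (C * δ) - C2 / z) * (y + lam ^ 2) :=
    mul_le_mul_of_nonneg_right (by linarith) (by positivity)
  have a5 : e / 4 * (y + lam ^ 2) ≤ 1 * (y + lam ^ 2) :=
    mul_le_mul_of_nonneg_right (by linarith) (by positivity)
  have a9 : (2 * (C * B) + C2 + 1) * (y + lam ^ 2)
      ≤ (2 * (C * B) + C2 + 1) * (T * m + T) :=
    mul_le_mul_of_nonneg_left (by linarith) (by linarith)
  linarith

/-- The radial profile of the slope of the Carleman weight. -/
noncomputable def zt (M R3 z : ℝ) : ℝ :=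
  exp (-M / z) * z ^ (-(1 + 1 / 200) / 2 : ℝ) * (R3 / (R3 + z))

/-- A bound for the second logarithmic derivative of the slope. -/
noncomputable def Wc (M : ℝ) : ℝ := 4 * M + 4 + (2 * M + 4) ^ 2 + 2 * (2 * M + 4)

theorem zt_pos (hR : 0 < R3) (hz : 0 < z) : 0 < zt M R3 z := by
  unfold zt; positivity

theorem zt_le_rpow (hM : 0 ≤ M) (hR : 0 < R3) (hz : 0 < z) :
    zt M R3 z ≤ z ^ (-(1 + 1 / 200) / 2 : ℝ) := by
  unfold zt
  have h1 : exp (-M / z) ≤ 1 := by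
    rw [exp_le_one_iff]; exact div_nonpos_of_nonpos_of_nonneg (by linarith) hz.le
  have h2 : R3 / (R3 + z) ≤ 1 := by rw [div_le_one (by positivity)]; linarith
  have h3 : 0 ≤ z ^ (-(1 + 1 / 200) / 2 : ℝ) := by positivity
  calc _ ≤ 1 * z ^ (-(1 + 1 / 200) / 2 : ℝ) * 1 := by gcongr
    _ = _ := by ring

theorem zt_le_one (hM : 0 ≤ M) (hR : 0 < R3) (hz : 1 ≤ z) : zt M R3 z ≤ 1 :=
  (zt_le_rpow hM hR (by linarith)).trans (rpow_le_one_of_one_le_of_nonpos hz (by norm_num))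

theorem le_zt {Z : ℝ} (hM : 0 ≤ M) (hZ : Z ≤ R3) (hz : 1 ≤ z) (hzZ : z ≤ Z) :
    exp (-M) * Z ^ (-(1 + 1 / 200) / 2 : ℝ) / 2 ≤ zt M R3 z := by
  have hz0 : 0 < z := by linarith
  have h1 : exp (-M) ≤ exp (-M / z) := by
    rw [exp_le_exp, neg_div, neg_le_neg_iff]
    exact div_le_self hM hz
  have h2 : 1 / 2 ≤ R3 / (R3 + z) := by
    rw [div_le_div_iff₀ (by norm_num) (by linarith)]; linarith
  have h3 : Z ^ (-(1 + 1 / 200) / 2 : ℝ) ≤ z ^ (-(1 + 1 / 200) / 2 : ℝ) :=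
    rpow_le_rpow_of_nonpos hz0 hzZ (by norm_num)
  have hZ0 : 0 < Z := by linarith
  unfold zt
  calc _ = exp (-M) * Z ^ (-(1 + 1 / 200) / 2 : ℝ) * (1 / 2) := by ring
    _ ≤ _ := by gcongr

theorem exists_ge_of_mul (hm : 0 < m) (b : ℝ) : ∃ s₀ ≥ 0, ∀ s ≥ s₀, b ≤ s * m :=
  ⟨max 0 (b / m), le_max_left _ _, fun s hs => by
    rw [← div_le_iff₀ hm]; exact (le_max_right _ _).trans hs⟩

set_option maxHeartbeats 1000000 in
theorem exists_positive_coefficient (hc : 0 < c₀) (hC : 0 ≤ C) (hB : 0 ≤ B)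
    (hC2 : 0 ≤ C2) (hS1 : 0 ≤ S1) (hS2 : 0 ≤ S2) (hl0 : 0 < lam0) (hη : 0 < η)
    (hη1 : η ≤ 1 / 400) :
    ∃ M > 0, ∃ C8 ≥ 0, ∃ C10 ≥ 0, ∀ C1 ≥ C10, ∃ R3 ≥ 1, ∃ K ≥ 1,
      ∀ {z r n dN Nn NdN δ lam e ω σ ζ : ℝ}, Geo d c₀ C δ z r n dN Nn NdN → δ ≤ B →
        δ * √z ≤ B * z ^ (-η) → lam0 ≤ lam → e = K / (K + z ^ η) → ω = z / (R3 + z) →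
        σ = 2 * M / z - 1 / 200 - 2 * ω → ζ = C1 * lam * zt M R3 z →
        e / 4 * (ζ ^ 2 * n + lam ^ 2)
            - (if r ≤ 1 / 4 then C8 * (1 + C1) ^ 2 * lam ^ 2 else 0)
          ≤ (e - 2 * (C * δ) - C2 / z) * (ζ ^ 2 * n + lam ^ 2)
            + ζ ^ 2 * (2 * σ * n ^ 2 / z - C * δ * r ^ 2) - C3c d (1 + C * B) S1 S2 / z
            - C4c d C (1 + C * B) (2 * M + 4) (Wc M) S1 * ζ := by
  have hCB : 0 ≤ C * B := mul_nonneg hC hB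
  obtain ⟨L, hL⟩ : ∃ L, L = 2 * (C * B) + C2 + 1 + C * B / c₀ := ⟨_, rfl⟩
  have hL0 : 0 < L := by
    have : 0 ≤ C * B / c₀ := by positivity
    linarith
  obtain ⟨Z1, hZ1⟩ : ∃ Z1, Z1 = 2 + (32 * (C * B) + 16 * C2) ^ 2 := ⟨_, rfl⟩
  have hZ12 : 2 ≤ Z1 := by rw [hZ1]; linarith only [sq_nonneg (32 * (C * B) + 16 * C2)]
  obtain ⟨M, hM⟩ : ∃ M, M = (17 * L / c₀ + 3) * Z1 := ⟨_, rfl⟩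
  have hM0 : 0 < M := by rw [hM]; positivity
  set C3 := C3c d (1 + C * B) S1 S2 with hC3
  set C4 := C4c d C (1 + C * B) (2 * M + 4) (Wc M) S1 with hC4
  have hC30 : 0 ≤ C3 := by rw [hC3]; unfold C3c; positivity
  have hC40 : 0 ≤ C4 := by rw [hC4]; unfold C4c Wc; positivity
  obtain ⟨C6, hC6⟩ : ∃ C6, C6 = C3 + 16 * C4 ^ 2 := ⟨_, rfl⟩
  have hC60 : 0 ≤ C6 := by rw [hC6]; positivity
  obtain ⟨Z2, hZ2⟩ : ∃ Z2, Z2 = Z1 + (64 * C6 / lam0 ^ 2) ^ 2 := ⟨_, rfl⟩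
  have hZ2Z1 : Z1 ≤ Z2 := by rw [hZ2]; linarith only [sq_nonneg (64 * C6 / lam0 ^ 2)]
  have hZ20 : 0 < Z2 := by linarith
  obtain ⟨m, hm⟩ : ∃ m, m = exp (-M) * Z2 ^ (-(1 + 1 / 200) / 2 : ℝ) / 2 := ⟨_, rfl⟩
  have hm0 : 0 < m := by rw [hm]; positivity
  obtain ⟨s1, hs1, h1⟩ := exists_ge_of_mul (show 0 < m by positivity) (48 / c₀ + 1)
  obtain ⟨s2, hs2, h2⟩ := exists_ge_of_mul (show 0 < lam0 * m by positivity) (48 * C3 / c₀ + 1)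
  obtain ⟨s3, hs3, h3⟩ := exists_ge_of_mul (show 0 < lam0 * m by positivity) (48 * C4 / c₀)
  obtain ⟨s4, hs4, h4⟩ := exists_ge_of_mul (show 0 < lam0 * m by positivity) (256 * C6 + 1)
  refine ⟨M, hM0, (2 * (C * B) + C2 + 1) * (1 + C * B + 1) + 6 * (1 + C * B) ^ 2 + C * B
      + C3 / lam0 ^ 2 + C4 / lam0, by positivity, s1 + s2 + s3 + s4, by positivity,
      fun C1 hC1 => ?_⟩
  obtain ⟨R4, hR4⟩ : ∃ R4, R4 = Z2 + (384 * C1 ^ 2) ^ (400 : ℝ) := ⟨_, rfl⟩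
  have hR4' : 0 ≤ (384 * C1 ^ 2) ^ (400 : ℝ) := by positivity
  have hR4Z2 : Z2 ≤ R4 := by rw [hR4]; linarith only [hR4']
  have hR40 : 0 < R4 := by linarith
  have hC10 : 0 ≤ C1 := by linarith
  refine ⟨200 * R4, by linarith, R4 ^ η, one_le_rpow (by linarith) hη.le, ?_⟩
  intro z r n dN Nn NdN δ lam e ω σ ζ g hδB hδz hlam he hω hσ hζ
  have hz := g.z_pos
  have hz1 := g.one_le_z
  have hδ := g.hδ
  have hn := g.n_nonneg hc.le
  have hlam0 : 0 < lam := hl0.trans_le hlam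
  have hzη : 1 ≤ z ^ η := one_le_rpow hz1 hη.le
  have hRη : 1 ≤ R4 ^ η := one_le_rpow (by linarith) hη.le
  have he0 : 0 < e := by rw [he]; positivity
  have he1 : e ≤ 1 := by rw [he, div_le_one (by positivity)]; linarith
  have hez : z ^ (-η) ≤ 2 * e := by
    rw [he, rpow_neg hz.le, inv_eq_one_div, ← mul_div_assoc, div_le_div_iff₀ (by positivity) (by positivity)]
    nlinarith only [mul_le_mul hRη hzη zero_le_one (by linarith), hRη, hzη]
  have heR : z ≤ R4 → 1 / 2 ≤ e := by
    intro h
    have : z ^ η ≤ R4 ^ η := rpow_le_rpow hz.le h hη.le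
    rw [he, div_le_div_iff₀ (by norm_num) (by positivity)]; linarith
  have hω0 : 0 ≤ ω := by rw [hω]; positivity
  have hω1 : ω ≤ 1 := by rw [hω, div_le_one (by positivity)]; linarith
  have hR30 : 0 < 200 * R4 := by linarith
  have hζ0 : 0 ≤ ζ := by rw [hζ]; have := (zt_pos (M := M) hR30 hz).le; positivity
  have hMz : 0 ≤ 2 * M / z := by positivity
  have hδe : δ * √z ≤ 2 * B * e := by
    have := mul_le_mul_of_nonneg_left hez hB; linarith
  have hsz : 0 < √z := sqrt_pos.2 hz
  -- lower bound for the slope on a fixed region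
  have hζlow : z ≤ Z2 → C1 * lam * m ≤ ζ := by
    intro h
    rw [hζ, hm]
    exact mul_le_mul_of_nonneg_left (le_zt hM0.le (by linarith) hz1 h) (by positivity)
  have hCm : ∀ s ≥ 0, s ≤ C1 → s * (lam0 * m) ≤ C1 * lam * m := by
    intro s hs hsC
    have : s * lam0 ≤ C1 * lam := by gcongr
    linarith only [mul_le_mul_of_nonneg_right this hm0.le]
  by_cases hr : r ≤ 1 / 4
  · rw [if_pos hr]
    refine g.near_lower hc hC hB hC2 he0.le he1 hδB hr hl0 hlam hC10 hC40 hζ0 ?_ ?_ hC30 le_rfl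
    · rw [hζ]
      exact mul_le_of_le_one_right (by positivity) (zt_le_one hM0.le hR30 hz1)
    · rw [hσ]; linarith
  rw [if_neg hr, sub_zero]
  push Not at hr
  rcases le_total z Z1 with hzZ1 | hzZ1
  · have hlow := hζlow (hzZ1.trans hZ2Z1)
    have hpos : 0 < ζ := lt_of_lt_of_le (by
      have := hCm s2 hs2 (by linarith)
      have := h2 s2 le_rfl
      have : 0 ≤ 48 * C3 / c₀ := by positivity
      linarith) hlow
    refine g.mid_lower hc hC hB hC2 he0.le he1 hδB hr.le hL (sq_nonneg lam) hζ0 ?_ hC30 ?_ ?_ ?_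
    · rw [hσ]
      have : 17 * L / c₀ + 3 ≤ 2 * M / z := by
        rw [le_div_iff₀ hz, hM]
        have : 0 ≤ 17 * L / c₀ + 3 := by positivity
        linarith only [mul_le_mul_of_nonneg_left hzZ1 this, mul_nonneg this hz.le]
      linarith
    · have k1 : (48 / c₀ + 1) * lam ≤ ζ := by
        refine le_trans ?_ hlow
        have := h1 C1 (by linarith)
        linarith only [mul_le_mul_of_nonneg_right this hlam0.le]
      have k2 : ((48 / c₀ + 1) * lam) ^ 2 ≤ ζ ^ 2 := pow_le_pow_left₀ (by positivity) k1 2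
      have k3 : 48 / c₀ * lam ^ 2 ≤ ζ ^ 2 := by
        refine le_trans ?_ k2
        rw [mul_pow]
        refine mul_le_mul_of_nonneg_right ?_ (sq_nonneg _)
        have : 0 ≤ 48 / c₀ := by positivity
        nlinarith only [this]
      have := mul_le_mul_of_nonneg_left k3 (show 0 ≤ c₀ / 48 by positivity)
      refine le_trans (le_of_eq ?_) this
      field_simp
    · have k1 : 48 * C3 / c₀ + 1 ≤ ζ :=
        ((h2 s2 le_rfl).trans (hCm s2 hs2 (by linarith))).trans hlow
      have k0 : 0 ≤ 48 * C3 / c₀ := by positivity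
      have k3 : 48 * C3 / c₀ ≤ ζ ^ 2 := by nlinarith only [k0, k1]
      have := mul_le_mul_of_nonneg_left k3 (show 0 ≤ c₀ / 48 by positivity)
      refine le_trans (le_of_eq ?_) this
      field_simp
    · have k1 : 48 * C4 / c₀ ≤ ζ :=
        ((h3 s3 le_rfl).trans (hCm s3 hs3 (by linarith))).trans hlow
      have := mul_le_mul_of_nonneg_left k1 (show 0 ≤ c₀ / 48 by positivity)
      refine le_trans (le_of_eq ?_) this
      field_simp
      exact hC4.symm
  -- the exterior region
  have hzhalf : z ^ (-(1 / 2) : ℝ) ≤ z ^ (-η) :=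
    rpow_le_rpow_of_exponent_le hz1 (by linarith)
  have hsqrt : z ^ (-(1 / 2) : ℝ) * √z = 1 := by
    rw [sqrt_eq_rpow, ← rpow_add hz]; norm_num
  have hze : 1 ≤ 2 * e * √z := by
    rw [← hsqrt]; gcongr; exact hzhalf.trans hez
  have hz1' : 32 * (C * B) + 16 * C2 ≤ √z := by
    apply le_sqrt_of_sq_le; linarith
  have hs0 : 0 ≤ 1 / 200 + 2 * ω := by positivity
  refine le_trans ?_ (g.far_lower hc hC hC2 he0 he1 hδe hze hz1' (sq_nonneg lam) hs0
    (by rw [hσ]; linarith))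
  have hCδ : C * δ ≤ 1 / 2 := by
    have q1 : C * (δ * √z) ≤ C * (2 * B * e) := mul_le_mul_of_nonneg_left hδe hC
    have q2 : C * (2 * B * e) ≤ 2 * (C * B) := by nlinarith only [mul_le_mul_of_nonneg_left he1 hCB]
    have q3 : 4 * (C * B) ≤ √z := by linarith
    by_contra hne
    push Not at hne
    nlinarith only [q1, q2, q3, hne, hsz]
  have hr2 : z / 2 ≤ r ^ 2 := by have := g.hz; linarith
  have hnr : r ^ 2 / 2 ≤ n := by
    have := (abs_le.1 g.n_err).1
    linarith only [this, mul_le_mul_of_nonneg_right hCδ (sq_nonneg r)]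
  have hnz4 : z / 4 ≤ n := by linarith
  have hn2 : n ≤ 2 * z := by
    have := (div_le_iff₀ hz).1 (g.n_div_le hC)
    nlinarith only [this, mul_le_mul_of_nonneg_right hCδ hz.le, hz]
  have hy0 : 0 ≤ ζ ^ 2 * n := by positivity
  -- absorption of the lower order terms
  have habs : C3 / z + C4 * ζ ≤ e / 16 * (ζ ^ 2 * n) + e / 16 * (ζ ^ 2 * n + lam ^ 2) := by
    refine absorb_lower hz he0 he1 hC30 hnz4 ?_
    rw [← hC6]
    rcases le_total z Z2 with h | h
    · have hlow := hζlow h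
      have k1 : 256 * C6 + 1 ≤ ζ := ((h4 s4 le_rfl).trans (hCm s4 hs4 (by linarith))).trans hlow
      have k2 : 256 * C6 ≤ ζ ^ 2 := by nlinarith only [k1, hC60]
      have k3 := heR (h.trans hR4Z2)
      have k4 : 1 / 4 ≤ e ^ 2 * z := by
        have : 1 / 4 ≤ e ^ 2 := by nlinarith only [k3]
        nlinarith only [this, hz1]
      have k5 : ζ ^ 2 / 4 ≤ ζ ^ 2 * n := by
        have : 1 / 4 ≤ n := by linarith
        nlinarith only [this, sq_nonneg ζ]
      have k6 : 1 / 4 * (ζ ^ 2 / 4) ≤ e ^ 2 * z * (ζ ^ 2 * n + lam ^ 2) := by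
        have : ζ ^ 2 / 4 ≤ ζ ^ 2 * n + lam ^ 2 := by linarith only [k5, sq_nonneg lam]
        gcongr
      linarith
    · have k1 : √z / 4 ≤ e ^ 2 * z := by
        have q0 : z ^ (-(1 / 4) : ℝ) ≤ 2 * e :=
          (rpow_le_rpow_of_exponent_le hz1 (by linarith)).trans hez
        have q1 : (z ^ (-(1 / 4) : ℝ)) ^ 2 * z = √z := by
          rw [sqrt_eq_rpow, ← rpow_natCast, ← rpow_mul hz.le]
          nth_rewrite 2 [← rpow_one z]
          rw [← rpow_add hz]; norm_num
        have q2 : (z ^ (-(1 / 4) : ℝ)) ^ 2 ≤ (2 * e) ^ 2 := by gcongr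
        linarith only [mul_le_mul_of_nonneg_right q2 hz.le, q1]
      have k2 : 64 * C6 / lam0 ^ 2 ≤ √z := by
        apply le_sqrt_of_sq_le; linarith
      have k3 : 64 * C6 ≤ √z * lam ^ 2 := by
        rw [div_le_iff₀ (by positivity)] at k2
        exact k2.trans (by gcongr)
      have k4 : √z / 4 * lam ^ 2 ≤ e ^ 2 * z * (ζ ^ 2 * n + lam ^ 2) := by
        gcongr; linarith
      linarith
  rcases le_total z R4 with h | h
  · have k1 := heR h
    have k2 : ω ≤ 1 / 200 := by
      rw [hω, div_le_div_iff₀ (by positivity) (by norm_num)]; linarith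
    have k3 : 4 * (1 / 200 + 2 * ω) * (ζ ^ 2 * n) ≤ e / 8 * (ζ ^ 2 * n) := by
      gcongr; linarith
    have k4 : 0 ≤ e * (ζ ^ 2 * n) := by positivity
    have k5 : 0 ≤ e * lam ^ 2 := by positivity
    linarith
  · have k1 : ζ ^ 2 * n ≤ 2 * C1 ^ 2 * lam ^ 2 * z ^ (-(1 / 200) : ℝ) := by
      have q1 : zt M (200 * R4) z ^ 2 ≤ (z ^ (-(1 + 1 / 200) / 2 : ℝ)) ^ 2 :=
        pow_le_pow_left₀ (zt_pos hR30 hz).le (zt_le_rpow hM0.le hR30 hz) 2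
      have q2 : (z ^ (-(1 + 1 / 200) / 2 : ℝ)) ^ 2 * z = z ^ (-(1 / 200) : ℝ) := by
        rw [← rpow_natCast, ← rpow_mul hz.le]
        nth_rewrite 2 [← rpow_one z]
        rw [← rpow_add hz]; norm_num
      rw [hζ, mul_pow, mul_pow, ← q2]
      calc C1 ^ 2 * lam ^ 2 * zt M (200 * R4) z ^ 2 * n
          ≤ C1 ^ 2 * lam ^ 2 * (z ^ (-(1 + 1 / 200) / 2 : ℝ)) ^ 2 * (2 * z) := by gcongr
        _ = _ := by ring
    have k2 : 384 * C1 ^ 2 * z ^ (-(1 / 400) : ℝ) ≤ 1 := by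
      have q1 : 384 * C1 ^ 2 ≤ z ^ (1 / 400 : ℝ) := by
        have : ((384 * C1 ^ 2) ^ (400 : ℝ)) ^ (1 / 400 : ℝ) ≤ z ^ (1 / 400 : ℝ) :=
          rpow_le_rpow (by positivity) (by linarith) (by norm_num)
        refine le_trans (le_of_eq ?_) this
        rw [← rpow_mul (by positivity)]
        norm_num
      have q2 : z ^ (1 / 400 : ℝ) * z ^ (-(1 / 400) : ℝ) = 1 := by
        rw [← rpow_add hz]; norm_num
      calc 384 * C1 ^ 2 * z ^ (-(1 / 400) : ℝ)
          ≤ z ^ (1 / 400 : ℝ) * z ^ (-(1 / 400) : ℝ) :=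
            mul_le_mul_of_nonneg_right q1 (by positivity)
        _ = 1 := q2
    have k3 : z ^ (-(1 / 200) : ℝ) = z ^ (-(1 / 400) : ℝ) * z ^ (-(1 / 400) : ℝ) := by
      rw [← rpow_add hz]; norm_num
    have k4 : z ^ (-(1 / 400) : ℝ) ≤ 2 * e :=
      (rpow_le_rpow_of_exponent_le hz1 (by linarith)).trans hez
    have k5 : 12 * (ζ ^ 2 * n) ≤ e / 8 * lam ^ 2 := by
      have q1 : 384 * C1 ^ 2 * z ^ (-(1 / 400) : ℝ) * (z ^ (-(1 / 400) : ℝ) * lam ^ 2)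
          ≤ 1 * (2 * e * lam ^ 2) := by gcongr
      rw [k3] at k1
      linarith
    have k6 : 4 * (1 / 200 + 2 * ω) * (ζ ^ 2 * n) ≤ 12 * (ζ ^ 2 * n) := by
      gcongr; linarith
    have k4 : 0 ≤ e * (ζ ^ 2 * n) := by positivity
    have k5' : 0 ≤ e * lam ^ 2 := by positivity
    linarith

/-- The radial slope of the high frequency weight. -/
noncomputable def zeta0 (M R3 : ℝ) (hR : 0 < R3) : Sm (E d) :=
  Sm.exp ((-M) • zp (-1)) * zp (-(1 + 1 / 200) / 2) * (1 - th R3 hR 1)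

theorem zeta0_apply (M R3 : ℝ) (hR : 0 < R3) (x : E d) : zeta0 M R3 hR x = zt M R3 (zz x) := by
  have := one_sub_th hR 1 x
  simp only [zeta0, zt, Sm.mul_apply, Sm.sub_apply, Sm.one_apply, this, Sm.exp_apply,
    Sm.smul_apply, zp_apply, rpow_neg_one, rpow_one, div_eq_mul_inv]

/-- The logarithmic derivative of the slope of the weight. -/
noncomputable def sig (M R3 : ℝ) (hR : 0 < R3) : Sm (E d) :=
  (2 * M) • zp (-1) - algebraMap ℝ _ (1 / 200) - 2 * th R3 hR 1

theorem pd_zeta0 (M R3 : ℝ) (hR : 0 < R3) (i : Fin d) :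
    pd i (zeta0 M R3 hR : Sm (E d)) = ((sig M R3 hR - 1) * zeta0 M R3 hR * zp (-1)) * X i := by
  simp only [zeta0, D_mul, D_exp, Derivation.map_smul, pd_zp_neg_one, map_sub, pd_th,
    Derivation.map_one_eq_zero, pd_zp (-(1 + 1 / 200) / 2)]
  ext x
  simp [sig]
  ring

theorem pd_sig (M R3 : ℝ) (hR : 0 < R3) (i : Fin d) :
    pd i (sig M R3 hR : Sm (E d))
      = (((-4 * M) • zp (-1) - 4 * (th R3 hR 1 * (1 - th R3 hR 1))) * zp (-1)) * X i := by
  have h2 : pd i (2 : Sm (E d)) = 0 := by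
    have := D_algebraMap (EuclideanSpace.single i (1 : ℝ)) (2 : ℝ)
    rwa [map_ofNat] at this
  simp only [sig, map_sub, D_mul, Derivation.map_smul, pd_zp_neg_one, pd_th, D_algebraMap, h2]
  ext x
  simp
  ring

/-- The zeroth order multiplier of the high frequency estimate. -/
noncomputable def qhf (K : ℝ) (hK : 0 < K) (η C2 : ℝ) : Sm (E d) :=
  bt K hK η * (algebraMap ℝ _ ((d : ℝ) - 1) + C2 • zp (-1))

/-- The first reduced derivative of `qhf`. -/
noncomputable def q1hf (K : ℝ) (hK : 0 < K) (η C2 : ℝ) : Sm (E d) :=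
  (-2 * C2) • zp (-1) - (algebraMap ℝ _ ((d : ℝ) - 1) + C2 • zp (-1)) * th K hK η

/-- The second reduced derivative of `qhf`. -/
noncomputable def q2hf (K : ℝ) (hK : 0 < K) (η C2 : ℝ) : Sm (E d) :=
  -((th K hK η + 2) * q1hf K hK η C2) + (4 * C2) • zp (-1) + (2 * C2) • (zp (-1) * th K hK η)
    - (2 * η) • ((algebraMap ℝ _ ((d : ℝ) - 1) + C2 • zp (-1))
        * (th K hK η * (1 - th K hK η)))

theorem pd_qhf {K : ℝ} (hK : 0 < K) (hη : 0 < η) (C2 : ℝ) (i : Fin d) :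
    pd i (qhf K hK η C2 : Sm (E d)) = (bt K hK η * q1hf K hK η C2 * zp (-1)) * X i := by
  simp only [qhf, D_mul, map_add, D_algebraMap, Derivation.map_smul, pd_zp_neg_one, pd_bt hK hη]
  ext x
  simp [q1hf]
  ring

theorem pd_q1hf {K : ℝ} (hK : 0 < K) (hη : 0 < η) (C2 : ℝ) (i : Fin d) :
    pd i (bt K hK η * q1hf K hK η C2 * zp (-1) : Sm (E d))
      = (bt K hK η * q2hf K hK η C2 * zp (-1) ^ 2) * X i := by
  simp only [q1hf, q2hf, D_mul, map_add, map_sub, D_algebraMap, Derivation.map_smul,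
    pd_zp_neg_one, pd_bt hK hη, pd_th]
  ext x
  simp
  ring

theorem zp_neg_one_nonneg (x : E d) : 0 ≤ (zp (-1) : Sm (E d)) x := by
  rw [zp_neg_one_apply]; exact inv_nonneg.2 (zz_pos x).le

theorem zp_neg_one_le (x : E d) : (zp (-1) : Sm (E d)) x ≤ 1 := by
  rw [zp_neg_one_apply]; exact inv_le_one_of_one_le₀ (one_le_zz x)

theorem abs_q1hf_le (hd : 1 ≤ d) {K : ℝ} (hK : 0 < K) (hC2 : 0 ≤ C2) (x : E d) :
    |(q1hf K hK η C2 : Sm (E d)) x| ≤ 3 * C2 + d := by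
  have h1 := zp_neg_one_nonneg x
  have h2 := zp_neg_one_le x
  have h3 := th_nonneg hK η x
  have h4 := (th_lt_one hK η x).le
  have hd' : (1 : ℝ) ≤ d := by exact_mod_cast hd
  simp only [q1hf, Sm.sub_apply, Sm.smul_apply, Sm.mul_apply, Sm.add_apply, Sm.algebraMap_apply]
  set Z := (zp (-1) : Sm (E d)) x
  set θ := th K hK η x
  have h5 : C2 * Z ≤ C2 := by nlinarith only [h2, hC2]
  have h5' : 0 ≤ C2 * Z := by positivity
  have h6 : ((d : ℝ) - 1 + C2 * Z) * θ ≤ (d - 1 + C2) := by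
    have : (d : ℝ) - 1 + C2 * Z ≥ 0 := by linarith
    nlinarith only [this, h4, h5]
  have h7 : 0 ≤ ((d : ℝ) - 1 + C2 * Z) * θ := mul_nonneg (by linarith) h3
  rw [abs_le]
  constructor <;> nlinarith only [h5, h5', h6, h7, hd', hC2]

theorem abs_q2hf_le (hd : 1 ≤ d) {K : ℝ} (hK : 0 < K) (hη : 0 ≤ η) (hη1 : η ≤ 1)
    (hC2 : 0 ≤ C2) (x : E d) :
    |(q2hf K hK η C2 : Sm (E d)) x| ≤ 3 * (3 * C2 + d) + 6 * C2 + 2 * (d + C2) := by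
  have h0 := abs_q1hf_le hd hK (η := η) hC2 x
  have h1 := zp_neg_one_nonneg x
  have h2 := zp_neg_one_le x
  have h3 := th_nonneg hK η x
  have h4 := (th_lt_one hK η x).le
  have hd' : (1 : ℝ) ≤ d := by exact_mod_cast hd
  simp only [q2hf, Sm.sub_apply, Sm.smul_apply, Sm.mul_apply, Sm.add_apply, Sm.algebraMap_apply,
    Sm.neg_apply, Sm.one_apply, Sm.ofNat_apply]
  set Z := (zp (-1) : Sm (E d)) x
  set θ := th K hK η x
  set w := (q1hf K hK η C2 : Sm (E d)) x
  have h5 : C2 * Z ≤ C2 := by nlinarith only [h2, hC2]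
  have h5' : 0 ≤ C2 * Z := by positivity
  have k1 : |(θ + 2) * w| ≤ 3 * (3 * C2 + d) :=
    abs_mul_le' (by rw [abs_of_nonneg (by linarith)]; linarith) h0
  have k2 : C2 * Z * θ ≤ C2 := by nlinarith only [h5, h5', h4]
  have k2' : 0 ≤ C2 * Z * θ := by positivity
  have k3 : 0 ≤ η * (((d : ℝ) - 1 + C2 * Z) * (θ * (1 - θ))) :=
    mul_nonneg hη (mul_nonneg (by linarith) (mul_nonneg h3 (by linarith)))
  have k4 : η * (((d : ℝ) - 1 + C2 * Z) * (θ * (1 - θ))) ≤ d + C2 := by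
    have e1 : θ * (1 - θ) ≤ 1 := by nlinarith only [h3, h4]
    have e2 : ((d : ℝ) - 1 + C2 * Z) * (θ * (1 - θ)) ≤ d - 1 + C2 * Z :=
      mul_le_of_le_one_right (by linarith) e1
    have e3 : η * (((d : ℝ) - 1 + C2 * Z) * (θ * (1 - θ)))
        ≤ ((d : ℝ) - 1 + C2 * Z) * (θ * (1 - θ)) :=
      mul_le_of_le_one_left (mul_nonneg (by linarith) (mul_nonneg h3 (by linarith))) hη1
    linarith
  rw [abs_le] at k1 ⊢
  constructor <;> nlinarith only [k1.1, k1.2, k2, k2', k3, k4, h5, h5', hd', hC2]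

theorem dl_mul_sqrt_le (hB : 0 ≤ B) (hη : η ≤ a / 2) (x : E d) :
    dl a B x * √(zz x) ≤ B * zz x ^ (-η) := by
  rw [dl, mul_assoc, sqrt_eq_rpow, ← rpow_add (zz_pos x)]
  refine mul_le_mul_of_nonneg_left ?_ hB
  exact rpow_le_rpow_of_exponent_le (one_le_zz x) (by linarith)

set_option maxHeartbeats 1000000 in
theorem exists_carleman_weight (hd : 1 ≤ d) (ha : 0 < a) (hc : 0 < c₀)
    (hB : 0 ≤ B) (hl0 : 0 < lam0) :
    ∃ η > 0, η ≤ a / 2 ∧ η ≤ 1 / 400 ∧ ∃ C2 ≥ 0, ∃ M > 0, ∃ C8 ≥ 0, ∃ C10 ≥ 0, ∀ C1 ≥ C10,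
      ∃ R3, ∃ hR3 : 1 ≤ R3, ∃ K, ∃ hK : 1 ≤ K, ∀ A : Fin d → Fin d → Sm (E d), Coef d a c₀ B A →
      ∀ lam ≥ lam0, ∀ φ : Sm (E d), (∀ i, pd i φ = zeta0 M R3 (by linarith) * X i) →
      ∀ (v : Sm (E d)) (x : E d),
        bt K (by linarith) η x * (1 - th K (by linarith) η x) * gsq v x
          + (bt K (by linarith) η x * (1 - th K (by linarith) η x)
              * ((C1 * lam * zeta0 M R3 (by linarith) x) ^ 2 * nn A x + lam ^ 2) / 2
            - 2 * bt K (by linarith) η x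
              * (if ‖x‖ ≤ 1 / 4 then C8 * (1 + C1) ^ 2 * lam ^ 2 else 0)) * v x ^ 2
        ≤ 2 * Gform A (fun i => bt K (by linarith) η * NN A i) ((C1 * lam) • φ)
              (qhf K (by linarith) η C2) v x
          + Zcoef A (fun i => bt K (by linarith) η * NN A i) ((C1 * lam) • φ)
              (algebraMap ℝ _ (lam ^ 2)) (qhf K (by linarith) η C2) x * v x ^ 2 := by
  set η := min (a / 2) (1 / 400) with hηdef
  have hη : 0 < η := lt_min (by linarith) (by norm_num)
  have hηa : η ≤ a / 2 := min_le_left _ _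
  have hη1 : η ≤ 1 / 400 := min_le_right _ _
  have hC : 0 ≤ CG d B := by unfold CG; positivity
  set Cg := CG d B with hCg
  set Dc := 9 * Cg + 2 * Cg ^ 2 * B with hDc
  have hD : 0 ≤ Dc := by positivity
  set Z0 := (4 * (Dc * B)) ^ 2 with hZ0
  set C2 := Dc * B * Z0 / c₀ with hC2d
  have hC2 : 0 ≤ C2 := by positivity
  refine ⟨η, hη, hηa, hη1, C2, hC2, ?_⟩
  obtain ⟨M, hM, C8, hC8, C10, hC10, h⟩ := exists_positive_coefficient (d := d) hc hC hB hC2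
    (show (0:ℝ) ≤ 3 * C2 + d by positivity)
    (show (0:ℝ) ≤ 3 * (3 * C2 + d) + 6 * C2 + 2 * (d + C2) by positivity) hl0 hη hη1
  refine ⟨M, hM, C8, hC8, C10, hC10, fun C1 hC1 => ?_⟩
  obtain ⟨R3, hR3, K, hK, h⟩ := h C1 hC1
  refine ⟨R3, hR3, K, hK, fun A hA lam hlam φ hφ v x => ?_⟩
  have hR0 : 0 < R3 := by linarith
  have hK0 : 0 < K := by linarith
  have hlam0 : 0 < lam := by linarith
  set β := (bt K hK0 η : Sm (E d))
  set s := C1 * lam with hs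
  have hs0 : 0 ≤ s := mul_nonneg (by linarith) hlam0.le
  have pf : ∀ i, pd i β = (-(th K hK0 η * β * zp (-1))) * X i := pd_bt hK0 hη
  have pφ : ∀ i, pd i (s • φ) = (s • zeta0 M R3 hR0) * X i := fun i => by
    rw [Derivation.map_smul, hφ, smul_mul_assoc]
  have pζ : ∀ i, pd i (s • zeta0 M R3 hR0 : Sm (E d))
      = ((sig M R3 hR0 - 1) * (s • zeta0 M R3 hR0) * zp (-1)) * X i := fun i => by
    rw [Derivation.map_smul, pd_zeta0]; ext y; simp
  set ζ := (s • zeta0 M R3 hR0 : Sm (E d)) with hζ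
  set σ := (sig M R3 hR0 : Sm (E d)) with hσ
  set w : Sm (E d) := ((-4 * M) • zp (-1) - 4 * (th R3 hR0 1 * (1 - th R3 hR0 1)))
    + (σ - 1) ^ 2 - 2 * (σ - 1) with hw
  have pζ1 : ∀ i, pd i ((σ - 1) * ζ * zp (-1)) = (w * ζ * zp (-1) ^ 2) * X i := fun i => by
    simp only [D_mul, map_sub, pζ, hσ, pd_sig, pd_zp_neg_one, Derivation.map_one_eq_zero]
    rw [hw]; ring
  have g := hA.geo hd ha hB x
  have gr := hA.grd hd ha hB v x
  have hz := zz_pos x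
  have hz1 := one_le_zz x
  have hi : (zp (-1) : Sm (E d)) x = 1 / zz x := by rw [zp_neg_one_apply, one_div]
  have hθ := th_nonneg hK0 η x
  have hθ1 := (th_lt_one hK0 η x).le
  have hβ := (bt_pos hK0 η x).le
  have hδB := dl_le (d := d) ha hB x
  have hω0 := th_nonneg hR0 1 x
  have hω1 := (th_lt_one hR0 1 x).le
  have hzi1 : 1 / zz x ≤ 1 := by rw [← hi]; exact zp_neg_one_le x
  have hzi0 : 0 ≤ 1 / zz x := by positivity
  have hσx : σ x = 2 * M / zz x - 1 / 200 - 2 * th R3 hR0 1 x := by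
    simp [hσ, sig, rpow_neg_one, div_eq_mul_inv]
  have hMz : M / zz x ≤ M := div_le_self hM.le hz1
  have hMz0 : 0 ≤ M / zz x := by positivity
  have hσM : 2 * M / zz x = 2 * (M / zz x) := by ring
  have hS : |σ x - 1| ≤ 2 * M + 4 := by
    rw [hσx, hσM, abs_le]; constructor <;> linarith
  have hW : |w x| ≤ Wc M := by
    have e1 : (σ x - 1) ^ 2 ≤ (2 * M + 4) ^ 2 := by
      rw [← sq_abs]; exact pow_le_pow_left₀ (abs_nonneg _) hS 2
    have e2 : w x = (-4 * (M / zz x) - 4 * (th R3 hR0 1 x * (1 - th R3 hR0 1 x)))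
        + (σ x - 1) ^ 2 - 2 * (σ x - 1) := by
      simp [hw, rpow_neg_one, div_eq_mul_inv]; ring
    have e3 : 0 ≤ th R3 hR0 1 x * (1 - th R3 hR0 1 x) := mul_nonneg hω0 (by linarith)
    have e4 : th R3 hR0 1 x * (1 - th R3 hR0 1 x) ≤ 1 := by nlinarith only [hω0, hω1]
    have e5 := abs_le.1 hS
    have e6 := sq_nonneg (σ x - 1)
    rw [e2, abs_le, Wc]
    constructor <;> linarith [e5.1, e5.2]
  have hζx : ζ x = C1 * lam * zt M R3 (zz x) := by simp [hζ, zeta0_apply, hs]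
  have hζ0 : 0 ≤ ζ x := by
    rw [hζx]; exact mul_nonneg hs0 (zt_pos hR0 hz).le
  have hδs := dl_mul_sqrt_le (d := d) hB hηa x
  have hez : zz x ^ (-η) ≤ 2 * (1 - th K hK0 η x) := by
    have := half_rpow_le hK0 hK hη.le x; linarith
  have hl2 : 0 ≤ lam ^ 2 := sq_nonneg _
  have hm : 1 + Cg * dl a B x ≤ 1 + Cg * B := by
    have := mul_le_mul_of_nonneg_left hδB hC; linarith
  -- the gradient part
  have hG : β x * (1 - th K hK0 η x) / 2 * gsq v x
      ≤ Gform A (fun i => β * NN A i) (s • φ) (qhf K hK0 η C2) v x := by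
    have k1 := g.G_lower gr hc.le hC hδB hθ hθ1 hζ0 hβ hC2
    have k2 := half_le_of_error (B := B) (C2 := C2) (D := Dc) (Z0 := Z0)
      (e := 1 - th K hK0 η x) (δ := dl a B x) hc hD hB hz (by linarith) hδB
      (hδs.trans (by
        have := mul_le_mul_of_nonneg_left hez hB
        linarith)) (by rw [hZ0, sqrt_sq (by positivity)]) le_rfl hC2
    rw [Gform_radial_apply hA.symm _ _ pf pφ]
    have k3 : β x * ((1 - th K hK0 η x) / 2 * gsq v x)
        ≤ β x * ((1 - th K hK0 η x + c₀ * C2 / zz x - Dc * dl a B x) * gsq v x) :=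
      mul_le_mul_of_nonneg_left (mul_le_mul_of_nonneg_right k2 gr.hp) hβ
    refine le_trans (le_of_eq (by ring)) (k3.trans (k1.trans (le_of_eq ?_)))
    simp [qhf, rpow_neg_one, div_eq_mul_inv]
    ring
  have hZ : 2 * (β x * ((1 - th K hK0 η x) / 4 * (ζ x ^ 2 * nn A x + lam ^ 2)
        - (if ‖x‖ ≤ 1 / 4 then C8 * (1 + C1) ^ 2 * lam ^ 2 else 0)))
      ≤ Zcoef A (fun i => β * NN A i) (s • φ) (algebraMap ℝ _ (lam ^ 2)) (qhf K hK0 η C2) x := by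
    have k1 := g.half_Z_lower (C2 := C2) (σ := σ x) (w := w x) (w1 := q1hf K hK0 η C2 x)
      (w2 := q2hf K hK0 η C2 x) hc.le hC hθ hθ1 hl2 hζ0 hβ hm hS hW (abs_q1hf_le hd hK0 hC2 x)
      (abs_q2hf_le hd hK0 hη.le (by linarith) hC2 x)
    have k2 := h (ω := th R3 hR0 1 x) (σ := σ x) g hδB hδs hlam (one_sub_th hK0 η x)
      (by rw [th_apply, rpow_one]) hσx hζx
    have k3 := (mul_le_mul_of_nonneg_left k2 hβ).trans k1
    rw [Zcoef_radial _ pf pφ pζ pζ1 (pd_qhf hK0 hη C2) (pd_q1hf hK0 hη C2)]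
    have k4 := mul_le_mul_of_nonneg_left k3 (zero_le_two (α := ℝ))
    refine k4.trans (le_of_eq ?_)
    simp [qhf, rpow_neg_one, div_eq_mul_inv]
    ring
  have hv := mul_le_mul_of_nonneg_right hZ (sq_nonneg (v x))
  have hzz : s * zeta0 M R3 hR0 x = ζ x := by simp [hζ]
  rw [hzz]
  refine le_trans (le_of_eq ?_) (add_le_add (mul_le_mul_of_nonneg_left hG zero_le_two) hv)
  ring

theorem vf_exp (Y : Fin d → Sm (E d)) (φ u : Sm (E d)) :
    vf Y (Sm.exp φ * u) = Sm.exp φ * (vf Y u + vf Y φ * u) := by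
  rw [vf_mul]
  have : vf Y (Sm.exp φ) = Sm.exp φ * vf Y φ := by
    simp only [vf, D_exp, mul_sum]
    exact sum_congr rfl fun i _ => by ring
  rw [this]; ring

theorem fl_mul (A : Fin d → Fin d → Sm (E d)) (f u : Sm (E d)) :
    fl A (f * u) = fun i => f * fl A u i + u * fl A f i := by
  funext i
  simp only [fl, D_mul, mul_sum, ← sum_add_distrib]
  exact sum_congr rfl fun i _ => by ring

theorem fl_exp (A : Fin d → Fin d → Sm (E d)) (φ : Sm (E d)) :
    fl A (Sm.exp φ) = fun i => Sm.exp φ * fl A φ i := by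
  funext i
  simp only [fl, D_exp, mul_sum]
  exact sum_congr rfl fun i _ => by ring

theorem vf_fl_exp (A : Fin d → Fin d → Sm (E d)) (φ u : Sm (E d)) :
    vf (fl A (Sm.exp φ)) u = Sm.exp φ * vf (fl A φ) u := by
  rw [fl_exp, vf_smul_left]

theorem Pop_mul (hA : ∀ i j, A i j = A j i) (f u : Sm (E d)) :
    Pop A (f * u) = f * Pop A u + 2 * vf (fl A f) u + u * Pop A f := by
  rw [Pop, fl_mul, dv_add, dv_mul, dv_mul, ← Pop, ← Pop, vf_fl_symm hA u f]; ring

theorem Pop_exp (A : Fin d → Fin d → Sm (E d)) (φ : Sm (E d)) :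
    Pop A (Sm.exp φ) = Sm.exp φ * (Pop A φ + vf (fl A φ) φ) := by
  rw [Pop, fl_exp, dv_mul, ← Pop]
  have : vf (fl A φ) (Sm.exp φ) = Sm.exp φ * vf (fl A φ) φ := by
    have := vf_exp (fl A φ) φ 1
    simpa [vf] using this
  rw [this]; ring

theorem Pconj_exp (hA : ∀ i j, A i j = A j i) (φ l u : Sm (E d)) :
    Pconj A φ l (Sm.exp φ * u) = Sm.exp φ * (Pop A u + l * u) := by
  rw [Pconj, Pop_mul hA, Pop_exp, vf_exp, vf_fl_exp]; ring

theorem gsq_exp_le (φ u : Sm (E d)) (x : E d) :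
    exp (φ x) ^ 2 * gsq u x
      ≤ 2 * gsq (Sm.exp φ * u) x + 2 * gsq φ x * (Sm.exp φ * u : Sm (E d)) x ^ 2 := by
  simp only [gsq_apply, mul_sum, sum_mul, ← sum_add_distrib]
  refine sum_le_sum fun i _ => ?_
  simp only [D_mul, D_exp, Sm.mul_apply, Sm.add_apply, Sm.exp_apply]
  nlinarith [sq_nonneg (exp (φ x) * pd i u x + 2 * (exp (φ x) * pd i φ x * u x))]

theorem gsq_radial {ζ : Sm (E d)} (h : ∀ i, pd i φ = ζ * X i) (x : E d) :
    gsq φ x = ζ x ^ 2 * ‖x‖ ^ 2 := by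
  simp only [gsq_apply, h, Sm.mul_apply, X_apply, mul_pow, norm_sq_eq_sum, mul_sum]

theorem bt_le_rpow {K : ℝ} (hK : 0 < K) (hη : 0 < η) (x : E d) :
    bt K hK η x ≤ zz x ^ (-(1 / 2) : ℝ) := by
  have hz := zz_pos x
  have : zz x ^ (-(1 / 2) : ℝ) = (zz x ^ η) ^ (-1 / (2 * η)) := by
    rw [← rpow_mul hz.le]; congr 1; field_simp
  rw [bt_apply, this]
  exact rpow_le_rpow_of_nonpos (by positivity) (by linarith)
    (div_nonpos_of_nonpos_of_nonneg (by norm_num) (by positivity))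

theorem bt_le_one {K : ℝ} (hK : 0 < K) (hη : 0 < η) (x : E d) : bt K hK η x ≤ 1 :=
  (bt_le_rpow hK hη x).trans
    (rpow_le_one_of_one_le_of_nonpos (one_le_zz x) (by norm_num))

theorem le_bt {K : ℝ} (hK : 0 < K) (hη : 0 < η) (x : E d) :
    (K + 1) ^ (-1 / (2 * η)) * zz x ^ (-(1 / 2) : ℝ) ≤ bt K hK η x := by
  have hz := zz_pos x
  have h1 : 1 ≤ zz x ^ η := one_le_rpow (one_le_zz x) hη.le
  have : zz x ^ (-(1 / 2) : ℝ) = (zz x ^ η) ^ (-1 / (2 * η)) := by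
    rw [← rpow_mul hz.le]; congr 1; field_simp
  rw [bt_apply, this, ← mul_rpow (by linarith) (by positivity)]
  refine rpow_le_rpow_of_nonpos (by positivity) ?_
    (div_nonpos_of_nonpos_of_nonneg (by norm_num) (by positivity))
  nlinarith

theorem bt_le_at_zero {K : ℝ} (hK : 0 < K) (hη : 0 < η) (x : E d) :
    bt K hK η x ≤ (K + 1) ^ (-1 / (2 * η)) := by
  rw [bt_apply]
  refine rpow_le_rpow_of_nonpos (by positivity) ?_
    (div_nonpos_of_nonpos_of_nonneg (by norm_num) (by positivity))
  linarith [one_le_rpow (one_le_zz x) hη.le]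

/-- Comparison of the radial weight at two points of a bounded region. -/
theorem bt_le_six {K : ℝ} (hK : 0 < K) (hK1 : 1 ≤ K) (hη : 0 < η) (hη1 : η ≤ 1 / 2)
    (x y : E d) (hy : zz y ≤ 4) : bt K hK η x ≤ 6 * (bt K hK η y * (1 - th K hK η y)) := by
  have h1 := bt_le_at_zero hK hη x
  have h2 := le_bt hK hη y
  have h3 : (1 / 2 : ℝ) ≤ zz y ^ (-(1 / 2) : ℝ) := by
    have : (4 : ℝ) ^ (-(1 / 2) : ℝ) = 1 / 2 := by
      rw [show (4 : ℝ) = 2 ^ (2 : ℝ) by norm_num, ← rpow_mul (by norm_num)]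
      norm_num
    exact this.symm.le.trans (rpow_le_rpow_of_nonpos (zz_pos y) hy (by norm_num))
  have h4 : (1 / 3 : ℝ) ≤ 1 - th K hK η y := by
    have : zz y ^ η ≤ 2 := by
      calc zz y ^ η ≤ 4 ^ η := rpow_le_rpow (zz_pos y).le hy hη.le
        _ ≤ 4 ^ (1 / 2 : ℝ) := rpow_le_rpow_of_exponent_le (by norm_num) hη1
        _ = 2 := by
          rw [show (4 : ℝ) = 2 ^ (2 : ℝ) by norm_num, ← rpow_mul (by norm_num)]
          norm_num
    rw [one_sub_th, div_le_div_iff₀ (by norm_num)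
      (add_pos hK (rpow_pos_of_pos (zz_pos y) _))]
    linarith
  have hb := bt_pos hK η y
  have h0 : 0 < (K + 1) ^ (-1 / (2 * η)) := by positivity
  have h5 : bt K hK η y * (1 / 3) ≤ bt K hK η y * (1 - th K hK η y) :=
    mul_le_mul_of_nonneg_left h4 hb.le
  have h6 := mul_le_mul_of_nonneg_left h3 h0.le
  linarith

theorem zt_le_tail (hM : 0 ≤ M) (hR : 0 < R3) (hz : 1 ≤ z) :
    zt M R3 z ≤ R3 * z ^ (-(3 / 2) : ℝ) := by
  have hz0 : 0 < z := by linarith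
  have h1 : exp (-M / z) ≤ 1 :=
    exp_le_one_iff.2 (div_nonpos_of_nonpos_of_nonneg (by linarith) hz0.le)
  have h2 : z ^ (-(1 + 1 / 200) / 2 : ℝ) ≤ z ^ (-(1 / 2) : ℝ) :=
    rpow_le_rpow_of_exponent_le hz (by norm_num)
  have h3 : R3 / (R3 + z) ≤ R3 * z ^ (-1 : ℝ) := by
    rw [rpow_neg_one, ← div_eq_mul_inv]
    exact div_le_div_of_nonneg_left hR.le hz0 (by linarith)
  calc zt M R3 z ≤ 1 * z ^ (-(1 / 2) : ℝ) * (R3 * z ^ (-1 : ℝ)) := by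
        unfold zt; gcongr
    _ = R3 * (z ^ (-(1 / 2) : ℝ) * z ^ (-1 : ℝ)) := by ring
    _ = _ := by rw [← rpow_add hz0]; norm_num

theorem zt_ge_near (hM : 0 ≤ M) (hR : 1 ≤ R3) (hz : 1 ≤ z) (hz2 : z ≤ 2) :
    exp (-M) / 6 ≤ zt M R3 z := by
  have hz0 : 0 < z := by linarith
  have h1 : exp (-M) ≤ exp (-M / z) := by
    refine exp_le_exp.2 ?_
    rw [neg_div, neg_le_neg_iff]; exact div_le_self hM hz
  have h2 : (1 / 2 : ℝ) ≤ z ^ (-(1 + 1 / 200) / 2 : ℝ) := by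
    calc (1 / 2 : ℝ) ≤ z ^ (-1 : ℝ) := by
          rw [rpow_neg_one, one_div]; exact inv_anti₀ hz0 hz2
      _ ≤ _ := rpow_le_rpow_of_exponent_le hz (by norm_num)
  have h3 : (1 / 3 : ℝ) ≤ R3 / (R3 + z) := by
    rw [div_le_div_iff₀ (by norm_num) (by linarith)]; linarith
  calc exp (-M) / 6 = exp (-M) * (1 / 2) * (1 / 3) := by ring
    _ ≤ _ := by unfold zt; gcongr

/-- The bounded radial weight with slope `zeta0`. -/
theorem exists_weight (hM : 0 ≤ M) (hR : 1 ≤ R3) :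
    ∃ φ : Sm (E d), (∀ i, pd i φ = zeta0 M R3 (by linarith) * X i) ∧ (∀ x, 0 ≤ φ x) ∧
      (∀ x, φ x ≤ R3) ∧
      ∀ x y : E d, ‖x‖ ≤ 1 / 4 → 3 / 4 ≤ ‖y‖ → φ x + exp (-M) / 24 ≤ φ y := by
  have hR0 : 0 < R3 := by linarith
  obtain ⟨g, φ, hg1, hg, hφ, hpd⟩ := exists_radial_primitive (d := d)
    (fun y => zt M R3 y / 2) (by
      have : ContDiffOn ℝ (⊤ : ℕ∞) (fun y : ℝ => y) (Ioi 0) := contDiffOn_id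
      have hn : ∀ y ∈ Ioi (0 : ℝ), y ≠ 0 := fun y hy => (mem_Ioi.1 hy).ne'
      have hn2 : ∀ y ∈ Ioi (0 : ℝ), R3 + y ≠ 0 := fun y hy => by
        have := mem_Ioi.1 hy; positivity
      unfold zt
      refine ContDiffOn.div_const (((contDiff_exp.comp_contDiffOn
        (contDiffOn_const.div this hn)).mul ?_).mul
          (contDiffOn_const.div (contDiffOn_const.add this) hn2)) _
      exact this.rpow_const_of_ne hn) 0 (zeta0 M R3 hR0) (fun x => by rw [zeta0_apply]; ring)
  have hmono : MonotoneOn g (Ici 1) := by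
    refine monotoneOn_of_deriv_nonneg (convex_Ici 1) (fun y hy => ?_) (fun y hy => ?_)
      (fun y hy => ?_)
    · exact (hg y (by have := mem_Ici.1 hy; linarith)).continuousAt.continuousWithinAt
    · rw [interior_Ici] at hy
      exact (hg y (by have := mem_Ioi.1 hy; linarith)).differentiableAt.differentiableWithinAt
    · rw [interior_Ici] at hy
      have hy0 : 0 < y := by have := mem_Ioi.1 hy; linarith
      rw [(hg y hy0).deriv]
      have := zt_pos (M := M) hR0 hy0; positivity
  have hup : AntitoneOn (fun y => g y + R3 * y ^ (-(1 / 2) : ℝ)) (Ici 1) := by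
    have hd : ∀ y > 0, HasDerivAt (fun y => g y + R3 * y ^ (-(1 / 2) : ℝ))
        (zt M R3 y / 2 + R3 * (-(1 / 2) * y ^ (-(1 / 2) - 1 : ℝ))) y := fun y hy =>
      (hg y hy).add ((hasDerivAt_rpow_const (Or.inl hy.ne')).const_mul R3)
    refine antitoneOn_of_deriv_nonpos (convex_Ici 1) (fun y hy => ?_) (fun y hy => ?_)
      (fun y hy => ?_)
    · exact (hd y (by have := mem_Ici.1 hy; linarith)).continuousAt.continuousWithinAt
    · rw [interior_Ici] at hy
      exact (hd y (by have := mem_Ioi.1 hy; linarith)).differentiableAt.differentiableWithinAt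
    · rw [interior_Ici] at hy
      have hy1 : 1 < y := hy
      rw [(hd y (by linarith)).deriv]
      have := zt_le_tail hM hR0 hy1.le
      rw [show (-(1 / 2) - 1 : ℝ) = -(3 / 2) by norm_num]
      linarith
  have hlow : MonotoneOn (fun y => g y - exp (-M) / 12 * y) (Icc 1 2) := by
    have hd : ∀ y > 0, HasDerivAt (fun y => g y - exp (-M) / 12 * y)
        (zt M R3 y / 2 - exp (-M) / 12 * 1) y := fun y hy =>
      (hg y hy).sub ((hasDerivAt_id y).const_mul _)
    refine monotoneOn_of_deriv_nonneg (convex_Icc 1 2) (fun y hy => ?_) (fun y hy => ?_)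
      (fun y hy => ?_)
    · exact (hd y (by have := hy.1; linarith)).continuousAt.continuousWithinAt
    · rw [interior_Icc] at hy
      exact (hd y (by have := hy.1; linarith)).differentiableAt.differentiableWithinAt
    · rw [interior_Icc] at hy
      rw [(hd y (by linarith [hy.1])).deriv]
      linarith [zt_ge_near hM hR hy.1.le hy.2.le]
  refine ⟨φ, hpd, fun x => ?_, fun x => ?_, fun x y hx hy => ?_⟩
  · rw [hφ, ← hg1]; exact hmono (mem_Ici.2 le_rfl) (mem_Ici.2 (one_le_zz x)) (one_le_zz x)
  · rw [hφ]
    have := hup (mem_Ici.2 le_rfl) (mem_Ici.2 (one_le_zz x)) (one_le_zz x)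
    have h2 : 0 < zz x ^ (-(1 / 2) : ℝ) := rpow_pos_of_pos (zz_pos x) _
    simp only [hg1, one_rpow] at this
    nlinarith
  · rw [hφ, hφ]
    have hx2 : zz x ≤ 17 / 16 := by rw [zz_apply]; nlinarith [norm_nonneg x]
    have hy2 : 25 / 16 ≤ zz y := by rw [zz_apply]; nlinarith [norm_nonneg y]
    have h1 := hmono (mem_Ici.2 (one_le_zz x)) (show (17 / 16 : ℝ) ∈ Ici 1 by norm_num) hx2
    have h2 := hmono (show (25 / 16 : ℝ) ∈ Ici 1 by norm_num) (mem_Ici.2 (one_le_zz y)) hy2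
    have h3 := hlow (show (17 / 16 : ℝ) ∈ Icc 1 2 by norm_num)
      (show (25 / 16 : ℝ) ∈ Icc 1 2 by norm_num) (by norm_num)
    simp only at h3
    linarith

theorem Pop_zero_off (hK : IsCompact K) (hu : ∀ x ∉ K, u x = 0) : ∀ x ∉ K, Pop A u x = 0 := by
  intro x hx
  have h1 : ∀ i, ∀ x ∉ K, pd i u x = 0 := fun i x hx => D_eq_zero_of_notMem hK.isClosed hu hx _
  have h2 : ∀ i, ∀ x ∉ K, fl A u i x = 0 := fun i x hx => by simp [fl, h1 _ x hx]
  simp [Pop, dv, fun i => D_eq_zero_of_notMem hK.isClosed (h2 i) hx (EuclideanSpace.single i 1)]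

theorem gsq_zero_off (hK : IsCompact K) (hu : ∀ x ∉ K, u x = 0) : ∀ x ∉ K, gsq u x = 0 := by
  intro x hx
  have h1 : ∀ i, pd i u x = 0 := fun i => D_eq_zero_of_notMem hK.isClosed hu hx _
  simp [gsq_apply, h1]

/-- The density of the stationary energy at frequency `lam`. -/
noncomputable def sen (lam : ℝ) (u : Sm (E d)) : Sm (E d) := gsq u + lam ^ 2 • u ^ 2

theorem sen_apply (lam : ℝ) (u : Sm (E d)) (x : E d) :
    sen lam u x = gsq u x + lam ^ 2 * u x ^ 2 := by simp [sen]

theorem sen_nonneg (lam : ℝ) (u : Sm (E d)) (x : E d) : 0 ≤ sen lam u x := by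
  rw [sen_apply]; have := gsq_nonneg u x; positivity

theorem sen_zero_off (lam : ℝ) (hK : IsCompact K) (hu : ∀ x ∉ K, u x = 0) : ∀ x ∉ K, sen lam u x = 0 := fun x hx => by
  rw [sen_apply, gsq_zero_off hK hu x hx, hu x hx]; simp

/-- The Helmholtz operator `P + lam²`. -/
noncomputable def Hop (A : Fin d → Fin d → Sm (E d)) (lam : ℝ) (u : Sm (E d)) : Sm (E d) :=
  Pop A u + lam ^ 2 • u

theorem Hop_zero_off (lam : ℝ) (hK : IsCompact K) (hu : ∀ x ∉ K, u x = 0) : ∀ x ∉ K, Hop A lam u x = 0 := fun x hx => by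
  simp [Hop, Pop_zero_off hK hu x hx, hu x hx]

theorem Grd.Nv_sq_le {F : ℝ} (h : Grd c₀ C δ r p F Q Nv err) (hC : 0 ≤ C)
    (hδB : δ ≤ B) : Nv ^ 2 ≤ r ^ 2 * ((1 + 2 * (C * B)) * p) := by
  refine h.Nv_le.trans (mul_le_mul_of_nonneg_left ?_ (sq_nonneg r))
  have h1 := (abs_le.1 h.FQ).2
  have h2 := (abs_le.1 h.Qp).2
  have h3 : C * δ * p ≤ C * B * p :=
    mul_le_mul_of_nonneg_right (mul_le_mul_of_nonneg_left hδB hC) h.hp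
  nlinarith

theorem cross_le {F : ℝ} (hk : 0 < k) : -(2 * (F * L)) ≤ k⁻¹ * F ^ 2 + k * L ^ 2 := by
  have h : k⁻¹ * F ^ 2 + k * L ^ 2 + 2 * (F * L) = k⁻¹ * (F + k * L) ^ 2 := by
    field_simp; ring
  have : 0 ≤ k⁻¹ * (F + k * L) ^ 2 := by positivity
  linarith

/-- Bound for the multiplier in the high frequency estimate. -/
theorem multiplier_sq_le {Cm Nu u : ℝ} (h1 : β ^ 2 * Nu ^ 2 ≤ Cm * p)
    (h2 : |2 * β * ζ * n + q| ≤ t) (ht : 0 ≤ t) :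
    (2 * (β * (Nu + ζ * n * u)) + q * u) ^ 2 ≤ 8 * (Cm * p) + 2 * t ^ 2 * u ^ 2 := by
  have h3 : (2 * β * ζ * n + q) ^ 2 ≤ t ^ 2 := by
    rw [← sq_abs]; exact pow_le_pow_left₀ (abs_nonneg _) h2 2
  have h4 := mul_le_mul_of_nonneg_right h3 (sq_nonneg u)
  have h5 : 2 * (β * (Nu + ζ * n * u)) + q * u = 2 * (β * Nu) + (2 * β * ζ * n + q) * u := by ring
  rw [h5]
  nlinarith [sq_nonneg (2 * (β * Nu) - (2 * β * ζ * n + q) * u)]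

set_option maxHeartbeats 1000000 in
theorem carleman_center (hd : 1 ≤ d) (ha : 0 < a) (hc : 0 < c₀)
    (hB : 0 ≤ B) (hl0 : 0 < lam0) :
    ∃ η > 0, η ≤ a / 2 ∧ ∃ δ > 0, ∃ C9 ≥ 0, ∃ C10 ≥ 0, ∀ C1 ≥ C10, ∃ C11 ≥ 0,
      ∃ W b φ : Sm (E d), (∀ x, 0 ≤ φ x) ∧ (∀ x, 0 ≤ W x) ∧ (∀ x, 0 ≤ b x) ∧
        (∃ c > 0, ∀ x, c * zz x ^ (-(1 / 2 + η)) ≤ W x) ∧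
        (∀ x y, ‖x‖ ≤ 1 / 4 → 3 / 4 ≤ ‖y‖ → ‖y‖ ≤ 5 / 4 → φ x + δ ≤ φ y ∧ b x ≤ 6 * W y) ∧
        ∀ A : Fin d → Fin d → Sm (E d), Coef d a c₀ B A → ∀ lam ≥ lam0, ∀ (u : Sm (E d))
          (K' : Set (E d)), IsCompact K' → (∀ x ∉ K', u x = 0) → ∀ k > 0,
          ∫ x, W x * exp (C1 * lam * φ x) ^ 2 * sen lam u x
            ≤ C11 * exp (C11 * lam) * (∫ x, (k⁻¹ * Hop A lam u x ^ 2 + k * sen lam u x))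
              + C9 * (1 + C1) ^ 2 * lam ^ 2 *
                ∫ x in Metric.closedBall 0 (1 / 4), b x * exp (C1 * lam * φ x) ^ 2 * u x ^ 2 := by
  obtain ⟨η, hη, hηa, hη1, C2, hC2, M, hM, C8, hC8, C10, hC10, hmain⟩ :=
    exists_carleman_weight hd ha hc hB hl0
  have hC : 0 ≤ CG d B := by unfold CG; positivity
  set Cg := CG d B with hCg
  set m := 2 + 4 / c₀ with hm
  have hm2 : 2 ≤ m := by have : 0 < 4 / c₀ := by positivity
                         linarith
  refine ⟨η, hη, hηa, exp (-M) / 24, by positivity, 2 * m * C8, by positivity, C10, hC10,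
    fun C1 hC1 => ?_⟩
  obtain ⟨R3, hR3, K, hK, hmain⟩ := hmain C1 hC1
  have hR0 : 0 < R3 := by linarith
  have hK0 : 0 < K := by linarith
  have hC1' : 0 ≤ C1 := by linarith
  obtain ⟨φ, hφ, hφ0, hφR, hφδ⟩ := exists_weight (d := d) hM.le hR3
  set β := (bt K hK0 η : Sm (E d)) with hβd
  set θ := (th K hK0 η : Sm (E d)) with hθd
  set t0 := 2 * C1 * (1 + Cg * B) + (d + C2) / lam0 with ht0
  have ht00 : 0 ≤ t0 := by positivity
  set Cm := 1 + 2 * (Cg * B) with hCm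
  have hCm0 : 0 ≤ Cm := by positivity
  set L := 8 * Cm + 2 * t0 ^ 2 with hL
  have hL0 : 0 ≤ L := by positivity
  set C11 := m * (1 + L) + 2 * C1 * R3 with hC11
  have hC110 : 0 ≤ C11 := by positivity
  have hθ1 : ∀ x, 0 ≤ 1 - θ x := fun x => by linarith [th_lt_one hK0 η x]
  have hβ0 : ∀ x, 0 ≤ β x := fun x => (bt_pos hK0 η x).le
  refine ⟨C11, hC110, β * (1 - θ), β, φ, hφ0, fun x => ?_, hβ0, ?_, ?_, ?_⟩
  · exact mul_nonneg (hβ0 x) (hθ1 x)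
  · refine ⟨(K + 1) ^ (-1 / (2 * η)) / 2, by positivity, fun x => ?_⟩
    have h1 := le_bt hK0 hη x
    have h2 := half_rpow_le hK0 hK hη.le x
    have hz := zz_pos x
    calc (K + 1) ^ (-1 / (2 * η)) / 2 * zz x ^ (-(1 / 2 + η))
        = ((K + 1) ^ (-1 / (2 * η)) * zz x ^ (-(1 / 2) : ℝ)) * (zz x ^ (-η) / 2) := by
          rw [neg_add, rpow_add hz]; ring
      _ ≤ β x * (1 - θ x) := mul_le_mul h1 h2 (by positivity) (hβ0 x)
      _ = _ := by simp
  · intro x y hx hy hy2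
    refine ⟨hφδ x y hx hy, ?_⟩
    have := bt_le_six hK0 hK hη (by linarith) x y (by rw [zz_apply]; nlinarith [norm_nonneg y])
    simpa using this
  intro A hA lam hlam u K' hK' hu k hk
  have hlam0 : 0 < lam := by linarith
  set s := C1 * lam with hs
  have hs0 : 0 ≤ s := mul_nonneg hC1' hlam0.le
  set v := Sm.exp (s • φ) * u with hv
  set ex : Sm (E d) := Sm.exp (s • φ) with hex
  have hexa : ∀ x, ex x = exp (s * φ x) := fun x => by simp [hex]
  have hvK : ∀ x ∉ K', v x = 0 := fun x hx => by simp [hv, hu x hx]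
  have hsen := sen_zero_off lam hK' hu
  have hHop := Hop_zero_off (A := A) lam hK' hu
  set S : Sm (E d) := β * (1 - θ) * ex ^ 2 * sen lam u with hS
  have hSi : Integrable S := Sm.integrable hK' fun x hx => by simp [hS, hsen x hx]
  set T : Sm (E d) := β * ex ^ 2 * u ^ 2 with hT
  have hTi : Integrable T := Sm.integrable hK' fun x hx => by simp [hT, hu x hx]
  set Bq := Metric.closedBall (0 : E d) (1 / 4) with hBq
  have hBm : MeasurableSet Bq := Metric.isClosed_closedBall.measurableSet
  set cT := 2 * C8 * (1 + C1) ^ 2 * lam ^ 2 with hcT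
  have hTI : Integrable (Bq.indicator fun x => T x) := hTi.indicator hBm
  have pφ : ∀ i, pd i (s • φ) = (s • zeta0 M R3 hR0) * X i := fun i => by
    rw [Derivation.map_smul, hφ, smul_mul_assoc]
  -- lower bound
  have hlow : ∀ x, S x / m - cT * Bq.indicator (fun x => T x) x
      ≤ 2 * Gform A (fun i => β * NN A i) (s • φ) (qhf K hK0 η C2) v x
        + Zcoef A (fun i => β * NN A i) (s • φ) (algebraMap ℝ _ (lam ^ 2)) (qhf K hK0 η C2) x
          * v x ^ 2 := by
    intro x
    refine le_trans ?_ (hmain A hA lam hlam φ hφ v x)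
    have h1 := gsq_exp_le (s • φ) u x
    rw [gsq_radial pφ, ← hv, ← Sm.exp_apply, ← hex] at h1
    have g := hA.geo hd ha hB x
    have hn := g.n_lo
    have hW0 : 0 ≤ β x * (1 - θ x) := mul_nonneg (hβ0 x) (hθ1 x)
    set y := (s * zeta0 M R3 hR0 x) ^ 2 with hy
    have hy0 : 0 ≤ y := sq_nonneg _
    have hvx : v x ^ 2 = ex x ^ 2 * u x ^ 2 := by simp [hv, mul_pow]
    have hg0 := gsq_nonneg v x
    have h2 : y * ‖x‖ ^ 2 ≤ y * nn A x / c₀ := by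
      rw [le_div_iff₀ hc]; nlinarith only [mul_le_mul_of_nonneg_left hn hy0]
    have hn0 : 0 ≤ nn A x := g.n_nonneg hc.le
    have h3 : ex x ^ 2 * sen lam u x / m ≤ gsq v x + (y * nn A x + lam ^ 2) / 2 * v x ^ 2 := by
      rw [div_le_iff₀ (by linarith), sen_apply, mul_add]
      have e1 : 2 * ((s • zeta0 M R3 hR0 : Sm (E d)) x ^ 2 * ‖x‖ ^ 2) * v x ^ 2
          ≤ 2 * (y * nn A x / c₀) * v x ^ 2 := by
        refine mul_le_mul_of_nonneg_right ?_ (sq_nonneg _)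
        have : (s • zeta0 M R3 hR0 : Sm (E d)) x ^ 2 = y := by simp [hy]
        rw [this]; linarith only [h2]
      have e2 : ex x ^ 2 * (lam ^ 2 * u x ^ 2) = lam ^ 2 * v x ^ 2 := by rw [hvx]; ring
      have e3 : 0 ≤ y * nn A x * v x ^ 2 := by positivity
      have e4 : 0 ≤ lam ^ 2 * v x ^ 2 := by positivity
      have e5 : (gsq v x + (y * nn A x + lam ^ 2) / 2 * v x ^ 2) * m
          = m * gsq v x + (2 + 4 / c₀) / 2 * (y * nn A x * v x ^ 2)
            + m / 2 * (lam ^ 2 * v x ^ 2) := by rw [hm]; ring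
      have e6 : 2 * (y * nn A x / c₀) * v x ^ 2 = (4 / c₀) / 2 * (y * nn A x * v x ^ 2) := by ring
      have e7 : 2 * gsq v x ≤ m * gsq v x := mul_le_mul_of_nonneg_right hm2 hg0
      have e8 : 1 * (lam ^ 2 * v x ^ 2) ≤ m / 2 * (lam ^ 2 * v x ^ 2) :=
        mul_le_mul_of_nonneg_right (by linarith only [hm2]) e4
      rw [e5, e2]
      linarith only [e1, e3, e6, e7, e8, h1]
    have h4 := mul_le_mul_of_nonneg_left h3 hW0
    have h5 : cT * Bq.indicator (fun x => T x) x
        = 2 * β x * (if ‖x‖ ≤ 1 / 4 then C8 * (1 + C1) ^ 2 * lam ^ 2 else 0) * v x ^ 2 := by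
      by_cases hx : ‖x‖ ≤ 1 / 4
      · rw [indicator_of_mem (by simpa [hBq] using hx), if_pos hx, hvx, hT, hcT]
        simp; ring
      · rw [indicator_of_notMem (by simpa [hBq] using hx), if_neg hx]; ring
    have h6 : S x / m = β x * (1 - θ x) * (ex x ^ 2 * sen lam u x / m) := by
      simp [hS]; ring
    rw [h5, h6]
    refine le_trans (sub_le_sub_right h4 _) (le_of_eq ?_)
    ring
  have hkey := multiplier_integral hA.symm (fun i => β * NN A i) (s • φ)
    (algebraMap ℝ _ (lam ^ 2)) (qhf K hK0 η C2) v hK' hvK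
    (H := fun x => S x / m - cT * Bq.indicator (fun x => T x) x)
    ((hSi.div_const m).sub (hTI.const_mul cT)) hlow
  -- upper bound
  have hup : ∀ x, -(2 * (Pconj A (s • φ) (algebraMap ℝ _ (lam ^ 2)) v x
        * (2 * vf (fun i => β * NN A i) v x + qhf K hK0 η C2 x * v x)))
      ≤ (1 + L) * exp (2 * C1 * R3 * lam) * (k⁻¹ * Hop A lam u x ^ 2 + k * sen lam u x) := by
    intro x
    have g := hA.geo hd ha hB x
    have gr := hA.grd hd ha hB u x
    have hz := zz_pos x
    have hz1 := one_le_zz x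
    have hδB := dl_le (d := d) ha hB x
    have hP : Pconj A (s • φ) (algebraMap ℝ _ (lam ^ 2)) v x = ex x * Hop A lam u x := by
      rw [hv, Pconj_exp hA.symm]; simp [Hop, hex]
    have hvf : vf (fun i => β * NN A i) v x
        = ex x * (β x * (vf (NN A) u x + s * zeta0 M R3 hR0 x * nn A x * u x)) := by
      rw [hv, vf_exp, vf_smul_left, vf_smul_left, vf_NN_radial pφ]
      simp [hex]; ring
    have hb12 := bt_le_rpow hK0 hη x
    have hb1 := bt_le_one hK0 hη x
    have hn0 := g.n_nonneg hc.le
    have h1 : β x ^ 2 * vf (NN A) u x ^ 2 ≤ Cm * gsq u x := by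
      have e1 := gr.Nv_sq_le hC hδB
      have e2 : β x ^ 2 * ‖x‖ ^ 2 ≤ 1 := by
        have : β x ^ 2 ≤ (zz x ^ (-(1 / 2) : ℝ)) ^ 2 := pow_le_pow_left₀ (hβ0 x) hb12 2
        have e3 : (zz x ^ (-(1 / 2) : ℝ)) ^ 2 * zz x = 1 := by
          rw [← rpow_natCast, ← rpow_mul hz.le]
          nth_rewrite 2 [← rpow_one (zz x)]
          rw [← rpow_add hz]; norm_num
        rw [← e3]
        exact mul_le_mul this (by rw [zz_apply]; linarith) (sq_nonneg _) (by positivity)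
      calc β x ^ 2 * vf (NN A) u x ^ 2 ≤ β x ^ 2 * (‖x‖ ^ 2 * (Cm * gsq u x)) :=
            mul_le_mul_of_nonneg_left e1 (sq_nonneg _)
        _ = β x ^ 2 * ‖x‖ ^ 2 * (Cm * gsq u x) := by ring
        _ ≤ 1 * (Cm * gsq u x) := mul_le_mul_of_nonneg_right e2
            (mul_nonneg hCm0 (gsq_nonneg u x))
        _ = _ := one_mul _
    have hζ0 : 0 ≤ zeta0 M R3 hR0 x := by rw [zeta0_apply]; exact (zt_pos hR0 hz).le
    have h2 : β x * zeta0 M R3 hR0 x * nn A x ≤ 1 + Cg * B := by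
      have e1 : zeta0 M R3 hR0 x ≤ zz x ^ (-(1 / 2) : ℝ) := by
        rw [zeta0_apply]
        exact (zt_le_rpow hM.le hR0 hz).trans
          (rpow_le_rpow_of_exponent_le hz1 (by norm_num))
      have e2 : zz x ^ (-(1 / 2) : ℝ) * zz x ^ (-(1 / 2) : ℝ) = 1 / zz x := by
        rw [← rpow_add hz]; norm_num [rpow_neg_one]
      have e3 := g.n_div_le hC
      calc β x * zeta0 M R3 hR0 x * nn A x
          ≤ zz x ^ (-(1 / 2) : ℝ) * zz x ^ (-(1 / 2) : ℝ) * nn A x := by gcongr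
        _ = nn A x / zz x := by rw [e2]; ring
        _ ≤ 1 + Cg * dl a B x := e3
        _ ≤ _ := by have := mul_le_mul_of_nonneg_left hδB hC; linarith
    have h3 : 0 ≤ qhf K hK0 η C2 x ∧ qhf K hK0 η C2 x ≤ d + C2 := by
      have hd' : (1 : ℝ) ≤ d := by exact_mod_cast hd
      have e0 : 0 ≤ C2 * (zp (-1) : Sm (E d)) x := mul_nonneg hC2 (zp_neg_one_nonneg x)
      have e1 : C2 * (zp (-1) : Sm (E d)) x ≤ C2 :=
        mul_le_of_le_one_right hC2 (zp_neg_one_le x)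
      have e2 : qhf K hK0 η C2 x = β x * ((d : ℝ) - 1 + C2 * (zp (-1) : Sm (E d)) x) := rfl
      rw [e2]
      refine ⟨mul_nonneg (hβ0 x) (by linarith), ?_⟩
      exact (mul_le_of_le_one_left (by linarith) hb1).trans (by linarith)
    have h4 : |2 * β x * (s * zeta0 M R3 hR0 x) * nn A x + qhf K hK0 η C2 x| ≤ lam * t0 := by
      have e1 : 2 * β x * (s * zeta0 M R3 hR0 x) * nn A x
          = 2 * s * (β x * zeta0 M R3 hR0 x * nn A x) := by ring
      have e2 : 0 ≤ β x * zeta0 M R3 hR0 x * nn A x :=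
        mul_nonneg (mul_nonneg (hβ0 x) hζ0) hn0
      rw [e1, abs_of_nonneg (add_nonneg (mul_nonneg (by linarith) e2) h3.1)]
      have e3 : 2 * s * (β x * zeta0 M R3 hR0 x * nn A x) ≤ 2 * s * (1 + Cg * B) :=
        mul_le_mul_of_nonneg_left h2 (by linarith)
      have e4 : (d : ℝ) + C2 ≤ lam * ((d + C2) / lam0) := by
        rw [mul_div_assoc', le_div_iff₀ hl0]
        have : (0 : ℝ) ≤ d + C2 := by positivity
        nlinarith only [this, hlam]
      have e5 : lam * t0 = 2 * s * (1 + Cg * B) + lam * ((d + C2) / lam0) := by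
        rw [ht0, hs]; ring
      linarith only [h3.2, e3, e4, e5]
    have h5 := multiplier_sq_le (u := u x) h1 h4 (by positivity)
    have h6 : (2 * (β x * (vf (NN A) u x + s * zeta0 M R3 hR0 x * nn A x * u x))
        + qhf K hK0 η C2 x * u x) ^ 2 ≤ L * sen lam u x := by
      refine h5.trans ?_
      rw [sen_apply, hL]
      have e1 : 0 ≤ t0 ^ 2 * gsq u x := mul_nonneg (sq_nonneg _) (gsq_nonneg u x)
      have e2 : 0 ≤ Cm * (lam ^ 2 * u x ^ 2) := by positivity
      nlinarith only [e1, e2]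
    set l := 2 * (β x * (vf (NN A) u x + s * zeta0 M R3 hR0 x * nn A x * u x))
        + qhf K hK0 η C2 x * u x with hl
    have h7 := cross_le (F := Hop A lam u x) (L := l) hk
    have hsn := sen_nonneg lam u x
    have hex2 : ex x ^ 2 ≤ exp (2 * C1 * R3 * lam) := by
      rw [hexa, ← exp_nat_mul]
      refine exp_le_exp.2 ?_
      have := mul_le_mul_of_nonneg_left (hφR x) hs0
      push_cast
      rw [hs] at this ⊢
      linarith
    have h8 : 0 ≤ k⁻¹ * Hop A lam u x ^ 2 := by positivity
    calc _ = ex x ^ 2 * -(2 * (Hop A lam u x * l)) := by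
          rw [hP, hvf, hl]
          have : v x = ex x * u x := rfl
          rw [this]; ring
      _ ≤ ex x ^ 2 * (k⁻¹ * Hop A lam u x ^ 2 + k * l ^ 2) :=
          mul_le_mul_of_nonneg_left h7 (sq_nonneg _)
      _ ≤ ex x ^ 2 * ((1 + L) * (k⁻¹ * Hop A lam u x ^ 2 + k * sen lam u x)) := by
          refine mul_le_mul_of_nonneg_left ?_ (sq_nonneg _)
          have e1 := mul_le_mul_of_nonneg_left h6 hk.le
          have e2 := mul_nonneg hL0 h8
          have e3 : 0 ≤ k * sen lam u x := mul_nonneg hk.le hsn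
          nlinarith only [e1, e2, e3]
      _ ≤ exp (2 * C1 * R3 * lam)
            * ((1 + L) * (k⁻¹ * Hop A lam u x ^ 2 + k * sen lam u x)) := by
          refine mul_le_mul_of_nonneg_right hex2 (mul_nonneg (by linarith) ?_)
          have e3 : 0 ≤ k * sen lam u x := mul_nonneg hk.le hsn
          linarith
      _ = _ := by ring
  have hRi : Integrable (fun x => k⁻¹ * Hop A lam u x ^ 2 + k * sen lam u x) :=
    Sm.integrable (f := k⁻¹ • Hop A lam u ^ 2 + k • sen lam u) hK' fun x hx => by
      simp [hHop x hx, hsen x hx]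
  have hPi : Integrable fun x => -(2 * (Pconj A (s • φ) (algebraMap ℝ _ (lam ^ 2)) v x
        * (2 * vf (fun i => β * NN A i) v x + qhf K hK0 η C2 x * v x))) := by
    refine Sm.integrable (f := -(2 * (Pconj A (s • φ) (algebraMap ℝ _ (lam ^ 2)) v
        * (2 * vf (fun i => β * NN A i) v + qhf K hK0 η C2 * v)))) hK' fun x hx => ?_
    have : Pconj A (s • φ) (algebraMap ℝ _ (lam ^ 2)) v x = 0 := by
      rw [hv, Pconj_exp hA.symm]
      have := hHop x hx
      simp only [Hop, Sm.add_apply, Sm.smul_apply] at this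
      simp [this]
    simp only [Sm.neg_apply, Sm.mul_apply, this]
    ring
  have hR := integral_mono hPi (hRi.const_mul ((1 + L) * exp (2 * C1 * R3 * lam))) hup
  rw [integral_const_mul] at hR
  rw [integral_sub (hSi.div_const m) (hTI.const_mul cT), integral_div, integral_const_mul,
    integral_indicator hBm] at hkey
  set I := ∫ x, (k⁻¹ * Hop A lam u x ^ 2 + k * sen lam u x) with hI
  have hI0 : 0 ≤ I := integral_nonneg fun x => by
    have := sen_nonneg lam u x
    simp only [Pi.zero_apply]; positivity
  have e1 : ∫ x, (β * (1 - θ) : Sm (E d)) x * exp (s * φ x) ^ 2 * sen lam u x = ∫ x, S x := by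
    refine integral_congr_ae (Eventually.of_forall fun x => ?_)
    simp [hS, hexa]
  have e2 : ∫ x in Bq, β x * exp (s * φ x) ^ 2 * u x ^ 2 = ∫ x in Bq, T x := by
    refine integral_congr_ae (Eventually.of_forall fun x => ?_)
    simp [hT, hexa]
  rw [e1, e2]
  have e3 := hkey.trans hR
  have e4 : ∫ x, S x ≤ m * ((1 + L) * exp (2 * C1 * R3 * lam) * I + cT * ∫ x in Bq, T x) := by
    have := sub_le_iff_le_add.1 e3
    rw [div_le_iff₀ (by linarith)] at this
    linarith only [this]
  refine e4.trans ?_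
  have e5 : m * ((1 + L) * exp (2 * C1 * R3 * lam) * I) ≤ C11 * exp (C11 * lam) * I := by
    have f1 : m * (1 + L) ≤ C11 := by rw [hC11]; have : 0 ≤ 2 * C1 * R3 := by positivity
                                      linarith
    have f2 : exp (2 * C1 * R3 * lam) ≤ exp (C11 * lam) := by
      refine exp_le_exp.2 (mul_le_mul_of_nonneg_right ?_ hlam0.le)
      rw [hC11]; have : 0 ≤ m * (1 + L) := by positivity
      linarith
    calc _ = (m * (1 + L)) * exp (2 * C1 * R3 * lam) * I := by ring
      _ ≤ _ := by gcongr
  have e6 : m * (cT * ∫ x in Bq, T x) = 2 * m * C8 * (1 + C1) ^ 2 * lam ^ 2 * ∫ x in Bq, T x := by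
    rw [hcT]; ring
  rw [mul_add, e6]
  linarith only [e5]

section Pull
variable {V W : Type*} [NormedAddCommGroup V] [NormedSpace ℝ V]
  [NormedAddCommGroup W] [NormedSpace ℝ W]

/-- Pullback of smooth functions under a smooth map. -/
noncomputable def Sm.pull (g : V → W) (hg : ContDiff ℝ (⊤ : ℕ∞) g) : Sm W →ₐ[ℝ] Sm V where
  toFun f := Sm.mk (fun x => f (g x)) (f.smooth.comp hg)
  map_one' := rfl
  map_mul' _ _ := rfl
  map_zero' := rfl
  map_add' _ _ := rfl
  commutes' _ := rfl

@[simp] theorem Sm.pull_apply (g : V → W) (hg) (f : Sm W) (x : V) :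
    Sm.pull g hg f x = f (g x) := rfl

theorem D_pull (g : V → W) (hg) (f : Sm W) (v x : V) :
    D v (Sm.pull g hg f) x = fderiv ℝ f (g x) (fderiv ℝ g x v) := by
  have h2 := (f.differentiable (g x)).hasFDerivAt.comp x
    ((hg.differentiable (by simp)) x).hasFDerivAt
  have h3 : fderiv ℝ (Sm.pull g hg f) x = _ := h2.fderiv
  rw [D_apply, h3]
  rfl

/-- Translation of smooth functions. -/
noncomputable def Tr (p : V) : Sm V →ₐ[ℝ] Sm V :=
  Sm.pull (fun x => x + p) (contDiff_id.add contDiff_const)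

@[simp] theorem Tr_apply (p : V) (f : Sm V) (x : V) : Tr p f x = f (x + p) := rfl

theorem D_Tr (p v : V) (f : Sm V) : D v (Tr p f) = Tr p (D v f) := by
  ext x
  rw [Tr, D_pull, fderiv_add_const]
  simp [D_apply]

end Pull

theorem pd_Tr (p : E d) (i : Fin d) (f : Sm (E d)) : pd i (Tr p f) = Tr p (pd i f) := D_Tr _ _ _

theorem Pop_Tr (p : E d) (A : Fin d → Fin d → Sm (E d)) (u : Sm (E d)) :
    Pop (fun i j => Tr p (A i j)) (Tr p u) = Tr p (Pop A u) := by
  have h : ∀ i, fl (fun i j => Tr p (A i j)) (Tr p u) i = Tr p (fl A u i) := fun i => by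
    simp [fl, pd_Tr, map_sum, map_mul]
  simp only [Pop, dv, h, pd_Tr, map_sum]

theorem Hop_Tr (p : E d) (A : Fin d → Fin d → Sm (E d)) (lam : ℝ) (u : Sm (E d)) :
    Hop (fun i j => Tr p (A i j)) lam (Tr p u) = Tr p (Hop A lam u) := by
  simp [Hop, Pop_Tr]

theorem sen_Tr (p : E d) (lam : ℝ) (u : Sm (E d)) : sen lam (Tr p u) = Tr p (sen lam u) := by
  ext x; simp [sen_apply, gsq_apply, pd_Tr]

/-- Near one of two centers the weight centered at the other one is larger. -/
theorem center_exchange {W b : Sm (E d)} (hW : ∀ x, 0 ≤ W x) (hs : 0 ≤ s)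
    (h : ∀ x y, ‖x‖ ≤ 1 / 4 → 3 / 4 ≤ ‖y‖ → ‖y‖ ≤ 5 / 4 → φ x + δ ≤ φ y ∧ b x ≤ 6 * W y)
    (p : E d) (hp : ‖p‖ = 1) (v : Sm (E d)) (hK : IsCompact K)
    (hv : ∀ x ∉ K, v x = 0) :
    ∫ x in Metric.closedBall 0 (1 / 4), b x * exp (s * φ x) ^ 2 * v (x + p) ^ 2
      ≤ 6 * exp (-(s * δ)) ^ 2 * ∫ x, W x * exp (s * φ x) ^ 2 * v x ^ 2 := by
  set G : Sm (E d) := W * Sm.exp (s • φ) ^ 2 * v ^ 2 with hG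
  have hGa : ∀ x, G x = W x * exp (s * φ x) ^ 2 * v x ^ 2 := fun x => by
    simp [hG, Sm.exp, Sm.comp]
  have hGi : Integrable G := Sm.integrable hK fun x hx => by simp [hGa, hv x hx]
  have hGn : ∀ x, 0 ≤ G x := fun x => by rw [hGa]; have := hW x; positivity
  have hGp : Integrable fun x => G (x + p) := hGi.comp_add_right p
  have hcb : IsCompact (Metric.closedBall (0 : E d) (1 / 4)) := isCompact_closedBall _ _
  calc _ ≤ ∫ x in Metric.closedBall 0 (1 / 4), 6 * exp (-(s * δ)) ^ 2 * G (x + p) := by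
        refine setIntegral_mono_on ?_ (hGp.const_mul _).integrableOn
          Metric.isClosed_closedBall.measurableSet fun x hx => ?_
        · have h1 := b.continuous
          have h2 := φ.continuous
          have h3 := v.continuous
          exact ContinuousOn.integrableOn_compact hcb (Continuous.continuousOn (by fun_prop))
        · have hx' : ‖x‖ ≤ 1 / 4 := by simpa using hx
          have h1 : ‖x + p‖ ≤ 5 / 4 := (norm_add_le _ _).trans (by rw [hp]; linarith)
          have h2 : 3 / 4 ≤ ‖x + p‖ := by
            have := norm_sub_norm_le p (-x)
            rw [norm_neg, sub_neg_eq_add, add_comm] at this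
            linarith
          obtain ⟨h3, h4⟩ := h x (x + p) hx' h2 h1
          have h5 : exp (s * φ x) ^ 2
              ≤ exp (-(s * δ)) ^ 2 * exp (s * φ (x + p)) ^ 2 := by
            rw [← mul_pow, ← exp_add]
            refine pow_le_pow_left₀ (exp_pos _).le (exp_le_exp.2 ?_) 2
            nlinarith [mul_le_mul_of_nonneg_left h3 hs]
          rw [hGa]
          have h6 : b x * exp (s * φ x) ^ 2 ≤ 6 * W (x + p) *
              (exp (-(s * δ)) ^ 2 * exp (s * φ (x + p)) ^ 2) :=
            mul_le_mul h4 h5 (by positivity) (by have := hW (x + p); positivity)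
          have h7 := mul_le_mul_of_nonneg_right h6 (sq_nonneg (v (x + p)))
          linarith only [h7]
    _ ≤ ∫ x, 6 * exp (-(s * δ)) ^ 2 * G (x + p) :=
        setIntegral_le_integral (hGp.const_mul _)
          (Eventually.of_forall fun x => by have := hGn (x + p); simp only [Pi.zero_apply]; positivity)
    _ = 6 * exp (-(s * δ)) ^ 2 * ∫ x, G x := by
        rw [integral_const_mul, integral_add_right_eq_self (fun x => G x)]
    _ = _ := by simp only [hGa]

theorem exists_exp_small {D C10 : ℝ} (hc : 0 < c) (hD : 0 ≤ D) :
    ∃ C1 ≥ C10, 0 ≤ C1 ∧ ∀ s ≥ C1 * c, D * (1 + C1) ^ 2 * exp (-s) ^ 2 ≤ 1 / 2 := by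
  have h1 : Tendsto (fun x : ℝ => x * exp (-x)) atTop (nhds 0) := by
    simpa using tendsto_pow_mul_exp_neg_atTop_nhds_zero 1
  have h2 : Tendsto (fun x : ℝ => exp (-x)) atTop (nhds 0) :=
    tendsto_exp_neg_atTop_nhds_zero
  have hm : Tendsto (fun x : ℝ => x * c) atTop atTop := tendsto_id.atTop_mul_const hc
  have h3 : Tendsto (fun x : ℝ => D * (exp (-(x * c)) + c⁻¹ * ((x * c) * exp (-(x * c)))) ^ 2)
      atTop (nhds (D * (0 + c⁻¹ * 0) ^ 2)) :=
    (((h2.comp hm).add ((h1.comp hm).const_mul c⁻¹)).pow 2).const_mul D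
  simp only [mul_zero, add_zero, ne_eq, OfNat.ofNat_ne_zero, not_false_eq_true, zero_pow] at h3
  have h4 := (h3.eventually_lt_const (show (0 : ℝ) < 1 / 2 by norm_num)).and
    (eventually_ge_atTop (max C10 0))
  obtain ⟨C1, h5, h6⟩ := h4.exists
  refine ⟨C1, (le_max_left _ _).trans h6, (le_max_right _ _).trans h6, fun s hs => ?_⟩
  have h7 : exp (-s) ≤ exp (-(C1 * c)) := exp_le_exp.2 (by linarith)
  have e : exp (-(C1 * c)) + c⁻¹ * ((C1 * c) * exp (-(C1 * c)))
      = (1 + C1) * exp (-(C1 * c)) := by field_simp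
  rw [e] at h5
  calc D * (1 + C1) ^ 2 * exp (-s) ^ 2
      ≤ D * (1 + C1) ^ 2 * exp (-(C1 * c)) ^ 2 := by gcongr
    _ = D * ((1 + C1) * exp (-(C1 * c))) ^ 2 := by ring
    _ ≤ _ := h5.le

/-- The resolvent estimate at high frequencies. -/
theorem high_frequency (hd : 1 ≤ d) (ha : 0 < a) (hc : 0 < c₀)
    (hB : 0 ≤ B) (hl0 : 0 < lam0) {p : E d} (hp : ‖p‖ = 1) (A : Fin d → Fin d → Sm (E d))
    (hA : Coef d a c₀ B A) (hA' : Coef d a c₀ B fun i j => Tr p (A i j)) :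
    ∃ C ≥ 0, ∀ lam ≥ lam0, ∀ (u : Sm (E d)) (K : Set (E d)), IsCompact K →
      (∀ x ∉ K, u x = 0) → ∀ k > 0,
      ∫ x, zz x ^ (-(1 + a) / 2) * sen lam u x
        ≤ C * exp (C * lam) * ∫ x, (k⁻¹ * Hop A lam u x ^ 2 + k * sen lam u x) := by
  obtain ⟨η, hη, hηa, δ, hδ, C9, hC9, C10, hC10, hmain⟩ := carleman_center hd ha hc hB hl0
  obtain ⟨C1, hC1, hC1', hsmall⟩ := exists_exp_small (c := lam0 * δ) (D := 6 * C9) (C10 := C10)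
    (by positivity) (by positivity)
  obtain ⟨C11, hC11, W, b, φ, hφ, hW, hb, ⟨c, hc', hWc⟩, hex, hmain⟩ := hmain C1 hC1
  refine ⟨max C11 (4 * C11 / c), le_max_of_le_left hC11, fun lam hlam u K hK hu k hk => ?_⟩
  have hlam0 : 0 < lam := by linarith
  set s := C1 * lam with hs
  have hs0 : 0 ≤ s := by positivity
  set J := ∫ x, (k⁻¹ * Hop A lam u x ^ 2 + k * sen lam u x) with hJ
  have hJ0 : 0 ≤ J := integral_nonneg fun x => by
    have := sen_nonneg lam u x
    simp only [Pi.zero_apply]; positivity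
  set u1 := Tr p u with hu1
  set K1 := (fun x => x + p) ⁻¹' K with hK1
  have hK1c : IsCompact K1 := (Homeomorph.addRight p).isCompact_preimage.2 hK
  have hu1z : ∀ x ∉ K1, u1 x = 0 := fun x hx => hu _ hx
  have m0 := hmain A hA lam hlam u K hK hu k hk
  have m1 := hmain _ hA' lam hlam u1 K1 hK1c hu1z k hk
  have eJ : ∫ x, (k⁻¹ * Hop (fun i j => Tr p (A i j)) lam u1 x ^ 2 + k * sen lam u1 x) = J := by
    rw [hJ, ← integral_add_right_eq_self (fun x => k⁻¹ * Hop A lam u x ^ 2 + k * sen lam u x) p]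
    simp [hu1, Hop_Tr, sen_Tr]
  rw [eJ] at m1
  rw [← hJ] at m0
  rw [← hs] at m0 m1
  have x0 : ∫ x in Metric.closedBall 0 (1 / 4), b x * exp (s * φ x) ^ 2 * u x ^ 2
      ≤ 6 * exp (-(s * δ)) ^ 2 * ∫ x, W x * exp (s * φ x) ^ 2 * u1 x ^ 2 := by
    have := center_exchange hW hs0 hex (-p) (by rw [norm_neg, hp]) u1 hK1c hu1z
    simpa [hu1] using this
  have x1 : ∫ x in Metric.closedBall 0 (1 / 4), b x * exp (s * φ x) ^ 2 * u1 x ^ 2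
      ≤ 6 * exp (-(s * δ)) ^ 2 * ∫ x, W x * exp (s * φ x) ^ 2 * u x ^ 2 :=
    center_exchange hW hs0 hex p hp u hK hu
  have hint : ∀ (v : Sm (E d)) (K : Set (E d)), IsCompact K → (∀ x ∉ K, v x = 0) →
      Integrable (fun x => W x * exp (s * φ x) ^ 2 * sen lam v x) ∧
      lam ^ 2 * (∫ x, W x * exp (s * φ x) ^ 2 * v x ^ 2)
        ≤ ∫ x, W x * exp (s * φ x) ^ 2 * sen lam v x := by
    intro v K hK hv
    have i1 : Integrable (fun x => W x * exp (s * φ x) ^ 2 * sen lam v x) := by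
      refine (Sm.integrable (f := W * Sm.exp (s • φ) ^ 2 * sen lam v) hK fun x hx => ?_).congr
        (Eventually.of_forall fun x => ?_)
      · simp [sen_zero_off lam hK hv x hx]
      · simp [Sm.exp, Sm.comp]
    have i2 : Integrable (fun x => W x * exp (s * φ x) ^ 2 * v x ^ 2) := by
      refine (Sm.integrable (f := W * Sm.exp (s • φ) ^ 2 * v ^ 2) hK fun x hx => ?_).congr
        (Eventually.of_forall fun x => ?_)
      · simp [hv x hx]
      · simp [Sm.exp, Sm.comp]
    refine ⟨i1, ?_⟩
    rw [← integral_const_mul]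
    refine integral_mono (i2.const_mul _) i1 fun x => ?_
    have h1 : 0 ≤ W x * exp (s * φ x) ^ 2 * gsq v x :=
      mul_nonneg (mul_nonneg (hW x) (sq_nonneg _)) (gsq_nonneg v x)
    simp only [sen_apply]
    linarith
  obtain ⟨i0, l0⟩ := hint u K hK hu
  obtain ⟨i1, l1⟩ := hint u1 K1 hK1c hu1z
  set I0 := ∫ x, W x * exp (s * φ x) ^ 2 * sen lam u x with hI0
  set I1 := ∫ x, W x * exp (s * φ x) ^ 2 * sen lam u1 x with hI1
  have hsm := hsmall (s * δ) (by
    rw [hs, show C1 * lam * δ = C1 * (lam * δ) by ring]; gcongr)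
  set ex := exp (-(s * δ)) ^ 2 with hex'
  have hex0 : 0 ≤ ex := by positivity
  have hcf : 0 ≤ C9 * (1 + C1) ^ 2 * lam ^ 2 := by positivity
  have hcf2 : 0 ≤ 6 * C9 * (1 + C1) ^ 2 * ex := by positivity
  have hnI0 : 0 ≤ I0 := integral_nonneg fun x => mul_nonneg (mul_nonneg (hW x) (sq_nonneg _)) (sen_nonneg lam u x)
  have hnI1 : 0 ≤ I1 := integral_nonneg fun x => mul_nonneg (mul_nonneg (hW x) (sq_nonneg _)) (sen_nonneg lam u1 x)
  have n0 : I0 ≤ C11 * exp (C11 * lam) * J + 1 / 2 * I1 := by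
    have e1 := mul_le_mul_of_nonneg_left x0 hcf
    have e2 := mul_le_mul_of_nonneg_left l1 hcf2
    have e3 := mul_le_mul_of_nonneg_right hsm hnI1
    linarith only [m0, e1, e2, e3]
  have n1 : I1 ≤ C11 * exp (C11 * lam) * J + 1 / 2 * I0 := by
    have e1 := mul_le_mul_of_nonneg_left x1 hcf
    have e2 := mul_le_mul_of_nonneg_left l0 hcf2
    have e3 := mul_le_mul_of_nonneg_right hsm hnI0
    linarith only [m1, e1, e2, e3]
  have n2 : I0 ≤ 4 * (C11 * exp (C11 * lam) * J) := by
    have : 0 ≤ C11 * exp (C11 * lam) * J := by positivity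
    linarith
  have hL : c * (∫ x, zz x ^ (-(1 + a) / 2) * sen lam u x) ≤ I0 := by
    rw [← integral_const_mul]
    have i2 : Integrable fun x => zz x ^ (-(1 + a) / 2) * sen lam u x :=
      (Sm.integrable (f := zp (-(1 + a) / 2) * sen lam u) hK fun x hx => by
        simp [sen_zero_off lam hK hu x hx]).congr (Eventually.of_forall fun x => by simp [zp_apply])
    refine integral_mono (i2.const_mul _) i0 fun x => ?_
    have hz1 := one_le_zz x
    have h1 : zz x ^ (-(1 + a) / 2) ≤ zz x ^ (-(1 / 2 + η)) :=
      rpow_le_rpow_of_exponent_le hz1 (by linarith)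
    have h2 := hWc x
    have h3 : 1 ≤ exp (s * φ x) ^ 2 :=
      one_le_pow₀ (one_le_exp (mul_nonneg hs0 (hφ x)))
    have h4 : c * zz x ^ (-(1 + a) / 2) ≤ W x * exp (s * φ x) ^ 2 :=
      calc _ ≤ c * zz x ^ (-(1 / 2 + η)) := by gcongr
        _ ≤ W x := h2
        _ ≤ _ := le_mul_of_one_le_right (hW x) h3
    have := mul_le_mul_of_nonneg_right h4 (sen_nonneg lam u x)
    simpa only [mul_assoc] using this
  have hfin : (∫ x, zz x ^ (-(1 + a) / 2) * sen lam u x)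
      ≤ 4 * C11 / c * exp (C11 * lam) * J := by
    rw [← mul_le_mul_iff_right₀ hc']
    refine hL.trans (n2.trans (le_of_eq ?_))
    field_simp
  refine hfin.trans ?_
  gcongr
  · exact le_max_right _ _
  · exact le_max_left _ _

set_option maxHeartbeats 1000000 in
theorem low_form_lower {F μ : ℝ} (hd : 3 ≤ d)
    (g : Geo d c₀ C δ z r n dN Nn NdN) (h : Grd c₀ C δ r p F Q Nv err) (hc : 0 < c₀) (hc1 : c₀ ≤ 1)
    (hC : 0 ≤ C) (hb : 0 ≤ b) (hθ : 0 ≤ θ) (hθ1 : θ ≤ 1) (hχ : 0 ≤ χ) (hχ1 : χ ≤ 1)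
    (hμ : μ = -θ + 2 * (1 - χ)) (hs : 10 * (C * δ / c₀) * χ ≤ (1 - θ) / 4) :
    b * ((1 - θ) / 4 * Q) ≤ b * (2 * χ * μ * (Nv ^ 2 / z) + 2 * χ * F
      - (χ * μ * (n / z) + χ * dN - (d - 1)) * Q + χ * err) := by
  refine mul_le_mul_of_nonneg_left ?_ hb
  have hz := g.z_pos
  have hz1 := g.one_le_z
  have hδ := g.hδ
  set ε := C * δ / c₀ with hε
  have hCδ : 0 ≤ C * δ := mul_nonneg hC hδ
  have hε0 : 0 ≤ ε := by positivity
  have hQ0 : 0 ≤ Q := le_trans (mul_nonneg hc.le h.hp) h.Q_lo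
  have hCε : C * δ ≤ ε := by rw [hε, le_div_iff₀ hc]; nlinarith
  have hDp : C * δ * p ≤ ε * Q := by
    rw [hε, div_mul_eq_mul_div, le_div_iff₀ hc]
    have := mul_le_mul_of_nonneg_left h.Q_lo hCδ
    linarith
  have hCQ : C * δ * Q ≤ ε * Q := mul_le_mul_of_nonneg_right hCε hQ0
  set ρ := r ^ 2 / z with hρ
  have hρ0 : 0 ≤ ρ := by positivity
  have hρ1 : ρ ≤ 1 := by rw [hρ, div_le_one hz, g.hz]; linarith
  set m := n / z with hm
  have hmρ : |m - ρ| ≤ C * δ := by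
    rw [hm, hρ, ← sub_div, abs_div, abs_of_pos hz, div_le_iff₀ hz]
    refine g.n_err.trans (mul_le_mul_of_nonneg_left ?_ hCδ)
    rw [g.hz]; linarith
  set ν := Nv ^ 2 / z with hν
  have hν0 : 0 ≤ ν := by positivity
  have hνF : ν ≤ ρ * F := by
    rw [hν, hρ, div_mul_eq_mul_div]
    exact div_le_div_of_nonneg_right h.Nv_le hz.le
  have hF1 := (abs_le.1 h.FQ).1
  have hF2 := (abs_le.1 h.FQ).2
  have he := (abs_le.1 h.err_le).1
  have hdN := (abs_le.1 g.dN_err).2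
  have hm1 := (abs_le.1 hmρ).1
  have hm2 := (abs_le.1 hmρ).2
  have hμ2 : μ ≤ 2 := by linarith
  have hμ1 : -1 ≤ μ := by linarith
  have hd' : (3 : ℝ) ≤ d := by exact_mod_cast hd
  have hdNQ : (dN - d) * Q ≤ ε * Q :=
    (mul_le_mul_of_nonneg_right hdN hQ0).trans hCQ
  have hX : (d - 1) * Q + χ * (2 * μ * ν + 2 * F - (μ * m + dN) * Q + err)
      = 2 * χ * μ * ν + 2 * χ * F - (χ * μ * m + χ * dN - (d - 1)) * Q + χ * err := by ring
  rw [← hX]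
  have hsQ := mul_le_mul_of_nonneg_right hs hQ0
  rcases le_or_gt 0 μ with h0 | h0
  · have k1 : 0 ≤ μ * ν := mul_nonneg h0 hν0
    have k2 : μ * (m - ρ) * Q ≤ 2 * (ε * Q) := by
      have e1 : μ * (m - ρ) ≤ 2 * (C * δ) := by
        calc _ ≤ μ * (C * δ) := mul_le_mul_of_nonneg_left hm2 h0
          _ ≤ _ := mul_le_mul_of_nonneg_right hμ2 hCδ
      have := mul_le_mul_of_nonneg_right e1 hQ0
      linarith
    have k3 : μ * ρ * Q ≤ μ * Q :=
      mul_le_mul_of_nonneg_right (mul_le_of_le_one_right h0 hρ1) hQ0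
    have k5 : 0 ≤ ε * Q := mul_nonneg hε0 hQ0
    have k4 : Q * (2 - d - μ - 10 * ε) ≤ 2 * μ * ν + 2 * F - (μ * m + dN) * Q + err := by
      linarith only [k1, k2, k3, k5, hF1, he, hdNQ, hDp]
    have k6 := mul_le_mul_of_nonneg_left k4 hχ
    have k7 : (d - 1 + χ * (2 - d - μ)) ≥ 7 / 8 := by
      rw [hμ]
      nlinarith only [mul_nonneg (sub_nonneg.2 hd') (sub_nonneg.2 hχ1), mul_nonneg hχ hθ,
        sq_nonneg (χ - 3 / 4)]
    have k8 := mul_le_mul_of_nonneg_right k7 hQ0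
    have k9 : 0 ≤ θ * Q := mul_nonneg hθ hQ0
    linarith only [k6, k8, k9, hsQ, hQ0]
  · have k1 : μ * (ρ * F) ≤ μ * ν := mul_le_mul_of_nonpos_left hνF h0.le
    have k5 : 0 ≤ ε * Q := mul_nonneg hε0 hQ0
    have k10 : μ * ρ * (F - Q) ≥ -(ε * Q) := by
      have e1 : -1 ≤ μ * ρ := by linarith [mul_le_mul_of_nonpos_left hρ1 h0.le]
      have e2 : μ * ρ ≤ 0 := mul_nonpos_of_nonpos_of_nonneg h0.le hρ0
      linarith [mul_le_mul_of_nonpos_left (hF2.trans hDp) e2, mul_le_mul_of_nonneg_right e1 k5]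
    have k2 : μ * (m - ρ) * Q ≤ 2 * (ε * Q) := by
      have e1 : μ * (m - ρ) ≤ 2 * (C * δ) := by
        have e0 : -(C * δ) * μ ≥ (m - ρ) * μ := mul_le_mul_of_nonpos_right hm1 h0.le
        have e3 := mul_le_mul_of_nonneg_right hμ1 hCδ
        linarith
      have := mul_le_mul_of_nonneg_right e1 hQ0
      linarith
    have k3 : μ * Q ≤ μ * ρ * Q := by
      refine mul_le_mul_of_nonneg_right ?_ hQ0
      linarith [mul_le_mul_of_nonpos_left hρ1 h0.le]
    have k4 : Q * (2 - d + μ - 10 * ε) ≤ 2 * μ * ν + 2 * F - (μ * m + dN) * Q + err := by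
      linarith only [k1, k2, k3, k5, k10, hF1, he, hdNQ, hDp]
    have k6 := mul_le_mul_of_nonneg_left k4 hχ
    have k7 : (d - 1 + χ * (2 - d + μ)) ≥ 1 - θ := by
      rw [hμ]
      nlinarith only [mul_nonneg (sub_nonneg.2 hd') (sub_nonneg.2 hχ1),
        mul_nonneg (sub_nonneg.2 hχ1) hθ, mul_nonneg hχ (sub_nonneg.2 hχ1)]
    have k8 := mul_le_mul_of_nonneg_right k7 hQ0
    have k9 : 0 ≤ (1 - θ) * Q := mul_nonneg (sub_nonneg.2 hθ1) hQ0
    linarith only [k6, k8, k9, hsQ, hQ0]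

/-- The part of the zeroth order coefficient that does not depend on the frequency. -/
theorem low_zero_lower (hd : 3 ≤ d)
    (g : Geo d c₀ C δ z r n dN Nn NdN)
    (hC : 0 ≤ C) (hθ : 0 ≤ θ) (hθ1 : θ ≤ 1) (hη : 0 ≤ η) (hη1 : η ≤ 1 / 4) :
    (d - 1) * θ * (1 - θ - 4 * (C * δ))
      ≤ (d - 1) * θ * (dN - n / z * (θ + 2 - 2 * η * (1 - θ))) := by
  have hd' : (3 : ℝ) ≤ d := by exact_mod_cast hd
  refine mul_le_mul_of_nonneg_left ?_ (mul_nonneg (by linarith) hθ)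
  have hz := g.z_pos
  have hCδ : 0 ≤ C * δ := mul_nonneg hC g.hδ
  have hdN := (abs_le.1 g.dN_err).1
  have hm : n / z ≤ 1 + C * δ := g.n_div_le hC
  have k1 : θ + 2 - 2 * η * (1 - θ) ≤ 3 := by nlinarith
  have k0 : 0 ≤ θ + 2 - 2 * η * (1 - θ) := by nlinarith
  have k2 := mul_le_mul_of_nonneg_right hm k0
  have k3 := mul_le_mul_of_nonneg_right k1 hCδ
  nlinarith [mul_nonneg hη (sub_nonneg.2 hθ1)]

/-- The coefficient of the squared frequency. -/
theorem low_freq_lower {μ : ℝ} (hd : 3 ≤ d)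
    (g : Geo d c₀ C δ z r n dN Nn NdN) (hC : 0 ≤ C) (hθ : 0 ≤ θ) (hθ1 : θ ≤ 1)
    (hχ : 0 ≤ χ) (hχ1 : χ ≤ 1)
    (hμ : μ = -θ + 2 * (1 - χ)) (hs : 3 * (C * δ) * χ ≤ (1 - θ) / 4) :
    3 / 4 * (1 - θ) - d * (1 - χ) ≤ χ * μ * (n / z) + χ * dN - (d - 1) := by
  have hd' : (3 : ℝ) ≤ d := by exact_mod_cast hd
  have hz := g.z_pos
  have hδ := g.hδ
  have hCδ : 0 ≤ C * δ := mul_nonneg hC hδ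
  set ρ := r ^ 2 / z with hρ
  have hρ0 : 0 ≤ ρ := by positivity
  have hρ1 : ρ ≤ 1 := by rw [hρ, div_le_one hz, g.hz]; linarith
  set m := n / z with hm
  have hmρ : |m - ρ| ≤ C * δ := by
    rw [hm, hρ, ← sub_div, abs_div, abs_of_pos hz, div_le_iff₀ hz]
    refine g.n_err.trans (mul_le_mul_of_nonneg_left ?_ hCδ)
    rw [g.hz]; linarith
  have hdN := (abs_le.1 g.dN_err).1
  have hμ2 : |μ| ≤ 2 := by rw [abs_le]; constructor <;> linarith
  have k1 : -(2 * (C * δ)) ≤ μ * (m - ρ) := by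
    have := abs_mul μ (m - ρ) ▸ mul_le_mul hμ2 hmρ (abs_nonneg _) zero_le_two
    exact (abs_le.1 this).1
  have k2 : -θ ≤ μ * ρ := by nlinarith
  have k3 : d - θ - 3 * (C * δ) ≤ μ * m + dN := by nlinarith
  have k4 := mul_le_mul_of_nonneg_left k3 hχ
  nlinarith [mul_nonneg (sub_nonneg.2 hχ1) hθ]

/-- The divergence of the radial field `g x u²`. -/
theorem dv_radial_sq (hg : ∀ i, pd i g = g1 * X i) (u : Sm (E d)) (x : E d) :
    dv (fun i => g * X i * u ^ 2) x
      = (d * g x + g1 x * ‖x‖ ^ 2) * u x ^ 2 + 2 * g x * u x * vf X u x := by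
  have h : ∀ i, pd i (g * X i * u ^ 2) x
      = (g x + g1 x * x i ^ 2) * u x ^ 2 + 2 * g x * u x * (x i * pd i u x) := fun i => by
    rw [pow_two]
    simp only [D_mul, hg, pd_X, if_pos]
    simp
    ring
  have h0 : dv (fun i => g * X i * u ^ 2) x = ∑ i, pd i (g * X i * u ^ 2) x := by simp [dv]
  rw [h0, sum_congr rfl fun i _ => h i, sum_add_distrib, ← sum_mul,
    sum_add_distrib, ← mul_sum, ← mul_sum, norm_sq_eq_sum]
  simp [vf]

theorem vf_X_sq_le (u : Sm (E d)) (x : E d) : vf X u x ^ 2 ≤ ‖x‖ ^ 2 * gsq u x := by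
  rw [norm_sq_eq_sum, gsq_apply]
  simpa [vf] using Finset.sum_mul_sq_le_sq_mul_sq Finset.univ (fun i => x i) (fun i => pd i u x)

/-- A weighted Hardy inequality in pointwise form. -/
theorem hardy_pointwise {w1 : ℝ} (hd : 3 ≤ d) (hw : 0 ≤ w)
    (hθ : 0 ≤ θ) (hη : 0 ≤ η) (hη1 : η ≤ 1 / 4)
    (hw1 : w1 = -(w * (θ * (1 + 2 * η) + 2)) / zz x ^ 2) :
    w / zz x * (3 / 4 - 3 / 2 * θ) * u x ^ 2 - 4 * w * gsq u x
      ≤ (d * (w / zz x) + w1 * ‖x‖ ^ 2) * u x ^ 2 + 2 * (w / zz x) * u x * vf X u x := by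
  have hd' : (3 : ℝ) ≤ d := by exact_mod_cast hd
  have hz := zz_pos x
  have hzx := zz_apply x
  set z := zz x
  set r := ‖x‖
  have hρ1 : r ^ 2 / z ≤ 1 := by rw [div_le_one hz, hzx]; linarith
  have e1 : w / z * (1 - 3 / 2 * θ) ≤ d * (w / z) + w1 * r ^ 2 := by
    have : d * (w / z) + w1 * r ^ 2 = w / z * (d - r ^ 2 / z * (θ * (1 + 2 * η) + 2)) := by
      rw [hw1]; field_simp
      ring
    rw [this]
    refine mul_le_mul_of_nonneg_left ?_ (by positivity)
    have k1 : r ^ 2 / z * (θ * (1 + 2 * η) + 2) ≤ 1 * (θ * (1 + 2 * η) + 2) :=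
      mul_le_mul_of_nonneg_right hρ1 (by positivity)
    nlinarith
  have e2 := mul_le_mul_of_nonneg_right e1 (sq_nonneg (u x))
  have e3 : -(w / z / 4 * u x ^ 2 + 4 * w * gsq u x) ≤ 2 * (w / z) * u x * vf X u x := by
    have h1 := vf_X_sq_le u x
    have h2 : vf X u x ^ 2 / z ≤ gsq u x := by
      rw [div_le_iff₀ hz, hzx]
      nlinarith [gsq_nonneg u x]
    have h3 := mul_le_mul_of_nonneg_left h2 hw
    have h4 : 0 ≤ w / z * (u x / 2 + 2 * vf X u x) ^ 2 := by positivity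
    have h5 : w / z * (u x / 2 + 2 * vf X u x) ^ 2 = w / z / 4 * u x ^ 2
        + 2 * (w / z) * u x * vf X u x + 4 * (w * (vf X u x ^ 2 / z)) := by ring
    linarith
  linarith

/-- Hardy's inequality with a radially nondecreasing weight. -/
theorem hardy_weight (hd : 3 ≤ d) {w w1 : Sm (E d)} (hw : ∀ x, 0 ≤ w x)
    (h1 : ∀ i, pd i w = w1 * X i) (hw1 : ∀ x, 0 ≤ w1 x) (hK : IsCompact K) (hu : ∀ x ∉ K, u x = 0) :
    ∫ x, w x * (u x ^ 2 / zz x) ≤ 16 / 3 * ∫ x, w x * gsq u x := by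
  have h2 : ∀ i, pd i (w * zp (-1)) = (w1 * zp (-1) + (-2 : ℝ) • (w * zp (-1) ^ 2)) * X i := fun i => by
    rw [D_mul, h1, pd_zp_neg_one]
    ext x; simp; ring
  have h3 : ∫ x, dv (fun i => w * zp (-1) * X i * u ^ 2) x = 0 :=
    integral_dv_eq_zero hK fun i x hx => by simp [hu x hx]
  have i1 : Integrable fun x => w x * (u x ^ 2 / zz x) :=
    (Sm.integrable (f := w * (u ^ 2 * zp (-1))) hK fun x hx => by simp [hu x hx]).congr
      (Eventually.of_forall fun x => by simp [rpow_neg_one, div_eq_mul_inv])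
  have i2 : Integrable fun x => w x * gsq u x :=
    Sm.integrable (f := w * gsq u) hK fun x hx => by simp [gsq_zero_off hK hu x hx]
  have i3 : Integrable (dv (fun i => w * zp (-1) * X i * u ^ 2)) :=
    Sm.integrable hK fun x hx => by
      rw [dv_radial_sq h2, hu x hx]; simp
  have h4 : ∫ x, (3 / 4 * (w x * (u x ^ 2 / zz x)) - 4 * (w x * gsq u x))
      ≤ ∫ x, dv (fun i => w * zp (-1) * X i * u ^ 2) x := by
    refine integral_mono ((i1.const_mul _).sub (i2.const_mul _)) i3 fun x => ?_
    rw [dv_radial_sq h2]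
    have := hardy_pointwise (w := w x) (θ := 0) (η := 0) hd (u := u) (x := x) (hw x)
      le_rfl le_rfl (by norm_num) rfl
    have hz := zz_pos x
    have h5 : 0 ≤ w1 x * (zz x)⁻¹ * ‖x‖ ^ 2 * u x ^ 2 := by have := hw1 x; positivity
    simp only [Sm.add_apply, Sm.mul_apply, Sm.smul_apply, Sm.pow_apply, zp_neg_one_apply]
    have h6 := add_le_add this h5
    rw [add_zero] at h6
    refine le_trans (le_of_eq ?_) (h6.trans (le_of_eq ?_))
    · ring
    · field_simp; ring
  rw [integral_sub (i1.const_mul _) (i2.const_mul _), integral_const_mul, integral_const_mul,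
    h3] at h4
  linarith

/-- Hardy's inequality. -/
theorem hardy (hd : 3 ≤ d) (hK : IsCompact K)
    (hu : ∀ x ∉ K, u x = 0) : ∫ x, u x ^ 2 / zz x ≤ 16 / 3 * ∫ x, gsq u x := by
  simpa using hardy_weight hd (w := 1) (w1 := 0) (by simp) (fun i => by simp) (by simp) hK hu

theorem Pconj_zero (A : Fin d → Fin d → Sm (E d)) (lam : ℝ) (u : Sm (E d)) :
    Pconj A 0 (algebraMap ℝ _ (lam ^ 2)) u = Hop A lam u := by
  have h : fl A (0 : Sm (E d)) = fun _ => 0 := by funext i; simp [fl]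
  ext x
  simp [Pconj, Hop, Pop, h, vf, dv]

theorem pd_weight {K : ℝ} (hK : 0 < K) (hη : 0 < η) (i : Fin d) :
    pd i (bt K hK η * (1 - th K hK η) * zp (-1) : Sm (E d))
      = (-(bt K hK η * (1 - th K hK η) * ((1 + 2 * η) • th K hK η + 2) * zp (-1) ^ 2)) * X i := by
  simp only [D_mul, map_sub, pd_zp_neg_one, pd_bt hK hη, pd_th, ← map_one (algebraMap ℝ (Sm (E d))),
    D_algebraMap]
  ext x
  simp
  ring

theorem pd_low {K : ℝ} (hK : 0 < K) (hη : 0 < η) (hR : 0 < R) (i : Fin d) :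
    pd i (bt K hK η * th R hR 1 : Sm (E d))
      = (bt K hK η * th R hR 1 * (-th K hK η + 2 * (1 - th R hR 1)) * zp (-1)) * X i := by
  simp only [D_mul, pd_bt hK hη, pd_th]
  ext x
  simp
  ring

theorem low_params {Cc : ℝ} (hB : 0 ≤ B) (hη : η ≤ a / 2)
    (hC : 0 ≤ Cc) (hω : 0 < ω) :
    ∃ R > 0, ∃ hR : 0 < R, ∀ x : E d, Cc * dl a B x * th R hR 1 x ≤ ω * zz x ^ (-η) := by
  set R := (Cc * B / ω) ^ 2 + 1 with hRd
  have hR : 0 < R := by positivity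
  refine ⟨R, hR, hR, fun x => ?_⟩
  have hz := zz_pos x
  have h1 := dl_mul_sqrt_le (a := a) hB hη x
  have hs : Cc * B / ω ≤ √R := le_sqrt_of_sq_le (by rw [hRd]; linarith)
  have hsz := sqrt_pos.2 hz
  have hsR := sqrt_pos.2 hR
  have h2 : th R hR 1 x ≤ √(zz x) / √R := by
    rw [th_apply, rpow_one, div_le_div_iff₀ (by positivity) hsR]
    have e1 := sq_sqrt hz.le
    have e2 := sq_sqrt hR.le
    nlinarith [mul_pos hsz hsR, sq_nonneg (√(zz x) - √R), mul_nonneg hsz.le hsz.le,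
      mul_nonneg hsz.le (sq_nonneg (√(zz x) - √R)), mul_pos (mul_pos hsz hsR) hsz]
  have hdl := dl_nonneg (a := a) hB x
  calc Cc * dl a B x * th R hR 1 x ≤ Cc * dl a B x * (√(zz x) / √R) :=
        mul_le_mul_of_nonneg_left h2 (mul_nonneg hC hdl)
    _ = Cc * (dl a B x * √(zz x)) / √R := by ring
    _ ≤ Cc * (B * zz x ^ (-η)) / √R := by gcongr
    _ = Cc * B / √R * zz x ^ (-η) := by ring
    _ ≤ ω * zz x ^ (-η) := by
        refine mul_le_mul_of_nonneg_right ?_ (rpow_nonneg hz.le _)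
        rw [div_le_iff₀ hsR]
        rw [div_le_iff₀ hω] at hs
        linarith

theorem rpow_neg_half_small (hω : 0 < ω) (hη : η ≤ 1 / 4) :
    ∃ Z ≥ 1, ∀ x : E d, Z ≤ zz x → c * (zz x)⁻¹ ≤ ω * zz x ^ (-η) := by
  refine ⟨(c / ω) ^ 2 + 1, by nlinarith [sq_nonneg (c / ω)], fun x hx => ?_⟩
  have hz := zz_pos x
  have hsz := sqrt_pos.2 hz
  have hs : c / ω ≤ √(zz x) := le_sqrt_of_sq_le (by linarith)
  have h1 : (√(zz x))⁻¹ ≤ zz x ^ (-η) := by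
    rw [sqrt_eq_rpow, ← rpow_neg hz.le]
    exact rpow_le_rpow_of_exponent_le (one_le_zz x) (by linarith)
  rw [div_le_iff₀ hω] at hs
  calc c * (zz x)⁻¹ ≤ √(zz x) * ω * (zz x)⁻¹ := by gcongr
    _ = ω * (√(zz x))⁻¹ := by
        have : √(zz x) * √(zz x) = zz x := mul_self_sqrt hz.le
        field_simp
        nlinarith
    _ ≤ _ := by gcongr

theorem dl_small (hB : 0 ≤ B) (hη : η ≤ a / 2) (hω : 0 < ω) (hc : 0 ≤ c) :
    ∃ Z ≥ 1, ∀ x : E d, Z ≤ zz x → c * dl a B x ≤ ω * zz x ^ (-η) := by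
  refine ⟨(c * B / ω) ^ 2 + 1, by nlinarith [sq_nonneg (c * B / ω)], fun x hx => ?_⟩
  have hz := zz_pos x
  have hsz := sqrt_pos.2 hz
  have hs : c * B / ω ≤ √(zz x) := le_sqrt_of_sq_le (by linarith)
  have h1 := dl_mul_sqrt_le (a := a) hB hη x
  rw [div_le_iff₀ hω] at hs
  have hp : 0 ≤ zz x ^ (-η) := rpow_nonneg hz.le _
  rw [← mul_le_mul_iff_left₀ hsz]
  calc c * dl a B x * √(zz x) = c * (dl a B x * √(zz x)) := by ring
    _ ≤ c * (B * zz x ^ (-η)) := by gcongr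
    _ = c * B * zz x ^ (-η) := by ring
    _ ≤ √(zz x) * ω * zz x ^ (-η) := by gcongr
    _ = _ := by ring

/-- Combination of the pointwise lower bounds at low frequency. -/
theorem low_combine {A1 A2 u2 : ℝ} (hε : ε = c / 16) (hc : 0 < c) (hc1 : c ≤ 1)
    (hb : 0 ≤ b) (hz : 0 < z) (hθ : 0 ≤ θ) (hθ1 : θ ≤ 1) (hQ : c * p ≤ Q)
    (hu : 0 ≤ u2) (h1 : θ * (1 - θ) - ε / 4 * (1 - θ) ≤ A1)
    (h2 : c / 4 * lam ^ 2 * (1 - θ) - ε / 2 * ((1 - θ) / z) ≤ 2 * lam ^ 2 * A2) :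
    c / 4 * (b * (1 - θ) * (p + lam ^ 2 * u2))
      - ε * (b * (1 - θ) / z * (3 / 4 - 3 / 2 * θ) * u2 - 4 * (b * (1 - θ)) * p)
      ≤ 2 * (b * ((1 - θ) / 4 * Q)) + (2 * lam ^ 2 * (b * A2) + b / z * A1) * u2 := by
  have k1 : b * (1 - θ) * (c * p) ≤ b * (1 - θ) * Q :=
    mul_le_mul_of_nonneg_left hQ (mul_nonneg hb (sub_nonneg.2 hθ1))
  have k2 := mul_le_mul_of_nonneg_left h2 (mul_nonneg hb hu)
  have k3 := mul_le_mul_of_nonneg_left h1 (mul_nonneg (div_nonneg hb hz.le) hu)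
  have k4 : 0 ≤ b / z * u2 * ((1 - θ) * (θ * (1 - 3 / 2 * ε))) := by
    have : 0 ≤ 1 - 3 / 2 * ε := by rw [hε]; linarith
    have := sub_nonneg.2 hθ1
    positivity
  have e1 : b * u2 * (c / 4 * lam ^ 2 * (1 - θ) - ε / 2 * ((1 - θ) / z))
      = c / 4 * (b * (1 - θ) * (lam ^ 2 * u2)) - ε / 2 * (1 - θ) * (b / z * u2) := by
    field_simp
  have e2 : ε * (b * (1 - θ) / z * (3 / 4 - 3 / 2 * θ) * u2)
      = ε * (1 - θ) * (3 / 4 - 3 / 2 * θ) * (b / z * u2) := by field_simp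
  rw [mul_sub ε, e2]
  rw [e1] at k2
  subst hε
  linarith only [k1, k2, k3, k4]

set_option maxHeartbeats 1000000 in
/-- The resolvent estimate at low frequencies. -/
theorem low_frequency (hd : 3 ≤ d) (ha : 0 < a) (hc : 0 < c₀) (hB : 0 ≤ B) :
    ∃ lam0 > 0, ∃ C ≥ 0, ∀ A : Fin d → Fin d → Sm (E d), Coef d a c₀ B A →
      ∀ lam : ℝ, 0 ≤ lam → lam ≤ lam0 → ∀ (u : Sm (E d)) (K' : Set (E d)), IsCompact K' →
      (∀ x ∉ K', u x = 0) → ∀ k > 0,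
      ∫ x, zz x ^ (-(1 + a) / 2) * sen lam u x
        ≤ C * ∫ x, (k⁻¹ * Hop A lam u x ^ 2 + k * sen lam u x) := by
  have hd1 : 1 ≤ d := by omega
  have hd' : (3 : ℝ) ≤ d := by exact_mod_cast hd
  set c := min c₀ 1 with hcd
  have hc0 : 0 < c := lt_min hc one_pos
  have hc1 : c ≤ 1 := min_le_right _ _
  set Cg := CG d B with hCg
  have hC : 0 ≤ Cg := by rw [hCg]; unfold CG; positivity
  set η := min (a / 2) (1 / 4) with hηd
  have hη : 0 < η := lt_min (by linarith) (by norm_num)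
  have hηa : η ≤ a / 2 := min_le_left _ _
  have hη1 : η ≤ 1 / 4 := min_le_right _ _
  obtain ⟨R, -, hR, hRx⟩ := low_params (d := d) (a := a) (Cc := 10 * Cg / c) (ω := 1 / 8) hB hηa
    (by positivity) (by norm_num)
  obtain ⟨Z0, hZ0, hZ0x⟩ := dl_small (d := d) (a := a) (c := 4 * Cg) (ω := 1 / 4) hB hηa
    (by norm_num) (by positivity)
  obtain ⟨Z4, hZ4, hZ4x⟩ := rpow_neg_half_small (d := d) (c := d * R) (ω := 1 / 8) (η := η)
    (by norm_num) hη1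
  set ε := c / 16 with hε
  have hε0 : 0 < ε := by positivity
  set K := 1 + Z0 ^ η + Z4 ^ η + 32 * Cg * B * (d - 1) * Z0 ^ η / ε with hKd
  have hd1' : (0 : ℝ) ≤ d - 1 := by linarith
  have q1 : 0 ≤ Z0 ^ η := rpow_nonneg (by linarith) _
  have q2 : 0 ≤ Z4 ^ η := rpow_nonneg (by linarith) _
  have q3 : 0 ≤ 32 * Cg * B * (d - 1) * Z0 ^ η / ε := by positivity
  have hK1 : 1 ≤ K := by linarith
  have hK0 : 0 < K := by linarith
  have hKZ0 : Z0 ^ η ≤ K := by linarith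
  have hKZ4 : Z4 ^ η ≤ K := by linarith
  have hKe : 32 * Cg * B * (d - 1) * Z0 ^ η ≤ ε * K := by
    have : 32 * Cg * B * (d - 1) * Z0 ^ η / ε ≤ K := by linarith
    rw [div_le_iff₀ hε0] at this
    linarith
  set lam0 := √(ε / (4 * Z4 * (2 * d + 1))) with hl0
  have hl0' : 0 < lam0 := sqrt_pos.2 (by positivity)
  have hl02 : lam0 ^ 2 * (2 * d + 1) = ε / 4 / Z4 := by
    rw [hl0, sq_sqrt (by positivity)]; field_simp
  set Cm := 1 + 2 * (Cg * B) with hCm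
  have hCm0 : 0 ≤ Cm := by positivity
  set cw := (K + 1) ^ (-1 / (2 * η)) / 2 with hcw
  have hcw0 : 0 < cw := by positivity
  set M := 8 * Cm + 2 * d ^ 2 * (16 / 3) with hM
  have hM0 : 0 ≤ M := by positivity
  refine ⟨lam0, hl0', (1 + M) * (4 / c) / cw, by positivity,
    fun A hA0 lam hlam hlam1 u K' hK' hu k hk => ?_⟩
  have hA : Coef d a c B A := ⟨hA0.symm, fun x ξ => le_trans
    (mul_le_mul_of_nonneg_right (min_le_left _ _) (sum_nonneg fun i _ => sq_nonneg _))
    (hA0.ell x ξ), hA0.dec0, hA0.dec1, hA0.dec2⟩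
  have hlam2 : lam ^ 2 * (2 * d + 1) ≤ ε / 4 / Z4 := by
    rw [← hl02]; gcongr
  set β := (bt K hK0 η : Sm (E d)) with hβd
  set θ := (th K hK0 η : Sm (E d)) with hθd
  set χ := (th R hR 1 : Sm (E d)) with hχd
  have hsen := sen_zero_off lam hK' hu
  have hHop := Hop_zero_off (A := A) lam hK' hu
  set w : Sm (E d) := β * (1 - θ) with hw
  have hwa : ∀ x, w x = β x * (1 - θ x) := fun x => by simp [hw]
  set Hd := dv (fun i => (w * zp (-1)) * X i * u ^ 2) with hHd
  have hHda := fun x => dv_radial_sq (pd_weight hK0 hη (d := d)) u x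
  have hHdi : ∫ x, Hd x = 0 := integral_dv_eq_zero hK' fun i x hx => by simp [hu x hx]
  have hHdz : ∀ x ∉ K', Hd x = 0 := fun x hx => by
    rw [hHd, hw, hHda, hu x hx]; simp
  have iHd : Integrable Hd := Sm.integrable hK' hHdz
  have iS : Integrable fun x => w x * sen lam u x :=
    Sm.integrable (f := w * sen lam u) hK' fun x hx => by simp [hsen x hx]
  have key := multiplier_integral (A := A) hA.symm (fun i => (β * χ) * NN A i) 0
    (algebraMap ℝ _ (lam ^ 2)) (qhf K hK0 η 0) u hK' hu
    (H := fun x => c / 4 * (w x * sen lam u x) - ε * Hd x)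
    ((iS.const_mul _).sub (iHd.const_mul _)) (fun x => by
      have g := hA.geo hd1 ha hB x
      have gr := hA.grd hd1 ha hB u x
      have hz := zz_pos x
      have hz1 := one_le_zz x
      have hθ0 := th_nonneg hK0 η x
      have hθ1 := (th_lt_one hK0 η x).le
      have hχ0 := th_nonneg hR 1 x
      have hχ1 := (th_lt_one hR 1 x).le
      have hb := (bt_pos hK0 η x).le
      have hη2 := half_rpow_le hK0 hK1 hη.le x
      have hδ0 := dl_nonneg (a := a) hB x
      have hδB := dl_le ha hB x
      have hz0 : 0 ≤ zz x ^ (-η) := rpow_nonneg hz.le _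
      have hs1 : 10 * (Cg * dl a B x / c) * χ x ≤ (1 - θ x) / 4 := by
        have e := hRx x
        have : 10 * (Cg * dl a B x / c) * χ x = 10 * Cg / c * dl a B x * χ x := by ring
        rw [this]; linarith
      have hs2 : 3 * (Cg * dl a B x) * χ x ≤ (1 - θ x) / 4 := by
        refine le_trans (mul_le_mul_of_nonneg_right ?_ hχ0) hs1
        have e0 : 0 ≤ Cg * dl a B x := mul_nonneg hC hδ0
        have : Cg * dl a B x ≤ Cg * dl a B x / c := by
          rw [le_div_iff₀ hc0]; nlinarith only [e0, hc1]
        linarith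
      have f1 := low_form_lower hd g gr hc0 hc1 hC hb hθ0 hθ1 hχ0 hχ1 rfl hs1
      have f2 := low_zero_lower hd g hC hθ0 hθ1 hη.le hη1
      have f3 := low_freq_lower hd g hC hθ0 hθ1 hχ0 hχ1 rfl hs2
      have f4 := hardy_pointwise hd (u := u) (x := x) (w := w x)
        (by rw [hwa]; exact mul_nonneg hb (by linarith)) hθ0 hη.le hη1 rfl
      have h1 : θ x * (1 - θ x) - ε / 4 * (1 - θ x)
          ≤ (d - 1) * θ x * (1 - θ x - 4 * (Cg * dl a B x)) := by
        have e4 : 0 ≤ θ x * (1 - θ x) := mul_nonneg hθ0 (by linarith)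
        have e5 : 0 ≤ ε / 4 * (1 - θ x) := mul_nonneg (by positivity) (by linarith)
        rcases le_or_gt Z0 (zz x) with h | h
        · have e1 := hZ0x x h
          have e2 : (1 - θ x) / 2 ≤ 1 - θ x - 4 * (Cg * dl a B x) := by linarith
          have e3 := mul_le_mul_of_nonneg_left e2 (mul_nonneg hd1' hθ0)
          have e6 := mul_le_mul_of_nonneg_left (show (2 : ℝ) ≤ d - 1 by linarith) e4
          linarith only [e3, e4, e5, e6]
        · have e1 := half_le_of_le hK0 hη.le hKZ0 h.le
          have e2 : θ x ≤ Z0 ^ η / K := by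
            rw [hθd, th_apply]
            have : zz x ^ η ≤ Z0 ^ η := rpow_le_rpow hz.le h.le hη.le
            have h0 : 0 ≤ zz x ^ η := rpow_nonneg hz.le _
            gcongr
            linarith
          have e3 : (d - 1) * θ x * (4 * (Cg * dl a B x)) ≤ ε / 8 := by
            calc (d - 1) * θ x * (4 * (Cg * dl a B x))
                ≤ (d - 1) * (Z0 ^ η / K) * (4 * (Cg * B)) := by gcongr
              _ = 32 * Cg * B * (d - 1) * Z0 ^ η / K / 8 := by ring
              _ ≤ ε / 8 := by
                gcongr
                rwa [div_le_iff₀ hK0]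
          have e6 := mul_le_mul_of_nonneg_left (show (1 : ℝ) ≤ d - 1 by linarith) e4
          have e7 : ε / 4 * (1 / 2) ≤ ε / 4 * (1 - θ x) :=
            mul_le_mul_of_nonneg_left e1 (by positivity)
          linarith only [e3, e6, e7]
      have h2 : c / 4 * lam ^ 2 * (1 - θ x) - ε / 2 * ((1 - θ x) / zz x)
          ≤ 2 * lam ^ 2 * (3 / 4 * (1 - θ x) - d * (1 - χ x)) := by
        have e0 : 0 ≤ lam ^ 2 * (1 - θ x) := mul_nonneg (sq_nonneg _) (by linarith)
        rcases le_or_gt Z4 (zz x) with h | h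
        · have e1 := hZ4x x h
          have e2 : d * (1 - χ x) ≤ (1 - θ x) / 4 := by
            have e3 : 1 - χ x ≤ R * (zz x)⁻¹ := by
              rw [hχd, one_sub_th, rpow_one, div_eq_mul_inv]
              gcongr
              linarith
            have e4 := mul_le_mul_of_nonneg_left e3 (show (0 : ℝ) ≤ d by positivity)
            linarith
          have e3 := mul_le_mul_of_nonneg_left e2 (sq_nonneg lam)
          have e4 : 0 ≤ ε / 2 * ((1 - θ x) / zz x) :=
            mul_nonneg (by positivity) (div_nonneg (by linarith) hz.le)
          nlinarith only [e0, e3, e4, hc1]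
        · have e1 := half_le_of_le hK0 hη.le hKZ4 h.le
          have e2 : ε / 4 / Z4 ≤ ε / 2 * ((1 - θ x) / zz x) := by
            rw [div_div, div_le_iff₀ (by positivity)]
            have : 1 / 2 * 1 ≤ (1 - θ x) * (Z4 / zz x) :=
              mul_le_mul e1 ((one_le_div hz).2 h.le) zero_le_one (by linarith)
            calc ε = ε * 2 * (1 / 2 * 1) := by ring
              _ ≤ ε * 2 * ((1 - θ x) * (Z4 / zz x)) := by gcongr
              _ = _ := by ring
          have e3 : 0 ≤ d * χ x * lam ^ 2 := by positivity
          have e4 : lam ^ 2 * (1 - θ x) * c ≤ lam ^ 2 * (1 - θ x) * 1 :=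
            mul_le_mul_of_nonneg_left hc1 e0
          have e5 := sq_nonneg lam
          linarith only [e2, e3, e4, e5, hlam2, e0]
      have h3 := h2.trans (mul_le_mul_of_nonneg_left f3 (by positivity))
      have h4 := low_combine hε hc0 hc1 hb hz hθ0 hθ1 gr.Q_lo (sq_nonneg (u x))
        (h1.trans f2) h3
      have f5 : w x / zz x * (3 / 4 - 3 / 2 * θ x) * u x ^ 2 - 4 * w x * gsq u x ≤ Hd x := by
        rw [hHd, hw, hHda]
        refine f4.trans (le_of_eq ?_)
        simp only [hw, Sm.mul_apply, Sm.sub_apply, Sm.one_apply, Sm.neg_apply, Sm.add_apply,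
          Sm.smul_apply, Sm.pow_apply, Sm.ofNat_apply, zp_neg_one_apply]
        rw [hβd, hθd]
        ring
      have f6 := mul_le_mul_of_nonneg_left f5 hε0.le
      rw [Gform_radial_apply hA.symm _ _ (pd_low hK0 hη hR) (ζ := 0) (by simp),
        Zcoef_radial _ (pd_low hK0 hη hR) (ζ := 0) (ζ1 := 0) (ζ2 := 0) (by simp) (by simp)
          (by simp) (pd_qhf hK0 hη 0) (pd_q1hf hK0 hη 0)]
      have h5 : c / 4 * (w x * sen lam u x) - ε * Hd x
          ≤ c / 4 * (β x * (1 - θ x) * (gsq u x + lam ^ 2 * u x ^ 2))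
            - ε * (β x * (1 - θ x) / zz x * (3 / 4 - 3 / 2 * θ x) * u x ^ 2
              - 4 * (β x * (1 - θ x)) * gsq u x) := by
        rw [← hwa, ← sen_apply]
        linarith only [f6]
      refine h5.trans (h4.trans ?_)
      have f7 := mul_le_mul_of_nonneg_left f1 (zero_le_two (α := ℝ))
      refine (add_le_add_left f7 _).trans (le_of_eq ?_)
      simp only [Sm.mul_apply, Sm.sub_apply, Sm.one_apply, Sm.neg_apply, Sm.add_apply,
          Sm.smul_apply, Sm.pow_apply, Sm.ofNat_apply, zp_neg_one_apply, Sm.zero_apply, qhf, q1hf,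
          q2hf, Sm.algebraMap_apply, hβd, hθd, hχd]
      ring)
  rw [integral_sub (iS.const_mul _) (iHd.const_mul _), integral_const_mul, integral_const_mul,
    hHdi, mul_zero, sub_zero] at key
  have iF : Integrable fun x => Hop A lam u x ^ 2 :=
    Sm.integrable (f := Hop A lam u ^ 2) hK' fun x hx => by simp [hHop x hx]
  have ig : Integrable (gsq u) := Sm.integrable hK' (gsq_zero_off hK' hu)
  have iu : Integrable fun x => u x ^ 2 / zz x :=
    (Sm.integrable (f := u ^ 2 * zp (-1)) hK' fun x hx => by simp [hu x hx]).congr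
      (Eventually.of_forall fun x => by simp [rpow_neg_one, div_eq_mul_inv])
  have isn : Integrable (sen lam u) := Sm.integrable hK' hsen
  have hup : ∫ x, -(2 * (Pconj A 0 (algebraMap ℝ _ (lam ^ 2)) u x
        * (2 * vf (fun i => β * χ * NN A i) u x + qhf K hK0 η 0 x * u x)))
      ≤ k⁻¹ * (∫ x, Hop A lam u x ^ 2)
        + k * (8 * Cm * (∫ x, gsq u x) + 2 * d ^ 2 * ∫ x, u x ^ 2 / zz x) := by
    have i1 : Integrable fun x => k⁻¹ * Hop A lam u x ^ 2 := iF.const_mul _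
    have i2 : Integrable fun x => 8 * Cm * gsq u x := ig.const_mul _
    have i3 : Integrable fun x => 2 * (d : ℝ) ^ 2 * (u x ^ 2 / zz x) := iu.const_mul _
    have i4 : Integrable fun x => k * (8 * Cm * gsq u x + 2 * (d : ℝ) ^ 2 * (u x ^ 2 / zz x)) :=
      (i2.add i3).const_mul _
    have e0 : ∫ x, (k⁻¹ * Hop A lam u x ^ 2
        + k * (8 * Cm * gsq u x + 2 * (d : ℝ) ^ 2 * (u x ^ 2 / zz x)))
        = k⁻¹ * (∫ x, Hop A lam u x ^ 2)
          + k * (8 * Cm * (∫ x, gsq u x) + 2 * d ^ 2 * ∫ x, u x ^ 2 / zz x) := by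
      rw [integral_add i1 i4, integral_const_mul, integral_const_mul, integral_add i2 i3,
        integral_const_mul, integral_const_mul]
    rw [← e0]
    refine integral_mono ?_ (i1.add i4) fun x => ?_
    · refine Sm.integrable (f := -(2 * (Pconj A 0 (algebraMap ℝ _ (lam ^ 2)) u
        * (2 * vf (fun i => β * χ * NN A i) u + qhf K hK0 η 0 * u)))) hK' fun x hx => ?_
      rw [Pconj_zero]
      simp [hHop x hx]
    · rw [Pconj_zero]
      refine (cross_le hk).trans ?_
      have gr := hA.grd hd1 ha hB u x
      have e1 := gr.Nv_sq_le hC (dl_le ha hB x)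
      have hz := zz_pos x
      have hzx := zz_apply x
      have hb := (bt_pos hK0 η x).le
      have hχ0 := th_nonneg hR 1 x
      have hχ1 := (th_lt_one hR 1 x).le
      have hb2 : β x ^ 2 ≤ (zz x)⁻¹ := by
        have := pow_le_pow_left₀ hb (bt_le_rpow hK0 hη x) 2
        rwa [← rpow_natCast, ← rpow_natCast, ← rpow_mul hz.le,
          show (-(1 / 2) : ℝ) * (2 : ℕ) = -1 by norm_num, rpow_neg_one, rpow_natCast] at this
      have e2 : (β x * χ x * vf (NN A) u x) ^ 2 ≤ Cm * gsq u x := by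
        have t1 : (β x * χ x) ^ 2 ≤ (zz x)⁻¹ := by
          rw [mul_pow]
          have : χ x ^ 2 ≤ 1 := pow_le_one₀ hχ0 hχ1
          exact (mul_le_of_le_one_right (sq_nonneg _) this).trans hb2
        calc (β x * χ x * vf (NN A) u x) ^ 2 = (β x * χ x) ^ 2 * vf (NN A) u x ^ 2 := by ring
          _ ≤ (zz x)⁻¹ * (‖x‖ ^ 2 * (Cm * gsq u x)) :=
            mul_le_mul t1 e1 (sq_nonneg _) (inv_nonneg.2 hz.le)
          _ = (‖x‖ ^ 2 * (zz x)⁻¹) * (Cm * gsq u x) := by ring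
          _ ≤ 1 * (Cm * gsq u x) := by
            refine mul_le_mul_of_nonneg_right ?_ (mul_nonneg hCm0 (gsq_nonneg u x))
            rw [← div_eq_mul_inv, div_le_one hz, hzx]; linarith
          _ = _ := one_mul _
      have e3 : (qhf K hK0 η 0 x * u x) ^ 2 ≤ d ^ 2 * (u x ^ 2 / zz x) := by
        have : qhf K hK0 η 0 x = β x * (d - 1) := by simp [qhf, hβd]
        rw [this]
        have t1 : ((d : ℝ) - 1) ^ 2 ≤ d ^ 2 := pow_le_pow_left₀ hd1' (by linarith) 2
        calc (β x * (d - 1) * u x) ^ 2 = β x ^ 2 * (d - 1) ^ 2 * u x ^ 2 := by ring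
          _ ≤ (zz x)⁻¹ * d ^ 2 * u x ^ 2 := by gcongr
          _ = _ := by ring
      refine add_le_add le_rfl (mul_le_mul_of_nonneg_left ?_ hk.le)
      have e4 : vf (fun i => β * χ * NN A i) u x = β x * χ x * vf (NN A) u x := by
        rw [vf_smul_left]; rfl
      rw [e4]
      nlinarith only [e2, e3, sq_nonneg (2 * (β x * χ x * vf (NN A) u x) - qhf K hK0 η 0 x * u x)]
  have hhar := hardy hd hK' hu
  have hgs : ∫ x, gsq u x ≤ ∫ x, sen lam u x := integral_mono ig isn fun x => by
    rw [sen_apply]; have := mul_nonneg (sq_nonneg lam) (sq_nonneg (u x)); linarith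
  rw [integral_add (iF.const_mul _) (isn.const_mul _), integral_const_mul, integral_const_mul]
  set I1 := ∫ x, Hop A lam u x ^ 2
  set I2 := ∫ x, sen lam u x
  set I3 := ∫ x, gsq u x
  have hI1 : 0 ≤ I1 := integral_nonneg fun x => sq_nonneg _
  have hI2 : 0 ≤ I2 := integral_nonneg fun x => sen_nonneg lam u x
  have s1 : c / 4 * (∫ x, w x * sen lam u x) ≤ (1 + M) * (k⁻¹ * I1 + k * I2) := by
    refine key.trans (hup.trans ?_)
    have t1 : 8 * Cm * I3 + 2 * d ^ 2 * (∫ x, u x ^ 2 / zz x) ≤ M * I2 := by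
      have e1 := mul_le_mul_of_nonneg_left hhar (show (0 : ℝ) ≤ 2 * d ^ 2 by positivity)
      have e2 := mul_le_mul_of_nonneg_left hgs hM0
      rw [hM] at e2 ⊢
      linarith only [e1, e2]
    have t2 := mul_le_mul_of_nonneg_left t1 hk.le
    have t3 : 0 ≤ M * (k⁻¹ * I1) := by positivity
    have t4 : 0 ≤ k * I2 := by positivity
    linarith only [t2, t3, t4]
  have s2 : cw * (∫ x, zz x ^ (-(1 + a) / 2) * sen lam u x) ≤ ∫ x, w x * sen lam u x := by
    rw [← integral_const_mul]
    have i2 : Integrable fun x => zz x ^ (-(1 + a) / 2) * sen lam u x :=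
      (Sm.integrable (f := zp (-(1 + a) / 2) * sen lam u) hK' fun x hx => by
        simp [hsen x hx]).congr (Eventually.of_forall fun x => by simp [zp_apply])
    refine integral_mono (i2.const_mul _) iS fun x => ?_
    have hz := zz_pos x
    have h1 : zz x ^ (-(1 + a) / 2) ≤ zz x ^ (-(1 / 2) : ℝ) * zz x ^ (-η) := by
      rw [← rpow_add hz]
      exact rpow_le_rpow_of_exponent_le (one_le_zz x) (by linarith)
    have h2 : cw * zz x ^ (-(1 + a) / 2) ≤ w x := by
      rw [hwa]
      calc cw * zz x ^ (-(1 + a) / 2) ≤ cw * (zz x ^ (-(1 / 2) : ℝ) * zz x ^ (-η)) := by gcongr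
        _ = ((K + 1) ^ (-1 / (2 * η)) * zz x ^ (-(1 / 2) : ℝ)) * (zz x ^ (-η) / 2) := by
          rw [hcw]; ring
        _ ≤ _ := mul_le_mul (le_bt hK0 hη x) (half_rpow_le hK0 hK1 hη.le x) (by positivity)
          (bt_pos hK0 η x).le
    have := mul_le_mul_of_nonneg_right h2 (sen_nonneg lam u x)
    simpa only [mul_assoc] using this
  rw [div_mul_eq_mul_div, le_div_iff₀ hcw0]
  have s3 := mul_le_mul_of_nonneg_left s2 (show 0 ≤ c / 4 by positivity)
  have s4 := mul_le_mul_of_nonneg_left (s3.trans s1) (show 0 ≤ 4 / c by positivity)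
  have e : 4 / c * (c / 4 * (cw * ∫ x, zz x ^ (-(1 + a) / 2) * sen lam u x))
      = (∫ x, zz x ^ (-(1 + a) / 2) * sen lam u x) * cw := by field_simp
  rw [e] at s4
  linarith only [s4]

/-- The resolvent estimate, with exponential loss in the frequency. -/
theorem resolvent_estimate (hd : 3 ≤ d) (ha : 0 < a) (hc : 0 < c₀)
    (hB : 0 ≤ B) {p : E d} (hp : ‖p‖ = 1) (A : Fin d → Fin d → Sm (E d))
    (hA : Coef d a c₀ B A) (hA' : Coef d a c₀ B fun i j => Tr p (A i j)) :
    ∃ C ≥ 0, ∀ lam ≥ 0, ∀ (u : Sm (E d)) (K : Set (E d)), IsCompact K →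
      (∀ x ∉ K, u x = 0) → ∀ k > 0,
      ∫ x, zz x ^ (-(1 + a) / 2) * sen lam u x
        ≤ C * exp (C * lam) * ∫ x, (k⁻¹ * Hop A lam u x ^ 2 + k * sen lam u x) := by
  obtain ⟨lam0, hl0, C1, hC1, h1⟩ := low_frequency hd ha hc hB
  obtain ⟨C2, hC2, h2⟩ := high_frequency (by omega) ha hc hB hl0 hp A hA hA'
  refine ⟨C1 + C2, by positivity, fun lam hlam u K hK hu k hk => ?_⟩
  have h0 : 0 ≤ ∫ x, (k⁻¹ * Hop A lam u x ^ 2 + k * sen lam u x) := integral_nonneg fun x =>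
    add_nonneg (by positivity) (mul_nonneg hk.le (sen_nonneg lam u x))
  rcases le_total lam lam0 with h | h
  · refine (h1 A hA lam hlam h u K hK hu k hk).trans (mul_le_mul_of_nonneg_right ?_ h0)
    have : 1 ≤ exp ((C1 + C2) * lam) := one_le_exp (by positivity)
    nlinarith only [this, hC1, hC2]
  · refine (h2 lam h u K hK hu k hk).trans (mul_le_mul_of_nonneg_right ?_ h0)
    have h3 : exp (C2 * lam) ≤ exp ((C1 + C2) * lam) := exp_le_exp.2 (by nlinarith)
    have h4 := exp_pos (C2 * lam)
    exact mul_le_mul (by linarith) h3 h4.le (by linarith)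

theorem Coef.mono {B' : ℝ} (h : Coef d a c₀ B A)
    (hB : B ≤ B') : Coef d a c₀ B' A :=
  have hz := fun x => mul_le_mul_of_nonneg_right hB
    (rpow_nonneg (zz_pos (d := d) x).le (-(1 + a) / 2))
  ⟨h.symm, h.ell, fun i j x => (h.dec0 i j x).trans (hz x),
    fun i j k x => (h.dec1 i j k x).trans (hz x), fun i j k l x => (h.dec2 i j k l x).trans (hz x)⟩

theorem zz_le_translate {p : E d} (hp : ‖p‖ = 1) (x : E d) : zz x ≤ 4 * zz (x + p) := by
  have h : ‖x‖ ≤ ‖x + p‖ + 1 := by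
    have := norm_sub_le (x + p) p
    rwa [add_sub_cancel_right, hp] at this
  have h0 := norm_nonneg x
  rw [zz_apply, zz_apply]
  nlinarith [sq_nonneg (‖x + p‖ - 1)]

theorem Coef.translate (ha : 0 < a) (hB : 0 ≤ B)
    (h : Coef d a c₀ B A) {p : E d} (hp : ‖p‖ = 1) :
    Coef d a c₀ (4 * 4 ^ ((1 + a) / 2) * B) fun i j => Tr p (A i j) := by
  have hz : ∀ x : E d, zz (x + p) ^ (-(1 + a) / 2)
      ≤ 4 ^ ((1 + a) / 2) * zz x ^ (-(1 + a) / 2) := fun x => by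
    have h1 := rpow_le_rpow (zz_pos x).le (zz_le_translate hp x)
      (show 0 ≤ (1 + a) / 2 by linarith)
    rw [mul_rpow (by norm_num) (zz_pos _).le] at h1
    rw [neg_div, rpow_neg (zz_pos _).le, rpow_neg (zz_pos _).le, ← div_eq_mul_inv,
      inv_eq_one_div, div_le_div_iff₀ (rpow_pos_of_pos (zz_pos _) _)
        (rpow_pos_of_pos (zz_pos _) _), one_mul]
    exact h1
  have hn : ∀ x : E d, 0 ≤ 4 ^ ((1 + a) / 2) * zz x ^ (-(1 + a) / 2) := fun x =>
    mul_nonneg (by positivity) (rpow_nonneg (zz_pos x).le _)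
  have key : ∀ (q : ℝ) (x : E d), |q| ≤ B * zz (x + p) ^ (-(1 + a) / 2) →
      4 * |q| ≤ 4 * 4 ^ ((1 + a) / 2) * B * zz x ^ (-(1 + a) / 2) := fun q x hq => by
    have := mul_le_mul_of_nonneg_left (hz x) hB
    linarith
  refine ⟨fun i j => by rw [h.symm], fun x ξ => h.ell _ _, fun i j x => ?_, fun i j k x => ?_,
    fun i j k l x => ?_⟩
  · have := key _ x (h.dec0 i j (x + p))
    have h0 := abs_nonneg (A i j (x + p) - if i = j then 1 else 0)
    simp only [Tr_apply]
    linarith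
  · have h1 : |pd k (A i j) (x + p) * √(zz (x + p))| ≤ B * zz (x + p) ^ (-(1 + a) / 2) := by
      rw [abs_mul, abs_of_nonneg (sqrt_nonneg _)]; exact h.dec1 i j k _
    refine le_trans ?_ (key _ x h1)
    rw [pd_Tr, Tr_apply, abs_mul, abs_of_nonneg (sqrt_nonneg _)]
    have h2 : √(zz x) ≤ 2 * √(zz (x + p)) := by
      rw [show (2 : ℝ) = √4 by rw [show (4 : ℝ) = 2 ^ 2 by norm_num]; simp,
        ← sqrt_mul (by norm_num)]
      exact sqrt_le_sqrt (zz_le_translate hp x)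
    have := mul_le_mul_of_nonneg_left h2 (abs_nonneg (pd k (A i j) (x + p)))
    have h3 := mul_nonneg (abs_nonneg (pd k (A i j) (x + p))) (sqrt_nonneg (zz (x + p)))
    linarith
  · have h1 : |pd l (pd k (A i j)) (x + p) * zz (x + p)| ≤ B * zz (x + p) ^ (-(1 + a) / 2) := by
      rw [abs_mul, abs_of_nonneg (zz_pos _).le]; exact h.dec2 i j k l _
    refine le_trans ?_ (key _ x h1)
    rw [pd_Tr, pd_Tr, Tr_apply, abs_mul, abs_of_nonneg (zz_pos _).le]
    have := mul_le_mul_of_nonneg_left (zz_le_translate hp x)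
      (abs_nonneg (pd l (pd k (A i j)) (x + p)))
    linarith

/-- Uniform ellipticity of a continuous positive definite matrix tending to the identity. -/
theorem exists_elliptic {A : Fin d → Fin d → E d → ℝ} (hd : 0 < d)
    (hA : ∀ i j, Continuous (A i j))
    (hA_pos : ∀ (x : E d) (v : Fin d → ℝ), v ≠ 0 → 0 < ∑ i, ∑ j, A i j x * v i * v j)
    (hρ : ∀ i j x, ρ < ‖x‖ → |A i j x - if i = j then 1 else 0| ≤ 1 / (2 * d)) :
    ∃ c > 0, ∀ x (ξ : Fin d → ℝ), c * ∑ i, ξ i ^ 2 ≤ ∑ i, ∑ j, A i j x * ξ i * ξ j := by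
  have hd' : (0 : ℝ) < d := by exact_mod_cast hd
  set S : Set (E d) := Metric.sphere 0 1
  set F : E d × E d → ℝ := fun q => ∑ i, ∑ j, A i j q.1 * q.2 i * q.2 j with hF
  have hFc : Continuous F := by
    refine continuous_finset_sum _ fun i _ => continuous_finset_sum _ fun j _ => ?_
    exact (((hA i j).comp continuous_fst).mul
      ((EuclideanSpace.proj (𝕜 := ℝ) i).continuous.comp continuous_snd)).mul
        ((EuclideanSpace.proj (𝕜 := ℝ) j).continuous.comp continuous_snd)
  have hK : IsCompact (Metric.closedBall (0 : E d) (max ρ 0) ×ˢ S) :=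
    (isCompact_closedBall _ _).prod (isCompact_sphere _ _)
  have hne : (Metric.closedBall (0 : E d) (max ρ 0) ×ˢ S).Nonempty :=
    ⟨(0, EuclideanSpace.single ⟨0, hd⟩ 1), by simp, by simp [S]⟩
  obtain ⟨q, hq, hmin⟩ := hK.exists_isMinOn hne hFc.continuousOn
  have hq0 : 0 < F q := hA_pos _ _ fun h => by
    have h1 : q.2 = 0 := by ext i; exact congrFun h i
    have := hq.2
    simp [S, h1] at this
  refine ⟨min (F q) (1 / 2), lt_min hq0 (by norm_num), fun x ξ => ?_⟩
  have hs : 0 ≤ ∑ i, ξ i ^ 2 := sum_nonneg fun i _ => sq_nonneg _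
  rcases le_or_gt ‖x‖ ρ with h | h
  · rcases eq_or_ne ξ 0 with rfl | hξ
    · simp
    set v : E d := WithLp.toLp 2 ξ with hv
    have hv2 : ∑ i, ξ i ^ 2 = ‖v‖ ^ 2 := by rw [EuclideanSpace.real_norm_sq_eq]
    have hv0 : 0 < ‖v‖ := norm_pos_iff.2 fun h => hξ (by
      funext i; have := congrArg (fun w : E d => w i) h; simpa [hv] using this)
    have hm := hmin (show (x, ‖v‖⁻¹ • v) ∈ _ from ⟨by simp [h], by
      simp [S, norm_smul, hv0.ne']⟩)
    have e : F (x, ‖v‖⁻¹ • v) = (∑ i, ∑ j, A i j x * ξ i * ξ j) / ‖v‖ ^ 2 := by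
      simp only [hF, Finset.sum_div]
      refine sum_congr rfl fun i _ => sum_congr rfl fun j _ => ?_
      simp only [PiLp.smul_apply, smul_eq_mul, hv]
      field_simp
    have hm' : F q ≤ F (x, ‖v‖⁻¹ • v) := hm
    rw [e, le_div_iff₀ (by positivity), ← hv2] at hm'
    exact (mul_le_mul_of_nonneg_right (min_le_left _ _) hs).trans hm'
  · have h1 : |∑ i, ∑ j, (A i j x - if i = j then 1 else 0) * ξ i * ξ j|
        ≤ 1 / 2 * ∑ i, ξ i ^ 2 := by
      calc |∑ i, ∑ j, (A i j x - if i = j then 1 else 0) * ξ i * ξ j|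
          ≤ ∑ i, ∑ j, |(A i j x - if i = j then 1 else 0) * ξ i * ξ j| :=
            (Finset.abs_sum_le_sum_abs _ _).trans
              (sum_le_sum fun i _ => Finset.abs_sum_le_sum_abs _ _)
        _ ≤ ∑ i, ∑ j, 1 / (2 * d) * ((ξ i ^ 2 + ξ j ^ 2) / 2) := by
            refine sum_le_sum fun i _ => sum_le_sum fun j _ => ?_
            rw [mul_assoc, abs_mul]
            refine mul_le_mul (hρ i j x h) ?_ (abs_nonneg _) (by positivity)
            rw [abs_le]
            constructor <;> nlinarith [sq_nonneg (ξ i - ξ j), sq_nonneg (ξ i + ξ j)]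
        _ = _ := by
            simp only [← mul_sum, add_div, sum_add_distrib, Finset.sum_const,
              Finset.card_univ, Fintype.card_fin, nsmul_eq_mul]
            simp only [← Finset.sum_div]
            field_simp
            ring
    have h2 : ∑ i, ∑ j, A i j x * ξ i * ξ j
        = ∑ i, ξ i ^ 2 + ∑ i, ∑ j, (A i j x - if i = j then 1 else 0) * ξ i * ξ j := by
      rw [← sum_add_distrib]
      refine sum_congr rfl fun i _ => ?_
      simp [sub_mul, sum_sub_distrib, sq]
    rw [h2]
    have h3 := (abs_le.1 h1).1
    have h4 := mul_le_mul_of_nonneg_right (min_le_right (F q) (1 / 2)) hs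
    linarith

theorem Coef.of_decay (hd : 0 < d) (ha : 0 < a) (hA_symm : ∀ i j x, A i j x = A j i x)
    (hA_pos : ∀ (x : E d) (v : Fin d → ℝ), v ≠ 0 → 0 < ∑ i, ∑ j, A i j x * v i * v j)
    (hB : 0 < B) (hdec : ∀ i j, ∀ k : ℕ, k ≤ 4 → ∀ x : E d,
      ‖iteratedFDeriv ℝ k (fun y => A i j y - if i = j then (1 : ℝ) else 0) x‖
        ≤ B * (1 + ‖x‖) ^ (-1 - a - (k : ℝ))) :
    ∃ c₀ > 0, Coef d a c₀ B A := by
  have hd' : (0 : ℝ) < d := by exact_mod_cast hd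
  have hz : ∀ (k : ℕ) (x : E d), (1 + ‖x‖) ^ (-1 - a - (k : ℝ)) * √(zz x) ^ k
      ≤ zz x ^ (-(1 + a) / 2) := fun k x => by
    have h0 : 0 < √(zz x) := sqrt_pos.2 (zz_pos x)
    have h1 : √(zz x) ≤ 1 + ‖x‖ := by
      rw [sqrt_le_left (by positivity), zz_apply]; nlinarith [norm_nonneg x]
    calc (1 + ‖x‖) ^ (-1 - a - (k : ℝ)) * √(zz x) ^ k
        ≤ √(zz x) ^ (-1 - a - (k : ℝ)) * √(zz x) ^ k := by
          refine mul_le_mul_of_nonneg_right ?_ (by positivity)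
          exact rpow_le_rpow_of_nonpos h0 h1 (by
            have : (0 : ℝ) ≤ k := Nat.cast_nonneg k
            linarith)
      _ = √(zz x) ^ (-(1 + a)) := by
          rw [← rpow_natCast, ← rpow_add h0]; ring_nf
      _ = _ := by
          rw [sqrt_eq_rpow, ← rpow_mul (zz_pos x).le]; ring_nf
  set g : Fin d → Fin d → Sm (E d) := fun i j => A i j - algebraMap ℝ _ (if i = j then 1 else 0)
    with hg
  have hgd : ∀ i j v, D v (g i j) = D v (A i j) := fun i j v => by
    simp only [hg, map_sub, D_algebraMap, sub_zero]
  have hk : ∀ i j, ∀ k : ℕ, k ≤ 4 → ∀ x : E d,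
      ‖iteratedFDeriv ℝ k (g i j) x‖ * √(zz x) ^ k ≤ B * zz x ^ (-(1 + a) / 2) :=
    fun i j k hk x => by
      have h1 := mul_le_mul_of_nonneg_right (hdec i j k hk x)
        (pow_nonneg (sqrt_nonneg (zz x)) k)
      have h2 := mul_le_mul_of_nonneg_left (hz k x) hB.le
      rw [mul_assoc] at h1
      exact h1.trans h2
  have dec0 : ∀ i j x, |A i j x - if i = j then 1 else 0| ≤ B * (zz x) ^ (-(1 + a) / 2) :=
    fun i j x => by
      have := hk i j 0 (by norm_num) x
      rw [norm_iteratedFDeriv_zero, pow_zero, mul_one] at this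
      exact this
  have hlim : ∃ ρ : ℝ, ∀ x : E d, ρ < ‖x‖ → B * zz x ^ (-(1 + a) / 2) ≤ 1 / (2 * d) := by
    have t1 : Tendsto (fun r : ℝ => B * (1 + r ^ 2) ^ (-(1 + a) / 2)) atTop (nhds (B * 0)) := by
      refine Tendsto.const_mul _ ?_
      have : Tendsto (fun r : ℝ => 1 + r ^ 2) atTop atTop :=
        tendsto_atTop_add_const_left _ _ (tendsto_pow_atTop (by norm_num))
      have h2 := (tendsto_rpow_neg_atTop (show 0 < (1 + a) / 2 by linarith)).comp this
      rw [neg_div]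
      exact h2
    rw [mul_zero] at t1
    obtain ⟨ρ, hρ⟩ := eventually_atTop.1 (t1.eventually (gt_mem_nhds
      (show (0 : ℝ) < 1 / (2 * d) by positivity)))
    exact ⟨ρ, fun x hx => by rw [zz_apply]; exact (hρ _ hx.le).le⟩
  obtain ⟨ρ, hρ⟩ := hlim
  obtain ⟨c, hc, hell⟩ := exists_elliptic hd (fun i j => (A i j).continuous) hA_pos
    (fun i j x hx => (dec0 i j x).trans (hρ x hx))
  refine ⟨c, hc, fun i j => Sm.ext fun x => hA_symm i j x, hell, dec0, fun i j k x => ?_,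
    fun i j k l x => ?_⟩
  · refine le_trans ?_ (hk i j 1 (by norm_num) x)
    rw [pow_one]
    refine mul_le_mul_of_nonneg_right ?_ (sqrt_nonneg _)
    rw [pd, ← hgd, D_apply, ← norm_eq_abs, ← norm_iteratedFDeriv_fderiv, norm_iteratedFDeriv_zero]
    refine (ContinuousLinearMap.le_opNorm _ _).trans ?_
    simp
  · refine le_trans ?_ (hk i j 2 (by norm_num) x)
    rw [sq_sqrt (zz_pos x).le]
    refine mul_le_mul_of_nonneg_right ?_ (zz_pos x).le
    have h1 : pd l (pd k (A i j)) x = iteratedFDeriv ℝ 2 (g i j) x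
        ![EuclideanSpace.single l 1, EuclideanSpace.single k 1] := by
      rw [iteratedFDeriv_two_apply, pd, pd, ← hgd, D_apply]
      have h2 : (D (EuclideanSpace.single k 1) (g i j) : E d → ℝ)
          = fun y => fderiv ℝ (g i j) y (EuclideanSpace.single k 1) := rfl
      have h3 : DifferentiableAt ℝ (fderiv ℝ (g i j)) x :=
        ((g i j).smooth.fderiv_right (m := 1) (by norm_cast)).differentiable (by simp) x
      rw [h2, fderiv_clm_apply h3 (differentiableAt_const _)]
      simp
    rw [h1, ← norm_eq_abs]
    refine (ContinuousMultilinearMap.le_opNorm _ _).trans ?_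
    simp

/-- Space-time. -/
abbrev W (d : ℕ) := ℝ × E d

/-- Restriction to a time slice. -/
noncomputable def slice (t : ℝ) : Sm (W d) →ₐ[ℝ] Sm (E d) :=
  Sm.pull (fun x => (t, x)) (contDiff_const.prodMk contDiff_id)

/-- Extension by a function independent of time. -/
noncomputable def lift : Sm (E d) →ₐ[ℝ] Sm (W d) := Sm.pull Prod.snd contDiff_snd

/-- Extension of a function of time. -/
noncomputable def liftT : Sm ℝ →ₐ[ℝ] Sm (W d) := Sm.pull Prod.fst contDiff_fst

/-- The time derivative. -/
noncomputable abbrev Dt : Derivation ℝ (Sm (W d)) (Sm (W d)) := D ((1, 0) : W d)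

/-- The spatial partial derivatives. -/
noncomputable abbrev dx (i : Fin d) : Derivation ℝ (Sm (W d)) (Sm (W d)) :=
  D ((0, EuclideanSpace.single i 1) : W d)

@[simp] theorem slice_apply (t : ℝ) (F : Sm (W d)) (x : E d) : slice t F x = F (t, x) := rfl
@[simp] theorem lift_apply (f : Sm (E d)) (p : W d) : lift f p = f p.2 := rfl
@[simp] theorem liftT_apply (f : Sm ℝ) (p : W d) : liftT f p = f p.1 := rfl
@[simp] theorem slice_lift (t : ℝ) (f : Sm (E d)) : slice t (lift f) = f := rfl
@[simp] theorem slice_liftT (t : ℝ) (f : Sm ℝ) :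
    slice t (liftT f : Sm (W d)) = algebraMap ℝ _ (f t) := rfl

theorem pd_slice (i : Fin d) (t : ℝ) (F : Sm (W d)) : pd i (slice t F) = slice t (dx i F) := by
  ext x
  have h : HasFDerivAt (fun x : E d => (t, x)) (ContinuousLinearMap.inr ℝ ℝ (E d)) x :=
    hasFDerivAt_prodMk_right t x
  rw [slice, D_pull, h.fderiv]
  simp [D_apply]

@[simp] theorem Dt_lift (f : Sm (E d)) : Dt (lift f) = 0 := by
  ext x
  rw [lift, D_pull]
  simp [fderiv_snd]

@[simp] theorem dx_lift (i : Fin d) (f : Sm (E d)) : dx i (lift f) = lift (pd i f) := by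
  ext x
  rw [lift, D_pull]
  simp [fderiv_snd, D_apply]

@[simp] theorem Dt_liftT (f : Sm ℝ) : Dt (liftT f : Sm (W d)) = liftT (D 1 f) := by
  ext x
  rw [liftT, D_pull]
  simp [fderiv_fst, D_apply]

@[simp] theorem dx_liftT (i : Fin d) (f : Sm ℝ) : dx i (liftT f) = 0 := by
  ext x
  rw [liftT, D_pull]
  simp [fderiv_fst]

theorem hasDerivAt_slice (F : Sm (W d)) (t : ℝ) (x : E d) :
    HasDerivAt (fun s => F (s, x)) (Dt F (t, x)) t := by
  have h : HasFDerivAt (fun s : ℝ => (s, x)) (ContinuousLinearMap.inl ℝ ℝ (E d)) t :=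
    hasFDerivAt_prodMk_left t x
  have := ((F.differentiable (t, x)).hasFDerivAt.comp t h).hasDerivAt
  have e : (fderiv ℝ F (t, x) ∘L ContinuousLinearMap.inl ℝ ℝ (E d)) 1 = Dt F (t, x) := by
    simp [D_apply]
  rw [e] at this
  exact this

/-- The support in space is compact, locally uniformly in time. -/
def LS (F : Sm (W d)) : Prop :=
  ∀ T : ℝ, ∃ K : Set (E d), IsCompact K ∧ ∀ t, |t| ≤ T → ∀ x ∉ K, F (t, x) = 0

theorem LS.mul_left {F : Sm (W d)} (h : LS F) (G : Sm (W d)) : LS (G * F) := fun T => by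
  obtain ⟨K, hK, h⟩ := h T
  exact ⟨K, hK, fun t ht x hx => by simp [h t ht x hx]⟩

theorem LS.mul_right {F : Sm (W d)} (h : LS F) (G : Sm (W d)) : LS (F * G) := by
  rw [mul_comm]; exact h.mul_left G

theorem LS.add {F G : Sm (W d)} (h : LS F) (h' : LS G) : LS (F + G) := fun T => by
  obtain ⟨K, hK, h⟩ := h T
  obtain ⟨K', hK', h'⟩ := h' T
  refine ⟨K ∪ K', hK.union hK', fun t ht x hx => ?_⟩
  rw [mem_union, not_or] at hx
  simp [h t ht x hx.1, h' t ht x hx.2]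

theorem LS.zero : LS (0 : Sm (W d)) := fun _ => ⟨∅, isCompact_empty, fun _ _ _ _ => rfl⟩

theorem LS.sum {ι : Type*} {s : Finset ι} {F : ι → Sm (W d)} (h : ∀ i, LS (F i)) :
    LS (∑ i ∈ s, F i) := by
  classical
  induction s using Finset.induction_on with
  | empty => simpa using LS.zero
  | insert i s hi ih => rw [Finset.sum_insert hi]; exact (h i).add ih

theorem LS.smul {F : Sm (W d)} (h : LS F) (c : ℝ) : LS (c • F) := fun T => by
  obtain ⟨K, hK, h⟩ := h T
  exact ⟨K, hK, fun t ht x hx => by simp [h t ht x hx]⟩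

theorem LS.sub {F G : Sm (W d)} (h : LS F) (h' : LS G) : LS (F - G) := by
  have := h.add (h'.smul (-1))
  rwa [neg_one_smul, ← sub_eq_add_neg] at this

theorem LS.D {F : Sm (W d)} (h : LS F) (v : W d) : LS (D v F) := fun T => by
  obtain ⟨K, hK, h⟩ := h (T + 1)
  refine ⟨K, hK, fun t ht x hx => D_eq_zero_of_eventually ?_ v⟩
  have h1 : ∀ᶠ p : W d in nhds (t, x), |p.1| < T + 1 :=
    (continuous_fst.abs.tendsto (t, x)).eventually (gt_mem_nhds (by simpa using by linarith))
  have h2 : ∀ᶠ p : W d in nhds (t, x), p.2 ∉ K :=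
    (continuous_snd.tendsto (t, x)).eventually (hK.isClosed.isOpen_compl.eventually_mem hx)
  filter_upwards [h1, h2] with p hp1 hp2
  exact h p.1 hp1.le p.2 hp2

theorem LS.zero_off {F : Sm (W d)} (h : LS F) (t : ℝ) :
    ∃ K : Set (E d), IsCompact K ∧ ∀ x ∉ K, slice t F x = 0 := by
  obtain ⟨K, hK, h⟩ := h |t|
  exact ⟨K, hK, fun x hx => h t le_rfl x hx⟩

theorem LS.integrable {F : Sm (W d)} (h : LS F) (t : ℝ) : Integrable (slice t F) := by
  obtain ⟨K, hK, h⟩ := h.zero_off t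
  exact Sm.integrable hK h

theorem LS.hasDerivAt_integral {F : Sm (W d)} (h : LS F) (t : ℝ) :
    HasDerivAt (fun s => ∫ x, slice s F x) (∫ x, slice t (Dt F) x) t := by
  obtain ⟨K, hK, h0⟩ := h (|t| + 2)
  obtain ⟨M, hM⟩ := ((isCompact_Icc (a := t - 1) (b := t + 1)).prod hK).exists_bound_of_continuousOn
    (Dt F).continuous.continuousOn
  have hD : ∀ s ∈ Icc (t - 1) (t + 1), ∀ x ∉ K, Dt F (s, x) = 0 := fun s hs x hx => by
    refine D_eq_zero_of_eventually ?_ _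
    have hs' : |s| < |t| + 2 := by
      have := abs_sub_abs_le_abs_sub s t
      have h1 : |s - t| ≤ 1 := abs_le.2 ⟨by linarith [hs.1], by linarith [hs.2]⟩
      linarith
    have h1 : ∀ᶠ p : W d in nhds (s, x), |p.1| < |t| + 2 :=
      (continuous_fst.abs.tendsto (s, x)).eventually (gt_mem_nhds hs')
    have h2 : ∀ᶠ p : W d in nhds (s, x), p.2 ∉ K :=
      (continuous_snd.tendsto (s, x)).eventually (hK.isClosed.isOpen_compl.eventually_mem hx)
    filter_upwards [h1, h2] with p hp1 hp2
    exact h0 p.1 hp1.le p.2 hp2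
  refine (hasDerivAt_integral_of_dominated_loc_of_deriv_le (F := fun s x => slice s F x)
    (F' := fun s x => slice s (Dt F) x) (bound := K.indicator fun _ => M)
    (Icc_mem_nhds (show t - 1 < t by linarith) (show t < t + 1 by linarith))
    (Eventually.of_forall fun s => (slice s F).continuous.aestronglyMeasurable)
    (h.integrable t) (slice t (Dt F)).continuous.aestronglyMeasurable
    (Eventually.of_forall fun x s hs => ?_)
    ((integrable_indicator_iff hK.measurableSet).2 (integrableOn_const hK.measure_lt_top.ne))
    (Eventually.of_forall fun x s _ => hasDerivAt_slice F s x)).2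
  by_cases hx : x ∈ K
  · rw [indicator_of_mem hx]; exact hM (s, x) ⟨hs, hx⟩
  · rw [indicator_of_notMem hx, slice_apply, hD s hs x hx, norm_zero]

/-- Twice the energy density. -/
noncomputable def edens (A : Fin d → Fin d → Sm (E d)) (ψ : Sm (W d)) : Sm (W d) :=
  Dt ψ ^ 2 + ∑ i, (∑ j, lift (A i j) * dx j ψ) * dx i ψ

theorem fl_slice (A : Fin d → Fin d → Sm (E d)) (ψ : Sm (W d)) (t : ℝ) (i : Fin d) :
    fl A (slice t ψ) i = slice t (∑ j, lift (A i j) * dx j ψ) := by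
  simp only [fl, pd_slice, map_sum, map_mul, slice_lift]

theorem slice_edens (A : Fin d → Fin d → Sm (E d)) (ψ : Sm (W d)) (t : ℝ) :
    slice t (edens A ψ) = slice t (Dt ψ) ^ 2 + vf (fl A (slice t ψ)) (slice t ψ) := by
  simp only [edens, vf, fl_slice, pd_slice, map_add, map_pow, map_sum (slice t), map_mul]

theorem slice_Dt_edens (hA : ∀ i j, A i j = A j i) (ψ : Sm (W d)) (t : ℝ) :
    slice t (Dt (edens A ψ)) = 2 * slice t (Dt ψ) * slice t (Dt (Dt ψ))
      + 2 * vf (fl A (slice t ψ)) (slice t (Dt ψ)) := by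
  have h1 : Dt (edens A ψ) = 2 * Dt ψ * Dt (Dt ψ)
      + ((∑ i, (∑ j, lift (A i j) * dx j ψ) * dx i (Dt ψ))
        + ∑ i, (∑ j, lift (A i j) * dx j (Dt ψ)) * dx i ψ) := by
    rw [edens, map_add, sq, D_mul, map_sum, ← sum_add_distrib]
    congr 1
    · ring
    · refine sum_congr rfl fun i _ => ?_
      rw [D_mul, map_sum, D_comm]
      congr 1
      rw [mul_comm]
      congr 1
      refine sum_congr rfl fun j _ => ?_
      rw [D_mul, Dt_lift, mul_zero, add_zero, D_comm]
  have h2 : slice t (∑ i, (∑ j, lift (A i j) * dx j (Dt ψ)) * dx i ψ)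
      = vf (fl A (slice t (Dt ψ))) (slice t ψ) := by
    simp only [vf, fl_slice, pd_slice, map_sum (slice t), map_mul]
  have h3 : slice t (∑ i, (∑ j, lift (A i j) * dx j ψ) * dx i (Dt ψ))
      = vf (fl A (slice t ψ)) (slice t (Dt ψ)) := by
    simp only [vf, fl_slice, pd_slice, map_sum (slice t), map_mul]
  rw [h1, map_add, map_add, h2, h3, vf_fl_symm hA (slice t (Dt ψ)) (slice t ψ)]
  simp only [map_mul, map_ofNat]
  ring

theorem LS.edens {ψ : Sm (W d)} (h : LS ψ) (A : Fin d → Fin d → Sm (E d)) : LS (edens A ψ) := by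
  rw [LogDecay.edens, sq]
  exact ((h.D _).mul_left _).add (LS.sum fun i => (h.D _).mul_left _)

/-- The weighted energy identity. -/
theorem hasDerivAt_energy (hA : ∀ i j, A i j = A j i) {ψ b g : Sm (W d)} (hLS : LS b ∨ LS ψ)
    (hg : ∀ t, slice t (Dt (Dt ψ)) = Pop A (slice t ψ) + slice t g) (t : ℝ) :
    HasDerivAt (fun t => ∫ x, (slice t b * slice t (edens A ψ)) x)
      (∫ x, (slice t (Dt b) * slice t (edens A ψ)
        + 2 * slice t b * slice t (Dt ψ) * slice t g
        - 2 * slice t (Dt ψ) * vf (fl A (slice t ψ)) (slice t b)) x) t := by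
  have hL : LS (b * edens A ψ) := hLS.elim (fun h => h.mul_right _) fun h => (h.edens A).mul_left _
  have h1 := hL.hasDerivAt_integral t
  simp only [map_mul (slice _)] at h1
  convert h1 using 1
  set J : Fin d → Sm (E d) := fun i => (slice t b * slice t (Dt ψ)) * fl A (slice t ψ) i
  have hJ : ∃ K, IsCompact K ∧ ∀ i, ∀ x ∉ K, J i x = 0 := by
    rcases hLS with h | h
    · obtain ⟨K, hK, h⟩ := h.zero_off t
      exact ⟨K, hK, fun i x hx => by simp only [J, Sm.mul_apply, h x hx, zero_mul]⟩
    · obtain ⟨K, hK, h⟩ := (h.D (1, 0)).zero_off t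
      exact ⟨K, hK, fun i x hx => by
        simp only [J, Sm.mul_apply, h x hx, mul_zero, zero_mul]⟩
  obtain ⟨K, hK, hJ⟩ := hJ
  have h2 := integral_dv_eq_zero hK hJ
  have e : slice t (Dt (b * edens A ψ)) = (slice t (Dt b) * slice t (edens A ψ)
        + 2 * slice t b * slice t (Dt ψ) * slice t g
        - 2 * slice t (Dt ψ) * vf (fl A (slice t ψ)) (slice t b)) + 2 * dv J := by
    rw [dv_mul, vf_mul, D_mul, map_add, map_mul, map_mul, slice_Dt_edens hA, hg]
    change _ = _ + 2 * (_ * Pop A (slice t ψ) + _)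
    ring
  have hK2 : ∀ x ∉ K, (2 * dv J : Sm (E d)) x = 0 := fun x hx => by
    have : ∀ i, pd i (J i) x = 0 := fun i => D_eq_zero_of_notMem hK.isClosed (hJ i) hx _
    simp [dv, this]
  have e' : (slice t (Dt b) * slice t (edens A ψ)
        + 2 * slice t b * slice t (Dt ψ) * slice t g
        - 2 * slice t (Dt ψ) * vf (fl A (slice t ψ)) (slice t b))
        = slice t (Dt (b * edens A ψ)) - 2 * dv J := by rw [e]; ring
  rw [e']
  have := integral_sub ((hL.D (1, 0)).integrable t) (Sm.integrable hK hK2)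
  refine Eq.trans this ?_
  have e3 : ∫ x, (2 * dv J : Sm (E d)) x = 2 * ∫ x, dv J x := integral_const_mul _ _
  rw [e3, h2, mul_zero, sub_zero]

variable {F ψ : Sm (W d)}

/-- Comparison of the quadratic form of the coefficients with the Euclidean one. -/
structure EB (A : Fin d → Fin d → Sm (E d)) (m L : ℝ) : Prop where
  symm : ∀ i j, A i j = A j i
  m_pos : 0 < m
  m_le : m ≤ 1
  one_le : 1 ≤ L
  lo : ∀ (u : Sm (E d)) x, m * gsq u x ≤ vf (fl A u) u x
  hi : ∀ (u : Sm (E d)) x, vf (fl A u) u x ≤ L * gsq u x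
  fl_le : ∀ (u : Sm (E d)) x, ∑ i, fl A u i x ^ 2 ≤ L * gsq u x

theorem Coef.exists_EB (h : Coef d a c₀ B A) (hd : 1 ≤ d) (ha : 0 < a) (hB : 0 ≤ B)
    (hc : 0 < c₀) : ∃ m L, EB A m L := by
  have hC : 0 ≤ CG d B := by unfold CG; positivity
  refine ⟨min c₀ 1, 1 + 2 * (CG d B * B), h.symm, lt_min hc one_pos, min_le_right _ _, ?_, ?_, ?_, ?_⟩
  · have := mul_nonneg hC hB
    linarith
  all_goals intro u x
  all_goals have g := h.grd hd ha hB u x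
  all_goals have hp := g.hp
  all_goals have h1 : CG d B * dl a B x * gsq u x ≤ CG d B * B * gsq u x :=
      mul_le_mul_of_nonneg_right (mul_le_mul_of_nonneg_left (dl_le ha hB x) hC) hp
  all_goals have h2 := (abs_le.1 g.Qp).2
  all_goals have h3 := (abs_le.1 g.FQ).2
  all_goals have h4 := mul_nonneg (mul_nonneg hC hB) hp
  · exact (mul_le_mul_of_nonneg_right (min_le_left _ _) hp).trans g.Q_lo
  · linarith
  · linarith

theorem EB.L_pos (h : EB A m L) : 0 < L := one_pos.trans_le h.one_le

theorem EB.Q_nonneg (h : EB A m L) (u : Sm (E d)) (x : E d) : 0 ≤ vf (fl A u) u x :=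
  (mul_nonneg h.m_pos.le (gsq_nonneg u x)).trans (h.lo u x)

theorem EB.one_le_speed (h : EB A m L) : 1 ≤ L / m := by
  rw [le_div_iff₀ h.m_pos]; linarith [h.m_le, h.one_le]

theorem EB.speed_pos (h : EB A m L) : 0 < L / m := one_pos.trans_le h.one_le_speed

theorem EB.vf_sq_le (h : EB A m L) (hf : gsq f x ≤ s ^ 2) :
    vf (fl A u) f x ^ 2 ≤ L / m * s ^ 2 * vf (fl A u) u x := by
  have h1 : vf (fl A u) f x ^ 2 ≤ (∑ i, fl A u i x ^ 2) * gsq f x := by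
    rw [gsq_apply]
    simpa [vf] using Finset.sum_mul_sq_le_sq_mul_sq Finset.univ (fun i => fl A u i x)
      (fun i => pd i f x)
  have h2 : gsq u x ≤ vf (fl A u) u x / m := by
    rw [le_div_iff₀ h.m_pos, mul_comm]; exact h.lo u x
  refine h1.trans ((mul_le_mul (h.fl_le u x) hf (gsq_nonneg _ _)
    (mul_nonneg h.L_pos.le (gsq_nonneg _ _))).trans ?_)
  calc L * gsq u x * s ^ 2 ≤ L * (vf (fl A u) u x / m) * s ^ 2 := by
        have := h.L_pos
        gcongr
    _ = _ := by ring

theorem EB.cross (h : EB A m L) (hs : 0 ≤ s)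
    (hf : gsq f x ≤ s ^ 2) (v : ℝ) :
    |2 * v * vf (fl A u) f x| ≤ L / m * s * (v ^ 2 + vf (fl A u) u x) := by
  have hQ := h.Q_nonneg u x
  have h1 := h.vf_sq_le (u := u) hf
  have h3 := h.one_le_speed
  have h4 := h.speed_pos
  set l := L / m
  set Q := vf (fl A u) u x
  set N := vf (fl A u) f x
  have h2 : N ^ 2 ≤ (l * s) ^ 2 * Q := by
    refine h1.trans (mul_le_mul_of_nonneg_right ?_ hQ)
    nlinarith only [h3, mul_nonneg (sub_nonneg.2 h3) (sq_nonneg s), mul_nonneg (mul_nonneg h4.le (sub_nonneg.2 h3)) (sq_nonneg s)]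
  have hls := mul_nonneg h4.le hs
  refine abs_le_of_sq_le_sq ?_ (by positivity)
  nlinarith only [mul_le_mul_of_nonneg_left h2 (sq_nonneg v), mul_nonneg (sq_nonneg (l * s)) (sq_nonneg (v ^ 2 - Q))]

theorem edens_apply (A : Fin d → Fin d → Sm (E d)) (ψ : Sm (W d)) (t : ℝ) (x : E d) :
    edens A ψ (t, x) = Dt ψ (t, x) ^ 2 + vf (fl A (slice t ψ)) (slice t ψ) x := by
  have := congrArg (fun f : Sm (E d) => f x) (slice_edens A ψ t)
  simpa using this

theorem EB.edens_nonneg (h : EB A m L) (ψ : Sm (W d)) (p : W d) : 0 ≤ edens A ψ p := by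
  rw [show p = (p.1, p.2) from rfl, edens_apply]
  exact add_nonneg (sq_nonneg _) (h.Q_nonneg _ _)

/-- The Euclidean energy density. -/
noncomputable def ed0 (ψ : Sm (W d)) : Sm (W d) := Dt ψ ^ 2 + ∑ i, dx i ψ ^ 2

theorem ed0_apply (ψ : Sm (W d)) (t : ℝ) (x : E d) :
    ed0 ψ (t, x) = Dt ψ (t, x) ^ 2 + gsq (slice t ψ) x := by
  simp [ed0, gsq_apply, pd_slice]

theorem ed0_nonneg (ψ : Sm (W d)) (p : W d) : 0 ≤ ed0 ψ p := by
  simp only [ed0, Sm.add_apply, Sm.pow_apply, Sm.sum_apply]; positivity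

theorem EB.ed0_le (h : EB A m L) (ψ : Sm (W d)) (p : W d) : m * ed0 ψ p ≤ edens A ψ p := by
  rw [show p = (p.1, p.2) from rfl, edens_apply, ed0_apply]
  have := h.lo (slice p.1 ψ) p.2
  nlinarith [h.m_le, sq_nonneg (Dt ψ (p.1, p.2))]

theorem EB.edens_le (h : EB A m L) (ψ : Sm (W d)) (p : W d) : edens A ψ p ≤ L * ed0 ψ p := by
  rw [show p = (p.1, p.2) from rfl, edens_apply, ed0_apply]
  have := h.hi (slice p.1 ψ) p.2
  nlinarith [h.one_le, sq_nonneg (Dt ψ (p.1, p.2))]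

/-- `ψ` solves the wave equation. -/
def Weq (A : Fin d → Fin d → Sm (E d)) (ψ : Sm (W d)) : Prop :=
  ∀ t, slice t (Dt (Dt ψ)) = Pop A (slice t ψ)

/-- Growth of a weighted energy is controlled by the growth of the weight along the cone. -/
theorem EB.weight_deriv (h : EB A m L) {b : Sm (W d)} (hψ : Weq A ψ) (hLS : LS b ∨ LS ψ) (t : ℝ) :
    ∃ D', HasDerivAt (fun t => ∫ x, (slice t b * slice t (edens A ψ)) x) D' t ∧
      ∀ c : Sm (W d), (LS c ∨ LS ψ) → (∀ x, ∃ s ≥ 0, gsq (slice t b) x ≤ s ^ 2 ∧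
        Dt b (t, x) + L / m * s ≤ c (t, x)) → D' ≤ ∫ x, (slice t c * slice t (edens A ψ)) x := by
  refine ⟨_, hasDerivAt_energy h.symm hLS (g := 0) (fun t => by simp [hψ t]) t, fun c hc hb => ?_⟩
  have hI : ∀ c : Sm (W d), (LS c ∨ LS ψ) →
      ∃ K, IsCompact K ∧ ∀ x ∉ K, (slice t c * slice t (edens A ψ)) x = 0 := fun c hc => by
    have hL : LS (c * edens A ψ) :=
      hc.elim (fun h => h.mul_right _) fun h => (h.edens A).mul_left _
    exact hL.zero_off t
  have hI2 : ∃ K, IsCompact K ∧ ∀ x ∉ K, (slice t (Dt b) * slice t (edens A ψ)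
        + 2 * slice t b * slice t (Dt ψ) * slice t 0
        - 2 * slice t (Dt ψ) * vf (fl A (slice t ψ)) (slice t b) : Sm (E d)) x = 0 := by
    rcases hLS with h | h
    · obtain ⟨K, hK, h⟩ := h (|t| + 1)
      have hz : ∀ x ∉ K, ∀ v, D v b (t, x) = 0 := fun x hx v => by
        refine D_eq_zero_of_eventually ?_ v
        have h1 : ∀ᶠ p : W d in nhds (t, x), |p.1| < |t| + 1 :=
          (continuous_fst.abs.tendsto (t, x)).eventually (gt_mem_nhds (by simp))
        have h2 : ∀ᶠ p : W d in nhds (t, x), p.2 ∉ K :=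
          (continuous_snd.tendsto (t, x)).eventually (hK.isClosed.isOpen_compl.eventually_mem hx)
        filter_upwards [h1, h2] with p hp1 hp2
        exact h p.1 hp1.le p.2 hp2
      refine ⟨K, hK, fun x hx => ?_⟩
      simp [vf, pd_slice, hz x hx]
    · obtain ⟨K, hK, h1⟩ := (h.D (1, 0)).zero_off t
      obtain ⟨K', hK', h2⟩ := (h.edens A).zero_off t
      refine ⟨K ∪ K', hK.union hK', fun x hx => ?_⟩
      rw [mem_union, not_or] at hx
      have e1 := h1 x hx.1
      have e2 := h2 x hx.2
      rw [slice_apply] at e1 e2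
      simp [e1, e2]
  obtain ⟨K, hK, h1⟩ := hI c hc
  obtain ⟨K', hK', h2⟩ := hI2
  refine integral_mono (Sm.integrable hK' h2) (Sm.integrable hK h1) fun x => ?_
  obtain ⟨s, hs, hg, hd⟩ := hb x
  have h3 := (abs_le.1 (h.cross (u := slice t ψ) hs hg (Dt ψ (t, x)))).1
  rw [← edens_apply] at h3
  have h4 := mul_le_mul_of_nonneg_right hd (h.edens_nonneg ψ (t, x))
  simp only [Sm.sub_apply, Sm.add_apply, Sm.mul_apply, slice_apply, map_zero, Sm.zero_apply,
    Sm.ofNat_apply, mul_zero, add_zero]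
  linarith only [h3, h4]

theorem EB.weight_antitone (h : EB A m L) {b : Sm (W d)} (hψ : Weq A ψ) (hLS : LS b ∨ LS ψ)
    (hb : ∀ t x, ∃ s ≥ 0, gsq (slice t b) x ≤ s ^ 2 ∧ Dt b (t, x) + L / m * s ≤ 0) :
    Antitone fun t => ∫ x, (slice t b * slice t (edens A ψ)) x := by
  choose D' h1 h2 using fun t => h.weight_deriv hψ hLS t
  refine antitone_of_deriv_nonpos (fun t => (h1 t).differentiableAt) fun t => ?_
  rw [(h1 t).deriv]
  have := h2 t 0 (Or.inl LS.zero) (hb t)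
  simpa using this

/-- A function of `α + β t + γ q(x)`. -/
noncomputable def wt (H : Sm ℝ) (α β γ : ℝ) (q : Sm (E d)) : Sm (W d) :=
  Sm.comp H (algebraMap ℝ _ α + β • liftT X0 + γ • lift q) fun _ => H.smooth.contDiffAt
where
  X0 : Sm ℝ := Sm.mk id contDiff_id

theorem wt_apply (H : Sm ℝ) (α β γ : ℝ) (q : Sm (E d)) (t : ℝ) (x : E d) :
    wt H α β γ q (t, x) = H (α + β * t + γ * q x) := rfl

theorem Dt_wt (H : Sm ℝ) (α β γ : ℝ) (q : Sm (E d)) (t : ℝ) (x : E d) :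
    Dt (wt H α β γ q) (t, x) = β * D 1 H (α + β * t + γ * q x) := by
  have : HasDerivAt (fun s : ℝ => H (α + β * s + γ * q x))
      (D 1 H (α + β * t + γ * q x) * β) t := by
    have h1 : HasDerivAt (fun s : ℝ => α + β * s + γ * q x) β t := by
      simpa using (((hasDerivAt_id t).const_mul β).const_add α).add_const (γ * q x)
    have h2 := (H.differentiable (α + β * t + γ * q x)).hasDerivAt
    exact h2.comp t h1
  have h3 := hasDerivAt_slice (wt H α β γ q) t x
  rw [mul_comm]
  exact h3.unique this

theorem gsq_wt (H : Sm ℝ) (α β γ : ℝ) (q : Sm (E d)) (t : ℝ) (x : E d) :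
    gsq (slice t (wt H α β γ q)) x
      = (D 1 H (α + β * t + γ * q x) * γ) ^ 2 * gsq q x := by
  have : ∀ i, pd i (slice t (wt H α β γ q)) x = D 1 H (α + β * t + γ * q x) * γ * pd i q x := by
    intro i
    have e : slice t (wt H α β γ q)
        = Sm.comp H (algebraMap ℝ _ (α + β * t) + γ • q) fun _ => H.smooth.contDiffAt := by
      ext y; rfl
    rw [e, D_comp_apply]
    simp only [map_add, D_algebraMap, zero_add, Derivation.map_smul, Sm.smul_apply, mul_assoc]
    rfl
  simp only [gsq_apply, this, mul_pow, mul_sum]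

theorem EB.wt_antitone (h : EB A m L) (hψ : Weq A ψ) {H : Sm ℝ} {α γ : ℝ}
    {q : Sm (E d)} (hLS : LS (wt H α β γ q) ∨ LS ψ) (hH : ∀ y, 0 ≤ D 1 H y)
    (hq : ∀ x, gsq q x ≤ 1) (hβ : β ≤ -(|γ| * (L / m))) :
    Antitone fun t => ∫ x, (slice t (wt H α β γ q) * slice t (edens A ψ)) x := by
  refine h.weight_antitone hψ hLS fun t x => ⟨D 1 H (α + β * t + γ * q x) * |γ|, ?_, ?_, ?_⟩
  · exact mul_nonneg (hH _) (abs_nonneg _)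
  · rw [gsq_wt, mul_pow, mul_pow, sq_abs]
    exact mul_le_of_le_one_right (by positivity) (hq x)
  · rw [Dt_wt]
    have := mul_le_mul_of_nonneg_right hβ (hH (α + β * t + γ * q x))
    linarith

theorem gsq_jap (x : E d) : gsq (zp (1 / 2)) x ≤ 1 := by
  have hz := zz_pos x
  rw [gsq_apply]
  have : ∀ i, pd i (zp (1 / 2)) x ^ 2 = (zz x)⁻¹ * x i ^ 2 := fun i => by
    rw [pd_zp]
    simp only [Sm.smul_apply, Sm.mul_apply, zp_apply, X_apply, rpow_neg_one,
      ← sqrt_eq_rpow]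
    rw [mul_pow, mul_pow, mul_pow, mul_pow, sq_sqrt hz.le]
    field_simp
  simp only [this, ← mul_sum]
  rw [show ∑ i, x i ^ 2 = ‖x‖ ^ 2 by simp [EuclideanSpace.norm_sq_eq],
    inv_mul_le_iff₀ hz, zz_apply]
  linarith

/-- The cutoff `exp (-1/x)` for positive `x`. -/
noncomputable def Hg : Sm ℝ := Sm.mk expNegInvGlue expNegInvGlue.contDiff

theorem D_one_apply (H : Sm ℝ) (y : ℝ) : D 1 H y = deriv H y := by
  rw [D_apply, fderiv_apply_one_eq_deriv]

theorem D_one_nonneg {H : Sm ℝ} (hH : Monotone H) (y : ℝ) : 0 ≤ D 1 H y := by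
  rw [D_one_apply]; exact hH.deriv_nonneg

theorem Sm.eq_zero_of_integral (hK : IsCompact K)
    (h : ∀ x ∉ K, f x = 0) (h0 : ∀ x, 0 ≤ f x) (hI : ∫ x, f x ≤ 0) (x : E d) : f x = 0 := by
  by_contra hx
  have := f.continuous.integral_pos_of_hasCompactSupport_nonneg_nonzero (μ := volume)
    (HasCompactSupport.intro hK h) h0 hx
  exact absurd hI (not_le.2 this)

theorem edens_eq_zero (hK : IsClosed K)
    (h0 : ∀ x ∉ K, ψ (t, x) = 0) (h1 : ∀ x ∉ K, Dt ψ (t, x) = 0) (hx : x ∉ K) :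
    edens A ψ (t, x) = 0 := by
  have : ∀ i, pd i (slice t ψ) x = 0 := fun i =>
    D_eq_zero_of_notMem (f := slice t ψ) hK (fun x hx => h0 x hx) hx _
  simp [edens_apply, h1 x hx, vf, this]

theorem EB.finite_speed_pos (h : EB A m L) (hψ : Weq A ψ) (h0 : ∀ x, ρ < ‖x‖ → ψ (0, x) = 0) (h1 : ∀ x, ρ < ‖x‖ → Dt ψ (0, x) = 0) (ht : 0 ≤ t)
    {x₀ : E d} (hx : ρ + L / m * t + 2 ≤ ‖x₀‖) : ψ (t, x₀) = 0 := by
  set q : Sm (E d) := Tr (-x₀) (zp (1 / 2)) with hq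
  set l := L / m
  have hl : 0 < l := h.speed_pos
  set b := wt Hg (l * t + 3 / 2) (-l) (-1) q
  have hqx : ∀ x, q x = √(1 + ‖x - x₀‖ ^ 2) := fun x => by
    simp only [hq, Tr_apply, zp_apply, zz_apply, ← sqrt_eq_rpow, sub_eq_add_neg]
  have hbx : ∀ s x, b (s, x) = expNegInvGlue (l * t + 3 / 2 + -l * s + -1 * q x) := fun s x => rfl
  have hqn : ∀ x, ‖x - x₀‖ ≤ q x := fun x => by
    rw [hqx]; exact le_sqrt_of_sq_le (by linarith)
  have hLS : LS b := fun T => by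
    refine ⟨Metric.closedBall x₀ (l * t + 3 / 2 + l * T), isCompact_closedBall _ _,
      fun s hs x hx => ?_⟩
    rw [hbx]
    refine expNegInvGlue.zero_of_nonpos ?_
    rw [Metric.mem_closedBall, dist_eq_norm, not_le] at hx
    have := hqn x
    nlinarith [(abs_le.1 hs).1]
  have hmono := h.wt_antitone hψ (H := Hg) (α := l * t + 3 / 2) (β := -l) (γ := -1) (q := q)
    (Or.inl hLS) (D_one_nonneg expNegInvGlue.monotone) (fun x => by
      have : gsq q x = gsq (zp (1 / 2)) (x + -x₀) := by
        simp only [gsq_apply, hq, pd_Tr, Tr_apply]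
      rw [this]; exact gsq_jap _) (by simp [l])
  have hz0 : ∀ x, (slice 0 b * slice 0 (edens A ψ)) x = 0 := fun x => by
    simp only [Sm.mul_apply, slice_apply]
    rcases le_or_gt ‖x‖ ρ with hxρ | hxρ
    · have h2 : b (0, x) = 0 := by
        rw [hbx]
        refine expNegInvGlue.zero_of_nonpos ?_
        have h3 := hqn x
        have h4 := norm_sub_norm_le x₀ x
        rw [norm_sub_rev] at h4
        linarith
      rw [h2, zero_mul]
    · rw [edens_eq_zero (K := Metric.closedBall 0 ρ) Metric.isClosed_closedBall, mul_zero]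
      · intro x hx; exact h0 x (by simpa using hx)
      · intro x hx; exact h1 x (by simpa using hx)
      · simpa using hxρ
  have hz : ∀ s ∈ Icc 0 t, Dt ψ (s, x₀) = 0 := fun s hs => by
    have h2 := hmono hs.1
    simp only [] at h2
    rw [show (∫ x, (slice 0 (wt Hg (l * t + 3 / 2) (-l) (-1) q) * slice 0 (edens A ψ)) x) = 0 from
      (integral_congr_ae (Eventually.of_forall hz0)).trans (integral_zero _ _)] at h2
    obtain ⟨K, hK, hK0⟩ := (hLS.mul_right (edens A ψ)).zero_off s
    rw [map_mul] at hK0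
    have h3 := Sm.eq_zero_of_integral hK hK0 (fun x => mul_nonneg (expNegInvGlue.nonneg _)
      (h.edens_nonneg ψ (s, x))) h2 x₀
    have h4 : 0 < b (s, x₀) := by
      rw [hbx]
      refine expNegInvGlue.pos_of_pos ?_
      have : q x₀ = 1 := by rw [hqx]; simp
      rw [this]
      nlinarith [hs.2]
    have h5 : edens A ψ (s, x₀) = 0 := by
      simpa [h4.ne'] using h3
    rw [edens_apply] at h5
    have := h.Q_nonneg (slice s ψ) x₀
    nlinarith [sq_nonneg (Dt ψ (s, x₀))]
  have := constant_of_has_deriv_right_zero (f := fun s => ψ (s, x₀)) (a := 0) (b := t)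
    (fun s _ => (hasDerivAt_slice ψ s x₀).continuousAt.continuousWithinAt)
    (fun s hs => by
      have := (hasDerivAt_slice ψ s x₀).hasDerivWithinAt (s := Ici s)
      rwa [hz s ⟨hs.1, hs.2.le⟩] at this) t ⟨ht, le_rfl⟩
  refine this.trans (h0 x₀ ?_)
  nlinarith

/-- Time reversal. -/
noncomputable def rev : Sm (W d) →ₐ[ℝ] Sm (W d) :=
  Sm.pull (fun p => (-p.1, p.2)) (contDiff_fst.neg.prodMk contDiff_snd)

@[simp] theorem slice_rev (t : ℝ) (F : Sm (W d)) : slice t (rev F) = slice (-t) F := rfl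

@[simp] theorem Dt_rev (F : Sm (W d)) : Dt (rev F) = -rev (Dt F) := by
  ext ⟨t, x⟩
  have h1 := hasDerivAt_slice (rev F) t x
  have h2 := (hasDerivAt_slice F (-t) x).comp t (hasDerivAt_neg t)
  rw [h1.unique h2, mul_neg_one]
  rfl

theorem Weq.rev (h : Weq A ψ) : Weq A (rev ψ) := fun t => by
  simp only [Dt_rev, map_neg, neg_neg, slice_rev, h (-t)]

/-- A smooth solution with spatially compact support. -/
structure Sol (A : Fin d → Fin d → Sm (E d)) (ψ : Sm (W d)) : Prop where
  eq : Weq A ψ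
  ls : LS ψ

theorem EB.finite_speed (h : EB A m L) (hψ : Weq A ψ)
    (h0 : ∃ K, IsCompact K ∧ ∀ x ∉ K, ψ (0, x) = 0)
    (h1 : ∃ K, IsCompact K ∧ ∀ x ∉ K, Dt ψ (0, x) = 0) : Sol A ψ := by
  obtain ⟨K, hK, h0⟩ := h0
  obtain ⟨K', hK', h1⟩ := h1
  obtain ⟨ρ, hρ⟩ := (hK.union hK').isBounded.subset_closedBall 0
  have hk : ∀ x, ρ < ‖x‖ → x ∉ K ∧ x ∉ K' := fun x hx => by
    have : x ∉ K ∪ K' := fun h => absurd (hρ h) (by simpa using hx)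
    rwa [mem_union, not_or] at this
  have g0 : ∀ x, ρ < ‖x‖ → ψ (0, x) = 0 := fun x hx => h0 x (hk x hx).1
  have g1 : ∀ x, ρ < ‖x‖ → Dt ψ (0, x) = 0 := fun x hx => h1 x (hk x hx).2
  refine ⟨hψ, fun T => ⟨Metric.closedBall 0 (ρ + L / m * T + 2), isCompact_closedBall _ _,
    fun t ht x hx => ?_⟩⟩
  have hx' : ρ + L / m * T + 2 ≤ ‖x‖ := by
    simp only [Metric.mem_closedBall, dist_zero_right, not_le] at hx; exact hx.le
  have hl := h.speed_pos
  rcases le_total 0 t with h2 | h2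
  · refine h.finite_speed_pos hψ g0 g1 h2 (le_trans ?_ hx')
    rw [abs_of_nonneg h2] at ht
    gcongr
  · have := h.finite_speed_pos hψ.rev (ρ := ρ) (t := -t) (x₀ := x)
      (fun x hx => by
        have : slice 0 (LogDecay.rev ψ) x = 0 := by rw [slice_rev, neg_zero]; exact g0 x hx
        exact this)
      (fun x hx => by
        have : slice 0 (Dt (LogDecay.rev ψ)) x = 0 := by
          rw [Dt_rev, map_neg, slice_rev, neg_zero, Sm.neg_apply, slice_apply, g1 x hx, neg_zero]
        exact this) (by linarith) (le_trans (by rw [abs_of_nonpos h2] at ht; gcongr) hx')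
    have e : slice (-t) (LogDecay.rev ψ) x = ψ (t, x) := by rw [slice_rev, neg_neg]; rfl
    rw [← e]; exact this

/-- The spatial operator acting on space-time functions. -/
noncomputable def PW (A : Fin d → Fin d → Sm (E d)) (F : Sm (W d)) : Sm (W d) :=
  ∑ i, dx i (∑ j, lift (A i j) * dx j F)

theorem Pop_slice (F : Sm (W d)) (t : ℝ) : Pop A (slice t F) = slice t (PW A F) := by
  rw [Pop, dv, PW, map_sum]
  refine sum_congr rfl fun i _ => ?_
  rw [fl_slice, pd_slice]

theorem PW_add (F G : Sm (W d)) : PW A (F + G) = PW A F + PW A G := by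
  simp only [PW, map_add, mul_add, sum_add_distrib]

theorem PW_smul (c : ℝ) (F : Sm (W d)) : PW A (c • F) = c • PW A F := by
  simp only [PW, Derivation.map_smul, mul_smul_comm, ← Finset.smul_sum]

theorem PW_sub (F G : Sm (W d)) : PW A (F - G) = PW A F - PW A G := by
  have : F - G = F + (-1 : ℝ) • G := by rw [neg_one_smul, sub_eq_add_neg]
  rw [this, PW_add, PW_smul, neg_one_smul, sub_eq_add_neg]

theorem PW_Dt (F : Sm (W d)) : PW A (Dt F) = Dt (PW A F) := by
  rw [PW, PW, map_sum]
  refine sum_congr rfl fun i _ => ?_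
  rw [D_comm _ _ (∑ j, lift (A i j) * dx j F), map_sum Dt]
  refine congrArg (dx i) (sum_congr rfl fun j _ => ?_)
  rw [D_mul, Dt_lift, mul_zero, add_zero, D_comm]

theorem Weq_iff : Weq A ψ ↔ Dt (Dt ψ) = PW A ψ := by
  constructor
  · intro h
    ext ⟨t, x⟩
    have := congrArg (fun f : Sm (E d) => f x) ((h t).trans (Pop_slice ψ t))
    exact this
  · intro h t
    rw [Pop_slice, h]

namespace Sol

variable {ψ ψ' : Sm (W d)}

theorem Dt (h : Sol A ψ) : Sol A (Dt ψ) :=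
  ⟨Weq_iff.2 (by rw [PW_Dt, ← Weq_iff.1 h.eq]), h.ls.D _⟩

theorem sub (h : Sol A ψ) (h' : Sol A ψ') : Sol A (ψ - ψ') :=
  ⟨Weq_iff.2 (by rw [PW_sub, ← Weq_iff.1 h.eq, ← Weq_iff.1 h'.eq]; simp only [map_sub]),
    h.ls.sub h'.ls⟩

theorem smul (h : Sol A ψ) (c : ℝ) : Sol A (c • ψ) :=
  ⟨Weq_iff.2 (by rw [PW_smul, ← Weq_iff.1 h.eq]; simp only [Derivation.map_smul]), h.ls.smul c⟩

end Sol

/-- The energy weighted by `μ`. -/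
noncomputable def Em (A : Fin d → Fin d → Sm (E d)) (μ : Sm (E d)) (ψ : Sm (W d)) (t : ℝ) : ℝ :=
  ∫ x, (μ * slice t (edens A ψ)) x

theorem LS.integrable_mul_edens (h : LS ψ) (μ : Sm (E d)) (t : ℝ) :
    Integrable fun x => (μ * slice t (LogDecay.edens A ψ)) x := by
  obtain ⟨K, hK, h⟩ := (h.edens A).zero_off t
  exact Sm.integrable hK fun x hx => by simp [h x hx]

theorem EB.Em_nonneg (h : EB A m L) (hμ : ∀ x, 0 ≤ μ x) (ψ : Sm (W d)) (t : ℝ) :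
    0 ≤ Em A μ ψ t :=
  integral_nonneg fun x => mul_nonneg (hμ x) (h.edens_nonneg ψ (t, x))

theorem EB.energy_eq (h : EB A m L) (hψ : Sol A ψ) (t s : ℝ) :
    Em A 1 ψ t = Em A 1 ψ s := by
  have h1 : ∀ t, HasDerivAt (fun t => Em A 1 ψ t) 0 t := fun t => by
    have := hasDerivAt_energy h.symm (b := 1) (g := 0) (Or.inr hψ.ls)
      (fun t => by simp [hψ.eq t]) t
    simp only [map_one, map_zero, Derivation.map_one_eq_zero] at this
    have e : ∀ u, vf (fl A u) (1 : Sm (E d)) = 0 := fun u => by simp [vf]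
    rw [e] at this
    simp only [zero_mul, mul_zero, sub_zero, add_zero, Sm.zero_apply, integral_zero] at this
    exact this
  exact is_const_of_deriv_eq_zero (fun t => (h1 t).differentiableAt) (fun t => (h1 t).deriv) t s

theorem EB.Em_growth (h : EB A m L) (hψ : Sol A ψ) (hμ : ∀ x, gsq μ x ≤ 1) (t s : ℝ) :
    Em A μ ψ t ≤ Em A μ ψ s + L / m * |t - s| * Em A 1 ψ 0 := by
  have key : ∀ γ : ℝ, |γ| = 1 → ∀ t,
      ∫ x, (slice t (wt (wt.X0) 0 (-(L / m)) γ μ) * slice t (edens A ψ)) x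
        = γ * Em A μ ψ t - L / m * t * Em A 1 ψ 0 := fun γ _ t => by
    rw [h.energy_eq hψ 0 t, Em, Em, ← integral_const_mul, ← integral_const_mul,
      ← integral_sub ((hψ.ls.integrable_mul_edens μ t).const_mul γ)
        ((hψ.ls.integrable_mul_edens 1 t).const_mul _)]
    refine integral_congr_ae (Eventually.of_forall fun x => ?_)
    simp only [Sm.mul_apply, slice_apply, wt_apply, wt.X0, Sm.mk_apply, id, Sm.one_apply]
    ring
  have hm : ∀ γ : ℝ, |γ| = 1 → Antitone fun t => γ * Em A μ ψ t - L / m * t * Em A 1 ψ 0 :=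
    fun γ hγ => by
    have := h.wt_antitone hψ.eq (H := wt.X0) (α := 0) (β := -(L / m)) (γ := γ) (q := μ)
      (Or.inr hψ.ls) (D_one_nonneg monotone_id) hμ (by rw [hγ, one_mul])
    simpa only [key γ hγ] using this
  rcases le_total s t with hst | hst
  · have := hm 1 (by simp) hst
    rw [abs_of_nonneg (by linarith)]
    simp only at this
    linarith
  · have := hm (-1) (by simp) hst
    rw [abs_of_nonpos (by linarith)]
    simp only at this
    linarith

/-- An integrable kernel supported in `[-T, T]`. -/
structure Ker (G : ℝ → ℝ) (T : ℝ) : Prop where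
  int : Integrable G
  supp : ∀ s, T < |s| → G s = 0

namespace Ker

variable {G : ℝ → ℝ} {T : ℝ}

theorem mul (h : Ker G T) {f : ℝ → ℝ} (hf : Continuous f) : Ker (fun s => G s * f s) T := by
  obtain ⟨M, hM⟩ := (isCompact_Icc (a := -T) (b := T)).exists_bound_of_continuousOn hf.continuousOn
  refine ⟨(h.int.norm.const_mul M).mono' (h.int.1.mul hf.aestronglyMeasurable)
    (Eventually.of_forall fun s => ?_), fun s hs => by rw [h.supp s hs, zero_mul]⟩
  rcases le_or_gt |s| T with hs | hs
  · rw [norm_mul, mul_comm]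
    exact mul_le_mul_of_nonneg_right (hM s (abs_le.1 hs)) (norm_nonneg _)
  · simp [h.supp s hs]

theorem abs (h : Ker G T) : Ker (fun s => |G s|) T :=
  ⟨h.int.abs, fun s hs => by rw [h.supp s hs, abs_zero]⟩

theorem sq_le (h : Ker G T) {f : ℝ → ℝ} (hf : Continuous f) :
    (∫ s, G s * f s) ^ 2 ≤ (∫ s, |G s|) * ∫ s, |G s| * f s ^ 2 := by
  have h1 := (h.mul hf).int
  have h2 := h.abs.int
  have h3 : Integrable fun s => |G s| * f s ^ 2 := (h.abs.mul (hf.pow 2)).int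
  have h4 := (h.abs.mul hf.abs).int
  have hy : |∫ s, G s * f s| ≤ ∫ s, |G s| * |f s| := by
    refine (abs_integral_le_integral_abs).trans (le_of_eq ?_)
    simp only [abs_mul]
  have key : ∀ c : ℝ, 0 ≤ (∫ s, |G s|) * (c * c) + (-2 * ∫ s, |G s| * |f s|) * c
      + ∫ s, |G s| * f s ^ 2 := fun c => by
    have : 0 ≤ ∫ s, (|G s| * (c * c) + (-2 * (|G s| * |f s|)) * c + |G s| * f s ^ 2) :=
      integral_nonneg fun s => by
        have : |G s| * (c * c) + (-2 * (|G s| * |f s|)) * c + |G s| * f s ^ 2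
          = |G s| * (c - |f s|) ^ 2 := by rw [← sq_abs (f s)]; ring
        simp only [this]
        positivity
    have i1 : Integrable fun s => |G s| * (c * c) := h2.mul_const _
    have i2 : Integrable fun s => (-2 * (|G s| * |f s|)) * c := (h4.const_mul _).mul_const _
    have i3 : Integrable fun s => |G s| * (c * c) + (-2 * (|G s| * |f s|)) * c := i1.add i2
    rwa [integral_add i3 h3, integral_add i1 i2, integral_mul_const, integral_mul_const,
      integral_const_mul] at this
  have := discrim_le_zero key
  rw [discrim] at this
  have h5 : (∫ s, G s * f s) ^ 2 ≤ (∫ s, |G s| * |f s|) ^ 2 := by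
    rw [← sq_abs (∫ s, G s * f s)]
    exact pow_le_pow_left₀ (abs_nonneg _) hy 2
  linarith

theorem integrable_prod (h : Ker G T) {Φ : W d → ℝ} (hΦ : Continuous Φ) (hK : IsCompact K) (h0 : ∀ s, |s| ≤ T → ∀ x ∉ K, Φ (s, x) = 0) :
    Integrable (fun p : W d => G p.1 * Φ p) := by
  obtain ⟨M, hM⟩ := ((isCompact_Icc (a := -T) (b := T)).prod hK).exists_bound_of_continuousOn
    hΦ.continuousOn
  have h1 : Integrable (K.indicator fun _ => M) (volume : Measure (E d)) :=
    (integrable_indicator_iff hK.measurableSet).2 (integrableOn_const hK.measure_lt_top.ne)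
  refine (h.int.norm.mul_prod h1).mono' (h.int.1.comp_fst.mul hΦ.aestronglyMeasurable)
    (Eventually.of_forall fun p => ?_)
  obtain ⟨s, x⟩ := p
  rw [norm_mul]
  rcases le_or_gt |s| T with hs | hs
  · refine mul_le_mul_of_nonneg_left ?_ (norm_nonneg _)
    by_cases hx : x ∈ K
    · rw [indicator_of_mem hx]; exact hM (s, x) ⟨abs_le.1 hs, hx⟩
    · rw [indicator_of_notMem hx, h0 s hs x hx, norm_zero]
  · simp [h.supp s hs]

theorem swap (h : Ker G T) {Φ : W d → ℝ} (hΦ : Continuous Φ) (hK : IsCompact K) (h0 : ∀ s, |s| ≤ T → ∀ x ∉ K, Φ (s, x) = 0) :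
    ∫ x, ∫ s, G s * Φ (s, x) = ∫ s, G s * ∫ x, Φ (s, x) := by
  have := integral_integral_swap (f := fun s x => G s * Φ (s, x)) (h.integrable_prod hΦ hK h0)
  simp only [integral_const_mul] at this
  exact this.symm

theorem integrable_inner (h : Ker G T) {Φ : W d → ℝ} (hΦ : Continuous Φ) (hK : IsCompact K) (h0 : ∀ s, |s| ≤ T → ∀ x ∉ K, Φ (s, x) = 0) :
    Integrable (fun x => ∫ s, G s * Φ (s, x)) ∧ Integrable (fun s => G s * ∫ x, Φ (s, x)) := by
  have := h.integrable_prod hΦ hK h0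
  refine ⟨this.integral_prod_right, ?_⟩
  have := this.integral_prod_left
  simpa only [integral_const_mul] using this

end Ker

/-- Compact support of a smooth kernel on the line. -/
theorem Ker.of_smooth {K : Sm ℝ} (h : ∀ s, T < |s| → K s = 0) : Ker K T :=
  ⟨K.continuous.integrable_of_hasCompactSupport (HasCompactSupport.intro
    (isCompact_Icc (a := -T) (b := T)) fun s hs => h s (by
      by_contra hc; exact hs (abs_le.1 (not_lt.1 hc)))), h⟩

theorem cv_smooth {K : Sm ℝ} (hK : Ker K T) (F : Sm (W d)) :
    ContDiff ℝ (⊤ : ℕ∞) fun p : W d => ∫ s, K s * F (p.1 - s, p.2) := by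
  have h := contDiffOn_convolution_right_with_param (𝕜 := ℝ) (n := ⊤) (μ := (volume : Measure ℝ))
    (f := fun _ : ℝ => (1 : ℝ)) (ContinuousLinearMap.mul ℝ ℝ)
    (g := fun (p : W d) (y : ℝ) => K (-y) * F (p.1 + y, p.2)) (s := univ) (k := Icc (-T) T)
    isOpen_univ isCompact_Icc (fun p y _ hy => by
      rw [hK.supp (-y) (by rw [abs_neg]; by_contra hc; exact hy (abs_le.1 (not_lt.1 hc))), zero_mul])
    (locallyIntegrable_const _) (by
      refine ContDiff.contDiffOn ?_
      refine ContDiff.mul (K.smooth.comp contDiff_snd.neg) (F.smooth.comp ?_)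
      exact (contDiff_fst.fst.add contDiff_snd).prodMk contDiff_fst.snd)
  rw [univ_prod_univ, contDiffOn_univ] at h
  have h2 := h.comp (contDiff_id.prodMk (contDiff_const (c := (0 : ℝ))))
  convert h2 using 2 with p
  simp [MeasureTheory.convolution, sub_eq_add_neg]

/-- Convolution in time with a compactly supported smooth kernel. -/
noncomputable def cv {K : Sm ℝ} (hK : Ker K T) : Sm (W d) →ₗ[ℝ] Sm (W d) where
  toFun F := Sm.mk _ (cv_smooth hK F)
  map_add' F G := by
    ext p
    have c : ∀ F : Sm (W d), Continuous fun s : ℝ => F (p.1 - s, p.2) := fun F =>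
      F.continuous.comp ((continuous_const.sub continuous_id).prodMk continuous_const)
    simp only [Sm.mk_apply, Sm.add_apply, mul_add]
    exact integral_add (hK.mul (c F)).int (hK.mul (c G)).int
  map_smul' c F := by
    ext p
    simp only [Sm.mk_apply, Sm.smul_apply, RingHom.id_apply, mul_left_comm _ c]
    exact integral_const_mul _ _

section cv

variable {K : Sm ℝ} {T : ℝ} (hK : Ker K T)

theorem cv_apply (F : Sm (W d)) (t : ℝ) (x : E d) : cv hK F (t, x) = ∫ s, K s * F (t - s, x) := rfl

theorem continuous_shift (F : Sm (W d)) (t : ℝ) (x : E d) : Continuous fun s : ℝ => F (t - s, x) :=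
  F.continuous.comp ((continuous_const.sub continuous_id).prodMk continuous_const)

theorem D_cv (v : W d) (F : Sm (W d)) : D v (cv hK F) = cv hK (D v F) := by
  have line : ∀ (G : Sm (W d)) (p : W d) (h : ℝ),
      HasDerivAt (fun h : ℝ => G (p + h • v)) (D v G (p + h • v)) h := fun G p h => by
    have h1 : HasDerivAt (fun h : ℝ => p + h • v) v h := by
      simpa using ((hasDerivAt_id h).smul_const v).const_add p
    exact ((G.differentiable (p + h • v)).hasFDerivAt.comp_hasDerivAt h h1)
  ext ⟨t, x⟩
  have h1 := line (cv hK F) (t, x) 0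
  have hc : Continuous fun q : ℝ × ℝ => D v F ((t - q.2, x) + q.1 • v) :=
    (D v F).continuous.comp (by fun_prop)
  obtain ⟨M, hM⟩ := ((isCompact_Icc (a := (-1 : ℝ)) (b := 1)).prod
    (isCompact_Icc (a := -T) (b := T))).exists_bound_of_continuousOn hc.continuousOn
  have cF : ∀ (G : Sm (W d)) (h : ℝ), Continuous fun s : ℝ => G ((t - s, x) + h • v) := fun G h =>
    G.continuous.comp (by fun_prop)
  have h2 := (hasDerivAt_integral_of_dominated_loc_of_deriv_le (μ := volume) (x₀ := (0 : ℝ))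
    (F := fun (h : ℝ) (s : ℝ) => K s * F ((t - s, x) + h • v))
    (F' := fun (h : ℝ) (s : ℝ) => K s * D v F ((t - s, x) + h • v))
    (bound := fun s => M * ‖K s‖) (s := Icc (-1) 1)
    (Icc_mem_nhds (by norm_num) (by norm_num))
    (Eventually.of_forall fun h => (hK.mul (cF F h)).int.1)
    (hK.mul (cF F 0)).int (hK.mul (cF (D v F) 0)).int.1
    (Eventually.of_forall fun s h hh => by
      rw [norm_mul, mul_comm]
      rcases le_or_gt |s| T with hs | hs
      · exact mul_le_mul_of_nonneg_right (hM (h, s) ⟨hh, abs_le.1 hs⟩) (norm_nonneg _)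
      · simp [hK.supp s hs])
    (hK.int.norm.const_mul M)
    (Eventually.of_forall fun s h _ => (line F (t - s, x) h).const_mul (K s))).2
  have e : (fun h : ℝ => cv hK F ((t, x) + h • v))
      = fun h : ℝ => ∫ s, K s * F ((t - s, x) + h • v) := by
    funext h
    change ∫ s, K s * F (t + h • v.1 - s, x + h • v.2) = _
    refine integral_congr_ae (Eventually.of_forall fun s => ?_)
    simp only [Prod.smul_def, Prod.mk_add_mk]
    rw [sub_add_eq_add_sub]
  rw [e] at h1
  have := h1.unique h2
  simpa [cv_apply] using this

theorem cv_lift_mul (f : Sm (E d)) (F : Sm (W d)) : cv hK (lift f * F) = lift f * cv hK F := by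
  ext ⟨t, x⟩
  simp only [cv_apply, Sm.mul_apply, lift_apply, mul_left_comm _ (f x)]
  exact integral_const_mul _ _

theorem PW_cv (F : Sm (W d)) : PW A (cv hK F) = cv hK (PW A F) := by
  simp only [PW, map_sum, D_cv]
  refine sum_congr rfl fun i _ => sum_congr rfl fun j _ => ?_
  rw [← cv_lift_mul, D_cv]

theorem LS.cv (hF : LS F) : LS (cv hK F) := fun S => by
  obtain ⟨K', hK', h⟩ := hF (S + T)
  refine ⟨K', hK', fun t ht x hx => ?_⟩
  rw [cv_apply]
  refine (integral_congr_ae (Eventually.of_forall fun s => ?_)).trans (integral_zero _ _)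
  rcases le_or_gt |s| T with hs | hs
  · simp only [h (t - s) ((abs_sub _ _).trans (by linarith)) x hx, mul_zero]
  · simp only [hK.supp s hs, zero_mul]

theorem Sol.cv (h : Sol A ψ) : Sol A (cv hK ψ) :=
  ⟨Weq_iff.2 (by rw [PW_cv, ← Weq_iff.1 h.eq, D_cv, D_cv]), h.ls.cv hK⟩

theorem Ker.deriv {K : Sm ℝ} (hK : Ker K T) : Ker (D 1 K) T :=
  Ker.of_smooth fun s hs => D_eq_zero_of_notMem (K := {s | |s| ≤ T})
    (isClosed_le continuous_abs continuous_const) (fun s hs => hK.supp s (not_le.1 hs))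
    (not_le.2 hs) _

theorem cv_Dt (F : Sm (W d)) : cv hK (Dt F) = cv hK.deriv F := by
  ext ⟨t, x⟩
  have h1 : ∀ s, HasDerivAt (fun s => K s * F (t - s, x))
      (D 1 K s * F (t - s, x) + K s * (Dt F (t - s, x) * -1)) s := fun s => by
    have h2 := (hasDerivAt_slice F (t - s) x).comp s ((hasDerivAt_id s).const_sub t)
    have h3 := (K.differentiable s).hasDerivAt
    rw [← D_one_apply] at h3
    exact h3.mul h2
  have i1 := (hK.deriv.mul (continuous_shift F t x)).int
  have i2 := (hK.mul (continuous_shift (Dt F) t x)).int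
  have i3 : Integrable fun s => K s * (Dt F (t - s, x) * -1) := by
    simpa only [mul_assoc] using i2.mul_const (-1)
  have := integral_eq_zero_of_hasDerivAt_of_integrable h1 (i1.add i3)
    (hK.mul (continuous_shift F t x)).int
  rw [integral_add i1 i3] at this
  simp only [mul_neg, mul_one, integral_neg] at this
  rw [cv_apply, cv_apply]
  linarith

end cv

theorem ed0_conv_le {G : ℝ → ℝ} (hG : Ker G T) {v : Sm (W d)} (hv : ∀ w, D w v (t, x) = ∫ s, G s * D w F (t - s, x)) :
    ed0 v (t, x) ≤ (∫ s, |G s|) * ∫ s, |G s| * ed0 F (t - s, x) := by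
  have h1 : ∀ w, D w v (t, x) ^ 2 ≤ (∫ s, |G s|) * ∫ s, |G s| * D w F (t - s, x) ^ 2 := fun w => by
    rw [hv w]; exact hG.sq_le (continuous_shift _ _ _)
  have hi : ∀ w, Integrable fun s => |G s| * D w F (t - s, x) ^ 2 := fun w =>
    (hG.abs.mul ((continuous_shift (D w F) t x).pow 2)).int
  have h2 : ∫ s, |G s| * ed0 F (t - s, x) = (∫ s, |G s| * Dt F (t - s, x) ^ 2)
      + ∑ i, ∫ s, |G s| * dx i F (t - s, x) ^ 2 := by
    rw [← integral_finsetSum _ fun i _ => hi _, ← integral_add (hi _)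
      (integrable_finsetSum _ fun i _ => hi _)]
    refine integral_congr_ae (Eventually.of_forall fun s => ?_)
    simp only [ed0, Sm.add_apply, Sm.pow_apply, Sm.sum_apply, mul_add, mul_sum]
  rw [h2, mul_add, mul_sum]
  simp only [ed0, Sm.add_apply, Sm.pow_apply, Sm.sum_apply]
  exact add_le_add (h1 _) (sum_le_sum fun i _ => h1 _)

theorem EB.edens_conv_le (h : EB A m L) {G : ℝ → ℝ} (hG : Ker G T) {v : Sm (W d)}
    (hv : ∀ w, D w v (t, x) = ∫ s, G s * D w F (t - s, x)) :
    edens A v (t, x) ≤ L / m * (∫ s, |G s|) * ∫ s, |G s| * edens A F (t - s, x) := by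
  have h1 := ed0_conv_le hG hv
  have hI : 0 ≤ ∫ s, |G s| := integral_nonneg fun s => abs_nonneg _
  have h2 : m * ∫ s, |G s| * ed0 F (t - s, x) ≤ ∫ s, |G s| * edens A F (t - s, x) := by
    rw [← integral_const_mul]
    refine integral_mono ((hG.abs.mul (continuous_shift _ t x)).int.const_mul m)
      (hG.abs.mul (continuous_shift _ t x)).int fun s => ?_
    have := mul_le_mul_of_nonneg_left (h.ed0_le F (t - s, x)) (abs_nonneg (G s))
    simp only
    linarith
  have hm := h.m_pos
  have h3 : ∫ s, |G s| * ed0 F (t - s, x) ≤ (∫ s, |G s| * edens A F (t - s, x)) / m := by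
    rw [le_div_iff₀ hm, mul_comm]; exact h2
  refine (h.edens_le v (t, x)).trans ((mul_le_mul_of_nonneg_left (h1.trans
    (mul_le_mul_of_nonneg_left h3 hI)) h.L_pos.le).trans (le_of_eq ?_))
  ring

theorem LS.shift_zero (hF : LS F) (t T : ℝ) :
    ∃ K, IsCompact K ∧ ∀ s, |s| ≤ T → ∀ x ∉ K, F (t - s, x) = 0 := by
  obtain ⟨K, hK, h⟩ := hF (|t| + T)
  exact ⟨K, hK, fun s hs x hx => h _ ((abs_sub _ _).trans (by linarith)) x hx⟩

theorem continuous_Em_kernel (μ : Sm (E d)) (F : Sm (W d)) (t : ℝ) :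
    Continuous fun p : W d => μ p.2 * F (t - p.1, p.2) :=
  (μ.continuous.comp continuous_snd).mul (F.continuous.comp (by fun_prop))

theorem integrable_ker_Em {G : ℝ → ℝ} (hG : Ker G T) (hF : LS F)
    (μ : Sm (E d)) (t : ℝ) : Integrable fun s => G s * Em A μ F (t - s) := by
  obtain ⟨K, hK, h0⟩ := (hF.edens A).shift_zero t T
  exact (hG.integrable_inner (continuous_Em_kernel μ (edens A F) t) hK
    fun s hs x hx => by simp [h0 s hs x hx]).2

theorem EB.Em_conv_le (h : EB A m L) {G : ℝ → ℝ} (hG : Ker G T) {v : Sm (W d)}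
    (hF : LS F) (hvL : LS v) (hv : ∀ w x, D w v (t, x) = ∫ s, G s * D w F (t - s, x))
    (hμ : ∀ x, 0 ≤ μ x) :
    Em A μ v t ≤ L / m * (∫ s, |G s|) * ∫ s, |G s| * Em A μ F (t - s) := by
  obtain ⟨K, hK, h0⟩ := (hF.edens A).shift_zero t T
  have h0' : ∀ s, |s| ≤ T → ∀ x ∉ K, μ x * edens A F (t - s, x) = 0 := fun s hs x hx => by
    simp [h0 s hs x hx]
  have hc := continuous_Em_kernel μ (edens A F) t
  have h1 := hG.abs.swap hc hK h0'
  have h2 := (hG.abs.integrable_inner hc hK h0').1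
  have e : ∫ s, |G s| * Em A μ F (t - s)
      = ∫ x, ∫ s, |G s| * (μ x * edens A F (t - s, x)) := h1.symm
  rw [e, ← integral_const_mul]
  refine integral_mono (hvL.integrable_mul_edens μ t) (h2.const_mul _) fun x => ?_
  have h3 := mul_le_mul_of_nonneg_left (h.edens_conv_le hG fun w => hv w x) (hμ x)
  simp only [Sm.mul_apply, slice_apply]
  refine h3.trans (le_of_eq ?_)
  simp only [mul_left_comm _ (μ x)]
  rw [integral_const_mul]
  ring

theorem edens_parallelogram (A : Fin d → Fin d → Sm (E d)) (F G : Sm (W d)) :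
    edens A (F + G) + edens A (F - G) = 2 * edens A F + 2 * edens A G := by
  simp only [edens, map_add, map_sub, mul_add, mul_sub, sum_add_distrib,
    sum_sub_distrib, add_mul, sub_mul]
  ring

theorem edens_smul (A : Fin d → Fin d → Sm (E d)) (c : ℝ) (F : Sm (W d)) :
    edens A (c • F) = c ^ 2 • edens A F := by
  simp only [edens, Derivation.map_smul, mul_smul_comm, ← Finset.smul_sum, smul_mul_assoc,
    smul_smul, smul_add, smul_pow, sq]

theorem EB.edens_sub_le (h : EB A m L) (F G : Sm (W d)) (p : W d) :
    edens A (F - G) p ≤ 2 * edens A F p + 2 * edens A G p := by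
  have h1 := congrArg (fun f : Sm (W d) => f p) (edens_parallelogram A F G)
  simp only [Sm.add_apply, Sm.mul_apply, Sm.ofNat_apply] at h1
  linarith [h.edens_nonneg (F + G) p]

theorem EB.edens_add_le (h : EB A m L) (F G : Sm (W d)) (p : W d) :
    edens A (F + G) p ≤ 2 * edens A F p + 2 * edens A G p := by
  have h1 := congrArg (fun f : Sm (W d) => f p) (edens_parallelogram A F G)
  simp only [Sm.add_apply, Sm.mul_apply, Sm.ofNat_apply] at h1
  linarith [h.edens_nonneg (F - G) p]

theorem EB.Em_sub_le (h : EB A m L) {G : Sm (W d)} (hF : LS F) (hG : LS G) (hμ : ∀ x, 0 ≤ μ x) (t : ℝ) :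
    Em A μ (F - G) t ≤ 2 * Em A μ F t + 2 * Em A μ G t := by
  have i1 := (hF.integrable_mul_edens (A := A) μ t).const_mul 2
  have i2 := (hG.integrable_mul_edens (A := A) μ t).const_mul 2
  rw [Em, Em, Em, ← integral_const_mul, ← integral_const_mul, ← integral_add i1 i2]
  refine integral_mono ((hF.sub hG).integrable_mul_edens μ t) (i1.add i2) fun x => ?_
  have := mul_le_mul_of_nonneg_left (h.edens_sub_le F G (t, x)) (hμ x)
  simp only [Sm.mul_apply, slice_apply, Pi.add_apply]
  linarith

theorem Em_smul (c : ℝ) (F : Sm (W d)) (μ : Sm (E d)) (t : ℝ) :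
    Em A μ (c • F) t = c ^ 2 * Em A μ F t := by
  rw [Em, Em, ← integral_const_mul, edens_smul]
  refine integral_congr_ae (Eventually.of_forall fun x => ?_)
  simp only [Sm.mul_apply, slice_apply, Sm.smul_apply]
  ring

/-- Constants controlling the moments of a kernel. -/
structure Mom (K : ℝ → ℝ) (T C : ℝ) : Prop extends Ker K T where
  zero : ∫ s, |K s| ≤ C
  one : ∫ s, |K s| * |s| ≤ C

theorem EB.Em_cv_le (h : EB A m L) {K : Sm ℝ} (hK : Ker K T) (hM : Mom K T C)
    (hψ : Sol A ψ) (hμ : ∀ x, 0 ≤ μ x) (hμ1 : ∀ x, gsq μ x ≤ 1) :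
    Em A μ (cv hK ψ) 0 ≤ L / m * C ^ 2 * (Em A μ ψ 0 + L / m * Em A 1 ψ 0) := by
  have hI : 0 ≤ ∫ s, |K s| := integral_nonneg fun s => abs_nonneg _
  have hC : 0 ≤ C := hI.trans hM.zero
  have hl := h.speed_pos
  have hE := h.Em_nonneg (μ := 1) (fun x => zero_le_one) ψ 0
  have hEm := h.Em_nonneg hμ ψ 0
  have h1 := h.Em_conv_le (A := A) (v := cv hK ψ) (F := ψ) (t := 0) hK hψ.ls (hψ.ls.cv hK)
    (fun w x => by rw [D_cv, cv_apply]) hμ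
  have i1 : Integrable fun s => |K s| * (Em A μ ψ 0) := hK.abs.int.mul_const _
  have i2 : Integrable fun s => |K s| * |s| * (L / m * Em A 1 ψ 0) :=
    (hK.abs.mul continuous_abs).int.mul_const _
  have h2 : ∫ s, |K s| * Em A μ ψ (0 - s)
      ≤ (∫ s, |K s|) * Em A μ ψ 0 + (∫ s, |K s| * |s|) * (L / m * Em A 1 ψ 0) := by
    rw [← integral_mul_const, ← integral_mul_const, ← integral_add i1 i2]
    refine integral_mono (integrable_ker_Em hK.abs hψ.ls μ 0) (i1.add i2) fun s => ?_
    have h3 := h.Em_growth hψ hμ1 (0 - s) 0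
    rw [zero_sub, sub_zero, abs_neg] at h3
    have h4 := mul_le_mul_of_nonneg_left h3 (abs_nonneg (K s))
    simp only [zero_sub, Pi.add_apply]
    linarith
  have h5 : (∫ s, |K s|) * Em A μ ψ 0 + (∫ s, |K s| * |s|) * (L / m * Em A 1 ψ 0)
      ≤ C * (Em A μ ψ 0 + L / m * Em A 1 ψ 0) := by
    rw [mul_add]
    exact add_le_add (mul_le_mul_of_nonneg_right hM.zero hEm)
      (mul_le_mul_of_nonneg_right hM.one (mul_nonneg hl.le hE))
  refine h1.trans ?_
  have h6 : 0 ≤ ∫ s, |K s| * Em A μ ψ (0 - s) :=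
    integral_nonneg fun s => mul_nonneg (abs_nonneg _) (h.Em_nonneg hμ ψ _)
  calc L / m * (∫ s, |K s|) * ∫ s, |K s| * Em A μ ψ (0 - s)
      ≤ L / m * C * (C * (Em A μ ψ 0 + L / m * Em A 1 ψ 0)) :=
        mul_le_mul (mul_le_mul_of_nonneg_left hM.zero hl.le) (h2.trans h5) h6
          (mul_nonneg hl.le hC)
    _ = _ := by ring

/-- The kernel of integration over `(0, S]`. -/
theorem Ker.indicator (S : ℝ) : Ker ((Ioc 0 S).indicator fun _ => (1 : ℝ)) S :=
  ⟨(integrable_indicator_iff measurableSet_Ioc).2 (integrableOn_const (by simp)), fun s hs =>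
    indicator_of_notMem (fun h => by rw [abs_of_pos h.1] at hs; linarith [h.2]) _⟩

theorem integral_indicator_Ioc (hS : 0 ≤ S) (f : ℝ → ℝ) :
    ∫ s, (Ioc 0 S).indicator (fun _ => (1 : ℝ)) s * f s = ∫ s in (0 : ℝ)..S, f s := by
  rw [intervalIntegral.integral_of_le hS, ← integral_indicator measurableSet_Ioc]
  refine integral_congr_ae (Eventually.of_forall fun s => ?_)
  by_cases h : s ∈ Ioc 0 S <;> simp [h]

theorem sq_diff_le (F : Sm (W d)) (t s : ℝ) (x : E d) :
    (F (t, x) - F (t - s, x)) ^ 2 ≤ s ^ 2 * ∫ σ in (0 : ℝ)..1, Dt F (t - σ * s, x) ^ 2 := by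
  have hc : Continuous fun σ : ℝ => Dt F (t - σ * s, x) := (Dt F).continuous.comp (by fun_prop)
  have h1 : ∀ σ, HasDerivAt (fun σ : ℝ => F (t - σ * s, x)) (Dt F (t - σ * s, x) * -s) σ :=
    fun σ => HasDerivAt.comp (h₂ := fun τ => F (τ, x)) (h := fun σ => t - σ * s) σ
      (hasDerivAt_slice F (t - σ * s) x) (by simpa using ((hasDerivAt_id σ).mul_const s).const_sub t)
  have h2 := intervalIntegral.integral_eq_sub_of_hasDerivAt (a := 0) (b := 1) (fun σ _ => h1 σ)
    ((hc.mul continuous_const).intervalIntegrable _ _)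
  rw [intervalIntegral.integral_mul_const, one_mul, zero_mul, sub_zero] at h2
  have h3 := (Ker.indicator 1).sq_le hc
  have h4 : ∀ s, |(Ioc (0 : ℝ) 1).indicator (fun _ => (1 : ℝ)) s|
      = (Ioc (0 : ℝ) 1).indicator (fun _ => (1 : ℝ)) s := fun s =>
    abs_of_nonneg (indicator_nonneg (fun _ _ => zero_le_one) s)
  simp only [h4, integral_indicator_Ioc zero_le_one] at h3
  rw [integral_indicator measurableSet_Ioc] at h3
  simp only [integral_const, MeasurableSet.univ, measureReal_restrict_apply, univ_inter,
    volume_real_Ioc, sub_zero, smul_eq_mul, mul_one, zero_le_one, sup_of_le_left, one_mul] at h3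
  have h5 : F (t, x) - F (t - s, x) = s * ∫ σ in (0 : ℝ)..1, Dt F (t - σ * s, x) := by linarith
  rw [h5, mul_pow]
  exact mul_le_mul_of_nonneg_left h3 (sq_nonneg s)

theorem continuous_slide (F : Sm (W d)) (t s : ℝ) :
    Continuous fun p : W d => F (t - p.1 * s, p.2) := F.continuous.comp (by fun_prop)

theorem LS.slide_zero (hF : LS F) (t s : ℝ) :
    ∃ K, IsCompact K ∧ ∀ σ, |σ| ≤ 1 → ∀ x ∉ K, F (t - σ * s, x) = 0 := by
  obtain ⟨K, hK, h⟩ := hF (|t| + |s|)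
  refine ⟨K, hK, fun σ hσ x hx => h _ ((abs_sub _ _).trans ?_) x hx⟩
  rw [abs_mul]
  have := mul_le_of_le_one_left (abs_nonneg s) hσ
  linarith

/-- The part of a solution removed by a time average is controlled by the time derivative. -/
theorem EB.energy_remainder_le (h : EB A m L) {K : Sm ℝ} (hK : Ker K T)
    (hψ : Sol A ψ) :
    Em A 1 ((∫ s, K s) • ψ - cv hK ψ) 0
      ≤ L / m * (∫ s, |K s|) * (∫ s, |K s| * s ^ 2) * Em A 1 (Dt ψ) 0 := by
  set v := (∫ s, K s) • ψ - cv hK ψ with hv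
  have hm := h.m_pos
  have hL := h.L_pos
  have hI : 0 ≤ ∫ s, |K s| := integral_nonneg fun s => abs_nonneg _
  have hDv : ∀ w x, D w v (0, x) = ∫ s, K s * (D w ψ (0, x) - D w ψ (0 - s, x)) := fun w x => by
    simp only [hv, map_sub, Derivation.map_smul, D_cv, Sm.sub_apply, Sm.smul_apply, cv_apply,
      mul_sub]
    rw [integral_sub (hK.int.mul_const _) (hK.mul (continuous_shift (D w ψ) 0 x)).int,
      integral_mul_const]
  set q : W d → ℝ := fun p => (Dt ψ (0, p.2) - Dt ψ (0 - p.1, p.2)) ^ 2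
    + ∑ i, (dx i ψ (0, p.2) - dx i ψ (0 - p.1, p.2)) ^ 2 with hq
  have hDc : ∀ w, Continuous fun p : W d => (D w ψ (0, p.2) - D w ψ (0 - p.1, p.2)) ^ 2 := fun w =>
    (((D w ψ).continuous.comp (by fun_prop)).sub ((D w ψ).continuous.comp (by fun_prop))).pow 2
  have hqc : Continuous q := (hDc _).add (continuous_finsetSum _ fun i _ => hDc _)
  obtain ⟨S, hS, hS0⟩ := hψ.ls (T + 1)
  have hD0 : ∀ w, ∃ S, IsCompact S ∧ ∀ s, |s| ≤ T → ∀ x ∉ S,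
      (D w ψ (0, x) - D w ψ (0 - s, x)) ^ 2 = 0 := fun w => by
    obtain ⟨S, hS, hS0⟩ := (hψ.ls.D w) T
    refine ⟨S, hS, fun s hs x hx => ?_⟩
    rw [hS0 0 (by rw [abs_zero]; exact (abs_nonneg s).trans hs) x hx,
      hS0 (0 - s) (by rw [zero_sub, abs_neg]; exact hs) x hx]
    simp
  choose S hS hS0 using hD0
  set S' : Set (E d) := S (1, 0) ∪ ⋃ i, S (0, EuclideanSpace.single i 1)
  have hS' : IsCompact S' := (hS _).union (isCompact_iUnion fun i => hS _)
  have hq0 : ∀ s, |s| ≤ T → ∀ x ∉ S', q (s, x) = 0 := fun s hs x hx => by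
    simp only [S', mem_union, mem_iUnion, not_or, not_exists] at hx
    simp only [hq, hS0 _ s hs x hx.1, hS0 _ s hs x (hx.2 _), Finset.sum_const_zero, add_zero]
  have hpt : ∀ x, edens A v (0, x) ≤ L * (∫ s, |K s|) * ∫ s, |K s| * q (s, x) := fun x => by
    have h1 : ∀ w, D w v (0, x) ^ 2 ≤ (∫ s, |K s|) *
        ∫ s, |K s| * (D w ψ (0, x) - D w ψ (0 - s, x)) ^ 2 := fun w => by
      rw [hDv w x]; exact hK.sq_le (continuous_const.sub (continuous_shift (D w ψ) 0 x))
    have hi : ∀ w, Integrable fun s => |K s| * (D w ψ (0, x) - D w ψ (0 - s, x)) ^ 2 := fun w =>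
      (hK.abs.mul ((continuous_const.sub (continuous_shift (D w ψ) 0 x)).pow 2)).int
    have h2 : ∫ s, |K s| * q (s, x) = (∫ s, |K s| * (Dt ψ (0, x) - Dt ψ (0 - s, x)) ^ 2)
        + ∑ i, ∫ s, |K s| * (dx i ψ (0, x) - dx i ψ (0 - s, x)) ^ 2 := by
      rw [← integral_finsetSum _ fun i _ => hi _, ← integral_add (hi _)
        (integrable_finsetSum _ fun i _ => hi _)]
      refine integral_congr_ae (Eventually.of_forall fun s => ?_)
      simp only [hq, mul_add, mul_sum]
    refine (h.edens_le v (0, x)).trans ?_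
    rw [mul_assoc]
    refine mul_le_mul_of_nonneg_left ?_ hL.le
    rw [h2, mul_add, mul_sum]
    simp only [ed0, Sm.add_apply, Sm.pow_apply, Sm.sum_apply]
    exact add_le_add (h1 _) (sum_le_sum fun i _ => h1 _)
  have hqs : ∀ s, ∫ x, q (s, x) ≤ s ^ 2 * (Em A 1 (Dt ψ) 0 / m) := fun s => by
    obtain ⟨S₂, hS₂, h₂⟩ := ((hψ.Dt.ls.edens A)).slide_zero 0 s
    have hk := (Ker.indicator 1).swap (continuous_slide (edens A (Dt ψ)) 0 s) hS₂ h₂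
    have hki := ((Ker.indicator 1).integrable_inner (continuous_slide (edens A (Dt ψ)) 0 s)
      hS₂ h₂).1
    simp only [integral_indicator_Ioc zero_le_one] at hk hki
    have he : ∀ σ, (∫ x, edens A (Dt ψ) (0 - σ * s, x)) = Em A 1 (Dt ψ) 0 := fun σ => by
      rw [← h.energy_eq hψ.Dt (0 - σ * s) 0, Em, one_mul]
      rfl
    simp only [he, intervalIntegral.integral_const, sub_zero, one_smul] at hk
    have : s ^ 2 * (Em A 1 (Dt ψ) 0 / m)
        = ∫ x, s ^ 2 / m * ∫ σ in (0 : ℝ)..1, edens A (Dt ψ) (0 - σ * s, x) := by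
      rw [integral_const_mul, hk]; ring
    rw [this]
    refine integral_mono_of_nonneg (Eventually.of_forall fun x => ?_) (hki.const_mul _)
      (Eventually.of_forall fun x => ?_)
    · simp only [hq, Pi.zero_apply]; positivity
    · have hii : ∀ w, IntervalIntegrable (fun σ : ℝ => D w (Dt ψ) (0 - σ * s, x) ^ 2)
          volume 0 1 := fun w =>
        (((D w (Dt ψ)).continuous.comp (by fun_prop)).pow 2).intervalIntegrable _ _
      have hsum : IntervalIntegrable (fun σ : ℝ => ∑ i, dx i (Dt ψ) (0 - σ * s, x) ^ 2)
          volume 0 1 := by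
        refine Continuous.intervalIntegrable (continuous_finsetSum _ fun i _ => ?_) _ _
        exact ((dx i (Dt ψ)).continuous.comp (by fun_prop)).pow 2
      have h3 : q (s, x) ≤ s ^ 2 * ∫ σ in (0 : ℝ)..1, ed0 (Dt ψ) (0 - σ * s, x) := by
        simp only [ed0, Sm.add_apply, Sm.pow_apply, Sm.sum_apply]
        rw [intervalIntegral.integral_add (hii _) hsum,
          intervalIntegral.integral_finsetSum fun i _ => hii _, mul_add, mul_sum]
        refine add_le_add (sq_diff_le (Dt ψ) 0 s x) (sum_le_sum fun i _ => ?_)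
        rw [D_comm]
        exact sq_diff_le (dx i ψ) 0 s x
      have h4 : m * ∫ σ in (0 : ℝ)..1, ed0 (Dt ψ) (0 - σ * s, x)
          ≤ ∫ σ in (0 : ℝ)..1, edens A (Dt ψ) (0 - σ * s, x) := by
        rw [← intervalIntegral.integral_const_mul]
        refine intervalIntegral.integral_mono_on zero_le_one ?_ ?_ fun σ _ => h.ed0_le _ _
        · exact (continuous_const.mul ((ed0 (Dt ψ)).continuous.comp
            (by fun_prop))).intervalIntegrable _ _
        · exact ((edens A (Dt ψ)).continuous.comp (by fun_prop)).intervalIntegrable _ _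
      refine h3.trans ?_
      beta_reduce
      rw [div_mul_eq_mul_div, mul_div_assoc]
      refine mul_le_mul_of_nonneg_left ?_ (sq_nonneg s)
      rw [le_div_iff₀ hm, mul_comm]
      exact h4
  have hsw := hK.abs.swap hqc hS' hq0
  obtain ⟨hi1, hi2⟩ := hK.abs.integrable_inner hqc hS' hq0
  have hvL : LS v := (hψ.ls.smul _).sub (hψ.ls.cv hK)
  have e1 : Em A 1 v 0 ≤ L * (∫ s, |K s|) * ∫ s, |K s| * ∫ x, q (s, x) := by
    rw [← hsw, ← integral_const_mul]
    refine integral_mono (hvL.integrable_mul_edens 1 0) (hi1.const_mul _) fun x => ?_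
    simp only [one_mul]
    exact hpt x
  have e2 : ∫ s, |K s| * ∫ x, q (s, x) ≤ (∫ s, |K s| * s ^ 2) * (Em A 1 (Dt ψ) 0 / m) := by
    rw [← integral_mul_const]
    refine integral_mono hi2 ((hK.abs.mul (continuous_pow 2)).int.mul_const _) fun s => ?_
    have := mul_le_mul_of_nonneg_left (hqs s) (abs_nonneg (K s))
    simp only
    linarith
  refine e1.trans ((mul_le_mul_of_nonneg_left e2 (mul_nonneg hL.le hI)).trans (le_of_eq ?_))
  ring

open FourierTransform SchwartzMap

/-- Cosine transform. -/
noncomputable def cT (f : ℝ → ℝ) (l : ℝ) : ℝ := ∫ s, cos (l * s) * f s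

/-- Sine transform. -/
noncomputable def sT (f : ℝ → ℝ) (l : ℝ) : ℝ := ∫ s, sin (l * s) * f s

section

variable {f : Sm ℝ} {S : ℝ}

theorem Sm.hasCompactSupport (hf : ∀ s, S < |s| → f s = 0) : HasCompactSupport f :=
  HasCompactSupport.intro (isCompact_Icc (a := -S) (b := S)) fun s hs => hf s <| by
    by_contra! h
    exact hs (abs_le.mp h)

theorem Sm.integrable_mul (hf : ∀ s, S < |s| → f s = 0) {g : ℝ → ℝ} (hg : Continuous g) :
    Integrable fun s => g s * f s :=
  (hg.mul f.continuous).integrable_of_hasCompactSupport (Sm.hasCompactSupport hf).mul_left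

theorem Sm.fourier_eq (hf : ∀ s, S < |s| → f s = 0) (w : ℝ) :
    𝓕 (fun s => (f s : ℂ)) w
      = (cT f (2 * Real.pi * w) : ℂ) - (sT f (2 * Real.pi * w) : ℂ) * Complex.I := by
  have h1 : Integrable fun s => ((Real.cos (2 * Real.pi * w * s) * f s : ℝ) : ℂ) :=
    (Sm.integrable_mul hf (by fun_prop)).ofReal
  have h2 : Integrable fun s => ((Real.sin (2 * Real.pi * w * s) * f s : ℝ) : ℂ) * Complex.I :=
    (Integrable.ofReal (Sm.integrable_mul hf (by fun_prop))).mul_const Complex.I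
  rw [Real.fourier_real_eq_integral_exp_smul, cT, sT, ← integral_complex_ofReal,
    ← integral_complex_ofReal, ← integral_mul_const]
  rw [← integral_sub h1 h2]
  refine integral_congr_ae (Eventually.of_forall fun s => ?_)
  simp only [smul_eq_mul]
  rw [show (-2 * Real.pi * s * w) = -(2 * Real.pi * w * s) by ring]
  rw [Complex.exp_mul_I, ← Complex.ofReal_cos, ← Complex.ofReal_sin, Real.cos_neg, Real.sin_neg]
  push_cast
  ring

theorem Sm.normSq_fourier (hf : ∀ s, S < |s| → f s = 0) (w : ℝ) :
    ‖𝓕 (fun s => (f s : ℂ)) w‖ ^ 2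
      = cT f (2 * Real.pi * w) ^ 2 + sT f (2 * Real.pi * w) ^ 2 := by
  rw [Sm.fourier_eq hf, ← Complex.normSq_eq_norm_sq, Complex.normSq_apply]
  simp
  ring

/-- Complexification as a Schwartz function. -/
noncomputable def Sm.toS (hf : ∀ s, S < |s| → f s = 0) : 𝓢(ℝ, ℂ) :=
  HasCompactSupport.toSchwartzMap (f := fun s => (f s : ℂ))
    ((Sm.hasCompactSupport hf).comp_left (g := ((↑) : ℝ → ℂ)) (by simp))
    (Complex.ofRealCLM.contDiff.comp f.smooth)

theorem Sm.toS_apply (hf : ∀ s, S < |s| → f s = 0) (w : ℝ) : Sm.toS hf w = (f w : ℂ) := rfl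

theorem Sm.fourier_toS (hf : ∀ s, S < |s| → f s = 0) (w : ℝ) :
    𝓕 (Sm.toS hf) w = 𝓕 (fun s => (f s : ℂ)) w := by
  rw [SchwartzMap.fourier_coe]; rfl

theorem Sm.plancherel (hf : ∀ s, S < |s| → f s = 0) :
    Integrable (fun w => cT f (2 * Real.pi * w) ^ 2 + sT f (2 * Real.pi * w) ^ 2) ∧
    ∫ w, (cT f (2 * Real.pi * w) ^ 2 + sT f (2 * Real.pi * w) ^ 2) = ∫ s, f s ^ 2 := by
  simp only [← Sm.normSq_fourier hf, ← Sm.fourier_toS hf]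
  refine ⟨((𝓕 (Sm.toS hf)).memLp 2).integrable_norm_pow (by norm_num), ?_⟩
  rw [SchwartzMap.integral_norm_sq_fourier]
  refine integral_congr_ae (Eventually.of_forall fun s => ?_)
  simp [Sm.toS_apply]

end

/-- A smooth plateau function: one for `2 s² ≤ 1`, zero for `1 ≤ |s|`. -/
noncomputable def plat : Sm ℝ :=
  Sm.mk (fun s => smoothTransition (2 - 2 * s ^ 2))
    (smoothTransition.contDiff.comp (by fun_prop))

theorem plat_apply (s : ℝ) : plat s = smoothTransition (2 - 2 * s ^ 2) := rfl

theorem plat_nonneg (s : ℝ) : 0 ≤ plat s := smoothTransition.nonneg _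
theorem plat_le_one (s : ℝ) : plat s ≤ 1 := smoothTransition.le_one _

theorem plat_eq_one (h : 2 * s ^ 2 ≤ 1) : plat s = 1 :=
  smoothTransition.one_of_one_le (by linarith)

theorem plat_eq_zero (h : 1 ≤ |s|) : plat s = 0 :=
  smoothTransition.zero_of_nonpos (by nlinarith [sq_abs s])

theorem one_sub_plat_le (s : ℝ) : |1 - plat s| ≤ 2 * |s| := by
  rw [abs_of_nonneg (by linarith [plat_le_one s])]
  rcases le_total (2 * s ^ 2) 1 with h | h
  · rw [plat_eq_one h]; simp
  · have := plat_nonneg s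
    nlinarith [sq_abs s, abs_nonneg s]

/-- The low-pass kernel. -/
noncomputable def lpC : 𝓢(ℝ, ℂ) := 𝓕⁻ (Sm.toS (f := plat) (S := 1) fun _ hs => plat_eq_zero hs.le)

noncomputable def lp : Sm ℝ :=
  Sm.mk (fun s => (lpC s).re) (Complex.reCLM.contDiff.comp (lpC.smooth ⊤))

theorem lp_apply (s : ℝ) : lp s = (lpC s).re := rfl

theorem lp_moment (k : ℕ) : Integrable fun s => |lp s| * |s| ^ k := by
  refine (lpC.integrable_pow_mul volume k).mono'
    (by have := lp.continuous; fun_prop) (Eventually.of_forall fun s => ?_)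
  rw [norm_of_nonneg (by positivity), norm_eq_abs, mul_comm]
  exact mul_le_mul_of_nonneg_left (Complex.abs_re_le_norm _) (by positivity)

theorem integrable_lp : Integrable lp := by
  have := lp_moment 0
  simp only [pow_zero, mul_one] at this
  exact (integrable_norm_iff lp.continuous.aestronglyMeasurable).mp this

theorem integral_lp : ∫ s, lp s = 1 := by
  have h1 : ∫ s, lpC s = 1 := by
    have h : 𝓕 lpC 0 = 1 := by
      rw [lpC, FourierTransform.fourier_fourierInv_eq]
      rw [Sm.toS_apply, plat_eq_one] <;> simp
    rw [SchwartzMap.fourier_coe, fourier_real_eq] at h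
    simpa using h
  have h2 := integral_re (lpC.integrable (μ := volume))
  rw [h1] at h2
  simp only [RCLike.re_eq_complex_re, Complex.one_re] at h2
  exact h2

theorem lp_filter {f : Sm ℝ} (hf : ∀ s, S < |s| → f s = 0) :
    Integrable (fun t => (∫ s, lp s * f (t - s)) ^ 2) ∧
    ∫ t, (∫ s, lp s * f (t - s)) ^ 2
      ≤ ∫ w in Icc (-1 : ℝ) 1, (cT f (2 * π * w) ^ 2 + sT f (2 * π * w) ^ 2) := by
  set b : 𝓢(ℝ, ℂ) := Sm.toS (f := plat) (S := 1) fun _ hs => plat_eq_zero hs.le with hb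
  have hb1 : ∀ w, b w = (plat w : ℂ) := fun w => rfl
  have hg : HasCompactSupport fun w => b w * 𝓕 (Sm.toS hf) w :=
    (HasCompactSupport.intro (isCompact_Icc (a := (-1 : ℝ)) (b := 1)) fun s hs => by
      rw [hb1, plat_eq_zero]; · simp
      by_contra! h
      exact hs (abs_le.mp h.le)).mul_right
  let g : 𝓢(ℝ, ℂ) := hg.toSchwartzMap ((b.smooth ⊤).mul ((𝓕 (Sm.toS hf)).smooth ⊤))
  have hgw : ∀ w, g w = b w * 𝓕 (Sm.toS hf) w := fun w => rfl
  have hcv : ∀ t, ∫ s, lpC s * (f (t - s) : ℂ) = 𝓕⁻ g t := by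
    intro t
    have hs : ∀ s, |t| + S < |s| → f (t - s) = 0 := fun s hs => hf _ (by
      have := abs_sub_abs_le_abs_sub s t
      rw [abs_sub_comm] at this
      linarith)
    let ft : Sm ℝ := Sm.mk (fun s => f (t - s)) (f.smooth.comp (by fun_prop))
    have h1 := SchwartzMap.integral_fourierInv_mul_eq b (Sm.toS (f := ft) hs)
    have h2 : ∀ w, 𝓕⁻ (Sm.toS (f := ft) hs) w
        = Complex.exp (2 * π * t * w * Complex.I) * 𝓕 (Sm.toS hf) w := by
      intro w
      rw [SchwartzMap.fourierInv_coe, fourierInv_eq_fourier_neg,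
        fourier_real_eq_integral_exp_smul, SchwartzMap.fourier_coe,
        fourier_real_eq_integral_exp_smul, ← integral_const_mul,
        ← integral_sub_left_eq_self _ volume t]
      refine integral_congr_ae (Eventually.of_forall fun s => ?_)
      change _ • ((f (t - (t - s)) : ℝ) : ℂ) = _ * (_ • ((f s : ℝ) : ℂ))
      rw [sub_sub_cancel, smul_eq_mul, smul_eq_mul, ← mul_assoc, ← Complex.exp_add]
      congr 2
      push_cast
      ring
    rw [SchwartzMap.fourierInv_coe, fourierInv_eq', ]
    refine h1.trans (integral_congr_ae (Eventually.of_forall fun w => ?_))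
    simp only [h2, hgw, smul_eq_mul]
    rw [mul_left_comm]
    congr 2
    simp
    ring_nf
  have hre : ∀ t, ∫ s, lp s * f (t - s) = (𝓕⁻ g t).re := by
    intro t
    have hi : Integrable fun s => lpC s * (f (t - s) : ℂ) := by
      refine Continuous.integrable_of_hasCompactSupport ?_ ?_
      · have := lpC.continuous; have := f.continuous; fun_prop
      · refine HasCompactSupport.mul_left (HasCompactSupport.intro
          (isCompact_Icc (a := t - S) (b := t + S)) fun s hs => ?_)
        rw [hf, Complex.ofReal_zero]
        by_contra! h
        exact hs ⟨by linarith [(abs_le.mp h).2], by linarith [(abs_le.mp h).1]⟩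
    rw [← hcv, ← RCLike.re_eq_complex_re, ← integral_re hi]
    simp [lp_apply]
  have hL2 : ∀ u : 𝓢(ℝ, ℂ), Integrable fun t => ‖u t‖ ^ 2 := fun u =>
    (u.memLp 2).integrable_norm_pow (by norm_num)
  have hle : ∀ t, (∫ s, lp s * f (t - s)) ^ 2 ≤ ‖𝓕⁻ g t‖ ^ 2 := fun t => by
    rw [hre, ← sq_abs]
    exact pow_le_pow_left₀ (abs_nonneg _) (Complex.abs_re_le_norm _) 2
  have hint : Integrable (fun t => (∫ s, lp s * f (t - s)) ^ 2) := by
    refine (hL2 (𝓕⁻ g)).mono' ?_ (Eventually.of_forall fun t => ?_)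
    · simp only [hre]
      exact ((Complex.continuous_re.comp (𝓕⁻ g).continuous).pow 2).aestronglyMeasurable
    · rw [norm_of_nonneg (sq_nonneg _)]; exact hle t
  refine ⟨hint, (integral_mono hint (hL2 _) hle).trans ?_⟩
  have hpl := SchwartzMap.integral_norm_sq_fourier (𝓕⁻ g)
  rw [FourierTransform.fourier_fourierInv_eq] at hpl
  rw [← hpl, ← integral_indicator measurableSet_Icc]
  refine integral_mono (hL2 g) ((Sm.plancherel hf).1.indicator measurableSet_Icc) fun w => ?_
  simp only [hgw, norm_mul, mul_pow]
  by_cases hw : w ∈ Icc (-1 : ℝ) 1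
  · rw [indicator_of_mem hw, Sm.fourier_toS, Sm.normSq_fourier hf, hb1]
    refine mul_le_of_le_one_left (by positivity) ?_
    rw [Complex.norm_real, norm_of_nonneg (plat_nonneg w)]
    exact pow_le_one₀ (plat_nonneg w) (plat_le_one w)
  · rw [indicator_of_notMem hw, hb1, plat_eq_zero]
    · simp
    · by_contra! h
      exact hw (abs_le.mp h.le)

theorem lp_filter_scaled {f : Sm ℝ} (hf : ∀ s, S < |s| → f s = 0) (hω : 0 < ω) :
    Integrable (fun t => (∫ s, ω * lp (ω * s) * f (t - s)) ^ 2) ∧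
    ∫ t, (∫ s, ω * lp (ω * s) * f (t - s)) ^ 2
      ≤ ∫ w in Icc (-ω) ω, (cT f (2 * π * w) ^ 2 + sT f (2 * π * w) ^ 2) := by
  let g : Sm ℝ := Sm.mk (fun s => f (ω⁻¹ * s)) (f.smooth.comp (by fun_prop))
  have hgs : ∀ s, ω * S < |s| → g s = 0 := fun s hs => hf _ (by
    rw [abs_mul, abs_of_pos (inv_pos.mpr hω), lt_inv_mul_iff₀ hω]; exact hs)
  have e1 : ∀ t, ∫ s, ω * lp (ω * s) * f (t - s) = ∫ s, lp s * g (ω * t - s) := by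
    intro t
    have := Measure.integral_comp_mul_left (fun s => lp s * g (ω * t - s)) ω
    rw [abs_of_pos (inv_pos.mpr hω), smul_eq_mul] at this
    simp only [mul_assoc, integral_const_mul]
    have e : ∀ s, lp (ω * s) * f (t - s) = lp (ω * s) * g (ω * t - ω * s) := fun s => by
      change _ = _ * f (ω⁻¹ * (ω * t - ω * s))
      congr 2; field_simp
    simp only [e, this]
    field_simp
  have e2 : ∀ w, cT g w = ω * cT f (ω * w) := by
    intro w
    have := Measure.integral_comp_mul_left (fun s => cos (w * s) * g s) ω
    rw [abs_of_pos (inv_pos.mpr hω), smul_eq_mul] at this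
    rw [cT, cT, ← mul_inv_cancel_left₀ hω.ne' (∫ s, cos (w * s) * g s), ← this]
    congr 1
    refine integral_congr_ae (Eventually.of_forall fun s => ?_)
    change cos _ * f (ω⁻¹ * (ω * s)) = cos _ * f s
    rw [inv_mul_cancel_left₀ hω.ne', show w * (ω * s) = ω * w * s by ring]
  have e3 : ∀ w, sT g w = ω * sT f (ω * w) := by
    intro w
    have := Measure.integral_comp_mul_left (fun s => sin (w * s) * g s) ω
    rw [abs_of_pos (inv_pos.mpr hω), smul_eq_mul] at this
    rw [sT, sT, ← mul_inv_cancel_left₀ hω.ne' (∫ s, sin (w * s) * g s), ← this]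
    congr 1
    refine integral_congr_ae (Eventually.of_forall fun s => ?_)
    change sin _ * f (ω⁻¹ * (ω * s)) = sin _ * f s
    rw [inv_mul_cancel_left₀ hω.ne', show w * (ω * s) = ω * w * s by ring]
  obtain ⟨h1, h2⟩ := lp_filter hgs
  simp only [e1]
  refine ⟨h1.comp_mul_left' hω.ne', ?_⟩
  have e4 := Measure.integral_comp_mul_left (fun t => (∫ s, lp s * g (t - s)) ^ 2) ω
  rw [abs_of_pos (inv_pos.mpr hω), smul_eq_mul] at e4
  rw [e4, inv_mul_le_iff₀ hω]
  refine h2.trans (le_of_eq ?_)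
  simp only [e2, e3]
  rw [← integral_indicator measurableSet_Icc, ← integral_indicator measurableSet_Icc]
  have e5 := Measure.integral_comp_mul_left ((Icc (-ω) ω).indicator fun w =>
    cT f (2 * π * w) ^ 2 + sT f (2 * π * w) ^ 2) ω
  rw [abs_of_pos (inv_pos.mpr hω), smul_eq_mul, ← mul_right_inj' (pow_pos hω 2).ne',
    ← integral_const_mul, ← mul_assoc, show ω ^ 2 * ω⁻¹ = ω by field_simp] at e5
  rw [← e5]
  refine integral_congr_ae (Eventually.of_forall fun w => ?_)
  have hiff : ω * w ∈ Icc (-ω) ω ↔ w ∈ Icc (-1 : ℝ) 1 := by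
    simp only [mem_Icc]
    constructor <;> rintro ⟨a, b⟩ <;> constructor <;> nlinarith
  by_cases hw : w ∈ Icc (-1 : ℝ) 1
  · rw [indicator_of_mem hw]
    simp only [indicator_of_mem (hiff.mpr hw)]
    ring_nf
  · rw [indicator_of_notMem hw]
    simp only [indicator_of_notMem (fun h => hw (hiff.mp h)), mul_zero]

/-- The low-pass kernel at frequency `ω`. -/
noncomputable def lpw (ω : ℝ) : Sm ℝ :=
  Sm.mk (fun s => ω * lp (ω * s)) (contDiff_const.mul (lp.smooth.comp (by fun_prop)))

/-- The low-pass kernel at frequency `ω`, truncated to times of size `T`. -/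
noncomputable def kT (ω T : ℝ) : Sm ℝ :=
  lpw ω * Sm.mk (fun s => plat (T⁻¹ * s)) (plat.smooth.comp (by fun_prop))

theorem lpw_apply (ω s : ℝ) : lpw ω s = ω * lp (ω * s) := rfl
theorem kT_apply (ω T s : ℝ) : kT ω T s = lpw ω s * plat (T⁻¹ * s) := rfl

theorem kT_ker (hT : 0 < T) : Ker (kT ω T) T := Ker.of_smooth fun s hs => by
  rw [kT_apply, plat_eq_zero, mul_zero]
  rw [abs_mul, abs_of_pos (inv_pos.mpr hT), le_inv_mul_iff₀ hT]
  linarith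

theorem lpw_moment (hω : 0 < ω) (k : ℕ) : Integrable (fun s => |lpw ω s| * |s| ^ k) ∧
    ∫ s, |lpw ω s| * |s| ^ k = (ω ^ k)⁻¹ * ∫ s, |lp s| * |s| ^ k := by
  have e : ∀ s, |lpw ω s| * |s| ^ k = (ω ^ k)⁻¹ * ω * (|lp (ω * s)| * |ω * s| ^ k) := fun s => by
    rw [lpw_apply, abs_mul, abs_mul, abs_of_pos hω, mul_pow]
    field_simp
  simp only [e]
  refine ⟨((lp_moment k).comp_mul_left' hω.ne').const_mul _, ?_⟩
  have := Measure.integral_comp_mul_left (fun s => |lp s| * |s| ^ k) ω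
  rw [abs_of_pos (inv_pos.mpr hω), smul_eq_mul] at this
  rw [integral_const_mul, this]
  field_simp

theorem abs_kT_le (s : ℝ) : |kT ω T s| ≤ |lpw ω s| := by
  rw [kT_apply, abs_mul, abs_of_nonneg (plat_nonneg _)]
  exact mul_le_of_le_one_right (abs_nonneg _) (plat_le_one _)

theorem kT_moment (hω : 0 < ω) (hT : 0 < T) (k : ℕ) :
    ∫ s, |kT ω T s| * |s| ^ k ≤ (ω ^ k)⁻¹ * ∫ s, |lp s| * |s| ^ k := by
  rw [← (lpw_moment hω k).2]
  refine integral_mono ((kT_ker hT).abs.mul (by fun_prop)).int (lpw_moment hω k).1 fun s => ?_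
  exact mul_le_mul_of_nonneg_right (abs_kT_le s) (by positivity)

theorem integrable_lpw (hω : 0 < ω) : Integrable (lpw ω) := by
  have := (lpw_moment hω 0).1
  simp only [pow_zero, mul_one] at this
  exact (integrable_norm_iff (lpw ω).continuous.aestronglyMeasurable).mp this

theorem integral_lpw (hω : 0 < ω) : ∫ s, lpw ω s = 1 := by
  have := Measure.integral_comp_mul_left lp ω
  rw [abs_of_pos (inv_pos.mpr hω), smul_eq_mul, integral_lp] at this
  simp only [lpw_apply]
  rw [integral_const_mul, this]
  field_simp

theorem kT_error (hω : 1 ≤ ω) (hT : 0 < T) :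
    ∫ s, |lpw ω s - kT ω T s| ≤ (2 * ∫ s, |lp s| * |s| ^ 1) / T := by
  have hω0 : 0 < ω := by linarith
  have h1 : ∀ s, |lpw ω s - kT ω T s| ≤ 2 / T * (|lpw ω s| * |s| ^ 1) := fun s => by
    have h2 := one_sub_plat_le (T⁻¹ * s)
    rw [abs_mul T⁻¹, abs_of_pos (inv_pos.mpr hT)] at h2
    rw [kT_apply, ← mul_one_sub, abs_mul, pow_one]
    refine (mul_le_mul_of_nonneg_left h2 (abs_nonneg _)).trans (le_of_eq ?_)
    field_simp
  refine (integral_mono ((integrable_lpw hω0).sub (kT_ker hT).int).abs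
    ((lpw_moment hω0 1).1.const_mul _) h1).trans ?_
  rw [integral_const_mul, (lpw_moment hω0 1).2, pow_one, div_mul_eq_mul_div]
  have h3 : 0 ≤ ∫ s, |lp s| * |s| ^ 1 := integral_nonneg fun s => by positivity
  refine div_le_div_of_nonneg_right (mul_le_mul_of_nonneg_left ?_ zero_le_two) hT.le
  exact mul_le_of_le_one_left h3 (inv_le_one_of_one_le₀ hω)

/-- Quantitative properties of the truncated low-pass kernels. -/
theorem kT_bounds : ∃ C : ℝ, 1 ≤ C ∧ ∀ ω T : ℝ, 1 ≤ ω → 0 < T →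
    Mom (kT ω T) T C ∧ ∫ s, |kT ω T s| * s ^ 2 ≤ C * (ω ^ 2)⁻¹ ∧
    ∫ s, |lpw ω s - kT ω T s| ≤ C / T ∧ 1 - C / T ≤ ∫ s, kT ω T s := by
  set M : ℕ → ℝ := fun k => ∫ s, |lp s| * |s| ^ k with hM
  have hM0 : ∀ k, 0 ≤ M k := fun k => integral_nonneg fun s => by positivity
  refine ⟨1 + M 0 + 2 * M 1 + M 2, by linarith [hM0 0, hM0 1, hM0 2], fun ω T hω hT => ?_⟩
  have hω0 : 0 < ω := by linarith
  have m0 := kT_moment hω0 hT 0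
  have m1 := kT_moment hω0 hT 1
  have m2 := kT_moment hω0 hT 2
  have me := kT_error hω hT
  simp only [pow_zero, mul_one, inv_one, one_mul, pow_one, sq_abs] at m0 m1 m2 me
  have e0 : M 0 = ∫ s, |lp s| := by simp [hM]
  have e1 : M 1 = ∫ s, |lp s| * |s| := by simp [hM]
  have e2 : M 2 = ∫ s, |lp s| * s ^ 2 := by simp [hM]
  rw [← e0] at m0
  rw [← e1] at m1 me
  rw [← e2] at m2
  have h0 := hM0 0
  have h1 := hM0 1
  have h2 := hM0 2
  have hr : ∫ s, |lpw ω s - kT ω T s| ≤ (1 + M 0 + 2 * M 1 + M 2) / T :=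
    me.trans (div_le_div_of_nonneg_right (by linarith) hT.le)
  refine ⟨⟨kT_ker hT, by linarith, ?_⟩, ?_, hr, ?_⟩
  · have := mul_le_of_le_one_left h1 (inv_le_one_of_one_le₀ hω)
    linarith
  · rw [mul_comm] at m2
    exact m2.trans (mul_le_mul_of_nonneg_right (by linarith) (by positivity))
  · have := (le_abs_self _).trans ((abs_integral_le_integral_abs (f := fun s =>
      lpw ω s - kT ω T s) (μ := volume)).trans hr)
    rw [integral_sub (integrable_lpw hω0) (kT_ker hT).int, integral_lpw hω0] at this
    linarith

/-- Restriction to a point in space. -/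
noncomputable def tsl (x : E d) : Sm (W d) →ₐ[ℝ] Sm ℝ :=
  Sm.pull (fun s => (s, x)) (contDiff_id.prodMk contDiff_const)

@[simp] theorem tsl_apply (x : E d) (F : Sm (W d)) (s : ℝ) : tsl x F s = F (s, x) := rfl

theorem D_tsl (x : E d) (F : Sm (W d)) : D 1 (tsl x F) = tsl x (Dt F) := by
  ext s
  rw [D_one_apply]
  exact (hasDerivAt_slice F s x).deriv

/-- Supported in `|t| ≤ S`. -/
def TS (S : ℝ) (F : Sm (W d)) : Prop := ∀ s x, S < |s| → F (s, x) = 0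

theorem TS.D (h : TS S F) (v : W d) : TS S (D v F) := fun s x hs =>
  D_eq_zero_of_notMem (K := {p : W d | |p.1| ≤ S})
    (isClosed_le (by fun_prop) continuous_const)
    (fun p hp => h p.1 p.2 (not_le.mp hp)) (not_le.mpr hs) v

theorem TS.tsl (h : TS S F) (x : E d) : ∀ s, S < |s| → tsl x F s = 0 :=
  fun s hs => h s x hs

theorem Sm.hasDerivAt (f : Sm ℝ) (s : ℝ) : HasDerivAt f (D 1 f s) s := by
  rw [D_one_apply]; exact (f.differentiable s).hasDerivAt

theorem cT_deriv {f : Sm ℝ} (hf : ∀ s, S < |s| → f s = 0) (hf' : ∀ s, S < |s| → D 1 f s = 0)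
    (l : ℝ) : cT (D 1 f) l = l * sT f l := by
  have h := integral_mul_deriv_eq_deriv_mul_of_integrable
    (u := fun s => cos (l * s)) (u' := fun s => -sin (l * s) * (l * 1)) (v := f)
    (v' := D 1 f) (fun s _ => ((hasDerivAt_id' s).const_mul l).cos)
    (fun s _ => f.hasDerivAt s)
    (Sm.integrable_mul hf' (by fun_prop)) (Sm.integrable_mul hf (by fun_prop))
    (Sm.integrable_mul hf (by fun_prop))
  rw [cT, sT, ← integral_const_mul, h, ← integral_neg]
  exact integral_congr_ae (Eventually.of_forall fun s => by ring)

theorem sT_deriv {f : Sm ℝ} (hf : ∀ s, S < |s| → f s = 0) (hf' : ∀ s, S < |s| → D 1 f s = 0)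
    (l : ℝ) : sT (D 1 f) l = -(l * cT f l) := by
  have h := integral_mul_deriv_eq_deriv_mul_of_integrable
    (u := fun s => sin (l * s)) (u' := fun s => cos (l * s) * (l * 1)) (v := f)
    (v' := D 1 f) (fun s _ => ((hasDerivAt_id' s).const_mul l).sin)
    (fun s _ => f.hasDerivAt s)
    (Sm.integrable_mul hf' (by fun_prop)) (Sm.integrable_mul hf (by fun_prop))
    (Sm.integrable_mul hf (by fun_prop))
  rw [cT, sT, ← integral_const_mul, h]
  exact congrArg _ (integral_congr_ae (Eventually.of_forall fun s => by ring))

/-- The spectral density of `F` at frequency `l`. -/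
noncomputable def pwr (F : Sm (W d)) (l : ℝ) (x : E d) : ℝ := cT (tsl x F) l ^ 2 + sT (tsl x F) l ^ 2

/-- The spectral energy density of `F` at frequency `l`. -/
noncomputable def pwe (F : Sm (W d)) (l : ℝ) (x : E d) : ℝ :=
  pwr (Dt F) l x + ∑ i, pwr (dx i F) l x

theorem pwr_nonneg (F : Sm (W d)) (l : ℝ) (x : E d) : 0 ≤ pwr F l x := by unfold pwr; positivity
theorem pwe_nonneg (F : Sm (W d)) (l : ℝ) (x : E d) : 0 ≤ pwe F l x :=
  add_nonneg (pwr_nonneg _ _ _) (sum_nonneg fun _ _ => pwr_nonneg _ _ _)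

theorem pwr_neg (F : Sm (W d)) (l : ℝ) (x : E d) : pwr F (-l) x = pwr F l x := by
  simp only [pwr, cT, sT, neg_mul, cos_neg, sin_neg, integral_neg, neg_sq]

theorem pwr_abs (F : Sm (W d)) (l : ℝ) (x : E d) : pwr F |l| x = pwr F l x := by
  rcases abs_choice l with h | h <;> rw [h]
  exact pwr_neg F l x

theorem pwe_abs (F : Sm (W d)) (l : ℝ) (x : E d) : pwe F |l| x = pwe F l x := by
  simp only [pwe, pwr_abs]

/-- Smooth cutoff of a function of time. -/
noncomputable def cutT (S : ℝ) (c : ℝ → ℝ) (hc : ContDiff ℝ (⊤ : ℕ∞) c) : Sm ℝ :=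
  Sm.mk (fun s => c s * plat ((2 * S)⁻¹ * s)) (hc.mul (plat.smooth.comp (by fun_prop)))

theorem cutT_ker (hS : 0 < S) (c : ℝ → ℝ) (hc) : Ker (cutT S c hc) (2 * S) :=
  Ker.of_smooth fun s hs => by
    change c s * plat _ = 0
    rw [plat_eq_zero, mul_zero]
    rw [abs_mul, abs_of_pos (by positivity), le_inv_mul_iff₀ (by positivity)]
    linarith

theorem cv_cutT (hS : 0 < S) (c : ℝ → ℝ) (hc) (hF : TS S F) (x : E d) :
    slice 0 (cv (cutT_ker hS c hc) F) x = ∫ s, c (-s) * tsl x F s := by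
  rw [slice_apply, cv_apply, ← integral_neg_eq_self]
  refine integral_congr_ae (Eventually.of_forall fun s => ?_)
  change c (-s) * plat _ * F (0 - -s, x) = c (-s) * F (s, x)
  rw [zero_sub, neg_neg]
  rcases le_or_gt |s| S with h | h
  · rw [plat_eq_one, mul_one]
    have h2 : s ^ 2 ≤ S ^ 2 := sq_le_sq' (abs_le.mp h).1 (abs_le.mp h).2
    have : ((2 * S)⁻¹ * -s) ^ 2 = s ^ 2 / S ^ 2 / 4 := by field_simp; ring
    rw [this]
    have := div_le_one_of_le₀ h2 (by positivity)
    linarith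
  · rw [hF s x h, mul_zero, mul_zero]

theorem sT_eq_neg (f : ℝ → ℝ) (l : ℝ) : ∫ s, sin (l * -s) * f s = -sT f l := by
  rw [sT, ← integral_neg]
  exact integral_congr_ae (Eventually.of_forall fun s => by simp)

theorem cT_eq (f : ℝ → ℝ) (l : ℝ) : ∫ s, cos (l * -s) * f s = cT f l :=
  integral_congr_ae (Eventually.of_forall fun s => by simp)

/-- The resolvent estimate transferred to the spectral density of an approximate solution. -/
theorem spectral_estimate (hres : ∀ lam ≥ 0, ∀ (u : Sm (E d)) (K : Set (E d)),
      IsCompact K → (∀ x ∉ K, u x = 0) → ∀ k > 0,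
      ∫ x, zz x ^ (-(1 + a) / 2) * sen lam u x
        ≤ C * exp (C * lam) * ∫ x, (k⁻¹ * Hop A lam u x ^ 2 + k * sen lam u x))
    (hS : 0 < S) {φ : Sm (W d)} (hφ : LS φ) (hT : TS S φ) (hF : TS S F)
    (he : Dt (Dt φ) = PW A φ + F) (hk : 0 < k) (l : ℝ) :
    ∫ x, zz x ^ (-(1 + a) / 2) * pwe φ l x
      ≤ C * exp (C * |l|) * ∫ x, (k⁻¹ * pwr F l x + k * pwe φ l x) := by
  wlog hl : 0 ≤ l generalizing l with H
  · have := H |l| (abs_nonneg l)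
    simpa only [pwr_abs, pwe_abs, abs_abs] using this
  rw [abs_of_nonneg hl]
  have hcos : ContDiff ℝ (⊤ : ℕ∞) fun s : ℝ => cos (l * s) :=
    contDiff_cos.comp (by fun_prop)
  have hsin : ContDiff ℝ (⊤ : ℕ∞) fun s : ℝ => sin (l * s) :=
    contDiff_sin.comp (by fun_prop)
  have hPW : PW A φ = Dt (Dt φ) - F := by rw [he, add_sub_cancel_right]
  have hTP : TS S (PW A φ) := fun s x hs => by
    rw [hPW, Sm.sub_apply, (hT.D _).D _ s x hs, hF s x hs, sub_zero]
  have key : ∀ (c : ℝ → ℝ) (hc : ContDiff ℝ (⊤ : ℕ∞) c) (N : (ℝ → ℝ) → ℝ)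
      (hN : ∀ G : Sm (W d), TS S G → ∀ x, ∫ s, c (-s) * tsl x G s = N (tsl x G))
      (hN' : ∀ x, N (tsl x (Dt (Dt φ))) = -(l ^ 2 * N (tsl x φ))),
      ∃ u : Sm (E d), ∃ K, IsCompact K ∧ (∀ x ∉ K, u x = 0) ∧
        (∀ x, sen l u x = ∑ i, N (tsl x (dx i φ)) ^ 2 + l ^ 2 * N (tsl x φ) ^ 2) ∧
        ∀ x, Hop A l u x ^ 2 = N (tsl x F) ^ 2 := by
    intro c hc N hN hN'
    obtain ⟨K, hK, h0⟩ := (hφ.cv (cutT_ker hS c hc)).zero_off 0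
    refine ⟨_, K, hK, h0, fun x => ?_, fun x => ?_⟩
    · rw [sen_apply, gsq_apply, cv_cutT hS c hc hT, hN _ hT]
      congr 1
      refine sum_congr rfl fun i _ => ?_
      rw [pd_slice, D_cv, cv_cutT hS c hc (hT.D _), hN _ (hT.D _)]
    · have h1 : Hop A l (slice 0 (cv (cutT_ker hS c hc) φ)) x = -N (tsl x F) := by
        rw [Hop, Sm.add_apply, Sm.smul_apply, Pop_slice, PW_cv, cv_cutT hS c hc hT, hN _ hT, hPW,
          map_sub, map_sub, Sm.sub_apply, cv_cutT hS c hc ((hT.D _).D _), hN _ ((hT.D _).D _), hN',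
          cv_cutT hS c hc hF, hN _ hF]
        ring
      rw [h1, neg_sq]
  have dc : ∀ G : Sm (W d), TS S G → ∀ x, cT (tsl x (Dt G)) l = l * sT (tsl x G) l :=
    fun G hG x => by
      rw [← D_tsl]
      exact cT_deriv (hG.tsl x) (by rw [D_tsl]; exact (hG.D _).tsl x) l
  have ds : ∀ G : Sm (W d), TS S G → ∀ x, sT (tsl x (Dt G)) l = -(l * cT (tsl x G) l) :=
    fun G hG x => by
      rw [← D_tsl]
      exact sT_deriv (hG.tsl x) (by rw [D_tsl]; exact (hG.D _).tsl x) l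
  obtain ⟨u, K, hK, hu, hu1, hu2⟩ := key _ hcos (fun f => cT f l) (fun G hG x => cT_eq _ l)
    (fun x => by rw [dc _ (hT.D _), ds _ hT]; ring)
  obtain ⟨v, K', hK', hv, hv1, hv2⟩ := key _ hsin (fun f => -sT f l) (fun G hG x => sT_eq_neg _ l)
    (fun x => by rw [ds _ (hT.D _), dc _ hT]; ring)
  have e1 : ∀ x, pwe φ l x = sen l u x + sen l v x := fun x => by
    rw [hu1, hv1, pwe]
    simp only [pwr]
    rw [dc _ hT, ds _ hT, sum_add_distrib]
    simp only [neg_sq]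
    ring
  have e2 : ∀ x, pwr F l x = Hop A l u x ^ 2 + Hop A l v x ^ 2 := fun x => by
    rw [hu2, hv2, pwr, neg_sq]
  have i1 : ∀ (w : Sm (E d)) (K : Set (E d)), IsCompact K → (∀ x ∉ K, w x = 0) →
      Integrable fun x => zz x ^ (-(1 + a) / 2) * sen l w x := fun w K hK hw =>
    Sm.integrable (f := zp (-(1 + a) / 2) * sen l w) hK fun x hx => by
      simp [sen_zero_off l hK hw x hx]
  have i2 : ∀ (w : Sm (E d)) (K : Set (E d)), IsCompact K → (∀ x ∉ K, w x = 0) →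
      Integrable fun x => k⁻¹ * Hop A l w x ^ 2 + k * sen l w x := fun w K hK hw =>
    Sm.integrable (f := k⁻¹ • Hop A l w ^ 2 + k • sen l w) hK fun x hx => by
      simp [sen_zero_off l hK hw x hx, Hop_zero_off l hK hw x hx]
  have e3 : (∫ x, zz x ^ (-(1 + a) / 2) * pwe φ l x)
      = (∫ x, zz x ^ (-(1 + a) / 2) * sen l u x) + ∫ x, zz x ^ (-(1 + a) / 2) * sen l v x := by
    rw [← integral_add (i1 u K hK hu) (i1 v K' hK' hv)]
    simp only [e1, mul_add]
  have e4 : (∫ x, (k⁻¹ * pwr F l x + k * pwe φ l x))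
      = (∫ x, (k⁻¹ * Hop A l u x ^ 2 + k * sen l u x))
        + ∫ x, (k⁻¹ * Hop A l v x ^ 2 + k * sen l v x) := by
    rw [← integral_add (i2 u K hK hu) (i2 v K' hK' hv)]
    refine integral_congr_ae (Eventually.of_forall fun x => ?_)
    simp only [e1, e2]
    ring
  rw [e3, e4, mul_add]
  exact add_le_add (hres l hl u K hK hu k hk) (hres l hl v K' hK' hv k hk)

theorem Ker.band (ω : ℝ) : Ker ((Icc (-ω) ω).indicator fun _ => (1 : ℝ)) ω :=
  ⟨(integrable_indicator_iff measurableSet_Icc).2 (integrableOn_const (by simp)), fun _ hs =>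
    indicator_of_notMem (s := Icc (-ω) ω) (fun h => not_lt.mpr (abs_le.mpr h) hs) _⟩

theorem integral_band (ω : ℝ) (f : ℝ → ℝ) :
    ∫ s, (Icc (-ω) ω).indicator (fun _ => (1 : ℝ)) s * f s = ∫ s in Icc (-ω) ω, f s := by
  rw [← integral_indicator measurableSet_Icc]
  refine integral_congr_ae (Eventually.of_forall fun s => ?_)
  by_cases h : s ∈ Icc (-ω) ω <;> simp [h]

/-- Integrals over a bounded time interval and over space may be exchanged. -/
theorem swap_band {Φ : W d → ℝ} (hΦ : Continuous Φ) (hK : IsCompact K)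
    (h0 : ∀ s, ∀ x ∉ K, Φ (s, x) = 0) :
    (∫ x, ∫ s in Icc (-S) S, Φ (s, x)) = ∫ s in Icc (-S) S, ∫ x, Φ (s, x) := by
  have := (Ker.band S).swap hΦ hK fun s _ x hx => h0 s x hx
  simpa only [integral_band] using this

theorem integrable_band {Φ : W d → ℝ} (hΦ : Continuous Φ) (hK : IsCompact K)
    (h0 : ∀ s, ∀ x ∉ K, Φ (s, x) = 0) :
    Integrable (fun x => ∫ s in Icc (-S) S, Φ (s, x)) ∧
      IntegrableOn (fun s => ∫ x, Φ (s, x)) (Icc (-S) S) := by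
  have := (Ker.band S).integrable_inner hΦ hK fun s _ x hx => h0 s x hx
  simp only [integral_band] at this
  refine ⟨this.1, (integrable_indicator_iff measurableSet_Icc).1 (this.2.congr ?_)⟩
  refine Eventually.of_forall fun s => ?_
  by_cases h : s ∈ Icc (-S) S <;> simp [h]

theorem TS.setIntegral (hF : TS S F) {g : ℝ → ℝ} (x : E d) :
    ∫ s, g s * LogDecay.tsl x F s = ∫ s in Icc (-S) S, g s * F (s, x) := by
  refine (setIntegral_eq_integral_of_forall_compl_eq_zero fun s hs => ?_).symm
  rw [hF.tsl x s (by by_contra h; exact hs (abs_le.mp (not_lt.mp h))), mul_zero]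

theorem TS.continuous_pwr (hF : TS S F) :
    Continuous fun p : W d => pwr F (2 * π * p.1) p.2 := by
  have e : ∀ (g : ℝ → ℝ) (x : E d), ∫ s, g s * LogDecay.tsl x F s = ∫ s in Icc (-S) S, g s * F (s, x) :=
    fun g x => hF.setIntegral x
  unfold pwr cT sT
  simp only [e]
  refine .add (.pow ?_ 2) (.pow ?_ 2)
  · refine continuous_parametric_integral_of_continuous (X := W d)
      (f := fun p s => cos (2 * π * p.1 * s) * F (s, p.2)) ?_ isCompact_Icc
    exact .mul (by fun_prop) (F.continuous.comp (by fun_prop))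
  · refine continuous_parametric_integral_of_continuous (X := W d)
      (f := fun p s => sin (2 * π * p.1 * s) * F (s, p.2)) ?_ isCompact_Icc
    exact .mul (by fun_prop) (F.continuous.comp (by fun_prop))

theorem TS.zero_off (hF : TS S F) (hL : LS F) :
    ∃ K, IsCompact K ∧ ∀ x ∉ K, ∀ s, F (s, x) = 0 := by
  obtain ⟨K, hK, h⟩ := hL S
  refine ⟨K, hK, fun x hx s => ?_⟩
  rcases le_or_gt |s| S with hs | hs
  · exact h s hs x hx
  · exact hF s x hs

theorem tsl_eq_zero (h : ∀ x ∉ K, ∀ s, F (s, x) = 0) (hx : x ∉ K) (l : ℝ) : pwr F l x = 0 := by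
  have : ∀ s, tsl x F s = 0 := fun s => h x hx s
  simp [pwr, cT, sT, this]

theorem TS.band_le (hF : TS S F) (ω : ℝ) (x : E d) :
    ∫ w in Icc (-ω) ω, pwr F (2 * π * w) x ≤ ∫ s in Icc (-S) S, F (s, x) ^ 2 := by
  obtain ⟨h1, h2⟩ := Sm.plancherel (hF.tsl x)
  have h3 : ∫ s, LogDecay.tsl x F s ^ 2 = ∫ s in Icc (-S) S, F (s, x) ^ 2 := by
    simp only [sq]
    exact hF.setIntegral (g := fun s => F (s, x)) x
  rw [← h3, ← h2]
  exact setIntegral_le_integral h1 (Eventually.of_forall fun w => pwr_nonneg _ _ _)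

theorem ed0_eq (ψ : Sm (W d)) (p : W d) : ed0 ψ p = Dt ψ p ^ 2 + ∑ i, dx i ψ p ^ 2 := by
  simp [ed0]

theorem setIntegral_band_le (hS : 0 ≤ S) {f : ℝ → ℝ} (hf : IntegrableOn f (Icc (-S) S))
    (h : ∀ s, f s ≤ M) : ∫ s in Icc (-S) S, f s ≤ 2 * S * M := by
  have := setIntegral_mono hf (integrableOn_const (C := M) (by simp)) h
  rw [setIntegral_const, Measure.real, volume_Icc, ENNReal.toReal_ofReal (by linarith),
    smul_eq_mul] at this
  linarith

/-- The spectral estimate integrated over a band of frequencies. -/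
theorem band_estimate (ha : -1 ≤ a) (hC : 0 ≤ C)
    (hres : ∀ lam ≥ 0, ∀ (u : Sm (E d)) (K : Set (E d)),
      IsCompact K → (∀ x ∉ K, u x = 0) → ∀ k > 0,
      ∫ x, zz x ^ (-(1 + a) / 2) * sen lam u x
        ≤ C * exp (C * lam) * ∫ x, (k⁻¹ * Hop A lam u x ^ 2 + k * sen lam u x))
    (hS : 0 < S) {φ : Sm (W d)} (hφ : LS φ) (hLF : LS F) (hT : TS S φ) (hF : TS S F)
    (he : Dt (Dt φ) = PW A φ + F) (hk : 0 < k) (hM : ∀ s, ∫ x, (k⁻¹ * F (s, x) ^ 2 + k * ed0 φ (s, x)) ≤ M) :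
    ∫ x, zz x ^ (-(1 + a) / 2) * ∫ w in Icc (-ω) ω, pwe φ (2 * π * w) x
      ≤ C * exp (C * (2 * π * ω)) * (2 * S * M) := by
  obtain ⟨K1, hK1, h1⟩ := hT.zero_off hφ
  obtain ⟨K2, hK2, h2⟩ := hF.zero_off hLF
  set K := K1 ∪ K2
  have hK : IsCompact K := hK1.union hK2
  have hD : ∀ v, ∀ x ∉ K, ∀ s, D v φ (s, x) = 0 := fun v x hx s =>
    D_eq_zero_of_notMem (K := univ ×ˢ K) (isClosed_univ.prod hK.isClosed)
      (fun p hp => h1 p.2 (fun h => hp ⟨trivial, Or.inl h⟩) p.1) (fun h => hx h.2) v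
  have hF0 : ∀ x ∉ K, ∀ s, F (s, x) = 0 := fun x hx s => h2 x (fun h => hx (Or.inr h)) s
  have cP : Continuous fun p : W d => pwe φ (2 * π * p.1) p.2 :=
    ((hT.D _).continuous_pwr).add (continuous_finsetSum _ fun i _ => (hT.D _).continuous_pwr)
  have zP : ∀ l, ∀ x ∉ K, pwe φ l x = 0 := fun l x hx => by
    rw [pwe, tsl_eq_zero (hD _) hx, Finset.sum_eq_zero fun i _ => tsl_eq_zero (hD _) hx l, add_zero]
  have cz : Continuous fun p : W d => zz p.2 ^ (-(1 + a) / 2) :=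
    (zp (-(1 + a) / 2)).continuous.comp continuous_snd
  have cW : Continuous fun p : W d => zz p.2 ^ (-(1 + a) / 2) * pwe φ (2 * π * p.1) p.2 :=
    cz.mul cP
  have zW : ∀ s : ℝ, ∀ x ∉ K, zz x ^ (-(1 + a) / 2) * pwe φ (2 * π * s) x = 0 :=
    fun s x hx => by rw [zP _ x hx, mul_zero]
  set R : W d → ℝ := fun p => k⁻¹ * pwr F (2 * π * p.1) p.2
    + k * pwe φ (2 * π * p.1) p.2
  have cR : Continuous R := (hF.continuous_pwr.const_mul _).add (cP.const_mul _)
  have zR : ∀ s, ∀ x ∉ K, R (s, x) = 0 := fun s x hx => by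
    simp only [R]
    rw [zP _ x hx, tsl_eq_zero hF0 hx]
    ring
  set Q : W d → ℝ := fun p => k⁻¹ * F p ^ 2 + k * ed0 φ p
  have cQ : Continuous Q := ((F.continuous.pow 2).const_mul _).add ((ed0 φ).continuous.const_mul _)
  have zQ : ∀ s, ∀ x ∉ K, Q (s, x) = 0 := fun s x hx => by
    simp only [Q]
    rw [ed0_eq, hF0 x hx]
    simp [hD _ x hx]
  have e1 : ∫ x, zz x ^ (-(1 + a) / 2) * ∫ w in Icc (-ω) ω, pwe φ (2 * π * w) x
      = ∫ w in Icc (-ω) ω, ∫ x, zz x ^ (-(1 + a) / 2) * pwe φ (2 * π * w) x := by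
    rw [← swap_band cW hK zW]
    simp only [integral_const_mul]
  have e2 := swap_band (S := ω) cR hK zR
  have e3 := swap_band (S := S) cQ hK zQ
  have i1 := (integrable_band (S := ω) cW hK zW).2
  have iR := integrable_band (S := ω) cR hK zR
  have iQ := integrable_band (S := S) cQ hK zQ
  have hcoef : 0 ≤ C * exp (C * (2 * π * ω)) := by positivity
  have step : ∫ w in Icc (-ω) ω, ∫ x, zz x ^ (-(1 + a) / 2) * pwe φ (2 * π * w) x
      ≤ C * exp (C * (2 * π * ω)) * ∫ w in Icc (-ω) ω, ∫ x, R (w, x) := by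
    rw [← integral_const_mul]
    refine setIntegral_mono_on i1 (iR.2.const_mul _) measurableSet_Icc fun w hw => ?_
    refine (spectral_estimate hres hS hφ hT hF he hk (2 * π * w)).trans ?_
    have hw' : |2 * π * w| ≤ 2 * π * ω := by
      rw [abs_mul, abs_of_pos two_pi_pos]
      exact mul_le_mul_of_nonneg_left (abs_le.mpr hw) two_pi_pos.le
    refine mul_le_mul_of_nonneg_right ?_ (integral_nonneg fun x => ?_)
    · gcongr
    · exact add_nonneg (mul_nonneg (by positivity) (pwr_nonneg _ _ _))
        (mul_nonneg hk.le (pwe_nonneg _ _ _))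
  rw [e1]
  refine step.trans (mul_le_mul_of_nonneg_left ?_ hcoef)
  rw [← e2]
  refine (integral_mono iR.1 iQ.1 fun x => ?_).trans
    (e3.trans_le (setIntegral_band_le hS.le iQ.2 hM))
  have cx : ∀ {Φ : W d → ℝ}, Continuous Φ → ∀ r, IntegrableOn (fun s => Φ (s, x)) (Icc (-r) r) :=
    fun h r => (h.comp (by fun_prop : Continuous fun s : ℝ => (s, x))).integrableOn_Icc
  have cD : ∀ v, Continuous fun p : W d => D v φ p ^ 2 := fun v => (D v φ).continuous.pow 2
  have s1 : ∫ w in Icc (-ω) ω, R (w, x)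
      = k⁻¹ * (∫ w in Icc (-ω) ω, pwr F (2 * π * w) x)
        + k * ((∫ w in Icc (-ω) ω, pwr (Dt φ) (2 * π * w) x)
          + ∑ i, ∫ w in Icc (-ω) ω, pwr (dx i φ) (2 * π * w) x) := by
    rw [← integral_finsetSum _ fun i _ => cx (hT.D _).continuous_pwr ω,
      ← integral_add (cx (hT.D _).continuous_pwr ω)
        (integrable_finsetSum _ fun i _ => cx (hT.D _).continuous_pwr ω), ← integral_const_mul,
      ← integral_const_mul]
    exact integral_add ((cx hF.continuous_pwr ω).const_mul _)
      (((cx (hT.D _).continuous_pwr ω).add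
      (integrable_finsetSum _ fun i _ => cx (hT.D _).continuous_pwr ω)).const_mul _)
  have s2 : ∫ s in Icc (-S) S, Q (s, x)
      = k⁻¹ * (∫ s in Icc (-S) S, F (s, x) ^ 2)
        + k * ((∫ s in Icc (-S) S, Dt φ (s, x) ^ 2)
          + ∑ i, ∫ s in Icc (-S) S, dx i φ (s, x) ^ 2) := by
    rw [← integral_finsetSum _ fun i _ => cx (cD _) S,
      ← integral_add (cx (cD _) S) (integrable_finsetSum _ fun i _ => cx (cD _) S),
      ← integral_const_mul, ← integral_const_mul]
    simp only [Q, ed0_eq]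
    exact integral_add ((cx (F.continuous.pow 2) S).const_mul _)
      (((cx (cD _) S).add (integrable_finsetSum _ fun i _ => cx (cD _) S)).const_mul _)
  beta_reduce
  rw [s1, s2]
  have := sum_le_sum fun i (_ : i ∈ Finset.univ) => (hT.D (0, EuclideanSpace.single i 1)).band_le ω x
  exact add_le_add (mul_le_mul_of_nonneg_left (hF.band_le ω x) (by positivity))
    (mul_le_mul_of_nonneg_left (add_le_add ((hT.D _).band_le ω x) this) hk.le)

/-- A truncated low-pass filter is controlled by the low frequencies, up to the truncation error. -/
theorem filter_estimate (hω : 0 < ω) (hT : 0 < T) (hS : 0 ≤ S) {f g : Sm (W d)}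
    (hf : TS S f) (hfL : LS f)
    (hg : ∀ t, |t| ≤ T → ∀ x, g (t, x) = ∫ s, kT ω T s * f (t - s, x))
    (hη : ∫ s, |lpw ω s - kT ω T s| ≤ η) (hM : ∀ s, ∫ x, f (s, x) ^ 2 ≤ M)
    {q : Sm (E d)} (hq : ∀ x, 0 ≤ q x) (hq1 : ∀ x, q x ≤ 1) :
    ∫ x, q x * ∫ t in Icc (-T) T, g (t, x) ^ 2
      ≤ 2 * (∫ x, q x * ∫ w in Icc (-ω) ω, pwr f (2 * π * w) x) + 4 * T * η ^ 2 * M := by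
  obtain ⟨K, hK, h0⟩ := hf.zero_off hfL
  have hη0 : 0 ≤ η := (integral_nonneg fun s => abs_nonneg _).trans hη
  set r : Sm ℝ := lpw ω - kT ω T with hr
  have hr1 : ∀ s, r s = lpw ω s - kT ω T s := fun s => by simp [hr]
  have hri : Integrable r := by
    have := (integrable_lpw hω).sub (kT_ker (ω := ω) hT).int
    exact this.congr (Eventually.of_forall fun s => (hr1 s).symm)
  set ρ : ℝ → ℝ := fun s => (Icc (-(T + S)) (T + S)).indicator (fun _ => (1 : ℝ)) s * r s with hρ
  have hρk : Ker ρ (T + S) := (Ker.band (T + S)).mul r.continuous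
  have hρle : ∀ s, |ρ s| ≤ |r s| := fun s => by
    by_cases h : s ∈ Icc (-(T + S)) (T + S) <;> simp only [hρ, h, indicator_of_mem, indicator_of_notMem, not_false_eq_true] <;> simp
  have hρη : ∫ s, |ρ s| ≤ η := by
    refine (integral_mono hρk.abs.int hri.abs hρle).trans ?_
    simpa only [hr1] using hη
  set Q : W d → ℝ := fun p => ∫ s, |ρ s| * f (p.1 - s, p.2) ^ 2 with hQ
  have cQ : Continuous Q := by
    have e : Q = fun p : W d => ∫ s in Icc (-(T + S)) (T + S), |r s| * f (p.1 - s, p.2) ^ 2 := by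
      funext p
      rw [← integral_band]
      refine integral_congr_ae (Eventually.of_forall fun s => ?_)
      by_cases h : s ∈ Icc (-(T + S)) (T + S) <;> simp only [hρ, h, indicator_of_mem, indicator_of_notMem, not_false_eq_true] <;> simp
    rw [e]
    refine continuous_parametric_integral_of_continuous (X := W d)
      (f := fun p s => |r s| * f (p.1 - s, p.2) ^ 2) ?_ isCompact_Icc
    exact .mul (r.continuous.comp continuous_snd).abs (.pow (f.continuous.comp (by fun_prop)) 2)
  have zQ : ∀ s, ∀ x ∉ K, Q (s, x) = 0 := fun s x hx => by simp [hQ, h0 x hx]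
  have cP : Continuous fun p : W d => q p.2 * pwr f (2 * π * p.1) p.2 :=
    (q.continuous.comp continuous_snd).mul hf.continuous_pwr
  have zP : ∀ s : ℝ, ∀ x ∉ K, q x * pwr f (2 * π * s) x = 0 := fun s x hx => by
    rw [tsl_eq_zero h0 hx, mul_zero]
  have iP := (integrable_band (S := ω) cP hK zP).1
  simp only [integral_const_mul] at iP
  have iQ := integrable_band (S := T) cQ hK zQ
  have hQ0 : ∀ p, 0 ≤ Q p := fun p => integral_nonneg fun s => by positivity
  have hM0 : 0 ≤ M := (integral_nonneg fun x => sq_nonneg _).trans (hM 0)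
  have hQM : ∀ t, ∫ x, Q (t, x) ≤ η * M := fun t => by
    have c2 : Continuous fun p : W d => f (t - p.1, p.2) ^ 2 :=
      (f.continuous.comp (by fun_prop)).pow 2
    have z2 : ∀ s, |s| ≤ T + S → ∀ x ∉ K, f (t - s, x) ^ 2 = 0 := fun s _ x hx => by
      rw [h0 x hx, zero_pow two_ne_zero]
    have h1 := hρk.abs.swap c2 hK z2
    have h2 := (hρk.abs.integrable_inner c2 hK z2).2
    simp only [hQ]
    rw [h1]
    refine (integral_mono h2 (hρk.abs.int.mul_const M) fun s =>
      mul_le_mul_of_nonneg_left (hM (t - s)) (abs_nonneg _)).trans ?_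
    rw [integral_mul_const]
    exact mul_le_mul_of_nonneg_right hρη hM0
  have hpt : ∀ x, ∫ t in Icc (-T) T, g (t, x) ^ 2
      ≤ 2 * (∫ w in Icc (-ω) ω, pwr f (2 * π * w) x)
        + 2 * η * ∫ t in Icc (-T) T, Q (t, x) := fun x => by
    obtain ⟨l1, l2⟩ := lp_filter_scaled (hf.tsl x) hω
    set G : ℝ → ℝ := fun t => ∫ s, ω * lp (ω * s) * tsl x f (t - s) with hG
    have cx : ∀ {Φ : W d → ℝ}, Continuous Φ → IntegrableOn (fun s => Φ (s, x)) (Icc (-T) T) :=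
      fun h => (h.comp (by fun_prop : Continuous fun s : ℝ => (s, x))).integrableOn_Icc
    have l3 : ∫ t in Icc (-T) T, G t ^ 2 ≤ ∫ w in Icc (-ω) ω, pwr f (2 * π * w) x :=
      (setIntegral_le_integral l1 (Eventually.of_forall fun t => sq_nonneg _)).trans l2
    have key : ∀ t ∈ Icc (-T) T, g (t, x) ^ 2 ≤ 2 * G t ^ 2 + 2 * η * Q (t, x) := fun t ht => by
      have cf : Continuous fun s => f (t - s, x) := continuous_shift f t x
      have e2 : ∫ s, ρ s * f (t - s, x) = G t - g (t, x) := by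
        have ht' := abs_le.mpr ht
        have hcomp : ∀ s, T + S < |s| → f (t - s, x) = 0 := fun s hs =>
          hf _ _ (by
            have := abs_sub_abs_le_abs_sub s t
            rw [abs_sub_comm] at this
            linarith)
        have iK := ((kT_ker (ω := ω) hT).mul cf).int
        have iρ := (hρk.mul cf).int
        rw [hg t ht' x, eq_sub_iff_add_eq, ← integral_add iρ iK]
        refine integral_congr_ae (Eventually.of_forall fun s => ?_)
        beta_reduce
        rw [tsl_apply, ← lpw_apply]
        by_cases h : s ∈ Icc (-(T + S)) (T + S)
        · simp only [hρ, indicator_of_mem h, hr1]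
          ring
        · rw [hcomp s (by by_contra h'; exact h (abs_le.mp (not_lt.mp h')))]
          simp
      have e3 := hρk.sq_le cf
      have e4 : (∫ s, |ρ s|) * Q (t, x) ≤ η * Q (t, x) :=
        mul_le_mul_of_nonneg_right hρη (hQ0 _)
      have e5 : (G t - g (t, x)) ^ 2 ≤ η * Q (t, x) := by
        rw [← e2]
        exact e3.trans e4
      nlinarith only [e5, sq_nonneg (2 * G t - g (t, x))]
    have i1 : IntegrableOn (fun t => 2 * G t ^ 2) (Icc (-T) T) := (l1.integrableOn).const_mul 2
    have i2 : IntegrableOn (fun t => 2 * η * Q (t, x)) (Icc (-T) T) := (cx cQ).const_mul _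
    refine (setIntegral_mono_on (cx (g.continuous.pow 2)) (i1.add i2) measurableSet_Icc key).trans ?_
    have := integral_add i1 i2
    rw [integral_const_mul, integral_const_mul] at this
    exact this.trans_le (by linarith)
  have iR : Integrable fun x => 2 * (q x * ∫ w in Icc (-ω) ω, pwr f (2 * π * w) x) :=
    iP.const_mul 2
  have iR2 : Integrable fun x => 2 * η * ∫ t in Icc (-T) T, Q (t, x) := iQ.1.const_mul _
  refine (integral_mono_of_nonneg (Eventually.of_forall fun x => mul_nonneg (hq x)
    (integral_nonneg fun t => sq_nonneg _)) (iR.add iR2) (Eventually.of_forall fun x => ?_)).trans ?_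
  · have h1 := mul_le_mul_of_nonneg_left (hpt x) (hq x)
    have h3 : 0 ≤ ∫ t in Icc (-T) T, Q (t, x) := integral_nonneg fun t => hQ0 _
    have h2 := mul_le_mul_of_nonneg_right (hq1 x) (mul_nonneg hη0 h3)
    simp only [Pi.add_apply]
    linarith
  · have h1 := integral_add iR iR2
    have h2 := setIntegral_band_le hT.le iQ.2 hQM
    rw [← swap_band cQ hK zQ] at h2
    rw [integral_const_mul, integral_const_mul] at h1
    refine h1.trans_le ?_
    have := mul_le_mul_of_nonneg_left h2 hη0
    linarith

/-- Dilation of a function of time. -/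
noncomputable def dil (ε : ℝ) (f : Sm ℝ) : Sm ℝ :=
  Sm.mk (fun s => f (ε * s)) (f.smooth.comp (by fun_prop))

theorem dil_apply (ε : ℝ) (f : Sm ℝ) (s : ℝ) : dil ε f s = f (ε * s) := rfl

theorem D_dil (ε : ℝ) (f : Sm ℝ) : D 1 (dil ε f) = ε • dil ε (D 1 f) := by
  ext s
  rw [D_one_apply]
  have h1 : HasDerivAt (fun s : ℝ => ε * s) ε s := by simpa using (hasDerivAt_id s).const_mul ε
  have h2 := HasDerivAt.comp (h₂ := f) (h := fun s => ε * s) s (f.hasDerivAt (ε * s)) h1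
  rw [Sm.smul_apply, dil_apply, mul_comm]
  exact h2.deriv

theorem Dt_smul (c : ℝ) (F : Sm (W d)) : Dt (c • F) = c • Dt F := Derivation.map_smul _ _ _

theorem PW_liftT_mul (f : Sm ℝ) (ψ : Sm (W d)) : PW A (liftT f * ψ) = liftT f * PW A ψ := by
  simp only [PW, D_mul, dx_liftT, mul_zero, add_zero, mul_left_comm _ (liftT f), ← mul_sum]

theorem dil_plat_zero (hε : 0 < ε) (h : ε⁻¹ < |s|) : dil ε plat s = 0 := by
  rw [dil_apply]
  refine plat_eq_zero ?_
  rw [abs_mul, abs_of_pos hε]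
  have := mul_lt_mul_of_pos_left h hε
  rw [mul_inv_cancel₀ hε.ne'] at this
  exact this.le

theorem exists_abs_le (f : Sm ℝ) (hf : ∀ s, 1 < |s| → f s = 0) : ∃ b, 0 ≤ b ∧ ∀ s, |f s| ≤ b := by
  obtain ⟨M, hM⟩ := (isCompact_Icc (a := -1) (b := (1 : ℝ))).exists_bound_of_continuousOn
    f.continuous.continuousOn
  refine ⟨|M|, abs_nonneg _, fun s => ?_⟩
  rcases le_or_gt |s| 1 with h | h
  · exact (hM s (abs_le.mp h)).trans (le_abs_self M)
  · rw [hf s h, abs_zero]; exact abs_nonneg _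

theorem Sm.D_line_zero {f : Sm ℝ} (hf : ∀ s, S < |s| → f s = 0) : ∀ s, S < |s| → D 1 f s = 0 :=
  fun s hs => D_eq_zero_of_notMem (K := {s : ℝ | |s| ≤ S})
    (isClosed_le (by fun_prop) continuous_const) (fun _ hp => hf _ (not_le.mp hp)) (not_le.mpr hs) 1

theorem LS.integrable_sq (hF : LS F) (t : ℝ) : Integrable fun x => F (t, x) ^ 2 :=
  (hF.mul_left F).integrable t |>.congr (Eventually.of_forall fun x => by simp [sq])

theorem LS.ed0 (hF : LS F) : LS (ed0 F) := by
  have : LogDecay.ed0 F = Dt F * Dt F + ∑ i, dx i F * dx i F := by simp only [LogDecay.ed0, sq]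
  rw [this]
  exact ((hF.D _).mul_left _).add (LS.sum fun i => (hF.D _).mul_left _)

theorem EB.ed0_int_le (h : EB A m L) (hψ : Sol A ψ) (t : ℝ) :
    ∫ x, ed0 ψ (t, x) ≤ Em A 1 ψ 0 / m := by
  rw [le_div_iff₀ h.m_pos, ← h.energy_eq hψ t 0, mul_comm, ← integral_const_mul]
  refine integral_mono ((hψ.ls.ed0.integrable t).const_mul m)
    (hψ.ls.integrable_mul_edens (A := A) 1 t) fun x => ?_
  simpa using h.ed0_le ψ (t, x)

theorem ed0_Dt_le (ψ : Sm (W d)) (p : W d) : Dt ψ p ^ 2 ≤ ed0 ψ p := by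
  rw [ed0_eq]
  exact le_add_of_nonneg_right (sum_nonneg fun _ _ => sq_nonneg _)

theorem ed0_dx_le (ψ : Sm (W d)) (p : W d) (i : Fin d) : dx i ψ p ^ 2 ≤ ed0 ψ p := by
  rw [ed0_eq]
  exact le_add_of_nonneg_of_le (sq_nonneg _)
    (Finset.single_le_sum (fun j _ => sq_nonneg (dx j ψ p)) (Finset.mem_univ i))

/-- Growth of the `L²` norm of a solution. -/
theorem EB.sq_int_le (h : EB A m L) (hψ : Sol A ψ) (t : ℝ) :
    ∫ x, ψ (t, x) ^ 2 ≤ 2 * (∫ x, ψ (0, x) ^ 2) + 2 * t ^ 2 * (Em A 1 ψ 0 / m) := by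
  obtain ⟨S, hS, h0⟩ := (hψ.ls.D (1, 0)).slide_zero t t
  have c := (continuous_slide (Dt ψ) t t).pow 2
  have h0' : ∀ σ, |σ| ≤ 1 → ∀ x ∉ S, Dt ψ (t - σ * t, x) ^ 2 = 0 := fun σ hσ x hx => by
    rw [h0 σ hσ x hx, zero_pow two_ne_zero]
  have hk := (Ker.indicator 1).swap c hS h0'
  have hki := ((Ker.indicator 1).integrable_inner c hS h0').1
  have e : ∀ x, ∫ s, (Ioc (0 : ℝ) 1).indicator (fun _ => (1 : ℝ)) s * ((fun p : W d =>
      Dt ψ (t - p.1 * t, p.2)) ^ 2) (s, x) = ∫ σ in (0 : ℝ)..1, Dt ψ (t - σ * t, x) ^ 2 :=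
    fun x => integral_indicator_Ioc zero_le_one _
  simp only [e] at hk hki
  have h2 : ∫ s, (Ioc (0 : ℝ) 1).indicator (fun _ => (1 : ℝ)) s * ∫ x, Dt ψ (t - s * t, x) ^ 2
      ≤ Em A 1 ψ 0 / m := by
    have hi : ∫ s, (Ioc (0 : ℝ) 1).indicator (fun _ => (1 : ℝ)) s * (Em A 1 ψ 0 / m)
        = Em A 1 ψ 0 / m := by
      rw [integral_indicator_Ioc zero_le_one]
      simp
    rw [← hi]
    refine integral_mono ((Ker.indicator 1).integrable_inner c hS h0').2
      ((Ker.indicator 1).int.mul_const _) fun s => ?_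
    refine mul_le_mul_of_nonneg_left ?_ (indicator_nonneg (fun _ _ => zero_le_one) s)
    exact (integral_mono ((hψ.ls.D _).integrable_sq _) (hψ.ls.ed0.integrable _)
      fun x => ed0_Dt_le ψ (_, x)).trans (h.ed0_int_le hψ _)
  have i0 := (hψ.ls.integrable_sq 0).const_mul 2
  have i1 := hki.const_mul (2 * t ^ 2)
  refine (integral_mono (hψ.ls.integrable_sq t) (i0.add i1) fun x => ?_).trans
    ((integral_add i0 i1).trans_le ?_)
  · have := sq_diff_le ψ t t x
    rw [sub_self] at this
    simp only [Pi.add_apply]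
    nlinarith only [this, sq_nonneg (ψ (t, x) - 2 * ψ (0, x))]
  · rw [integral_const_mul, integral_const_mul, hk]
    have := mul_le_mul_of_nonneg_left h2 (by positivity : 0 ≤ 2 * t ^ 2)
    exact add_le_add le_rfl this

/-- Localization of a solution to a long time interval. -/
theorem EB.exists_cutoff (h : EB A m L) : ∃ c, 0 ≤ c ∧ ∀ ψ : Sm (W d), Sol A ψ → ∀ ε > 0,
    ∃ φ F : Sm (W d), LS φ ∧ LS F ∧ TS ε⁻¹ φ ∧ TS ε⁻¹ F ∧ Dt (Dt φ) = PW A φ + F ∧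
      (∀ s x, 2 * (ε * s) ^ 2 < 1 → ∀ v, D v φ (s, x) = D v ψ (s, x)) ∧
      ∀ s, ∫ x, (ε⁻¹ * F (s, x) ^ 2 + ε * ed0 φ (s, x))
        ≤ ε * c * (Em A 1 ψ 0 + ε ^ 2 * ∫ x, ψ (0, x) ^ 2) := by
  have hp : ∀ s, 1 < |s| → plat s = 0 := fun s hs => plat_eq_zero hs.le
  obtain ⟨b1, hb1, hb1'⟩ := exists_abs_le _ (Sm.D_line_zero hp)
  obtain ⟨b2, hb2, hb2'⟩ := exists_abs_le _ (Sm.D_line_zero (Sm.D_line_zero hp))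
  set c1 := 8 * b1 ^ 2 + 2 with hc1
  set c2 := 2 * b2 ^ 2 + 2 * b1 ^ 2 with hc2
  have hm := h.m_pos
  refine ⟨(c1 + 2 * c2) / m + 2 * c2, by positivity, fun ψ hψ ε hε => ?_⟩
  set χ := dil ε plat
  set χ1 := dil ε (D 1 plat)
  set χ2 := dil ε (D 1 (D 1 plat))
  have hd1 : D 1 χ = ε • χ1 := D_dil _ _
  have hd2 : D 1 χ1 = ε • χ2 := D_dil _ _
  set F : Sm (W d) := (2 * ε) • (liftT χ1 * Dt ψ) + ε ^ 2 • (liftT χ2 * ψ) with hF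
  have hTS : ∀ {f : Sm ℝ}, (∀ s, 1 < |s| → f s = 0) → ∀ G : Sm (W d), TS ε⁻¹ (liftT (dil ε f) * G) :=
    fun {f} hf G s x hs => by
      rw [Sm.mul_apply, liftT_apply, dil_apply, hf, zero_mul]
      have := mul_lt_mul_of_pos_left hs hε
      rw [mul_inv_cancel₀ hε.ne'] at this
      rwa [abs_mul, abs_of_pos hε]
  have hTF : TS ε⁻¹ F := fun s x hs => by
    rw [hF, Sm.add_apply, Sm.smul_apply, Sm.smul_apply, hTS (Sm.D_line_zero hp) _ s x hs,
      hTS (Sm.D_line_zero (Sm.D_line_zero hp)) _ s x hs]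
    ring
  refine ⟨liftT χ * ψ, F, hψ.ls.mul_left _,
    (((hψ.ls.D _).mul_left _).smul _).add ((hψ.ls.mul_left _).smul _), hTS hp ψ, hTF, ?_, ?_, ?_⟩
  · rw [PW_liftT_mul, ← Weq_iff.mp hψ.eq, hF]
    simp only [D_mul, map_add, Dt_liftT, hd1, map_smul, Dt_smul, hd2]
    simp only [Algebra.smul_def]
    simp only [map_mul, map_pow, map_ofNat]
    ring
  · intro s x hs v
    have hev : ∀ᶠ p : W d in nhds (s, x), (liftT χ * ψ - ψ : Sm (W d)) p = 0 := by
      have hc : Continuous fun p : W d => 2 * (ε * p.1) ^ 2 := by fun_prop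
      filter_upwards [(hc.tendsto (s, x)).eventually_lt_const hs] with p hp
      rw [Sm.sub_apply, Sm.mul_apply, liftT_apply, dil_apply, plat_eq_one hp.le]
      ring
    have := D_eq_zero_of_eventually hev v
    rw [map_sub, Sm.sub_apply] at this
    linarith
  · intro s
    have hE := h.Em_nonneg (μ := 1) (fun x => zero_le_one) ψ 0
    have hN : 0 ≤ ∫ x, ψ (0, x) ^ 2 := integral_nonneg fun x => sq_nonneg _
    rcases le_or_gt |s| ε⁻¹ with hs | hs
    · have i1 : Integrable fun x => ε * c1 * ed0 ψ (s, x) :=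
        (hψ.ls.ed0.integrable s).const_mul (ε * c1)
      have i2 := (hψ.ls.integrable_sq s).const_mul (ε ^ 3 * c2)
      have b1s : χ1 s ^ 2 ≤ b1 ^ 2 := sq_le_sq' (abs_le.mp (hb1' _)).1 (abs_le.mp (hb1' _)).2
      have b2s : χ2 s ^ 2 ≤ b2 ^ 2 := sq_le_sq' (abs_le.mp (hb2' _)).1 (abs_le.mp (hb2' _)).2
      have b0 : χ s ^ 2 ≤ 1 := pow_le_one₀ (plat_nonneg _) (plat_le_one _)
      refine (integral_mono_of_nonneg (Eventually.of_forall fun x => ?_) (i1.add i2)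
        (Eventually.of_forall fun x => ?_)).trans ((integral_add i1 i2).trans_le ?_)
      · exact add_nonneg (by positivity) (mul_nonneg hε.le (ed0_nonneg _ _))
      · have e1 : F (s, x) = ε * (2 * χ1 s * Dt ψ (s, x) + ε * χ2 s * ψ (s, x)) := by
          simp only [hF, Sm.add_apply, Sm.smul_apply, Sm.mul_apply, liftT_apply]
          ring
        have e2 : ed0 (liftT χ * ψ) (s, x) ≤ 2 * ed0 ψ (s, x) + 2 * ε ^ 2 * b1 ^ 2 * ψ (s, x) ^ 2 := by
          rw [ed0_eq, ed0_eq]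
          simp only [D_mul, Dt_liftT, dx_liftT, hd1, Sm.add_apply, Sm.mul_apply, liftT_apply,
            map_smul, Sm.smul_apply, mul_zero, add_zero, mul_pow]
          have h1 : (χ s * Dt ψ (s, x) + ψ (s, x) * (ε * χ1 s)) ^ 2
              ≤ 2 * Dt ψ (s, x) ^ 2 + 2 * ε ^ 2 * b1 ^ 2 * ψ (s, x) ^ 2 := by
            have p1 := mul_le_mul_of_nonneg_right b0 (sq_nonneg (Dt ψ (s, x)))
            have p2 := mul_le_mul_of_nonneg_right b1s (sq_nonneg (ε * ψ (s, x)))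
            nlinarith only [p1, p2, sq_nonneg (χ s * Dt ψ (s, x) - ψ (s, x) * (ε * χ1 s))]
          have h2 : ∑ i, χ s ^ 2 * dx i ψ (s, x) ^ 2 ≤ ∑ i, dx i ψ (s, x) ^ 2 :=
            sum_le_sum fun i _ => mul_le_of_le_one_left (sq_nonneg _) b0
          have h3 : 0 ≤ ∑ i, dx i ψ (s, x) ^ 2 := sum_nonneg fun i _ => sq_nonneg _
          linarith
        have e3 : (2 * χ1 s * Dt ψ (s, x) + ε * χ2 s * ψ (s, x)) ^ 2
            ≤ 8 * b1 ^ 2 * ed0 ψ (s, x) + 2 * ε ^ 2 * b2 ^ 2 * ψ (s, x) ^ 2 := by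
          have p1 := mul_le_mul_of_nonneg_right b1s (sq_nonneg (Dt ψ (s, x)))
          have p2 := mul_le_mul_of_nonneg_right b2s (sq_nonneg (ε * ψ (s, x)))
          have p3 := mul_le_mul_of_nonneg_left (ed0_Dt_le ψ (s, x)) (sq_nonneg b1)
          nlinarith only [p1, p2, p3, sq_nonneg (2 * χ1 s * Dt ψ (s, x) - ε * χ2 s * ψ (s, x))]
        have e4 : ε⁻¹ * F (s, x) ^ 2
            = ε * (2 * χ1 s * Dt ψ (s, x) + ε * χ2 s * ψ (s, x)) ^ 2 := by
          rw [e1]; field_simp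
        simp only [Pi.add_apply]
        rw [e4]
        have q1 := mul_le_mul_of_nonneg_left e2 hε.le
        have q2 := mul_le_mul_of_nonneg_left e3 hε.le
        rw [hc1, hc2]
        linarith
      · rw [integral_const_mul, integral_const_mul]
        have h1 := mul_le_mul_of_nonneg_left (h.ed0_int_le hψ s) (by positivity : 0 ≤ ε * c1)
        have h2 := mul_le_mul_of_nonneg_left (h.sq_int_le hψ s) (by positivity : 0 ≤ ε ^ 3 * c2)
        have h3 : ε ^ 2 * s ^ 2 ≤ 1 := by
          rw [← mul_pow, sq_le_one_iff_abs_le_one, abs_mul, abs_of_pos hε]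
          have := mul_le_mul_of_nonneg_left hs hε.le
          rwa [mul_inv_cancel₀ hε.ne'] at this
        have hEm : 0 ≤ Em A 1 ψ 0 / m := div_nonneg hE hm.le
        have h4 := mul_le_mul_of_nonneg_right h3 (by positivity : 0 ≤ ε * (2 * c2) * (Em A 1 ψ 0 / m))
        have h5 : 0 ≤ ε * (2 * c2) * Em A 1 ψ 0 := by positivity
        have h6 : 0 ≤ ε * ((c1 + 2 * c2) / m) * (ε ^ 2 * ∫ x, ψ (0, x) ^ 2) := by positivity
        have h7 : ε * ((c1 + 2 * c2) / m + 2 * c2) * (Em A 1 ψ 0 + ε ^ 2 * ∫ x, ψ (0, x) ^ 2)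
          = ε * c1 * (Em A 1 ψ 0 / m) + ε * (2 * c2) * (Em A 1 ψ 0 / m)
            + ε * (2 * c2) * Em A 1 ψ 0 + ε * ((c1 + 2 * c2) / m) * (ε ^ 2 * ∫ x, ψ (0, x) ^ 2)
            + ε ^ 3 * c2 * (2 * ∫ x, ψ (0, x) ^ 2) := by ring
        rw [h7]
        linarith
    · have hz : ∀ v x, D v (liftT χ * ψ) (s, x) = 0 := fun v x => (hTS hp ψ).D v s x hs
      have : ∀ x, ε⁻¹ * F (s, x) ^ 2 + ε * ed0 (liftT χ * ψ) (s, x) = 0 := fun x => by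
        rw [hTF s x hs, ed0_eq]
        simp only [hz]
        simp
      simp only [this, integral_zero]
      positivity

theorem LS.band (hF : LS F) (T : ℝ) :
    (∫ x, ∫ t in Icc (-T) T, F (t, x)) = (∫ t in Icc (-T) T, ∫ x, F (t, x)) ∧
      IntegrableOn (fun t => ∫ x, F (t, x)) (Icc (-T) T) := by
  obtain ⟨K, hK, h⟩ := hF T
  have h1 := (Ker.band T).swap F.continuous hK h
  have h2 := ((Ker.band T).integrable_inner F.continuous hK h).2
  simp only [integral_band] at h1
  refine ⟨h1, (integrable_indicator_iff measurableSet_Icc).1 (h2.congr ?_)⟩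
  refine Eventually.of_forall fun s => ?_
  by_cases h : s ∈ Icc (-T) T <;> simp [h]

/-- The coordinate directions of space-time. -/
noncomputable def dir : Option (Fin d) → W d
  | none => (1, 0)
  | some i => (0, EuclideanSpace.single i 1)

theorem ed0_dir (ψ : Sm (W d)) : ed0 ψ = ∑ o, D (dir o) ψ * D (dir o) ψ := by
  rw [Fintype.sum_option, ed0, sq]
  simp only [sq]
  rfl

theorem pwe_dir (F : Sm (W d)) (l : ℝ) (x : E d) : pwe F l x = ∑ o, pwr (D (dir o) F) l x := by
  rw [Fintype.sum_option]
  rfl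

/-- Integrated local energy decay for frequency-localized solutions. -/
theorem EB.integrated_decay (h : EB A m L) (ha : -1 ≤ a) (hC : 0 ≤ C)
    (hres : ∀ lam ≥ 0, ∀ (u : Sm (E d)) (K : Set (E d)),
      IsCompact K → (∀ x ∉ K, u x = 0) → ∀ k > 0,
      ∫ x, zz x ^ (-(1 + a) / 2) * sen lam u x
        ≤ C * exp (C * lam) * ∫ x, (k⁻¹ * Hop A lam u x ^ 2 + k * sen lam u x)) :
    ∃ C', 0 ≤ C' ∧ ∀ ω T : ℝ, 1 ≤ ω → 1 ≤ T → ∀ (K : Ker (kT ω T) T) (ψ : Sm (W d)), Sol A ψ →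
      ∫ t in Icc (-T) T, ∫ x, zp (-(1 + a) / 2) x * ed0 (cv K ψ) (t, x)
        ≤ C' * exp (C' * ω) * Em A 1 ψ 0 := by
  obtain ⟨c, hc, hcut⟩ := h.exists_cutoff
  obtain ⟨b, hb, hk⟩ := kT_bounds
  set C1 := 4 * C * c + 4 * (d + 1) * b ^ 2 * c
  have hC1 : 0 ≤ C1 := by positivity
  refine ⟨C1 + 2 * π * C, by positivity, fun ω T hω hT K ψ hψ => ?_⟩
  have hT0 : 0 < T := by linarith
  set E0 := Em A 1 ψ 0
  set N0 := ∫ x, ψ (0, x) ^ 2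
  have hE0 : 0 ≤ E0 := h.Em_nonneg (fun _ => by simp) ψ 0
  set q : Sm (E d) := zp (-(1 + a) / 2) with hq
  have q0 : ∀ x, 0 ≤ q x := fun x => by rw [hq, zp_apply]; exact (rpow_pos_of_pos (zz_pos x) _).le
  have q1 : ∀ x, q x ≤ 1 := fun x => by
    rw [hq, zp_apply]; exact rpow_le_one_of_one_le_of_nonpos (one_le_zz x) (by linarith)
  set X := exp (C * (2 * π * ω))
  have hX : 1 ≤ X := one_le_exp (by positivity)
  have step : ∀ ε : ℝ, 0 < ε → 8 * ε ^ 2 * T ^ 2 < 1 →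
      ∫ t in Icc (-T) T, ∫ x, q x * ed0 (cv K ψ) (t, x) ≤ C1 * X * (E0 + ε ^ 2 * N0) := by
    intro ε hε hεT
    obtain ⟨φ, F, lφ, lF, tφ, tF, he, hag, hM⟩ := hcut ψ hψ ε hε
    have hband := band_estimate ha hC hres (inv_pos.2 hε) lφ lF tφ tF he hε (ω := ω) hM
    set M := c * (E0 + ε ^ 2 * N0) with hMd
    have hD : ∀ o s, ∫ x, D (dir o) φ (s, x) ^ 2 ≤ M := fun o s => by
      have i1 : Integrable fun x => ed0 φ (s, x) := lφ.ed0.integrable s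
      have i2 : Integrable fun x => F (s, x) ^ 2 := lF.integrable_sq s
      have e1 : ∫ x, D (dir o) φ (s, x) ^ 2 ≤ ∫ x, ed0 φ (s, x) :=
        integral_mono ((lφ.D _).integrable_sq s) i1 fun x => by
          cases o
          · exact ed0_Dt_le φ (s, x)
          · exact ed0_dx_le φ (s, x) _
      have e2 : ε * ∫ x, ed0 φ (s, x) ≤ ε * M := by
        rw [← integral_const_mul, hMd, ← mul_assoc]
        refine (integral_mono (i1.const_mul _) ((i2.const_mul ε⁻¹).add (i1.const_mul ε))
          fun x => ?_).trans (hM s)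
        exact le_add_of_nonneg_left (by positivity)
      exact e1.trans (le_of_mul_le_mul_left e2 hε)
    have hM0 : 0 ≤ M := (integral_nonneg fun x => sq_nonneg _).trans (hD none 0)
    have lQ : ∀ o, LS (lift q * (D (dir o) (cv K ψ) * D (dir o) (cv K ψ))) := fun o =>
      (((hψ.ls.cv K).D (dir o)).mul_left _).mul_left _
    have hfil : ∀ o, ∫ t in Icc (-T) T, ∫ x, (lift q * (D (dir o) (cv K ψ) * D (dir o) (cv K ψ)) : Sm (W d)) (t, x)
        ≤ 2 * (∫ x, q x * ∫ w in Icc (-ω) ω, pwr (D (dir o) φ) (2 * π * w) x)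
          + 4 * T * (b / T) ^ 2 * M := fun o => by
      rw [← ((lQ o).band T).1]
      refine le_of_eq_of_le ?_ (filter_estimate (by linarith) hT0 (inv_pos.2 hε).le (tφ.D (dir o)) (lφ.D (dir o))
        (g := D (dir o) (cv K ψ)) (fun t ht x => ?_) (hk ω T hω hT0).2.2.1 (hD o) q0 q1)
      · refine integral_congr_ae (Eventually.of_forall fun x => ?_)
        beta_reduce
        rw [← integral_const_mul]
        simp only [Sm.mul_apply, lift_apply, sq]
      · rw [D_cv, cv_apply]
        refine integral_congr_ae (Eventually.of_forall fun s => ?_)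
        beta_reduce
        by_cases hs : |s| ≤ T
        · rw [hag]
          have : |t - s| ≤ |2 * T| := by
            rw [abs_of_pos (by linarith : 0 < 2 * T)]
            linarith [abs_sub t s]
          have := sq_le_sq.2 this
          rw [mul_pow]
          nlinarith only [this, hεT, sq_nonneg ε]
        · rw [K.supp s (not_le.1 hs), zero_mul, zero_mul]
    have e1 : ∫ t in Icc (-T) T, ∫ x, q x * ed0 (cv K ψ) (t, x)
        = ∑ o, ∫ t in Icc (-T) T, ∫ x, (lift q * (D (dir o) (cv K ψ) * D (dir o) (cv K ψ)) : Sm (W d)) (t, x) := by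
      rw [← integral_finsetSum _ fun o _ => ((lQ o).band T).2]
      refine integral_congr_ae (Eventually.of_forall fun t => ?_)
      beta_reduce
      refine Eq.trans ?_ (integral_finsetSum _ fun o _ => (lQ o).integrable t)
      refine integral_congr_ae (Eventually.of_forall fun x => ?_)
      beta_reduce
      rw [ed0_dir, Sm.sum_apply, mul_sum]
      rfl
    have i3 : ∀ o, (Integrable fun x => q x * ∫ w in Icc (-ω) ω, pwr (D (dir o) φ) (2 * π * w) x) ∧
        ∀ x, IntegrableOn (fun w => pwr (D (dir o) φ) (2 * π * w) x) (Icc (-ω) ω) := fun o => by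
      obtain ⟨K', hK', h0⟩ := (tφ.D (dir o)).zero_off (lφ.D (dir o))
      have c1 := (tφ.D (dir o)).continuous_pwr
      constructor
      · have := (integrable_band (S := ω) (Φ := fun p => q p.2 * pwr (D (dir o) φ) (2 * π * p.1) p.2)
          ((q.continuous.comp continuous_snd).mul c1) hK' fun s x hx => by
            simp [tsl_eq_zero h0 hx]).1
        simpa only [integral_const_mul] using this
      · exact fun x => (c1.comp (by fun_prop : Continuous fun s : ℝ => (s, x))).integrableOn_Icc
    have e2 : ∑ o, ∫ x, q x * ∫ w in Icc (-ω) ω, pwr (D (dir o) φ) (2 * π * w) x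
        = ∫ x, q x * ∫ w in Icc (-ω) ω, pwe φ (2 * π * w) x := by
      rw [← integral_finsetSum _ fun o _ => (i3 o).1]
      refine integral_congr_ae (Eventually.of_forall fun x => ?_)
      beta_reduce
      simp only [pwe_dir]
      rw [← mul_sum, integral_finsetSum _ fun o _ => (i3 o).2 x]
    rw [e1]
    refine (sum_le_sum fun o _ => hfil o).trans ?_
    rw [sum_add_distrib, ← mul_sum, e2, Finset.sum_const, Finset.card_univ,
      Fintype.card_option, Fintype.card_fin, nsmul_eq_mul]
    have e3 : 2 * ε⁻¹ * (ε * c * (E0 + ε ^ 2 * N0)) = 2 * M := by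
      rw [hMd]; field_simp
    rw [e3] at hband
    have e4 : 4 * T * (b / T) ^ 2 ≤ 4 * b ^ 2 * X := by
      rw [div_pow, sq T, ← mul_div_assoc, div_le_iff₀ (by positivity)]
      nlinarith only [hT, hX, mul_le_mul hT hX zero_le_one hT0.le, mul_nonneg (sq_nonneg b) hT0.le,
        mul_nonneg (mul_nonneg (sq_nonneg b) hT0.le) (sub_nonneg.2 (mul_le_mul hT hX zero_le_one hT0.le))]
    have e5 := mul_le_mul_of_nonneg_left (mul_le_mul_of_nonneg_right e4 hM0)
      (by positivity : (0 : ℝ) ≤ d + 1)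
    have e6 : C1 * X * (E0 + ε ^ 2 * N0) = 2 * (C * X * (2 * M)) + (d + 1) * (4 * b ^ 2 * X * M) := by
      simp only [hMd, C1]; ring
    have e7 : ∫ x, q x * ∫ w in Icc (-ω) ω, pwe φ (2 * π * w) x ≤ C * X * (2 * M) := by
      simpa only [hq, zp_apply] using hband
    rw [e6]
    push_cast
    exact add_le_add (mul_le_mul_of_nonneg_left e7 (by norm_num)) e5
  have lim : Tendsto (fun ε : ℝ => C1 * X * (E0 + ε ^ 2 * N0)) (nhdsWithin 0 (Ioi 0))
      (nhds (C1 * X * (E0 + 0 ^ 2 * N0))) :=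
    ((by fun_prop : Continuous fun ε : ℝ => C1 * X * (E0 + ε ^ 2 * N0)).tendsto 0).mono_left inf_le_left
  have ev : ∀ᶠ ε : ℝ in nhdsWithin 0 (Ioi 0), 8 * ε ^ 2 * T ^ 2 < 1 :=
    (((by fun_prop : Continuous fun ε : ℝ => 8 * ε ^ 2 * T ^ 2).tendsto 0).mono_left inf_le_left).eventually
      (gt_mem_nhds (by norm_num))
  have fin := ge_of_tendsto lim (by
    filter_upwards [ev, self_mem_nhdsWithin] with ε h1 h2 using step ε h2 h1)
  rw [zero_pow two_ne_zero, zero_mul, add_zero] at fin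
  refine fin.trans (mul_le_mul_of_nonneg_right (mul_le_mul ?_ ?_ (exp_pos _).le (by positivity)) hE0)
  · exact le_add_of_nonneg_right (by positivity)
  · exact exp_le_exp.2 (by nlinarith only [mul_nonneg hC1 (by linarith : 0 ≤ ω)])

theorem pd_slice_wt (H : Sm ℝ) (α β γ : ℝ) (q : Sm (E d)) (t : ℝ) (i : Fin d) :
    pd i (slice t (wt H α β γ q)) = γ • (slice t (wt (D 1 H) α β γ q) * pd i q) := by
  ext x
  have e : slice t (wt H α β γ q)
      = Sm.comp H (algebraMap ℝ _ (α + β * t) + γ • q) fun _ => H.smooth.contDiffAt := by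
    ext y; rfl
  rw [e, D_comp_apply]
  simp only [map_add, D_algebraMap, zero_add, Derivation.map_smul, Sm.smul_apply, Sm.mul_apply]
  exact mul_left_comm _ _ _

theorem pd_jap (i : Fin d) : pd i (zp (1 / 2) : Sm (E d)) = zp (-1 / 2) * X i := by
  rw [pd_zp]
  ext x
  have : zz x ^ (-1 / 2 : ℝ) = zz x ^ (1 / 2 : ℝ) * zz x ^ (-1 : ℝ) := by
    rw [← rpow_add (zz_pos x)]; norm_num
  simp only [Sm.mul_apply, Sm.smul_apply, zp_apply, this]
  ring

theorem Hg_apply_of_pos (hs : 0 < s) : Hg s = exp (-s⁻¹) :=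
  if_neg (not_le.2 hs)

theorem D_Hg_nonneg (y : ℝ) : 0 ≤ D 1 Hg y := D_one_nonneg (H := Hg) expNegInvGlue.monotone y

theorem Hg_le_rpow (hs : 0 < s) (hδ : 0 ≤ δ) (hδ1 : δ ≤ 1) : Hg s ≤ s ^ δ := by
  rw [Hg_apply_of_pos hs]
  rcases le_total s 1 with h | h
  · refine le_trans ?_ (rpow_le_rpow_of_exponent_ge hs h hδ1)
    rw [rpow_one, exp_neg, inv_le_comm₀ (exp_pos _) hs]
    linarith [add_one_le_exp s⁻¹]
  · exact (exp_le_one_iff.2 (by simpa using hs.le)).trans (one_le_rpow h hδ)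

/-- The energy density together with the zeroth order term of Hardy's inequality. -/
noncomputable def fd (ψ : Sm (W d)) : Sm (W d) := ed0 ψ + lift (zp (-1)) * (ψ * ψ)

theorem fd_apply (ψ : Sm (W d)) (t : ℝ) (x : E d) :
    fd ψ (t, x) = ed0 ψ (t, x) + ψ (t, x) ^ 2 / zz x := by
  simp [fd, lift_apply, sq, rpow_neg_one]; ring

theorem LS.fd (h : LS ψ) : LS (LogDecay.fd ψ) := h.ed0.add ((h.mul_left ψ).mul_left _)

theorem hardy_slice (hd : 3 ≤ d) {w : Sm (W d)} {w1 : Sm (E d)} (hw : ∀ x, 0 ≤ w (t, x))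
    (h1 : ∀ i, pd i (slice t w) = w1 * X i) (hw1 : ∀ x, 0 ≤ w1 x) (hψ : LS ψ) :
    ∫ x, w (t, x) * fd ψ (t, x) ≤ 19 / 3 * ∫ x, w (t, x) * ed0 ψ (t, x) := by
  obtain ⟨K, hK, h0⟩ := hψ.zero_off t
  have h2 := hardy_weight hd (w := slice t w) hw h1 hw1 hK h0
  have i0 : Integrable fun x => w (t, x) * ed0 ψ (t, x) := (hψ.ed0.mul_left w).integrable t
  have i1 : Integrable fun x => w (t, x) * (ψ (t, x) ^ 2 / zz x) :=
    ((((hψ.mul_left ψ).mul_left (lift (zp (-1)))).mul_left w).integrable t).congr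
      (Eventually.of_forall fun x => by
        simp only [Sm.mul_apply, slice_apply, lift_apply, zp_apply, rpow_neg_one]; ring)
  have i2 : Integrable fun x => w (t, x) * gsq (slice t ψ) x :=
    Sm.integrable (f := slice t w * gsq (slice t ψ)) hK fun x hx => by
      simp [gsq_zero_off hK h0 x hx]
  have h3 : ∫ x, w (t, x) * gsq (slice t ψ) x ≤ ∫ x, w (t, x) * ed0 ψ (t, x) :=
    integral_mono i2 i0 fun x => mul_le_mul_of_nonneg_left
      (by rw [ed0_apply]; exact le_add_of_nonneg_left (sq_nonneg _)) (hw x)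
  have h4 : ∫ x, w (t, x) * fd ψ (t, x)
      = (∫ x, w (t, x) * ed0 ψ (t, x)) + ∫ x, w (t, x) * (ψ (t, x) ^ 2 / zz x) := by
    rw [← integral_add i0 i1]
    simp only [fd_apply, mul_add]
  simp only [slice_apply] at h2
  linarith

/-- A weight carrying the exterior of the light cone at distance `T`. -/
noncomputable def ext (c T : ℝ) : Sm (W d) := wt Hg 0 (-(c / T)) T⁻¹ (zp (1 / 2))

theorem ext_apply (c T t : ℝ) (x : E d) :
    ext c T (t, x) = Hg (0 + -(c / T) * t + T⁻¹ * zz x ^ (1 / 2 : ℝ)) := rfl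

theorem ext_nonneg (c T : ℝ) (p : W d) : 0 ≤ ext c T p := expNegInvGlue.nonneg _

/-- The energy outside the light cone is controlled by the weighted initial energy. -/
theorem EB.far_le (hd : 3 ≤ d) (h : EB A m L) (hψ : Sol A ψ) (hT : 0 < T)
    (ht : 0 ≤ t) (hδ : 0 ≤ δ) (hδ1 : δ ≤ 1) :
    ∫ x, ext (L / m) T (t, x) * fd ψ (t, x) ≤ 19 / 3 / m * (T ^ (-δ) * Em A (zp (δ / 2)) ψ 0) := by
  set Ω : Sm (W d) := ext (L / m) T with hΩ
  have i0 : ∀ t, Integrable fun x => Ω (t, x) * edens A ψ (t, x) := fun t =>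
    ((hψ.ls.edens A).mul_left Ω).integrable t
  have h1 : ∫ x, Ω (t, x) * fd ψ (t, x) ≤ 19 / 3 * ∫ x, Ω (t, x) * ed0 ψ (t, x) := by
    refine hardy_slice hd (fun x => ext_nonneg _ _ _)
      (w1 := T⁻¹ • (slice t (wt (D 1 Hg) 0 (-(L / m / T)) T⁻¹ (zp (1 / 2))) * zp (-1 / 2)))
      (fun i => ?_) (fun x => ?_) hψ.ls
    · rw [hΩ, ext, pd_slice_wt, pd_jap, ← mul_assoc, smul_mul_assoc]
    · have := D_Hg_nonneg (0 + -(L / m / T) * t + T⁻¹ * zp (1 / 2) x)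
      have hz := zz_pos x
      simp only [Sm.smul_apply, Sm.mul_apply, slice_apply, wt_apply, zp_apply] at *
      positivity
  have h2 : m * ∫ x, Ω (t, x) * ed0 ψ (t, x) ≤ ∫ x, Ω (t, x) * edens A ψ (t, x) := by
    rw [← integral_const_mul]
    refine integral_mono (((hψ.ls.ed0.mul_left Ω).integrable t).const_mul m) (i0 t) fun x => ?_
    have := mul_le_mul_of_nonneg_left (h.ed0_le ψ (t, x)) (ext_nonneg (L / m) T (t, x))
    simp only [slice_apply] at *
    linarith
  have h3 : ∫ x, Ω (t, x) * edens A ψ (t, x) ≤ ∫ x, Ω (0, x) * edens A ψ (0, x) :=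
    h.wt_antitone hψ.eq (Or.inr hψ.ls) D_Hg_nonneg gsq_jap
      (by rw [abs_of_pos (inv_pos.2 hT)]; exact le_of_eq (by ring)) ht
  have h4 : ∫ x, Ω (0, x) * edens A ψ (0, x) ≤ T ^ (-δ) * Em A (zp (δ / 2)) ψ 0 := by
    rw [Em, ← integral_const_mul]
    refine integral_mono (i0 0) ((hψ.ls.integrable_mul_edens _ 0).const_mul _) fun x => ?_
    have hz := zz_pos x
    have e1 : Ω (0, x) ≤ T ^ (-δ) * zz x ^ (δ / 2) := by
      rw [hΩ, ext_apply, mul_zero, zero_add, zero_add]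
      refine (Hg_le_rpow (by positivity) hδ hδ1).trans (le_of_eq ?_)
      rw [mul_rpow (by positivity) (by positivity), ← rpow_mul hz.le,
        inv_rpow hT.le, rpow_neg hT.le]
      ring_nf
    have := mul_le_mul_of_nonneg_right e1 (h.edens_nonneg ψ (0, x))
    simp only [Sm.mul_apply, slice_apply, zp_apply]
    linarith
  have hm := h.m_pos
  have h5 := h2.trans (h3.trans h4)
  have h6 : 19 / 3 / m * (T ^ (-δ) * Em A (zp (δ / 2)) ψ 0)
      = 19 / 3 * ((T ^ (-δ) * Em A (zp (δ / 2)) ψ 0) / m) := by ring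
  rw [h6]
  exact h1.trans (mul_le_mul_of_nonneg_left ((le_div_iff₀ hm).2 (by linarith)) (by norm_num))

/-- The derivative of the coefficients along the radial field, as a form in the gradient. -/
noncomputable def XA (A : Fin d → Fin d → Sm (E d)) (u : Sm (E d)) : Sm (E d) :=
  ∑ k, X k * ∑ i, ∑ j, pd k (A i j) * pd i u * pd j u

/-- The Morawetz multiplier `x · ∇u + (d - 1) / 2 u`. -/
noncomputable def Mo (u : Sm (E d)) : Sm (E d) := vf X u + algebraMap ℝ _ ((d - 1) / 2 : ℝ) * u

theorem wave_multiplier (hA : ∀ i j, A i j = A j i) (g u v : Sm (E d)) :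
    2 * g * (Pop A u * Mo u + v * Mo v)
      = dv (fun i => 2 * g * Mo u * fl A u i + g * (v ^ 2 - vf (fl A u) u) * X i)
        + (g * XA A u - g * (v ^ 2 + vf (fl A u) u) - 2 * Mo u * vf (fl A u) g
          + vf X g * (vf (fl A u) u - v ^ 2)) := by
  have e0 : ∀ Y : Fin d → Sm (E d), ∀ r : ℝ, vf Y (algebraMap ℝ _ r) = 0 := fun Y r => by
    simp [vf, D_algebraMap]
  have e1 : dv (X : Fin d → Sm (E d)) = algebraMap ℝ _ (d : ℝ) := by
    simp [dv, pd_X]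
  have e2 := vf_vf_fl hA X u
  have e3 : (∑ i, fl A u i * ∑ k, pd i (X k) * pd k u) = vf (fl A u) u := by
    simp [pd_X, vf]
  have e4 : (2 : Sm (E d)) = algebraMap ℝ _ (2 : ℝ) := (map_ofNat _ 2).symm
  have e5 : (algebraMap ℝ (Sm (E d)) ((d - 1) / 2 : ℝ)) * 2 = algebraMap ℝ _ (d : ℝ) - 1 := by
    rw [e4, ← map_mul, ← map_one (algebraMap ℝ (Sm (E d))), ← map_sub]
    congr 1; ring
  have e6 : ∀ Y : Fin d → Sm (E d), vf Y 2 = 0 := fun Y => by rw [e4, e0]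
  have e7 : ∀ Y : Fin d → Sm (E d), ∀ p q, vf Y (p - q) = vf Y p - vf Y q := fun Y p q => by
    simp only [vf, map_sub, mul_sub, sum_sub_distrib]
  rw [e3] at e2
  rw [dv_add, dv_mul, dv_mul, e1]
  simp only [Mo, vf_mul, vf_add, e7, e0, e6, sq, XA]
  change _ * (dv (fl A u) * _ + _) = _
  linear_combination g * (v * v - vf (fl A u) u) * e5 - g * e2

/-- The function `log (1 + exp y)`. -/
noncomputable def sp : Sm ℝ := Sm.mk (fun y => log (1 + exp y))
  ((contDiff_const.add contDiff_exp).log fun y => by positivity)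

theorem sp_apply (y : ℝ) : sp y = log (1 + exp y) := rfl

theorem sp_nonneg (y : ℝ) : 0 ≤ sp y :=
  log_nonneg (by linarith [exp_pos y])

theorem le_sp (y : ℝ) : y ≤ sp y :=
  (le_log_iff_exp_le (by positivity)).2 (by linarith)

theorem sp_sub (y : ℝ) : sp y - y = sp (-y) := by
  rw [sp_apply, sp_apply, sub_eq_iff_eq_add, exp_neg]
  nth_rw 3 [← log_exp y]
  rw [← log_mul (by positivity) (by positivity)]
  congr 1
  field_simp
  ring

theorem sp_le {y : ℝ} (h : y ≤ w) (hw : 1 ≤ w) : sp y ≤ 2 * w := by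
  refine (log_le_iff_le_exp (by positivity)).2 ?_
  have h1 := exp_le_exp.2 h
  have h2 := add_one_le_exp w
  rw [two_mul, exp_add]
  nlinarith only [h1, h2, hw]

theorem D_sp (y : ℝ) : 0 ≤ D 1 sp y ∧ D 1 sp y ≤ 1 := by
  have h : HasDerivAt sp (exp y / (1 + exp y)) y :=
    ((hasDerivAt_exp y).const_add 1).log (by positivity)
  rw [D_one_apply, h.deriv]
  exact ⟨by positivity, (div_le_one (by positivity)).2 (by linarith)⟩

/-- A radial plateau at scale `4 * c * T`. -/
noncomputable def pl (c T : ℝ) : Sm (E d) := slice 0 (wt plat 0 0 (4 * c * T)⁻¹ (zp (1 / 2)))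

/-- The radial derivative of `pl` divided by the radius. -/
noncomputable def pl1 (c T : ℝ) : Sm (E d) :=
  (4 * c * T)⁻¹ • (slice 0 (wt (D 1 plat) 0 0 (4 * c * T)⁻¹ (zp (1 / 2))) * zp (-1 / 2))

theorem pl_apply (c T : ℝ) (x : E d) : pl c T x = plat ((4 * c * T)⁻¹ * zz x ^ (1 / 2 : ℝ)) := by
  change plat (0 + 0 * 0 + _ * zp (1 / 2) x) = _
  rw [zero_mul, zero_add, zero_add, zp_apply]

theorem pd_pl (c T : ℝ) (i : Fin d) : pd i (pl c T) = pl1 c T * X i := by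
  rw [pl, pd_slice_wt, pd_jap, ← mul_assoc, ← smul_mul_assoc]; rfl

theorem pl_nonneg (c T : ℝ) (x : E d) : 0 ≤ pl c T x := plat_nonneg _
theorem pl_le_one (c T : ℝ) (x : E d) : pl c T x ≤ 1 := plat_le_one _

theorem pl_mul_le (hc : 1 ≤ c) (hT : 0 < T) (x : E d) (h : pl c T x ≠ 0) :
    zz x ^ (1 / 2 : ℝ) ≤ 4 * c * T := by
  by_contra! h'
  refine h ((pl_apply c T x).trans (plat_eq_zero (le_trans ?_ (le_abs_self _))))
  rw [inv_mul_eq_div, one_le_div (by positivity)]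
  exact h'.le

theorem exists_pl_far (d : ℕ) : ∃ p, 1 ≤ p ∧ ∀ c T t : ℝ, 1 ≤ c → 0 < T → t ≤ T → ∀ x : E d,
    1 - pl c T x ≤ p * ext c T (t, x) ∧ |pl1 c T x| * zz x ≤ p * ext c T (t, x) ∧
      |pl1 c T x| * zz x * zz x ^ (1 / 2 : ℝ) ≤ 4 * c * T * (p * ext c T (t, x)) := by
  have hp : ∀ s, 1 < |s| → plat s = 0 := fun s hs => plat_eq_zero hs.le
  obtain ⟨b, hb, hb'⟩ := exists_abs_le _ (Sm.D_line_zero hp)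
  refine ⟨exp 1 * (1 + b), ?_, fun c T t hc hT ht x => ?_⟩
  · nlinarith only [add_one_le_exp 1, hb]
  have hz := zz_pos x
  have hΩ := ext_nonneg c T (t, x)
  have hcT : 0 < 4 * c * T := by positivity
  set w := zz x ^ (1 / 2 : ℝ) with hw
  have hw0 : 0 < w := rpow_pos_of_pos hz _
  have hww : zz x = w * w := by rw [hw, ← rpow_add hz]; norm_num
  have hwi : zz x ^ (-1 / 2 : ℝ) = w⁻¹ := by rw [hw, ← rpow_neg hz.le]; norm_num
  set s := (4 * c * T)⁻¹ * w with hs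
  have hsw : w = 4 * c * T * s := by rw [hs, mul_inv_cancel_left₀ hcT.ne']
  have hs0 : 0 < s := by positivity
  have e0 : pl c T x = plat s := pl_apply c T x
  have e1 : |pl1 c T x| * zz x = s * |D 1 plat s| := by
    have : pl1 c T x = (4 * c * T)⁻¹ * (D 1 plat (0 + 0 * 0 + (4 * c * T)⁻¹ * zp (1 / 2) x)
      * zp (-1 / 2) x) := rfl
    rw [this, zero_mul, zero_add, zero_add, zp_apply, zp_apply, hwi, ← hw, ← hs, abs_mul, abs_mul,
      abs_of_pos (inv_pos.2 hcT), abs_of_pos (inv_pos.2 hw0), hww]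
    rw [hs]
    field_simp
  rw [e0, e1]
  rcases lt_or_ge (2 * s ^ 2) 1 with h | h
  · have h0 : D 1 plat s = 0 := by
      have h1 : D 1 (plat - 1) s = 0 := D_eq_zero_of_eventually
        (((by fun_prop : Continuous fun s : ℝ => 2 * s ^ 2).continuousAt.eventually
          (gt_mem_nhds h)).mono fun y hy => by
            rw [Sm.sub_apply, plat_eq_one (le_of_lt hy)]; simp) _
      simpa [← map_one (algebraMap ℝ (Sm ℝ)), D_algebraMap, -map_one] using h1
    rw [plat_eq_one h.le, h0, abs_zero, mul_zero, zero_mul, sub_self]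
    exact ⟨by positivity, by positivity, by positivity⟩
  · have hs2 : 1 / 2 ≤ s := by nlinarith only [h, hs0]
    have hE : 1 ≤ exp 1 * ext c T (t, x) := by
      have h1 : 1 ≤ 0 + -(c / T) * t + T⁻¹ * w := by
        have h2 : c / T * t ≤ c := by
          rw [div_mul_eq_mul_div, div_le_iff₀ hT]; nlinarith only [hc, ht]
        have h3 : T⁻¹ * w = 4 * c * s := by rw [hsw]; field_simp
        rw [h3]; nlinarith only [h2, hc, hs2]
      have h4 : Hg 1 ≤ ext c T (t, x) := expNegInvGlue.monotone h1
      rw [Hg_apply_of_pos one_pos, inv_one, exp_neg] at h4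
      rwa [← inv_le_iff_one_le_mul₀' (exp_pos 1)]
    have hE' : 1 + b ≤ exp 1 * (1 + b) * ext c T (t, x) := by nlinarith only [hE, hb]
    have hD : s * |D 1 plat s| ≤ b := by
      rcases le_or_gt s 1 with h1 | h1
      · nlinarith only [hb' s, h1, hs0, abs_nonneg (D 1 plat s)]
      · rw [Sm.D_line_zero hp s (by rwa [abs_of_pos hs0]), abs_zero, mul_zero]; exact hb
    refine ⟨by linarith [plat_nonneg s], by linarith, ?_⟩
    rcases le_or_gt s 1 with h1 | h1
    · rw [mul_comm]
      exact mul_le_mul (by nlinarith only [hsw, h1, hcT]) (by linarith) (by positivity) hcT.le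
    · rw [Sm.D_line_zero hp s (by rwa [abs_of_pos hs0]), abs_zero, mul_zero, zero_mul]
      positivity

theorem EB.quadratic_nonneg (h : EB A m L) (u f : Sm (E d)) (x : E d) (s : ℝ) :
    0 ≤ vf (fl A u) u x + 2 * s * vf (fl A u) f x + s ^ 2 * vf (fl A f) f x := by
  have h1 := h.Q_nonneg (u + s • f) x
  have h2 : vf (fl A (u + s • f)) (u + s • f)
      = vf (fl A u) u + s • vf (fl A u) f + s • (vf (fl A f) u + s • vf (fl A f) f) := by
    simp only [vf, fl, map_add, Derivation.map_smul, mul_add, add_mul, sum_add_distrib,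
      mul_smul_comm, smul_mul_assoc, ← Finset.smul_sum, smul_add]
    abel
  rw [h2, vf_fl_symm h.symm f u] at h1
  simp only [Sm.add_apply, Sm.smul_apply] at h1
  linarith

theorem XA_abs_le (h : Coef d a c₀ B A) (hB : 0 ≤ B) (u : Sm (E d)) (x : E d) :
    |XA A u x| ≤ d ^ 3 * (dl a B x * gsq u x) := by
  have hδ := dl_nonneg (a := a) hB x
  have hp := gsq_nonneg u x
  have hw : 0 < √(zz x) := sqrt_pos.2 (zz_pos x)
  have hu : ∀ i, |pd i u x| ≤ √(gsq u x) := fun i => by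
    rw [gsq_apply]; exact abs_le_sqrt_sum (fun i => pd i u x) i
  have h1 : ∀ k, |∑ i, ∑ j, pd k (A i j) x * pd i u x * pd j u x|
      ≤ d * (d * (dl a B x / √(zz x) * √(gsq u x) * √(gsq u x))) := fun k =>
    abs_sum_le_card fun i => abs_sum_le_card fun j => abs_mul_le' (abs_mul_le' (h.dA_abs i j k x) (hu i)) (hu j)
  have h2 : ∀ k, |x k * ∑ i, ∑ j, pd k (A i j) x * pd i u x * pd j u x|
      ≤ √(zz x) * (d * (d * (dl a B x / √(zz x) * √(gsq u x) * √(gsq u x)))) := fun k =>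
    abs_mul_le' ((abs_coord_le x k).trans (norm_le_sqrt_zz x)) (h1 k)
  have h3 := abs_sum_le_card h2
  have e : XA A u x = ∑ k, x k * ∑ i, ∑ j, pd k (A i j) x * pd i u x * pd j u x := by
    simp [XA]
  rw [e]
  refine h3.trans (le_of_eq ?_)
  rw [mul_assoc (dl a B x / _), mul_self_sqrt hp]
  field_simp

theorem morawetz_pointwise {g g1 h h' Ω v U J xa : ℝ} (hg : 0 ≤ g) (hg1 : g ≤ 1)
    (hΩ : 1 - g ≤ Ω) (hΩ1 : |g1| * z ≤ Ω) (hz : 0 < z) (hw : w ^ 2 = z) (hh : 0 ≤ h) (hh2 : h ≤ 2 * w)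
    (hh0 : 0 ≤ h') (hh1 : h' ≤ 1) (hp : 0 ≤ p) (hQ0 : 0 ≤ Q) (hL : 1 ≤ L) (hQ : Q ≤ L * p)
    (hM : M ^ 2 ≤ r ^ 2 * p) (hS : S ^ 2 ≤ r ^ 2 * (L * p)) (hr : r ^ 2 ≤ z) (hδ : 0 ≤ δ) (hc : 0 ≤ c)
    (hJ : -(c * δ * v ^ 2) ≤ v ^ 2 + Q + 2 * v * J) (hxa : |xa| ≤ c * (δ * p)) :
    (1 - g) * (v ^ 2 + Q) - g * h' * (v ^ 2 + Q + 2 * v * J) - 2 * (v * h + (M + κ * U)) * (g1 * S)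
        + g * xa + g1 * r ^ 2 * (Q - v ^ 2)
      ≤ (15 + 3 * κ ^ 2 + 3 * L) * (Ω * (v ^ 2 + p + U ^ 2 / z)) + 2 * c * (δ * (v ^ 2 + p)) := by
  set F := v ^ 2 + p + U ^ 2 / z with hF
  have hU : 0 ≤ U ^ 2 / z := by positivity
  have hUz : U ^ 2 = z * (U ^ 2 / z) := by field_simp
  have hv := sq_nonneg v
  have hF0 : 0 ≤ F := by positivity
  have hΩ0 : 0 ≤ Ω := le_trans (by linarith) hΩ
  have hqF : v ^ 2 + Q ≤ L * F := by nlinarith only [hF, hQ, hL, hv, hU]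
  have b1 : (1 - g) * (v ^ 2 + Q) ≤ Ω * (L * F) :=
    mul_le_mul hΩ hqF (by positivity) hΩ0
  have hgh : g * h' ≤ 1 := by nlinarith only [hg1, hh1, hg, hh0]
  have hcd : 0 ≤ c * δ * v ^ 2 := by positivity
  have b2 : -(g * h' * (v ^ 2 + Q + 2 * v * J)) ≤ c * δ * v ^ 2 := by
    have := mul_le_mul_of_nonneg_left hJ (mul_nonneg hg hh0)
    nlinarith only [this, mul_le_mul_of_nonneg_right hgh hcd]
  have hY : (v * h + (M + κ * U)) ^ 2 ≤ z * ((15 + 3 * κ ^ 2) * F) := by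
    have y1 : (v * h + (M + κ * U)) ^ 2 ≤ 3 * (v ^ 2 * h ^ 2) + 3 * M ^ 2 + 3 * κ ^ 2 * U ^ 2 := by
      nlinarith only [sq_nonneg (v * h - M), sq_nonneg (v * h - κ * U), sq_nonneg (M - κ * U)]
    have y2 : h ^ 2 ≤ 4 * z := by nlinarith only [hh, hh2, hw]
    have y3 := mul_le_mul_of_nonneg_left y2 hv
    have y4 : M ^ 2 ≤ z * p := hM.trans (mul_le_mul_of_nonneg_right hr hp)
    have y5 : 0 ≤ z * v ^ 2 := by positivity
    have y6 : 0 ≤ z * p := by positivity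
    have y7 : 0 ≤ z * (U ^ 2 / z) := by positivity
    have y8 := mul_nonneg (sq_nonneg κ) (add_nonneg y5 y6)
    rw [hUz] at y1
    rw [hF]
    nlinarith only [y1, y3, y4, y5, y6, y7, y8]
  have hSz : S ^ 2 ≤ z * (L * F) := by
    refine hS.trans (mul_le_mul hr ?_ (by positivity) hz.le)
    nlinarith only [hF, hL, hv, hU]
  have key : ∀ y : ℝ, ∀ k : ℝ, |y| ≤ z * (k * F) → 0 ≤ k → g1 * y ≤ k * (Ω * F) := fun y k hy hk => by
    refine (le_abs_self _).trans ?_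
    rw [abs_mul]
    have := mul_le_mul_of_nonneg_left hy (abs_nonneg g1)
    nlinarith only [this, mul_le_mul_of_nonneg_right hΩ1 (mul_nonneg hk hF0)]
  have b3 := key (-(2 * (v * h + (M + κ * U)) * S)) (15 + 3 * κ ^ 2 + L) (by
    rw [abs_neg]
    refine abs_le.2 ⟨?_, ?_⟩
    · nlinarith only [hY, hSz, sq_nonneg (v * h + (M + κ * U) + S)]
    · nlinarith only [hY, hSz, sq_nonneg (v * h + (M + κ * U) - S)]) (by positivity)
  have b4 := key (r ^ 2 * (Q - v ^ 2)) L (by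
    rw [abs_mul, abs_of_nonneg (sq_nonneg r)]
    refine mul_le_mul hr (abs_le.2 ⟨?_, ?_⟩) (abs_nonneg _) hz.le <;> linarith) (by linarith)
  have b5 : g * xa ≤ c * (δ * p) := by
    have := (abs_le.1 hxa).2
    have h0 : 0 ≤ c * (δ * p) := by positivity
    nlinarith only [mul_le_mul_of_nonneg_left this hg, mul_le_mul_of_nonneg_right hg1 h0]
  have b6 : 0 ≤ c * (δ * (v ^ 2 + p)) := by positivity
  linarith only [b1, b2, b3, b4, b5, b6]

/-- The Morawetz multiplier on space-time. -/
noncomputable def MoW (ψ : Sm (W d)) : Sm (W d) :=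
  ∑ i, lift (X i) * dx i ψ + algebraMap ℝ _ ((d - 1) / 2 : ℝ) * ψ

theorem slice_MoW (t : ℝ) (ψ : Sm (W d)) : slice t (MoW ψ) = Mo (slice t ψ) := by
  simp only [MoW, map_add, map_mul, map_sum (slice t), slice_lift, ← pd_slice, AlgHom.commutes, Mo, vf]

theorem Dt_MoW (ψ : Sm (W d)) : Dt (MoW ψ) = MoW (Dt ψ) := by
  rw [MoW, map_add, map_sum, D_mul, D_algebraMap, mul_zero, add_zero, MoW]
  congr 1
  refine sum_congr rfl fun i _ => ?_
  rw [D_mul, Dt_lift, mul_zero, add_zero, D_comm]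

/-- The density of the localized Morawetz functional. -/
noncomputable def mor (c T : ℝ) (ψ : Sm (W d)) : Sm (W d) := lift (2 * pl c T) * (Dt ψ * MoW ψ)

theorem slice_Dt_mor (c T t : ℝ) (hψ : Weq A ψ) :
    slice t (Dt (mor c T ψ)) = 2 * pl c T * (Pop A (slice t ψ) * Mo (slice t ψ)
      + slice t (Dt ψ) * Mo (slice t (Dt ψ))) := by
  rw [mor, D_mul, D_mul, Dt_lift, mul_zero, add_zero, Dt_MoW, ← hψ t]
  simp only [map_mul (slice t), map_add (slice t), slice_lift, slice_MoW]
  ring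

/-- The weight of the energy in the conformal multiplier. -/
noncomputable def bw (c T : ℝ) : Sm (W d) :=
  liftT wt.X0 + lift (pl c T) * wt sp 0 (-1) 1 (zp (1 / 2))

theorem bw_apply (c T t : ℝ) (x : E d) :
    bw c T (t, x) = t + pl c T x * sp (zz x ^ (1 / 2 : ℝ) - t) := by
  change t + pl c T x * sp (0 + -1 * t + 1 * zp (1 / 2) x) = _
  rw [zp_apply]; ring_nf

theorem vf_eq_of_radial (hg : ∀ i, pd i g = g1 * X i) (Y : Fin d → Sm (E d)) (x : E d) :
    vf Y g x = g1 x * ∑ i, Y i x * x i := by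
  simp only [vf, hg, Sm.sum_apply, Sm.mul_apply, X_apply, mul_sum]
  exact sum_congr rfl fun i _ => mul_left_comm _ _ _

theorem Dt_bw (c T t : ℝ) (x : E d) :
    Dt (bw c T) (t, x) = 1 - pl c T x * D 1 sp (zz x ^ (1 / 2 : ℝ) - t) := by
  have h0 : D 1 wt.X0 t = 1 := by rw [D_one_apply]; exact deriv_id t
  have h1 := Dt_wt sp 0 (-1) 1 (zp (1 / 2)) t x
  rw [bw, map_add, D_mul, Dt_lift, mul_zero, add_zero, Dt_liftT]
  simp only [Sm.add_apply, Sm.mul_apply, liftT_apply, lift_apply, h0, h1, zp_apply]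
  ring_nf

theorem vf_bw (c T t : ℝ) (Y : Fin d → Sm (E d)) (x : E d) :
    vf Y (slice t (bw c T)) x = sp (zz x ^ (1 / 2 : ℝ) - t) * vf Y (pl c T) x
      + pl c T x * (D 1 sp (zz x ^ (1 / 2 : ℝ) - t) * vf Y (zp (1 / 2)) x) := by
  have e1 : slice t (bw c T : Sm (W d)) = algebraMap ℝ _ t
      + pl c T * slice t (wt sp 0 (-1) 1 (zp (1 / 2))) := by
    rw [bw, map_add, map_mul, slice_lift, slice_liftT]; rfl
  have e2 : vf Y (slice t (wt sp 0 (-1) 1 (zp (1 / 2))))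
      = slice t (wt (D 1 sp) 0 (-1) 1 (zp (1 / 2))) * vf Y (zp (1 / 2)) := by
    simp only [vf, pd_slice_wt, one_smul, mul_sum]
    exact sum_congr rfl fun i _ => mul_left_comm _ _ _
  have e3 : vf Y (algebraMap ℝ _ t) = 0 := by simp [vf, D_algebraMap]
  have e4 : ∀ H, wt H 0 (-1) 1 (zp (1 / 2)) (t, x) = H (zz x ^ (1 / 2 : ℝ) - t) := fun H => by
    rw [wt_apply, zp_apply]; ring_nf
  rw [e1, vf_add, e3, zero_add, vf_mul, e2]
  simp only [Sm.add_apply, Sm.mul_apply, slice_apply, e4]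
  ring

/-- The localized conformal energy. -/
noncomputable def Zf (A : Fin d → Fin d → Sm (E d)) (c T : ℝ) (ψ : Sm (W d)) (t : ℝ) : ℝ :=
  (∫ x, (slice t (bw c T) * slice t (edens A ψ) : Sm (E d)) x) + ∫ x, slice t (mor c T ψ) x

theorem EB.hasDerivAt_Zf (h : EB A m L) (hd : 1 ≤ d) (hA : Coef d a c₀ B A) (ha : 0 < a)
    (hB : 0 ≤ B) : ∃ C, 0 ≤ C ∧ ∀ (ψ : Sm (W d)), Sol A ψ → ∀ T t : ℝ, 0 < T → 0 ≤ t → t ≤ T →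
      ∃ Z', HasDerivAt (Zf A (L / m) T ψ) Z' t ∧
        Z' ≤ C * ((∫ x, ext (L / m) T (t, x) * fd ψ (t, x))
          + ∫ x, zp (-(1 + a) / 2) x * ed0 ψ (t, x)) := by
  obtain ⟨p, hp1, hp⟩ := exists_pl_far d
  set κ : ℝ := (d - 1) / 2 with hκ
  set c := CG d B + d ^ 3 with hc
  have hCG : 0 ≤ CG d B := by unfold CG; positivity
  have hL := h.one_le
  set C := (15 + 3 * κ ^ 2 + 3 * L) * p + 2 * c * B with hC
  have hC0 : 0 ≤ C := by positivity
  refine ⟨C, hC0, fun ψ hψ T t hT ht htT => ?_⟩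
  have d1 := hasDerivAt_energy h.symm (b := bw (L / m) T) (g := 0) (Or.inr hψ.ls)
    (fun t => by rw [hψ.eq t, map_zero, add_zero]) t
  have lm : LS (mor (L / m) T ψ) := ((hψ.ls.D _).mul_right _).mul_left _
  refine ⟨_, d1.add (lm.hasDerivAt_integral t), ?_⟩
  set u := slice t ψ with hu
  set v := slice t (Dt ψ) with hv
  set g : Sm (E d) := pl (L / m) T with hg
  have e1 := (slice_Dt_mor (L / m) T t hψ.eq).trans (wave_multiplier h.symm g u v)
  set J : Fin d → Sm (E d) := fun i => 2 * g * Mo u * fl A u i + g * (v ^ 2 - vf (fl A u) u) * X i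
  set R : Sm (E d) := g * XA A u - g * (v ^ 2 + vf (fl A u) u) - 2 * Mo u * vf (fl A u) g
          + vf X g * (vf (fl A u) u - v ^ 2)
  obtain ⟨K, hK, h0⟩ := hψ.ls.zero_off t
  obtain ⟨K', hK', h0'⟩ := (hψ.ls.D (1, 0)).zero_off t
  have hKK := hK.union hK'
  have hJ : ∀ i, ∀ x ∉ K ∪ K', J i x = 0 := fun i x hx => by
    have h1 : ∀ i, pd i u x = 0 := fun i => D_eq_zero_of_notMem hK.isClosed h0 (fun h => hx (Or.inl h)) _
    have h2 : v x = 0 := h0' x fun h => hx (Or.inr h)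
    have h3 : u x = 0 := h0 x fun h => hx (Or.inl h)
    simp [J, Mo, vf, h1, h2, h3]
  have iJ : Integrable (dv J) := Sm.integrable hKK fun x hx => by
    have h1 : ∀ i, pd i (J i) x = 0 := fun i => D_eq_zero_of_notMem hKK.isClosed (hJ i) hx _
    simp [dv, h1]
  have iM : Integrable (slice t (Dt (mor (L / m) T ψ))) := (lm.D _).integrable t
  have eR : ∀ x, R x = slice t (Dt (mor (L / m) T ψ)) x - dv J x := fun x => by
    rw [e1]; simp
  have iR : Integrable R := (iM.sub iJ).congr (Eventually.of_forall fun x => (eR x).symm)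
  have e2 : ∫ x, slice t (Dt (mor (L / m) T ψ)) x = ∫ x, R x := by
    simp only [eR]
    rw [integral_sub iM iJ, integral_dv_eq_zero hKK hJ, sub_zero]
  have iq : Integrable (slice t (Dt (bw (L / m) T)) * slice t (edens A ψ)
        + 2 * slice t (bw (L / m) T) * v * slice t 0
        - 2 * v * vf (fl A u) (slice t (bw (L / m) T)) : Sm (E d)) := by
    obtain ⟨K2, hK2, h2⟩ := (hψ.ls.edens A).zero_off t
    refine Sm.integrable (hK2.union hK') fun x hx => ?_
    have h3 : v x = 0 := h0' x fun h => hx (Or.inr h)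
    simp [h2 x fun h => hx (Or.inl h), h3]
  have i1 : Integrable fun x => ext (L / m) T (t, x) * fd ψ (t, x) :=
    ((hψ.ls.fd).mul_left (ext (L / m) T)).integrable t
  have i2 : Integrable fun x => zp (-(1 + a) / 2) x * ed0 ψ (t, x) :=
    (hψ.ls.ed0.mul_left (lift (zp (-(1 + a) / 2)))).integrable t
  rw [e2, ← integral_add iq iR, ← integral_add i1 i2, ← integral_const_mul]
  refine integral_mono (iq.add iR) ((i1.add i2).const_mul C) fun x => ?_
  obtain ⟨f1, f2, -⟩ := hp (L / m) T t h.one_le_speed hT htT x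
  have hz := zz_pos x
  set w := zz x ^ (1 / 2 : ℝ) with hw
  have hww : w ^ 2 = zz x := by rw [hw, ← rpow_natCast, ← rpow_mul hz.le]; norm_num
  have hw1 : 1 ≤ w := one_le_rpow (one_le_zz x) (by norm_num)
  have grd := hA.grd hd ha hB u x
  have hδ := dl_nonneg (a := a) hB x
  have hS : (∑ i, fl A u i x * x i) ^ 2 ≤ ‖x‖ ^ 2 * (L * gsq u x) := by
    rw [norm_sq_eq_sum]
    refine (Finset.sum_mul_sq_le_sq_mul_sq _ _ _).trans ?_
    rw [mul_comm]
    exact mul_le_mul_of_nonneg_left (h.fl_le u x) (sum_nonneg fun _ _ => sq_nonneg _)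
  have hJ' : -(c * dl a B x * v x ^ 2) ≤ v x ^ 2 + vf (fl A u) u x
      + 2 * v x * vf (fl A u) (zp (1 / 2)) x := by
    have q1 := h.quadratic_nonneg u (zp (1 / 2)) x (v x)
    have q2 := (abs_le.1 (hA.grd hd ha hB (zp (1 / 2)) x).Qp).2
    have q3 := gsq_jap x
    have q4 : CG d B * dl a B x * gsq (zp (1 / 2)) x ≤ c * dl a B x := by
      have := mul_le_mul_of_nonneg_left q3 (mul_nonneg hCG hδ)
      have h3 : 0 ≤ (d : ℝ) ^ 3 * dl a B x := by positivity
      rw [hc]; linarith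
    nlinarith only [q1, mul_le_mul_of_nonneg_left (show vf (fl A (zp (1 / 2))) (zp (1 / 2)) x ≤ 1 + c * dl a B x by linarith) (sq_nonneg (v x))]
  have hxa : |XA A u x| ≤ c * (dl a B x * gsq u x) := by
    refine (XA_abs_le hA hB u x).trans (mul_le_mul_of_nonneg_right ?_ (mul_nonneg hδ grd.hp))
    rw [hc]; linarith
  have key := morawetz_pointwise (g := g x) (g1 := pl1 (L / m) T x) (U := u x) (κ := κ)
    (pl_nonneg _ _ x) (pl_le_one _ _ x) f1 f2 hz hww (sp_nonneg (w - t)) (sp_le (by linarith) hw1)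
    (D_sp (w - t)).1 (D_sp (w - t)).2 grd.hp (h.Q_nonneg u x) hL (h.hi u x) (vf_X_sq_le u x) hS
    (by rw [zz_apply]; linarith : ‖x‖ ^ 2 ≤ zz x) hδ (by positivity) hJ' hxa
  have hX : ∑ i, X i x * x i = ‖x‖ ^ 2 := by
    rw [norm_sq_eq_sum]; exact sum_congr rfl fun i _ => (sq (x i)).symm
  have hMo : Mo u x = vf X u x + κ * u x := by simp [Mo, hκ]
  have hdl : dl a B x = B * zp (-(1 + a) / 2) x := rfl
  have hfd : fd ψ (t, x) = v x ^ 2 + gsq u x + u x ^ 2 / zz x := by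
    rw [fd_apply, ed0_apply]; rfl
  have hed : ed0 ψ (t, x) = v x ^ 2 + gsq u x := ed0_apply ψ t x
  have hE : edens A ψ (t, x) = v x ^ 2 + vf (fl A u) u x := edens_apply A ψ t x
  have hΩF : 0 ≤ ext (L / m) T (t, x) * fd ψ (t, x) :=
    mul_nonneg (ext_nonneg _ _ _) (by rw [fd_apply]; have := ed0_nonneg ψ (t, x); positivity)
  have hwE : 0 ≤ zp (-(1 + a) / 2) x * ed0 ψ (t, x) :=
    mul_nonneg (by rw [zp_apply]; positivity) (ed0_nonneg _ _)
  simp only [Sm.add_apply, Sm.sub_apply, Sm.mul_apply, Sm.ofNat_apply, Sm.pow_apply, map_zero,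
    Sm.zero_apply, slice_apply, Dt_bw, vf_bw, hE, hMo, R, vf_eq_of_radial (pd_pl (L / m) T), hX,
    ← hw, hg] at key ⊢
  rw [hdl, ← hfd, ← hed] at key
  set F := ext (L / m) T (t, x) * fd ψ (t, x) with hF
  set G := zp (-(1 + a) / 2) x * ed0 ψ (t, x) with hG
  have e3 : (15 + 3 * κ ^ 2 + 3 * L) * (p * ext (L / m) T (t, x) * fd ψ (t, x))
      + 2 * c * (B * zp (-(1 + a) / 2) x * ed0 ψ (t, x))
      = (15 + 3 * κ ^ 2 + 3 * L) * p * F + 2 * c * B * G := by rw [hF, hG]; ring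
  have e4 : (15 + 3 * κ ^ 2 + 3 * L) * p * F + 2 * c * B * G ≤ C * (F + G) := by
    have h1 : 0 ≤ (15 + 3 * κ ^ 2 + 3 * L) * p * G := by positivity
    have h2 : 0 ≤ 2 * c * B * F := by positivity
    rw [hC]; linarith
  rw [e3] at key
  have key' := key.trans e4
  linarith only [key']

theorem zp_half_sq (x : E d) : (zz x ^ (1 / 2 : ℝ)) ^ 2 = zz x := by
  rw [← rpow_natCast, ← rpow_mul (zz_pos x).le]; norm_num

theorem one_le_jap (x : E d) : 1 ≤ zz x ^ (1 / 2 : ℝ) :=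
  one_le_rpow (one_le_zz x) (by norm_num)

theorem norm_sq_le_zz (x : E d) : ‖x‖ ^ 2 ≤ zz x := by rw [zz_apply]; linarith

/-- The lower order part of the Morawetz multiplier has a sign after integration by parts. -/
theorem integral_Mo_sq_le (hd : 1 ≤ d) (hg : ∀ i, pd i g = g1 * X i)
    (hg0 : ∀ x, 0 ≤ g x) (hK : IsCompact K) (hu : ∀ x ∉ K, u x = 0) :
    ∫ x, (g * zp (-1 / 2) * Mo u ^ 2 : Sm (E d)) x
      ≤ ∫ x, (g x * zz x ^ (1 / 2 : ℝ) * gsq u x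
        + (d - 1) / 2 * (|g1 x| * zz x * zz x ^ (1 / 2 : ℝ) * (u x ^ 2 / zz x))) := by
  set κ : ℝ := (d - 1) / 2 with hκ
  have hκ0 : 0 ≤ κ := by
    have : (1 : ℝ) ≤ d := by exact_mod_cast hd
    rw [hκ]; linarith
  have hG : ∀ i, pd i (g * zp (-1 / 2)) = (g1 * zp (-1 / 2) - g * (zp (-1 / 2) * zp (-1))) * X i :=
    fun i => by
    rw [D_mul, hg, pd_zp]
    norm_num
    ring
  have hJ : ∀ i, ∀ x ∉ K, (g * zp (-1 / 2) * X i * u ^ 2 : Sm (E d)) x = 0 := fun i x hx => by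
    simp [hu x hx]
  have h1 : ∀ x ∉ K, ∀ i, pd i u x = 0 := fun x hx i => D_eq_zero_of_notMem hK.isClosed hu hx _
  have iM : Integrable (g * zp (-1 / 2) * Mo u ^ 2 : Sm (E d)) := Sm.integrable hK fun x hx => by
    simp [Mo, vf, h1 x hx, hu x hx]
  have iD : Integrable (dv fun i => g * zp (-1 / 2) * X i * u ^ 2) := Sm.integrable hK fun x hx => by
    rw [dv_radial_sq hG, hu x hx]; simp
  have i2 : Integrable fun x => (g x * zz x ^ (1 / 2 : ℝ) * gsq u x
        + κ * (|g1 x| * zz x * zz x ^ (1 / 2 : ℝ) * (u x ^ 2 / zz x))) := by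
    refine Continuous.integrable_of_hasCompactSupport ?_
      (HasCompactSupport.of_support_subset_isCompact hK fun x hx => ?_)
    · have c1 : Continuous fun x : E d => zz x ^ (1 / 2 : ℝ) := (zp (1 / 2) : Sm (E d)).continuous
      have c2 := (zz : Sm (E d)).continuous
      have c3 := g.continuous
      have c4 := g1.continuous
      have c5 := (gsq u).continuous
      have c6 := u.continuous
      exact ((c3.mul c1).mul c5).add (continuous_const.mul (((c4.abs.mul c2).mul c1).mul
        ((c6.pow 2).div c2 fun x => (zz_pos x).ne')))
    · by_contra h
      exact hx (by simp [gsq_zero_off hK hu x h, hu x h])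
  have h3 := integral_mono iM (i2.add (iD.const_mul κ)) fun x => ?_
  · refine h3.trans_eq ?_
    rw [integral_add' i2 (iD.const_mul κ), integral_const_mul, integral_dv_eq_zero hK hJ, mul_zero,
      add_zero]
  have hz := zz_pos x
  simp only [Pi.add_apply]
  rw [dv_radial_sq hG]
  have hw1 := one_le_jap x
  have hww := zp_half_sq x
  have hv := vf_X_sq_le u x
  have hn := norm_sq_le_zz x
  have e1 : zp (-1 / 2) x = (zz x ^ (1 / 2 : ℝ))⁻¹ := by
    rw [zp_apply, ← rpow_neg hz.le]; norm_num
  have hMo : Mo u x = vf X u x + κ * u x := by simp [Mo, hκ]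
  have hdκ : (d : ℝ) = 2 * κ + 1 := by rw [hκ]; ring
  simp only [Sm.mul_apply, Sm.pow_apply, Sm.sub_apply, e1, zp_neg_one_apply, hMo, hdκ]
  set w := zz x ^ (1 / 2 : ℝ)
  have hw0 : 0 < w := by linarith
  have hg := hg0 x
  rw [← hww] at hn ⊢
  have p1 : g x * w⁻¹ * vf X u x ^ 2 ≤ g x * w * gsq u x := by
    have : vf X u x ^ 2 ≤ w ^ 2 * gsq u x :=
      hv.trans (mul_le_mul_of_nonneg_right hn (gsq_nonneg u x))
    calc g x * w⁻¹ * vf X u x ^ 2 ≤ g x * w⁻¹ * (w ^ 2 * gsq u x) := by gcongr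
      _ = _ := by field_simp
  have p2 : -(g1 x * w⁻¹ * ‖x‖ ^ 2 * u x ^ 2) ≤ |g1 x| * w ^ 2 * w * (u x ^ 2 / w ^ 2) := by
    calc -(g1 x * w⁻¹ * ‖x‖ ^ 2 * u x ^ 2) = (-g1 x) * (w⁻¹ * ‖x‖ ^ 2 * u x ^ 2) := by ring
      _ ≤ |g1 x| * (w⁻¹ * w ^ 2 * u x ^ 2) :=
        mul_le_mul (neg_le_abs _) (by gcongr) (by positivity) (abs_nonneg _)
      _ = _ := by field_simp
  have p3 : g x * (w⁻¹ * (w ^ 2)⁻¹) * ‖x‖ ^ 2 * u x ^ 2 ≤ g x * w⁻¹ * u x ^ 2 := by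
    calc g x * (w⁻¹ * (w ^ 2)⁻¹) * ‖x‖ ^ 2 * u x ^ 2
        ≤ g x * (w⁻¹ * (w ^ 2)⁻¹) * w ^ 2 * u x ^ 2 := by gcongr
      _ = _ := by field_simp
  have p4 : 0 ≤ κ ^ 2 * (g x * w⁻¹ * u x ^ 2) := by positivity
  linarith only [p1, mul_le_mul_of_nonneg_left p2 hκ0, mul_le_mul_of_nonneg_left p3 hκ0, p4]

theorem dl_mul_le (ha : 0 ≤ a) (hB : 0 ≤ B) (x : E d) :
    dl a B x * zz x ^ (1 / 2 : ℝ) ≤ B := by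
  change B * zp (-(1 + a) / 2) x * _ ≤ _
  rw [zp_apply, mul_assoc, ← rpow_add (zz_pos x)]
  exact mul_le_of_le_one_right hB (rpow_le_one_of_one_le_of_nonpos (one_le_zz x) (by linarith))

theorem EB.le_Zf (h : EB A m L) (hd : 1 ≤ d) (hA : Coef d a c₀ B A) (ha : 0 < a)
    (hB : 0 ≤ B) : ∃ C, 0 ≤ C ∧ ∀ (ψ : Sm (W d)), Sol A ψ → ∀ R T : ℝ, 0 ≤ R → 2 * (1 + R) ≤ T →
      T / 2 * ∫ x in Metric.closedBall 0 R, edens A ψ (T, x) ≤ Zf A (L / m) T ψ T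
        + C * (Em A 1 ψ 0 + T * ∫ x, ext (L / m) T (T, x) * fd ψ (T, x)) := by
  obtain ⟨p, hp1, hp⟩ := exists_pl_far d
  set κ : ℝ := (d - 1) / 2 with hκ
  have hκ0 : 0 ≤ κ := by
    have : (1 : ℝ) ≤ d := by exact_mod_cast hd
    rw [hκ]; linarith
  have hCG : 0 ≤ CG d B := by unfold CG; positivity
  have hc := h.one_le_speed
  set c := L / m with hc'
  have hm := h.m_pos
  set C₁ := CG d B * B with hC₁
  have hC₁0 : 0 ≤ C₁ := by positivity
  set C₂ := κ * (4 * c * p) with hC₂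
  have hC₂0 : 0 ≤ C₂ := by positivity
  refine ⟨C₁ / m + C₂, by positivity, fun ψ hψ R T hR hT => ?_⟩
  have hT0 : 0 < T := by linarith
  set u := slice T ψ with hu
  set v := slice T (Dt ψ) with hv
  set g : Sm (E d) := pl c T with hg
  obtain ⟨K, hK, h0⟩ := hψ.ls.zero_off T
  replace h0 : ∀ x ∉ K, u x = 0 := h0
  have hM := integral_Mo_sq_le hd (pd_pl c T) (pl_nonneg c T) hK h0
  rw [← hκ, ← hg] at hM
  have lm : LS (mor c T ψ) := ((hψ.ls.D _).mul_right _).mul_left _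
  have i1 : Integrable (slice T (bw c T) * slice T (edens A ψ) : Sm (E d)) :=
    hψ.ls.integrable_mul_edens _ T
  have i2 := lm.integrable T
  have i3 : Integrable (g * zp (-1 / 2) * Mo u ^ 2 : Sm (E d)) := Sm.integrable hK fun x hx => by
    have h1 : ∀ i, pd i u x = 0 := fun i => D_eq_zero_of_notMem hK.isClosed h0 hx _
    simp [Mo, vf, h1, h0 x hx]
  have i4 : Integrable fun x => ext c T (T, x) * fd ψ (T, x) :=
    ((hψ.ls.fd).mul_left (ext c T)).integrable T
  have i5 : Integrable fun x => ed0 ψ (T, x) := hψ.ls.ed0.integrable T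
  have i6 : Integrable fun x => (g x * zz x ^ (1 / 2 : ℝ) * gsq u x
        + κ * (|pl1 c T x| * zz x * zz x ^ (1 / 2 : ℝ) * (u x ^ 2 / zz x))) := by
    refine Continuous.integrable_of_hasCompactSupport ?_
      (HasCompactSupport.of_support_subset_isCompact hK fun x hx => ?_)
    · have c1 : Continuous fun x : E d => zz x ^ (1 / 2 : ℝ) := (zp (1 / 2) : Sm (E d)).continuous
      have c2 := (zz : Sm (E d)).continuous
      have c3 := g.continuous
      have c4 := (pl1 c T : Sm (E d)).continuous
      have c5 := (gsq u).continuous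
      have c6 := u.continuous
      exact ((c3.mul c1).mul c5).add (continuous_const.mul (((c4.abs.mul c2).mul c1).mul
        ((c6.pow 2).div c2 fun x => (zz_pos x).ne')))
    · by_contra h
      exact hx (by simp [gsq_zero_off hK h0 x h, h0 x h])
  have iq : Integrable fun x => edens A ψ (T, x) := (hψ.ls.edens A).integrable T
  have hpt : ∀ x, (Metric.closedBall (0 : E d) R).indicator (fun x => T / 2 * edens A ψ (T, x)) x
      ≤ ((slice T (bw c T) * slice T (edens A ψ) : Sm (E d)) x + slice T (mor c T ψ) x)
        + ((g * zp (-1 / 2) * Mo u ^ 2 : Sm (E d)) x - (g x * zz x ^ (1 / 2 : ℝ) * gsq u x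
        + κ * (|pl1 c T x| * zz x * zz x ^ (1 / 2 : ℝ) * (u x ^ 2 / zz x))))
        + (C₁ * ed0 ψ (T, x) + C₂ * T * (ext c T (T, x) * fd ψ (T, x))) := fun x => by
    have hz := zz_pos x
    have hw1 := one_le_jap x
    have hww := zp_half_sq x
    have hq := h.edens_nonneg ψ (T, x)
    have hed : ed0 ψ (T, x) = v x ^ 2 + gsq u x := ed0_apply ψ T x
    have hE : edens A ψ (T, x) = v x ^ 2 + vf (fl A u) u x := edens_apply A ψ T x
    have hfd := fd_apply ψ T x
    have hdl := dl_mul_le (d := d) ha.le hB x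
    have hQ := (abs_le.1 (hA.grd hd ha hB u x).Qp).1
    have hδ := dl_nonneg (a := a) hB x
    obtain ⟨-, -, f3⟩ := hp c T T hc hT0 le_rfl x
    have hg0 := pl_nonneg c T x
    have hg1 := pl_le_one c T x
    have e1 : zp (-1 / 2) x = (zz x ^ (1 / 2 : ℝ))⁻¹ := by
      rw [zp_apply, ← rpow_neg hz.le]; norm_num
    have e2 : slice T (mor c T ψ) x = 2 * g x * (v x * Mo u x) := by
      rw [mor, map_mul, slice_lift, map_mul, slice_MoW, ← hu, ← hv, ← hg]; simp only [Sm.mul_apply, Sm.ofNat_apply]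
    have e3 := sp_sub (zz x ^ (1 / 2 : ℝ) - T)
    simp only [Sm.mul_apply, Sm.pow_apply, slice_apply, bw_apply, e1, e2]
    rw [← hg] at hg0 hg1 ⊢
    have hball : x ∈ Metric.closedBall (0 : E d) R → zz x ^ (1 / 2 : ℝ) ≤ T / 2 := fun hx => by
      have hx' : ‖x‖ ≤ R := by simpa using hx
      refine abs_le_of_sq_le_sq' ?_ (by linarith) |>.2
      rw [hww, zz_apply]
      nlinarith only [norm_nonneg x, hx', hR, hT]
    set w := zz x ^ (1 / 2 : ℝ)
    have hw0 : 0 < w := by linarith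
    have s0 := sp_nonneg (-(w - T))
    have s1 := le_sp (-(w - T))
    have hgsq := gsq_nonneg u x
    have r1 : 0 ≤ 2 * (v x * Mo u x) + w * v x ^ 2 + w⁻¹ * Mo u x ^ 2 := by
      have : 2 * (v x * Mo u x) + w * v x ^ 2 + w⁻¹ * Mo u x ^ 2
          = w⁻¹ * (w * v x + Mo u x) ^ 2 := by field_simp; ring
      rw [this]; positivity
    have r2 : g x * w * (v x ^ 2 + gsq u x)
        ≤ g x * w * edens A ψ (T, x) + C₁ * ed0 ψ (T, x) := by
      have a1 : g x * w * (CG d B * dl a B x * gsq u x) ≤ C₁ * gsq u x := by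
        calc g x * w * (CG d B * dl a B x * gsq u x)
            = CG d B * gsq u x * (g x * (dl a B x * w)) := by ring
          _ ≤ CG d B * gsq u x * (1 * B) := by gcongr
          _ = _ := by rw [hC₁]; ring
      have a2 : C₁ * gsq u x ≤ C₁ * ed0 ψ (T, x) := by
        rw [hed]; exact mul_le_mul_of_nonneg_left (by nlinarith only) hC₁0
      have a3 := mul_le_mul_of_nonneg_left hQ (mul_nonneg hg0 hw0.le)
      rw [hE]
      linarith only [a1, a2, a3]
    have r3 : κ * (|pl1 c T x| * zz x * w * (u x ^ 2 / zz x))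
        ≤ C₂ * T * (ext c T (T, x) * fd ψ (T, x)) := by
      have b1 : u x ^ 2 / zz x ≤ fd ψ (T, x) := by
        rw [hfd]; have := ed0_nonneg ψ (T, x); rw [hu, slice_apply]; linarith
      calc κ * (|pl1 c T x| * zz x * w * (u x ^ 2 / zz x))
          ≤ κ * (4 * c * T * (p * ext c T (T, x)) * fd ψ (T, x)) := by
            refine mul_le_mul_of_nonneg_left (mul_le_mul f3 b1 (by positivity) ?_) hκ0
            have := ext_nonneg c T (T, x); positivity
        _ = _ := by rw [hC₂]; ring
    have hwt : (Metric.closedBall (0 : E d) R).indicator (fun x => T / 2 * edens A ψ (T, x)) x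
        ≤ (T * (1 - g x) + g x * sp (-(w - T))) * edens A ψ (T, x) := by
      by_cases hx : x ∈ Metric.closedBall (0 : E d) R
      · rw [indicator_of_mem hx]
        have := hball hx
        exact mul_le_mul_of_nonneg_right (by
          nlinarith only [mul_le_mul_of_nonneg_left (show T / 2 ≤ sp (-(w - T)) by linarith) hg0, hg1, hT0]) hq
      · rw [indicator_of_notMem hx]
        have : 0 ≤ 1 - g x := by linarith
        positivity
    have e4 : sp (w - T) = sp (-(w - T)) + (w - T) := by linarith
    have r4 := mul_nonneg hg0 r1
    rw [e4]
    linarith only [hwt, r2, r3, r4]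
  have i7 := i5.const_mul C₁
  have i8 := i4.const_mul (C₂ * T)
  have hfin := integral_mono ((iq.const_mul (T / 2)).indicator Metric.isClosed_closedBall.measurableSet)
    (((i1.add i2).add (i3.sub i6)).add (i7.add i8)) hpt
  rw [integral_indicator Metric.isClosed_closedBall.measurableSet, integral_const_mul,
    integral_add' ((i1.add i2).add (i3.sub i6)) (i7.add i8), integral_add' (i1.add i2) (i3.sub i6),
    integral_add' i1 i2, integral_sub' i3 i6, integral_add' i7 i8, integral_const_mul,
    integral_const_mul] at hfin
  have h5 := mul_le_mul_of_nonneg_left (h.ed0_int_le hψ T) hC₁0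
  have hext : 0 ≤ ∫ x, ext c T (T, x) * fd ψ (T, x) := integral_nonneg fun x =>
    mul_nonneg (ext_nonneg _ _ _) (by
      rw [fd_apply]; have := ed0_nonneg ψ (T, x); have := zz_pos x; positivity)
  have hE0 := h.Em_nonneg (μ := 1) (fun _ => zero_le_one) ψ 0
  have g1 : 0 ≤ C₁ / m * (T * ∫ x, ext c T (T, x) * fd ψ (T, x)) := by positivity
  have g2 : 0 ≤ C₂ * Em A 1 ψ 0 := by positivity
  rw [Zf]
  have e5 : C₁ * (Em A 1 ψ 0 / m) = C₁ / m * Em A 1 ψ 0 := by ring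
  linarith only [hfin, hM, h5, g1, g2, e5]

theorem EB.weighted_fd_le (h : EB A m L) (hd : 3 ≤ d) (hψ : LS ψ) (hp : 0 ≤ p) : ∫ x, lift (zp p) ((0 : ℝ), x) * fd ψ (0, x) ≤ 19 / 3 / m * Em A (zp p) ψ 0 := by
  refine (hardy_slice (w := lift (zp p)) (w1 := (2 * p) • (zp p * zp (-1))) hd (fun x => ?_) (fun i => ?_) (fun x => ?_)
    hψ).trans ?_
  · rw [lift_apply, zp_apply]; have := zz_pos x; positivity
  · rw [slice_lift, pd_zp]
  · have := zz_pos x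
    simp only [Sm.smul_apply, Sm.mul_apply, zp_apply]; positivity
  · rw [div_mul_eq_mul_div (19 / 3) m, mul_div_assoc (19 / 3 : ℝ)]
    refine mul_le_mul_of_nonneg_left ?_ (show (0 : ℝ) ≤ 19 / 3 by norm_num)
    rw [le_div_iff₀ h.m_pos, mul_comm, ← integral_const_mul]
    refine integral_mono (((hψ.ed0.mul_left (lift (zp p))).integrable 0).const_mul m)
      (hψ.integrable_mul_edens _ 0) fun x => ?_
    have h0 : 0 ≤ zp p x := by rw [zp_apply]; have := zz_pos x; positivity
    have := mul_le_mul_of_nonneg_left (h.ed0_le ψ (0, x)) h0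
    simp only [Sm.mul_apply, slice_apply, lift_apply]
    linarith

theorem EB.Zf_zero_le (h : EB A m L) (hd : 3 ≤ d) : ∃ C, 0 ≤ C ∧ ∀ (ψ : Sm (W d)), Sol A ψ →
    ∀ T δ : ℝ, 0 < T → 0 ≤ δ → δ ≤ 1 →
      Zf A (L / m) T ψ 0 ≤ C * (T ^ (1 - δ) * Em A (zp (δ / 2)) ψ 0) := by
  set κ : ℝ := (d - 1) / 2 with hκ
  have hc := h.one_le_speed
  set c := L / m with hc'
  have hm := h.m_pos
  have hL := h.L_pos
  set C₁ := (2 * L + 3 + 2 * κ ^ 2) with hC₁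
  have hC₁0 : 0 ≤ C₁ := by positivity
  refine ⟨C₁ * (4 * c) * (19 / 3 / m), by positivity, fun ψ hψ T δ hT hδ hδ1 => ?_⟩
  have lm : LS (mor c T ψ) := ((hψ.ls.D _).mul_right _).mul_left _
  have i1 : Integrable (slice 0 (bw c T) * slice 0 (edens A ψ) : Sm (E d)) :=
    hψ.ls.integrable_mul_edens _ 0
  have i2 := lm.integrable 0
  have i3 : Integrable fun x => lift (zp (δ / 2)) ((0 : ℝ), x) * fd ψ (0, x) :=
    (hψ.ls.fd.mul_left (lift (zp (δ / 2)))).integrable 0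
  set u := slice 0 ψ with hu
  set v := slice 0 (Dt ψ) with hv
  have hpt : ∀ x, (slice 0 (bw c T) * slice 0 (edens A ψ) : Sm (E d)) x + slice 0 (mor c T ψ) x
      ≤ C₁ * (4 * c * T ^ (1 - δ)) * (lift (zp (δ / 2)) ((0 : ℝ), x) * fd ψ (0, x)) := fun x => by
    have hz := zz_pos x
    have hw1 := one_le_jap x
    have hww := zp_half_sq x
    have hq := h.edens_nonneg ψ (0, x)
    have hqL := h.edens_le ψ (0, x)
    have hed : ed0 ψ (0, x) = v x ^ 2 + gsq u x := ed0_apply ψ 0 x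
    have hfd : fd ψ (0, x) = ed0 ψ (0, x) + u x ^ 2 / zz x := fd_apply ψ 0 x
    have hg0 := pl_nonneg c T x
    have hg1 := pl_le_one c T x
    have hX := vf_X_sq_le u x
    have hn := norm_sq_le_zz x
    have hMo : Mo u x = vf X u x + κ * u x := by simp [Mo, hκ]
    have e2 : slice 0 (mor c T ψ) x = 2 * pl c T x * (v x * Mo u x) := by
      rw [mor, map_mul, slice_lift, map_mul, slice_MoW, ← hu, ← hv]
      simp only [Sm.mul_apply, Sm.ofNat_apply]
    have hgw : pl c T x * zz x ^ (1 / 2 : ℝ) ≤ 4 * c * T ^ (1 - δ) * zp (δ / 2) x := by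
      have e : zz x ^ (1 / 2 : ℝ) = (zz x ^ (1 / 2 : ℝ)) ^ (1 - δ) * zp (δ / 2) x := by
        rw [zp_apply, ← rpow_mul hz.le, ← rpow_add hz]; ring_nf
      have hzp : 0 ≤ zp (δ / 2) x := by rw [zp_apply]; positivity
      by_cases h0 : pl c T x = 0
      · rw [h0, zero_mul]; positivity
      · have h1 := pl_mul_le hc hT x h0
        have h2 : (zz x ^ (1 / 2 : ℝ)) ^ (1 - δ) ≤ 4 * c * T ^ (1 - δ) := by
          refine (rpow_le_rpow (by positivity) h1 (by linarith)).trans ?_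
          rw [mul_rpow (by positivity) hT.le]
          refine mul_le_mul_of_nonneg_right ?_ (by positivity)
          exact (rpow_le_rpow_of_exponent_le (by linarith) (by linarith : 1 - δ ≤ 1)).trans_eq
            (rpow_one _)
        calc pl c T x * zz x ^ (1 / 2 : ℝ) ≤ 1 * zz x ^ (1 / 2 : ℝ) := by gcongr
          _ = (zz x ^ (1 / 2 : ℝ)) ^ (1 - δ) * zp (δ / 2) x := by rw [one_mul]; exact e
          _ ≤ _ := mul_le_mul_of_nonneg_right h2 hzp
    have hgsq := gsq_nonneg u x
    simp only [Sm.mul_apply, slice_apply, bw_apply, e2, zero_add, sub_zero, lift_apply]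
    set w := zz x ^ (1 / 2 : ℝ)
    have hw0 : 0 < w := by linarith
    have hsp := sp_le le_rfl hw1
    have hF0 : 0 ≤ u x ^ 2 / zz x := by positivity
    have hEF : ed0 ψ (0, x) ≤ fd ψ (0, x) := by linarith
    have hFd : 0 ≤ fd ψ (0, x) := (ed0_nonneg ψ (0, x)).trans hEF
    have r0 : u x ^ 2 = w ^ 2 * (u x ^ 2 / zz x) := by rw [hww]; field_simp
    have r1 : Mo u x ^ 2 ≤ 2 * (1 + κ ^ 2) * (w ^ 2 * fd ψ (0, x)) := by
      have a1 : Mo u x ^ 2 ≤ 2 * vf X u x ^ 2 + 2 * κ ^ 2 * u x ^ 2 := by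
        rw [hMo]; nlinarith only [sq_nonneg (vf X u x - κ * u x)]
      have a2 : vf X u x ^ 2 ≤ w ^ 2 * fd ψ (0, x) := by
        rw [hww]
        refine hX.trans (mul_le_mul hn ?_ hgsq hz.le)
        rw [hfd, hed]; nlinarith only [hF0, sq_nonneg (v x)]
      have a3 : u x ^ 2 ≤ w ^ 2 * fd ψ (0, x) := by
        rw [r0]
        refine mul_le_mul_of_nonneg_left ?_ (sq_nonneg w)
        have := ed0_nonneg ψ (0, x); linarith
      nlinarith only [a1, a2, mul_le_mul_of_nonneg_left a3 (sq_nonneg κ)]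
    have r2 : 2 * (v x * Mo u x) ≤ w * ((3 + 2 * κ ^ 2) * fd ψ (0, x)) := by
      have b1 : v x ^ 2 ≤ fd ψ (0, x) := by linarith
      have b2 : 2 * (v x * Mo u x) ≤ w * v x ^ 2 + w⁻¹ * Mo u x ^ 2 := by
        have : w * v x ^ 2 + w⁻¹ * Mo u x ^ 2 - 2 * (v x * Mo u x)
          = w⁻¹ * (w * v x - Mo u x) ^ 2 := by field_simp; ring
        have h3 : 0 ≤ w⁻¹ * (w * v x - Mo u x) ^ 2 := by positivity
        linarith
      have b3 : w⁻¹ * Mo u x ^ 2 ≤ w * (2 * (1 + κ ^ 2) * fd ψ (0, x)) := by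
        calc w⁻¹ * Mo u x ^ 2 ≤ w⁻¹ * (2 * (1 + κ ^ 2) * (w ^ 2 * fd ψ (0, x))) := by gcongr
          _ = _ := by field_simp
      linarith only [b2, b3, mul_le_mul_of_nonneg_left b1 hw0.le]
    have r3 : sp w * edens A ψ (0, x) ≤ 2 * w * (L * fd ψ (0, x)) :=
      mul_le_mul hsp (hqL.trans (mul_le_mul_of_nonneg_left hEF hL.le)) hq (by positivity)
    have r4 := mul_le_mul_of_nonneg_right hgw (mul_nonneg hC₁0 hFd)
    have r5 := mul_le_mul_of_nonneg_left (add_le_add r2 r3) hg0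
    rw [hC₁] at r4 ⊢
    linarith only [r4, r5]
  have h1 := integral_mono (i1.add i2) (i3.const_mul _) hpt
  rw [integral_add' i1 i2, integral_const_mul] at h1
  refine h1.trans ((mul_le_mul_of_nonneg_left (h.weighted_fd_le hd hψ.ls (by positivity))
    (by positivity)).trans_eq (by ring))

/-- Decay of the local energy in terms of integrated local energy decay. -/
theorem EB.local_energy_le (h : EB A m L) (hd : 3 ≤ d) (hA : Coef d a c₀ B A)
    (ha : 0 < a) (hB : 0 ≤ B) : ∃ C, 0 ≤ C ∧ ∀ (ψ : Sm (W d)), Sol A ψ → ∀ R T δ : ℝ,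
      0 ≤ R → 2 * (1 + R) ≤ T → 0 ≤ δ → δ ≤ 1 →
      T * ∫ x in Metric.closedBall 0 R, edens A ψ (T, x) ≤ C * (T ^ (1 - δ) * Em A (zp (δ / 2)) ψ 0
        + ∫ t in Icc (-T) T, ∫ x, zp (-(1 + a) / 2) x * ed0 ψ (t, x)) := by
  obtain ⟨C₁, hC₁, h1⟩ := h.le_Zf (by omega) hA ha hB
  obtain ⟨C₂, hC₂, h2⟩ := h.hasDerivAt_Zf (by omega) hA ha hB
  obtain ⟨C₃, hC₃, h3⟩ := h.Zf_zero_le hd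
  have hm := h.m_pos
  set k := 19 / 3 / m with hk
  have hk0 : 0 ≤ k := by positivity
  refine ⟨2 * (C₃ + C₂ * k + C₁ * (1 + k) + C₂), by positivity, fun ψ hψ R T δ hR hT hδ hδ1 => ?_⟩
  have hT1 : 1 ≤ T := by linarith
  have hT0 : 0 < T := by linarith
  set M := Em A (zp (δ / 2)) ψ 0 with hM
  have hM0 : 0 ≤ M := h.Em_nonneg (fun x => by
    rw [zp_apply]; have := zz_pos x; positivity) ψ 0
  have hTδ : 1 ≤ T ^ (1 - δ) := one_le_rpow hT1 (by linarith)
  have hTT : T * T ^ (-δ) = T ^ (1 - δ) := by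
    rw [sub_eq_add_neg, rpow_add hT0, rpow_one]
  have hE : Em A 1 ψ 0 ≤ T ^ (1 - δ) * M := by
    have : Em A 1 ψ 0 ≤ M := by
      refine integral_mono (hψ.ls.integrable_mul_edens 1 0) (hψ.ls.integrable_mul_edens _ 0) fun x => ?_
      simp only [Sm.mul_apply, Sm.one_apply, slice_apply]
      exact mul_le_mul_of_nonneg_right
        ((zp_apply (δ / 2) x).symm ▸ one_le_rpow (one_le_zz x) (by positivity)) (h.edens_nonneg _ _)
    nlinarith only [this, hTδ, hM0]
  have hfar : ∀ t, 0 ≤ t → ∫ x, ext (L / m) T (t, x) * fd ψ (t, x) ≤ k * (T ^ (-δ) * M) := fun t ht =>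
    h.far_le hd hψ hT0 ht hδ hδ1
  set I : ℝ → ℝ := fun t => ∫ x, zp (-(1 + a) / 2) x * ed0 ψ (t, x) with hI
  have hI0 : ∀ t, 0 ≤ I t := fun t => integral_nonneg fun x => mul_nonneg (by
    rw [zp_apply]; have := zz_pos x; positivity) (ed0_nonneg _ _)
  have hIint : IntegrableOn I (Icc (-T) T) :=
    ((hψ.ls.ed0.mul_left (lift (zp (-(1 + a) / 2)))).band T).2
  have hIint' : IntegrableOn I (Icc 0 T) := hIint.mono_set (Icc_subset_Icc_left (by linarith))
  have hder : ∀ t ∈ Icc 0 T, ∃ Z', HasDerivAt (Zf A (L / m) T ψ) Z' t ∧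
      Z' ≤ C₂ * (k * (T ^ (-δ) * M) + I t) := fun t ht => by
    obtain ⟨Z', hZ, hZ'⟩ := h2 ψ hψ T t hT0 ht.1 ht.2
    refine ⟨Z', hZ, hZ'.trans (mul_le_mul_of_nonneg_left ?_ hC₂)⟩
    have := hfar t ht.1
    linarith only [this]
  choose! Z' hZ hZ' using hder
  have hφ : IntegrableOn (fun t => C₂ * (k * (T ^ (-δ) * M) + I t)) (Icc 0 T) :=
    ((integrableOn_const (by simp)).add hIint').const_mul C₂
  have hftc := intervalIntegral.sub_le_integral_of_hasDeriv_right_of_le hT0.le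
    (fun t ht => (hZ t ht).continuousAt.continuousWithinAt)
    (fun t ht => (hZ t (Ioo_subset_Icc_self ht)).hasDerivWithinAt) hφ
    (fun t ht => hZ' t (Ioo_subset_Icc_self ht))
  have hint : ∫ t in (0 : ℝ)..T, C₂ * (k * (T ^ (-δ) * M) + I t)
      ≤ C₂ * (k * (T ^ (1 - δ) * M) + ∫ t in Icc (-T) T, I t) := by
    have hIi : IntervalIntegrable I volume 0 T :=
      (intervalIntegrable_iff_integrableOn_Icc_of_le hT0.le).2 hIint'
    rw [intervalIntegral.integral_const_mul, intervalIntegral.integral_add (by simp) hIi,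
      intervalIntegral.integral_const, smul_eq_mul, sub_zero, ← hTT,
      intervalIntegral.integral_of_le hT0.le, ← integral_Icc_eq_integral_Ioc]
    refine mul_le_mul_of_nonneg_left (add_le_add (le_of_eq (by ring)) ?_) hC₂
    exact setIntegral_mono_set hIint (Eventually.of_forall hI0)
      (Icc_subset_Icc_left (by linarith)).eventuallyLE
  have q1 := h1 ψ hψ R T hR hT
  have q3 := h3 ψ hψ T δ hT0 hδ hδ1
  have q4 : T * ∫ x, ext (L / m) T (T, x) * fd ψ (T, x) ≤ k * (T ^ (1 - δ) * M) := by
    rw [← hTT]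
    exact (mul_le_mul_of_nonneg_left (hfar T hT0.le) hT0.le).trans_eq (by ring)
  have q5 := mul_le_mul_of_nonneg_left (add_le_add hE q4) hC₁
  set J := ∫ t in Icc (-T) T, I t with hJ
  have hJ0 : 0 ≤ J := setIntegral_nonneg measurableSet_Icc fun t _ => hI0 t
  have q6 : 0 ≤ (C₃ + C₂ * k + C₁ * (1 + k)) * J := by positivity
  have q7 : 0 ≤ C₂ * (T ^ (1 - δ) * M) := by positivity
  linarith only [q1, q3, q5, hftc, hint, q6, q7]

theorem gsq_zp_le (hp : 0 ≤ p) (hp1 : p ≤ 1 / 2) (x : E d) : gsq (zp p) x ≤ 1 := by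
  have hz := zz_pos x
  have e : gsq (zp p) x = (2 * p) ^ 2 * (zz x ^ p * (zz x)⁻¹) ^ 2 * ‖x‖ ^ 2 := by
    rw [gsq_apply, norm_sq_eq_sum, mul_sum]
    refine sum_congr rfl fun i _ => ?_
    rw [pd_zp]
    simp only [Sm.mul_apply, Sm.smul_apply, zp_apply, X_apply, rpow_neg_one]
    ring
  have h1 : zz x ^ p ≤ zz x ^ (1 / 2 : ℝ) := rpow_le_rpow_of_exponent_le (one_le_zz x) hp1
  have h2 : (zz x ^ p) ^ 2 ≤ zz x :=
    (pow_le_pow_left₀ (by positivity) h1 2).trans_eq (zp_half_sq x)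
  have h3 : (2 * p) ^ 2 ≤ 1 := by nlinarith
  rw [e]
  calc (2 * p) ^ 2 * (zz x ^ p * (zz x)⁻¹) ^ 2 * ‖x‖ ^ 2
      = (2 * p) ^ 2 * ((zz x ^ p) ^ 2 * (zz x)⁻¹ ^ 2 * ‖x‖ ^ 2) := by ring
    _ ≤ 1 * (zz x * (zz x)⁻¹ ^ 2 * zz x) := by
        have := norm_sq_le_zz x; gcongr
    _ = 1 := by field_simp

theorem Dt_iterate_sub_cv {K : Sm ℝ} (hK : Ker K T) (N : ℝ) (j : ℕ) (ψ : Sm (W d)) :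
    Dt^[j] (N • ψ - cv hK ψ) = N • Dt^[j] ψ - cv hK (Dt^[j] ψ) := by
  induction j generalizing ψ with
  | zero => rfl
  | succ j ih => rw [Function.iterate_succ_apply, map_sub, Derivation.map_smul, D_cv, ih]; rfl

theorem iterate_Dt_sol (hψ : Sol A ψ) (j : ℕ) : Sol A (Dt^[j] ψ) := by
  induction j with
  | zero => exact hψ
  | succ j ih => rw [Function.iterate_succ_apply']; exact ih.Dt

/-- The energy in a ball. -/
noncomputable def El (A : Fin d → Fin d → Sm (E d)) (R : ℝ) (ψ : Sm (W d)) (t : ℝ) : ℝ :=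
  ∫ x in Metric.closedBall 0 R, edens A ψ (t, x)

theorem EB.El_le (h : EB A m L) (hψ : Sol A ψ) (R t : ℝ) :
    El A R ψ t ≤ Em A 1 ψ 0 := by
  rw [← h.energy_eq hψ t 0]
  refine (setIntegral_le_integral ((hψ.ls.edens A).integrable t)
    (Eventually.of_forall fun x => h.edens_nonneg ψ (t, x))).trans_eq ?_
  rw [Em]; simp

theorem EB.El_split (h : EB A m L) {N : ℝ} (hN : 1 / 2 ≤ N) {χ : Sm (W d)} (hψ : LS ψ)
    (hχ : LS χ) (R t : ℝ) : El A R ψ t ≤ 8 * (El A R χ t + El A R (N • ψ - χ) t) := by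
  have i0 : ∀ {F : Sm (W d)}, LS F → IntegrableOn (fun x => edens A F (t, x)) (Metric.closedBall 0 R) :=
    fun hF => ((hF.edens A).integrable t).integrableOn
  have i1 := i0 hχ
  have i2 := i0 ((hψ.smul N).sub hχ)
  rw [El, El, El, ← integral_add i1 i2, ← integral_const_mul]
  refine integral_mono (i0 hψ) ((i1.add i2).const_mul 8) fun x => ?_
  have h1 := h.edens_add_le χ (N • ψ - χ) (t, x)
  rw [add_sub_cancel, edens_smul, Sm.smul_apply] at h1
  have h2 := h.edens_nonneg ψ (t, x)
  simp only [Pi.add_apply]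
  nlinarith only [h1, mul_nonneg (show 0 ≤ N ^ 2 - 1 / 4 by nlinarith only [hN]) h2]

theorem EB.iterated_decay (h : EB A m L) (hd : 3 ≤ d) (hA : Coef d a c₀ B A)
    (ha : 0 < a) (hB : 0 ≤ B) (hC₀ : 0 ≤ C₀)
    (hres : ∀ lam ≥ 0, ∀ (u : Sm (E d)) (K : Set (E d)),
      IsCompact K → (∀ x ∉ K, u x = 0) → ∀ k > 0,
      ∫ x, zz x ^ (-(1 + a) / 2) * sen lam u x
        ≤ C₀ * exp (C₀ * lam) * ∫ x, (k⁻¹ * Hop A lam u x ^ 2 + k * sen lam u x)) (j : ℕ) :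
    ∃ C T₀, 0 ≤ C ∧ ∀ (ψ : Sm (W d)), Sol A ψ → ∀ R T δ ω : ℝ, 0 ≤ R → T₀ + 2 * (1 + R) ≤ T →
      0 ≤ δ → δ ≤ 1 → 1 ≤ ω →
      El A R ψ T ≤ C * ((ω ^ 2)⁻¹ ^ j * Em A 1 (Dt^[j] ψ) 0
        + exp (C * ω) / T * Em A 1 ψ 0 + T ^ (-δ) * Em A (zp (δ / 2)) ψ 0) := by
  obtain ⟨C₁, hC₁, h1⟩ := h.local_energy_le hd hA ha hB
  obtain ⟨C₂, hC₂, h2⟩ := h.integrated_decay (by linarith) hC₀ hres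
  obtain ⟨b, hb, hk⟩ := kT_bounds
  have hm := h.m_pos
  have hL := h.L_pos
  have hzp : ∀ δ : ℝ, 0 ≤ δ → ∀ x : E d, 0 ≤ zp (δ / 2) x := fun δ _ x => by
    rw [zp_apply]; have := zz_pos x; positivity
  have hE : ∀ (χ : Sm (W d)), 0 ≤ Em A 1 χ 0 := fun χ => h.Em_nonneg (fun _ => zero_le_one) χ 0
  have hM : ∀ (χ : Sm (W d)) (δ : ℝ), 0 ≤ δ → 0 ≤ Em A (zp (δ / 2)) χ 0 := fun χ δ hδ =>
    h.Em_nonneg (hzp δ hδ) χ 0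
  have hEM : ∀ (χ : Sm (W d)) (δ : ℝ), Sol A χ → 0 ≤ δ → Em A 1 χ 0 ≤ Em A (zp (δ / 2)) χ 0 :=
    fun χ δ hχ hδ => by
    refine integral_mono (hχ.ls.integrable_mul_edens 1 0) (hχ.ls.integrable_mul_edens _ 0) fun x => ?_
    simp only [Sm.mul_apply, Sm.one_apply, slice_apply]
    exact mul_le_mul_of_nonneg_right
      ((zp_apply (δ / 2) x).symm ▸ one_le_rpow (one_le_zz x) (by positivity)) (h.edens_nonneg _ _)
  set k₁ := L / m * b ^ 2 * (1 + L / m) with hk₁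
  have hk₁0 : 0 ≤ k₁ := by positivity
  set k₂ := 2 * b ^ 2 + 2 * k₁ with hk₂
  have hk₂0 : 0 ≤ k₂ := by positivity
  set k₃ := L / m * b * b with hk₃
  have hk₃0 : 0 ≤ k₃ := by positivity
  induction j with
  | zero =>
    refine ⟨1, 0, zero_le_one, fun ψ hψ R T δ ω hR hT hδ hδ1 hω => ?_⟩
    have hT0 : 0 < T := by linarith
    have q1 := h.El_le hψ R T
    have q2 : 0 ≤ exp (1 * ω) / T * Em A 1 ψ 0 := by have := hE ψ; positivity
    have q3 : 0 ≤ T ^ (-δ) * Em A (zp (δ / 2)) ψ 0 := by have := hM ψ δ hδ; positivity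
    rw [pow_zero, one_mul, one_mul, Function.iterate_zero, id]
    linarith
  | succ j ih =>
    obtain ⟨C₃, T₃, hC₃, h3⟩ := ih
    set C := C₂ + C₃ + 8 * (C₁ * (k₁ + C₂) + C₃ * (k₂ + k₃)) with hC
    refine ⟨C, |T₃| + 2 * b, by positivity, fun ψ hψ R T δ ω hR hT hδ hδ1 hω => ?_⟩
    have hT0 : 0 < T := by have := abs_nonneg T₃; linarith
    obtain ⟨hMom, hmom2, -, hN⟩ := hk ω T hω hT0
    have hK : Ker (kT ω T) T := kT_ker hT0
    set N := ∫ s, kT ω T s with hNdef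
    have hN2 : 1 / 2 ≤ N := by
      have : b / T ≤ 1 / 2 := by
        rw [div_le_iff₀ hT0]; have := abs_nonneg T₃; linarith
      linarith
    have hNb : N ^ 2 ≤ b ^ 2 := sq_le_sq' (by linarith)
      ((le_abs_self _).trans ((abs_integral_le_integral_abs).trans hMom.zero))
    have hcv : ∀ χ, Sol A χ → ∀ δ, 0 ≤ δ → δ ≤ 1 →
        Em A (zp (δ / 2)) (cv hK χ) 0 ≤ k₁ * Em A (zp (δ / 2)) χ 0 := fun χ hχ δ hδ hδ1 => by
      refine (h.Em_cv_le hK hMom hχ (hzp δ hδ) (gsq_zp_le (by linarith) (by linarith))).trans ?_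
      rw [hk₁, mul_assoc (L / m * b ^ 2)]
      refine mul_le_mul_of_nonneg_left ?_ (by positivity)
      have := mul_le_mul_of_nonneg_left (hEM χ δ hχ hδ) (show 0 ≤ L / m by positivity)
      linarith
    have hv : ∀ δ, 0 ≤ δ → δ ≤ 1 → Em A (zp (δ / 2)) (N • ψ - cv hK ψ) 0
        ≤ k₂ * Em A (zp (δ / 2)) ψ 0 := fun δ hδ hδ1 => by
      have q1 := h.Em_sub_le (hψ.smul N).ls (hψ.cv hK).ls (hzp δ hδ) 0
      rw [Em_smul] at q1
      have q2 := hcv ψ hψ δ hδ hδ1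
      have q3 := mul_le_mul_of_nonneg_right hNb (hM ψ δ hδ)
      rw [hk₂]
      linarith
    have hz1 : (zp (0 / 2) : Sm (E d)) = 1 := by ext x; simp
    have hv1 := hv 0 le_rfl zero_le_one
    rw [hz1] at hv1
    have hvj : Em A 1 (Dt^[j] (N • ψ - cv hK ψ)) 0
        ≤ k₃ * ((ω ^ 2)⁻¹ * Em A 1 (Dt^[j + 1] ψ) 0) := by
      rw [Dt_iterate_sub_cv, Function.iterate_succ_apply']
      refine (h.energy_remainder_le hK (iterate_Dt_sol hψ j)).trans ?_
      have hE' := hE (Dt (Dt^[j] ψ))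
      calc L / m * (∫ s, |kT ω T s|) * (∫ s, |kT ω T s| * s ^ 2) * Em A 1 (Dt (Dt^[j] ψ)) 0
          ≤ L / m * b * (b * (ω ^ 2)⁻¹) * Em A 1 (Dt (Dt^[j] ψ)) 0 := by
            have := hMom.zero
            have h0 : 0 ≤ ∫ s, |kT ω T s| * s ^ 2 := integral_nonneg fun s => by positivity
            gcongr
        _ = _ := by rw [hk₃]; ring
    have q0 := h.El_split hN2 hψ.ls (hψ.cv hK).ls R T
    have q1 : El A R (cv hK ψ) T ≤ C₁ * (k₁ * (T ^ (-δ) * Em A (zp (δ / 2)) ψ 0)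
        + C₂ * (exp (C * ω) / T * Em A 1 ψ 0)) := by
      have r1 := h1 (cv hK ψ) (hψ.cv hK) R T δ hR (by have := abs_nonneg T₃; linarith) hδ hδ1
      have r2 := h2 ω T hω (by have := abs_nonneg T₃; linarith) hK ψ hψ
      have hTT : T ^ (1 - δ) = T * T ^ (-δ) := by
        rw [sub_eq_add_neg, rpow_add hT0, rpow_one]
      refine le_of_mul_le_mul_left (r1.trans ?_) hT0
      rw [mul_left_comm T]
      refine mul_le_mul_of_nonneg_left ?_ hC₁
      have r3 : T ^ (1 - δ) * Em A (zp (δ / 2)) (cv hK ψ) 0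
          ≤ T * (k₁ * (T ^ (-δ) * Em A (zp (δ / 2)) ψ 0)) := by
        rw [hTT]
        exact (mul_le_mul_of_nonneg_left (hcv ψ hψ δ hδ hδ1) (by positivity)).trans_eq (by ring)
      have r4 : C₂ * exp (C₂ * ω) * Em A 1 ψ 0
          ≤ T * (C₂ * (exp (C * ω) / T * Em A 1 ψ 0)) := by
        have e : T * (C₂ * (exp (C * ω) / T * Em A 1 ψ 0))
            = C₂ * exp (C * ω) * Em A 1 ψ 0 := by field_simp
        rw [e]
        have := hE ψ
        have hCC : C₂ ≤ C := by
          have : 0 ≤ C₃ + 8 * (C₁ * (k₁ + C₂) + C₃ * (k₂ + k₃)) := by positivity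
          linarith
        gcongr
      linarith only [r2, r3, r4]
    have q2 := h3 (N • ψ - cv hK ψ) ((hψ.smul N).sub (hψ.cv hK)) R T δ ω hR
      (by have := le_abs_self T₃; linarith) hδ hδ1 hω
    set P := (ω ^ 2)⁻¹ ^ (j + 1) * Em A 1 (Dt^[j + 1] ψ) 0 with hP
    set Q := exp (C * ω) / T * Em A 1 ψ 0 with hQ
    set S := T ^ (-δ) * Em A (zp (δ / 2)) ψ 0 with hS
    have hP0 : 0 ≤ P := by have := hE (Dt^[j + 1] ψ); positivity
    have hQ0 : 0 ≤ Q := by have := hE ψ; positivity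
    have hS0 : 0 ≤ S := by have := hM ψ δ hδ; positivity
    have s1 : (ω ^ 2)⁻¹ ^ j * Em A 1 (Dt^[j] (N • ψ - cv hK ψ)) 0 ≤ k₃ * P :=
      (mul_le_mul_of_nonneg_left hvj (by positivity)).trans_eq (by rw [hP]; ring)
    have s2 : exp (C₃ * ω) / T * Em A 1 (N • ψ - cv hK ψ) 0 ≤ k₂ * Q := by
      have hCC : C₃ ≤ C := by
        have : 0 ≤ C₂ + 8 * (C₁ * (k₁ + C₂) + C₃ * (k₂ + k₃)) := by positivity
        linarith
      have := hE ψ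
      calc exp (C₃ * ω) / T * Em A 1 (N • ψ - cv hK ψ) 0
          ≤ exp (C * ω) / T * (k₂ * Em A 1 ψ 0) := by
            have := hE (N • ψ - cv hK ψ)
            gcongr
        _ = _ := by rw [hQ]; ring
    have s3 : T ^ (-δ) * Em A (zp (δ / 2)) (N • ψ - cv hK ψ) 0 ≤ k₂ * S :=
      (mul_le_mul_of_nonneg_left (hv δ hδ hδ1) (by positivity)).trans_eq (by rw [hS]; ring)
    have s4 := mul_le_mul_of_nonneg_left (add_le_add (add_le_add s1 s2) s3) hC₃
    have s5 : 8 * (C₁ * (k₁ * S + C₂ * Q) + C₃ * (k₃ * P + k₂ * Q + k₂ * S)) ≤ C * (P + Q + S) := by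
      have t1 : 0 ≤ (C₂ + C₃) * (P + Q + S) := by positivity
      have t2 : 0 ≤ C₁ * (k₁ * (P + Q) + C₂ * (P + S)) := by positivity
      have t3 : 0 ≤ C₃ * (k₂ * P + k₃ * (Q + S)) := by positivity
      rw [hC]; linarith only [t1, t2, t3]
    linarith only [q0, q1, q2, s4, s5]

theorem exists_log_scale (hC : 0 ≤ C) (j : ℕ) : ∃ K, 0 ≤ K ∧ ∀ τ, 2 ≤ τ → ∃ ω, 1 ≤ ω ∧
    (ω ^ 2)⁻¹ ^ j ≤ K * (log (2 + τ) ^ (2 * j))⁻¹ ∧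
    exp (C * ω) / τ ≤ K * (log (2 + τ) ^ (2 * j))⁻¹ := by
  set s := (2 * (C + 1))⁻¹ with hs
  have hs0 : 0 < s := by positivity
  have hCs : C * s ≤ 1 / 2 := by
    rw [hs, ← div_eq_mul_inv, div_le_div_iff₀ (by positivity) (by norm_num)]; linarith
  set F : ℝ := 2 ^ (2 * j) * (2 * j).factorial with hF
  have hF0 : 0 < F := by positivity
  refine ⟨(s ^ (2 * j))⁻¹ + 2 * exp C * F, by positivity, fun τ hτ => ?_⟩
  set l := log (2 + τ) with hl
  have hl0 : 0 < l := log_pos (by linarith)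
  have hel : exp l = 2 + τ := exp_log (by linarith)
  refine ⟨max 1 (s * l), le_max_left _ _, ?_, ?_⟩
  · have h1 : (s * l) ^ (2 * j) ≤ (max 1 (s * l) ^ 2) ^ j := by
      rw [← pow_mul]
      exact pow_le_pow_left₀ (by positivity) (le_max_right _ _) _
    calc ((max 1 (s * l) ^ 2)⁻¹) ^ j = ((max 1 (s * l) ^ 2) ^ j)⁻¹ := inv_pow _ _
      _ ≤ ((s * l) ^ (2 * j))⁻¹ := inv_anti₀ (by positivity) h1
      _ = (s ^ (2 * j))⁻¹ * (l ^ (2 * j))⁻¹ := by rw [mul_pow, mul_inv]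
      _ ≤ _ := mul_le_mul_of_nonneg_right (le_add_of_nonneg_right (by positivity)) (by positivity)
  · have h1 : exp (C * max 1 (s * l)) ≤ exp C * exp (l / 2) := by
      rw [← exp_add, exp_le_exp]
      have h2 : max 1 (s * l) ≤ 1 + s * l := max_le (by nlinarith) (by linarith)
      nlinarith [mul_le_mul_of_nonneg_left h2 hC, mul_le_mul_of_nonneg_right hCs hl0.le]
    have h2 : l ^ (2 * j) ≤ F * exp (l / 2) := by
      have := pow_div_factorial_le_exp (x := l / 2) (by positivity) (2 * j)
      rw [div_le_iff₀ (by positivity), div_pow, div_le_iff₀ (by positivity)] at this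
      rw [hF]; linarith
    have h3 : exp (l / 2) * exp (l / 2) ≤ 2 * τ := by
      rw [← exp_add, add_halves, hel]; linarith
    have h4 : exp (C * max 1 (s * l)) / τ ≤ 2 * exp C * F * (l ^ (2 * j))⁻¹ := by
      rw [← div_eq_mul_inv, div_le_div_iff₀ (by linarith) (by positivity)]
      calc exp (C * max 1 (s * l)) * l ^ (2 * j)
          ≤ (exp C * exp (l / 2)) * (F * exp (l / 2)) := by gcongr
        _ = exp C * F * (exp (l / 2) * exp (l / 2)) := by ring
        _ ≤ exp C * F * (2 * τ) := by gcongr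
        _ = _ := by ring
    exact h4.trans (mul_le_mul_of_nonneg_right (le_add_of_nonneg_left (by positivity)) (by positivity))

theorem decay_combine {K E e₁ e₂ E₁ E₂ : ℝ} (hC : 0 ≤ C) (hK : 0 ≤ K) (hQ : 0 ≤ Q)
    (hl : 0 ≤ l) (hM : 0 ≤ M) (hS : 0 ≤ S) (he₁ : e₁ ≤ K * l) (he₂ : e₂ ≤ K * l)
    (hE₁ : E₁ ≤ S) (hE₂ : E₂ ≤ S) (hE₁0 : 0 ≤ E₁) (hE₂0 : 0 ≤ E₂)
    (hE : E ≤ C * (e₁ * E₁ + e₂ * E₂ + M)) : E ≤ (C * (2 * K + 1) + Q) * (l * S + M) := by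
  have p1 := mul_le_mul he₁ hE₁ hE₁0 (by positivity)
  have p2 := mul_le_mul he₂ hE₂ hE₂0 (by positivity)
  have p3 := mul_le_mul_of_nonneg_left (add_le_add (add_le_add p1 p2) (le_refl M)) hC
  have p4 : 0 ≤ Q * (l * S + M) := by positivity
  have p5 : 0 ≤ C * (2 * K * M + l * S) := by positivity
  linarith

theorem le_combine (hk : 0 ≤ k) (hQ : 0 ≤ Q) (hl : 0 ≤ l) (hM : 0 ≤ M) (hS : 0 ≤ S)
    (h : 1 ≤ Q * l) : S ≤ (k + Q) * (l * S + M) := by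
  have p2 := mul_le_mul_of_nonneg_right h hS
  have p3 : 0 ≤ k * (l * S + M) + Q * M := by positivity
  linarith

theorem EB.log_decay (h : EB A m L) (hd : 3 ≤ d) (hA : Coef d a c₀ B A)
    (ha : 0 < a) (hB : 0 ≤ B) (hC₀ : 0 ≤ C₀)
    (hres : ∀ lam ≥ 0, ∀ (u : Sm (E d)) (K : Set (E d)),
      IsCompact K → (∀ x ∉ K, u x = 0) → ∀ k > 0,
      ∫ x, zz x ^ (-(1 + a) / 2) * sen lam u x
        ≤ C₀ * exp (C₀ * lam) * ∫ x, (k⁻¹ * Hop A lam u x ^ 2 + k * sen lam u x)) (j : ℕ)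
    (hR : 0 ≤ R) (hδ : 0 ≤ δ) (hδ1 : δ ≤ 1) :
    ∃ C, 0 ≤ C ∧ ∀ (ψ : Sm (W d)), Sol A ψ → ∀ τ : ℝ, 0 < τ →
      El A R ψ τ ≤ C * ((log (2 + τ) ^ (2 * j))⁻¹
        * (∑ i ∈ Finset.range (j + 1), Em A 1 (Dt^[i] ψ) 0) + τ ^ (-δ) * Em A (zp (δ / 2)) ψ 0) := by
  obtain ⟨C, T₀, hC, hdec⟩ := h.iterated_decay hd hA ha hB hC₀ hres j
  obtain ⟨K, hK, hω⟩ := exists_log_scale hC j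
  set T₁ := |T₀| + 2 * (1 + R) with hT₁
  have hT₁0 : 2 ≤ T₁ := by have := abs_nonneg T₀; linarith
  refine ⟨C * (2 * K + 1) + log (2 + T₁) ^ (2 * j), by
    have := log_nonneg (show 1 ≤ 2 + T₁ by linarith); positivity, fun ψ hψ τ hτ => ?_⟩
  have hE : ∀ i, 0 ≤ Em A 1 (Dt^[i] ψ) 0 := fun i => h.Em_nonneg (fun _ => zero_le_one) _ 0
  have hS : ∀ i ≤ j, Em A 1 (Dt^[i] ψ) 0 ≤ ∑ i ∈ Finset.range (j + 1), Em A 1 (Dt^[i] ψ) 0 :=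
    fun i hi => Finset.single_le_sum (f := fun i => Em A 1 (Dt^[i] ψ) 0) (fun i _ => hE i)
      (Finset.mem_range.2 (by omega))
  have hM : 0 ≤ τ ^ (-δ) * Em A (zp (δ / 2)) ψ 0 := mul_nonneg (by positivity)
    (h.Em_nonneg (fun x => by rw [zp_apply]; have := zz_pos x; positivity) ψ 0)
  have hS0 := hS 0 (by omega)
  have hSj := hS j le_rfl
  have hE0 := hE 0
  have hEj := hE j
  rw [Function.iterate_zero, id] at hS0 hE0
  set S := ∑ i ∈ Finset.range (j + 1), Em A 1 (Dt^[i] ψ) 0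
  set M := τ ^ (-δ) * Em A (zp (δ / 2)) ψ 0
  have hl : 0 < log (2 + τ) := log_pos (by linarith)
  have hl1 : 0 < log (2 + T₁) := log_pos (by linarith)
  set l := (log (2 + τ) ^ (2 * j))⁻¹ with hldef
  have hl0 : 0 < l := by positivity
  have hSS : 0 ≤ S := hE0.trans hS0
  rcases le_total T₁ τ with hτ1 | hτ1
  · obtain ⟨ω, hω1, o1, o2⟩ := hω τ (by linarith)
    exact decay_combine hC hK (pow_nonneg hl1.le _) hl0.le hM hSS o1 o2 hSj hS0 hEj hE0
      (hdec ψ hψ R τ δ ω hR (by have := le_abs_self T₀; linarith) hδ hδ1 hω1)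
  · refine (h.El_le hψ R τ).trans (hS0.trans (le_combine (by positivity) (pow_nonneg hl1.le _)
      hl0.le hM hSS ?_))
    rw [hldef, ← div_eq_mul_inv, one_le_div (by positivity)]
    exact pow_le_pow_left₀ hl.le (log_le_log (by linarith) (by linarith)) _

theorem timeIteratedDeriv_eq (ψ : Sm (W d)) (j : ℕ) (t : ℝ) (x : E d) :
    timeIteratedDeriv j ψ t x = (Dt^[j] ψ) (t, x) := by
  induction j generalizing t with
  | zero => simp [timeIteratedDeriv]
  | succ j ih =>
    rw [timeIteratedDeriv, iteratedDeriv_succ, Function.iterate_succ_apply',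
      ← (hasDerivAt_slice (Dt^[j] ψ) t x).deriv]
    exact congrArg (fun f => deriv f t) (funext fun s => ih s)

theorem timeDeriv_eq (ψ : Sm (W d)) (t : ℝ) (x : E d) : timeDeriv ψ t x = Dt ψ (t, x) :=
  (hasDerivAt_slice ψ t x).deriv

theorem ed0_eq_deriv (ψ : Sm (W d)) (t : ℝ) (x : E d) :
    ed0 ψ (t, x) = timeDeriv ψ t x ^ 2 + ∑ i, spatialDeriv i (fun y => ψ (t, y)) x ^ 2 := by
  rw [ed0_apply, gsq_apply, timeDeriv_eq]; rfl

theorem EB.Em_le_ed0 (h : EB A m L) (hψ : LS ψ) (hμ : ∀ x, 0 ≤ μ x) :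
    Em A μ ψ 0 ≤ L * ∫ x, μ x * ed0 ψ (0, x) := by
  rw [Em, ← integral_const_mul]
  refine integral_mono (hψ.integrable_mul_edens μ 0)
    (((hψ.ed0.mul_left (lift μ)).integrable 0).const_mul L) fun x => ?_
  have := mul_le_mul_of_nonneg_left (h.edens_le ψ (0, x)) (hμ x)
  simp only [Sm.mul_apply, slice_apply]
  linarith

theorem EB.ed0_le_El (h : EB A m L) (hψ : LS ψ) (R t : ℝ) :
    ∫ x in Metric.closedBall 0 R, ed0 ψ (t, x) ≤ m⁻¹ * El A R ψ t := by
  rw [El, ← integral_const_mul]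
  have i1 : Integrable fun x => edens A ψ (t, x) := (hψ.edens A).integrable t
  have i2 : Integrable fun x => ed0 ψ (t, x) := hψ.ed0.integrable t
  refine integral_mono i2.integrableOn (i1.integrableOn.const_mul _) fun x => ?_
  have := h.ed0_le ψ (t, x)
  have hm := h.m_pos
  rw [inv_mul_eq_div, le_div_iff₀ hm]
  linarith

theorem decay_constants {S' M' F E : ℝ} (hm : 0 < m) (hl : 0 < l) (hθ : 0 ≤ θ)
    (hC : 0 ≤ C) (hS : 0 ≤ S) (hM : 0 ≤ M) (hF : F ≤ m⁻¹ * E) (hE : E ≤ C * (l⁻¹ * S' + θ * M'))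
    (hS' : S' ≤ L * S) (hM' : M' ≤ L * M) :
    F ≤ (m⁻¹ * C * L + 1) / l * S + (m⁻¹ * C * L + 1) * θ * M := by
  have q1 := mul_le_mul_of_nonneg_left hS' (inv_pos.2 hl).le
  have q2 := mul_le_mul_of_nonneg_left hM' hθ
  have q3 := mul_le_mul_of_nonneg_left (add_le_add q1 q2) hC
  have q4 := mul_le_mul_of_nonneg_left (hE.trans q3) (inv_pos.2 hm).le
  have q5 : 0 ≤ l⁻¹ * S + θ * M := by positivity
  rw [div_eq_mul_inv]
  linarith

theorem zp_le_weight (hδ : 0 ≤ δ) (x : E d) : zp (δ / 2) x ≤ (1 + ‖x‖) ^ δ := by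
  have h0 := norm_nonneg x
  have h1 : zz x ^ (1 / 2 : ℝ) ≤ 1 + ‖x‖ := by
    refine abs_le_of_sq_le_sq' ?_ (by linarith) |>.2
    rw [zp_half_sq, zz_apply]; nlinarith
  rw [zp_apply, show δ / 2 = 1 / 2 * δ by ring, rpow_mul (zz_pos x).le]
  have := zz_pos x
  exact rpow_le_rpow (by positivity) h1 hδ

end LogDecay

open LogDecay in
/-- Logarithmic local energy decay for the wave equation
`∂_t² ψ = ∑_{i,j} ∂_i (a^{ij} ∂_j ψ)` on `ℝ × ℝ^d`, `d ≥ 3`, where the smooth symmetric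
positive definite coefficient matrix `a^{ij}` tends quantitatively to the identity at
spatial infinity. -/
theorem logarithmic_local_energy_decay
    (d : ℕ) (hd : 3 ≤ d) (a : ℝ) (ha : 0 < a) (ha' : a ≤ 1)
    (A : Fin d → Fin d → EuclideanSpace ℝ (Fin d) → ℝ)
    (hA_smooth : ∀ i j, ContDiff ℝ (⊤ : ℕ∞) (A i j))
    (hA_symm : ∀ i j x, A i j x = A j i x)
    (hA_pos : ∀ (x : EuclideanSpace ℝ (Fin d)) (v : Fin d → ℝ), v ≠ 0 →
      0 < ∑ i, ∑ j, A i j x * v i * v j)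
    (hA_decay : ∃ B > 0, ∀ i j, ∀ k : ℕ, k ≤ 4 → ∀ x : EuclideanSpace ℝ (Fin d),
      ‖iteratedFDeriv ℝ k (fun y => A i j y - if i = j then (1 : ℝ) else 0) x‖
        ≤ B * (1 + ‖x‖) ^ (-1 - a - (k : ℝ))) :
    ∀ R : ℝ, 0 < R → ∀ δ₀ : ℝ, 0 < δ₀ → δ₀ ≤ 1 → ∀ m : ℕ, 0 < m →
      ∃ C > 0, ∀ ψ : ℝ × EuclideanSpace ℝ (Fin d) → ℝ,
        ContDiff ℝ (⊤ : ℕ∞) ψ →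
        -- the wave equation ∂_t²ψ = ∑_{i,j} ∂_i (a^{ij} ∂_j ψ)
        (∀ (t : ℝ) (x : EuclideanSpace ℝ (Fin d)),
          iteratedDeriv 2 (fun s => ψ (s, x)) t
            = ∑ i, spatialDeriv i
                (fun y => ∑ j, A i j y * spatialDeriv j (fun z => ψ (t, z)) y) x) →
        -- compactly supported initial data
        HasCompactSupport (fun x => ψ (0, x)) →
        HasCompactSupport (fun x => timeDeriv ψ 0 x) →
        ∀ τ : ℝ, 0 < τ →
          (∫ x in {x : EuclideanSpace ℝ (Fin d) | ‖x‖ ≤ R},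
              ((timeDeriv ψ τ x) ^ 2 + ∑ i, (spatialDeriv i (fun y => ψ (τ, y)) x) ^ 2))
            ≤ C / (Real.log (2 + τ)) ^ (2 * m) *
                (∑ j ∈ Finset.range (m + 1),
                  ∫ x : EuclideanSpace ℝ (Fin d),
                    ((timeIteratedDeriv (j + 1) ψ 0 x) ^ 2
                      + ∑ i, (spatialDeriv i (fun y => timeIteratedDeriv j ψ 0 y) x) ^ 2))
              + C * τ ^ (-δ₀) *
                  ∫ x : EuclideanSpace ℝ (Fin d),
                    (1 + ‖x‖) ^ δ₀ *
                      ((timeDeriv ψ 0 x) ^ 2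
                        + ∑ i, (spatialDeriv i (fun y => ψ (0, y)) x) ^ 2) := by
  intro R hR δ hδ hδ1 j hj
  obtain ⟨B, hB, hdec⟩ := hA_decay
  set As : Fin d → Fin d → Sm (E d) := fun i j => Sm.mk (A i j) (hA_smooth i j) with hAs
  obtain ⟨c₀, hc₀, hC⟩ := Coef.of_decay (A := As) (by omega) ha hA_symm hA_pos hB hdec
  obtain ⟨m, L, h⟩ := hC.exists_EB (by omega) ha hB.le hc₀
  obtain ⟨p, hp⟩ : ∃ p : E d, ‖p‖ = 1 := ⟨EuclideanSpace.single ⟨0, by omega⟩ 1, by simp⟩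
  set B' := 4 * 4 ^ ((1 + a) / 2) * B with hB'
  have hBB : B ≤ B' := by
    have : (1 : ℝ) ≤ 4 ^ ((1 + a) / 2) := Real.one_le_rpow (by norm_num) (by positivity)
    rw [hB']; nlinarith
  obtain ⟨C₀, hC₀, hres⟩ := resolvent_estimate hd ha hc₀ (hB.le.trans hBB) hp As (hC.mono hBB)
    (hC.translate ha hB.le hp)
  obtain ⟨C, hC1, hlog⟩ := h.log_decay hd hC ha hB.le hC₀ hres j hR.le hδ.le hδ1
  have hm := h.m_pos
  have hL := h.L_pos
  refine ⟨m⁻¹ * C * L + 1, by positivity, fun ψ₀ hψ₀ heq hc0 hc1 τ hτ => ?_⟩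
  obtain ⟨ψ, rfl⟩ : ∃ ψ : Sm (W d), (ψ : W d → ℝ) = ψ₀ := ⟨Sm.mk ψ₀ hψ₀, rfl⟩
  have hweq : Weq As ψ := fun t => by
    ext x
    have h1 := heq t x
    have h2 : Dt (Dt ψ) (t, x) = iteratedDeriv 2 (fun s => ψ (s, x)) t :=
      (timeIteratedDeriv_eq ψ 2 t x).symm
    rw [slice_apply, h2, h1]
    simp only [Pop, dv, Sm.sum_apply]
    refine Finset.sum_congr rfl fun i _ => ?_
    refine congrArg (fun f => fderiv ℝ f x (EuclideanSpace.single i 1)) (funext fun y => ?_)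
    simp only [fl, Sm.sum_apply, Sm.mul_apply]
    rfl
  have hψ : Sol As ψ := by
    refine h.finite_speed hweq ⟨_, hc0, fun x hx =>
      image_eq_zero_of_notMem_tsupport (f := fun x => ψ (0, x)) hx⟩
      ⟨_, hc1, fun x hx => ?_⟩
    rw [← timeDeriv_eq]
    exact image_eq_zero_of_notMem_tsupport (f := fun x => timeDeriv ψ 0 x) hx
  have hl : 0 < Real.log (2 + τ) := Real.log_pos (by linarith)
  have e1 : ∀ i, ∫ x, ((timeIteratedDeriv (i + 1) ψ 0 x) ^ 2
      + ∑ k, (spatialDeriv k (fun y => timeIteratedDeriv i ψ 0 y) x) ^ 2)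
      = ∫ x, ed0 (Dt^[i] ψ) (0, x) := fun i => by
    refine integral_congr_ae (Eventually.of_forall fun x => ?_)
    beta_reduce
    simp only [timeIteratedDeriv_eq, Function.iterate_succ_apply', ed0_eq_deriv, timeDeriv_eq]
  have hset : {x : EuclideanSpace ℝ (Fin d) | ‖x‖ ≤ R} = Metric.closedBall 0 R := by
    ext x; simp
  simp only [e1]
  simp only [hset, ← ed0_eq_deriv]
  have q0 := h.ed0_le_El hψ.ls R τ
  have q1 := hlog ψ hψ τ hτ
  have q2 : ∑ i ∈ Finset.range (j + 1), Em As 1 (Dt^[i] ψ) 0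
      ≤ L * ∑ i ∈ Finset.range (j + 1), ∫ x, ed0 (Dt^[i] ψ) (0, x) := by
    rw [Finset.mul_sum]
    refine Finset.sum_le_sum fun i _ => ?_
    have := h.Em_le_ed0 (iterate_Dt_sol hψ i).ls (μ := 1) (fun _ => zero_le_one)
    simpa only [Sm.one_apply, one_mul] using this
  have hzp : ∀ x : E d, 0 ≤ zp (δ / 2) x := fun x => by
    rw [zp_apply]; have := zz_pos x; positivity
  have i1 : Integrable fun x : E d => (1 + ‖x‖) ^ δ * ed0 ψ (0, x) := by
    obtain ⟨K, hK, h0⟩ := hψ.ls.ed0.zero_off 0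
    have c0 : Continuous fun x : E d => (1 + ‖x‖) ^ δ :=
      (continuous_const.add continuous_norm).rpow_const fun x => Or.inr hδ.le
    have c1 : Continuous fun x : E d => ed0 ψ (0, x) := (slice 0 (ed0 ψ)).continuous
    refine (c0.mul c1).integrable_of_hasCompactSupport
      (HasCompactSupport.of_support_subset_isCompact hK fun x hx => ?_)
    by_contra hx'
    have h2 : ed0 ψ (0, x) = 0 := h0 x hx'
    exact hx (by simp [h2])
  have i2 : Integrable fun x : E d => zp (δ / 2) x * ed0 ψ (0, x) :=
    (hψ.ls.ed0.mul_left (lift (zp (δ / 2)))).integrable 0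
  have q3 : Em As (zp (δ / 2)) ψ 0 ≤ L * ∫ x, (1 + ‖x‖) ^ δ * ed0 ψ (0, x) :=
    (h.Em_le_ed0 hψ.ls hzp).trans (mul_le_mul_of_nonneg_left (integral_mono i2 i1 fun x =>
      mul_le_mul_of_nonneg_right (zp_le_weight hδ.le x) (ed0_nonneg _ _)) hL.le)
  set S := ∑ i ∈ Finset.range (j + 1), ∫ x, ed0 (Dt^[i] ψ) (0, x)
  set M := ∫ x, (1 + ‖x‖) ^ δ * ed0 ψ (0, x)
  have hS : 0 ≤ S := Finset.sum_nonneg fun i _ => integral_nonneg fun x => ed0_nonneg _ _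
  have hM : 0 ≤ M := integral_nonneg fun x => mul_nonneg (by positivity) (ed0_nonneg _ _)
  have hl0 : 0 < Real.log (2 + τ) ^ (2 * j) := by positivity
  have hτδ : 0 < τ ^ (-δ) := by positivity
  exact decay_constants hm hl0 hτδ.le hC1 hS hM q0 q1 q2 q3
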